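/- Let M_N := (f_{j−k} − f_{j+k+2})_{j,k=0}^{N−1} be the Toeplitz-minus-Hankel matrix of the semi-infinite chain with boundary (Sp(2N)-type model); its eigenvalues lie in [−1,1]. Then 2·S(M_N) − S(T_N(f)) → R/3 as N → ∞. (Equivalently: the entanglement entropy of the boundary block satisfies S(M_N) = (R/6)log₂(2N) + κ/2 + o(1), where κ is the constant for which S(T_N(f)) = (R/3)log₂N + κ + o(1); the boundary entropy log₂ g vanishes.) -/

import Mathlib

/-!
Entanglement entropy of the boundary block of the semi-infinite chain
(`Sp(2N)`-type model): with `M_N = (f_{j−k} − f_{j+k+2})` and `T_N(f) = (f_{j−k})`,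
the eigenvalues of `M_N` lie in `[−1,1]` and `2·S(M_N) − S(T_N(f)) → R/3`, i.e.
`S(M_N) = (R/6)log₂(2N) + κ/2 + o(1)` with vanishing boundary entropy.
-/

noncomputable section

/-- The `n`-th Fourier coefficient `f_n = (1/2π) ∫_0^{2π} f(θ) e^{−inθ} dθ`. -/
def fourierCoef (f : ℝ → ℝ) (n : ℤ) : ℂ :=
  (1 / (2 * Real.pi) : ℂ) *
    ∫ t in (0 : ℝ)..(2 * Real.pi), (f t : ℂ) * Complex.exp (-Complex.I * (n : ℂ) * (t : ℂ))

/-- The bipartite entanglement function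
`e(1, ν) = −((1+ν)/2)log₂((1+ν)/2) − ((1−ν)/2)log₂((1−ν)/2)`
(with the convention `0·log₂ 0 = 0`, automatic since `Real.logb 2 0 = 0`). -/
def entBin (ν : ℝ) : ℝ :=
  -((1 + ν) / 2) * Real.logb 2 ((1 + ν) / 2) - ((1 - ν) / 2) * Real.logb 2 ((1 - ν) / 2)

noncomputable section
namespace EE
open Real Filter Topology MeasureTheory Set

lemma ent_pos {ν : ℝ} (h1 : -1 ≤ ν) (h2 : ν ≤ 1) (t : ℝ) : 0 < cosh t + ν * sinh t := by
  rw [cosh_eq, sinh_eq]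
  have := exp_pos t
  have := exp_pos (-t)
  rcases eq_or_lt_of_le h1 with h | h
  · subst h; linarith
  · nlinarith [mul_pos this (by linarith : 0 < 1 + ν), mul_nonneg (exp_pos (-t)).le (by linarith : 0 ≤ 1 - ν), mul_pos (exp_pos t) (by linarith : 0 < 1 + ν)]

lemma ent_neg_pos {ν : ℝ} (h1 : -1 ≤ ν) (h2 : ν ≤ 1) (t : ℝ) : 0 < cosh t - ν * sinh t := by
  have := ent_pos (ν := -ν) (by linarith) (by linarith) t
  linarith

/-- integrand -/
def eInt (ν t : ℝ) : ℝ :=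
  (log (cosh t + ν * sinh t) + log (cosh t - ν * sinh t)) / sinh t ^ 2

def ePhi (ν t : ℝ) : ℝ :=
  -(cosh t / sinh t) * (log (cosh t + ν * sinh t) + log (cosh t - ν * sinh t)) + 2 * t
    - ν * (log (cosh t + ν * sinh t) - log (cosh t - ν * sinh t))

lemma eLog_eq {ν : ℝ} (h1 : -1 ≤ ν) (h2 : ν ≤ 1) (t : ℝ) :
    log (cosh t + ν * sinh t) + log (cosh t - ν * sinh t) = log (1 + (1 - ν ^ 2) * sinh t ^ 2) := by
  rw [← log_mul (ent_pos h1 h2 t).ne' (ent_neg_pos h1 h2 t).ne']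
  congr 1
  have := cosh_sq t
  nlinarith

lemma eLog_nonneg {ν : ℝ} (h1 : -1 ≤ ν) (h2 : ν ≤ 1) (t : ℝ) :
    0 ≤ log (cosh t + ν * sinh t) + log (cosh t - ν * sinh t) := by
  rw [eLog_eq h1 h2]
  apply log_nonneg
  have : 0 ≤ (1 - ν ^ 2) := by nlinarith
  nlinarith [mul_nonneg this (sq_nonneg (sinh t))]

lemma eLog_le {ν : ℝ} (h1 : -1 ≤ ν) (h2 : ν ≤ 1) (t : ℝ) :
    log (cosh t + ν * sinh t) + log (cosh t - ν * sinh t) ≤ sinh t ^ 2 := by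
  rw [eLog_eq h1 h2]
  have : 0 ≤ (1 - ν ^ 2) := by nlinarith
  have h := log_le_sub_one_of_pos (x := 1 + (1 - ν ^ 2) * sinh t ^ 2)
    (by nlinarith [mul_nonneg this (sq_nonneg (sinh t))])
  nlinarith [mul_nonneg (sq_nonneg ν) (sq_nonneg (sinh t))]

lemma ePhi_deriv {ν : ℝ} (h1 : -1 ≤ ν) (h2 : ν ≤ 1) {t : ℝ} (ht : 0 < t) :
    HasDerivAt (ePhi ν) (eInt ν t) t := by
  have hs : sinh t ≠ 0 := (sinh_pos_iff.2 ht).ne'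
  have hp := (ent_pos h1 h2 t).ne'
  have hm := (ent_neg_pos h1 h2 t).ne'
  have d1 : HasDerivAt (fun t => log (cosh t + ν * sinh t))
      ((sinh t + ν * cosh t) / (cosh t + ν * sinh t)) t :=
    ((hasDerivAt_cosh t).add ((hasDerivAt_sinh t).const_mul ν)).log hp
  have d2 : HasDerivAt (fun t => log (cosh t - ν * sinh t))
      ((sinh t - ν * cosh t) / (cosh t - ν * sinh t)) t :=
    ((hasDerivAt_cosh t).sub ((hasDerivAt_sinh t).const_mul ν)).log hm
  have d3 : HasDerivAt (fun t => cosh t / sinh t) _ t :=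
    (hasDerivAt_cosh t).div (hasDerivAt_sinh t) hs
  have := ((d3.neg.mul (d1.add d2)).add ((hasDerivAt_id t).const_mul 2)).sub
    ((d1.sub d2).const_mul ν)
  convert! this using 1
  unfold eInt
  have hc := cosh_sq t
  simp only [Pi.add_apply, Pi.neg_apply]
  generalize log (cosh t + ν * sinh t) = a
  generalize log (cosh t - ν * sinh t) = b
  generalize cosh t = c at *
  generalize sinh t = s at *
  have hp' : c + s * ν ≠ 0 := by rwa [mul_comm s]
  have hm' : c - s * ν ≠ 0 := by rwa [mul_comm s]
  have k1 : (c / s + ν) * ((s + ν * c) / (c + ν * s)) = (s + ν * c) / s := by field_simp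
  have k2 : (c / s - ν) * ((s - ν * c) / (c - ν * s)) = (s - ν * c) / s := by field_simp
  have k3 : (s + ν * c) / s + (s - ν * c) / s = 2 := by field_simp; ring
  have k4 : -((s * s - c * c) / s ^ 2) = 1 / s ^ 2 := by
    field_simp; linarith
  rw [k4]
  linear_combination k1 + k2 + k3

lemma ePhi_zero (ν : ℝ) : ePhi ν 0 = 0 := by simp [ePhi]

lemma ePhi_cont {ν : ℝ} (h1 : -1 ≤ ν) (h2 : ν ≤ 1) : ContinuousWithinAt (ePhi ν) (Ici 0) 0 := by
  have hc1 : Tendsto (fun t => cosh t / sinh t * (log (cosh t + ν * sinh t) + log (cosh t - ν * sinh t)))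
      (𝓝[Ici 0] 0) (𝓝 0) := by
    have hb : Tendsto (fun t : ℝ => cosh t * sinh t) (𝓝[Ici 0] 0) (𝓝 0) := by
      have : ContinuousAt (fun t : ℝ => cosh t * sinh t) 0 :=
        (continuous_cosh.mul continuous_sinh).continuousAt
      have h := this.tendsto
      simp only [sinh_zero, mul_zero] at h
      exact h.mono_left nhdsWithin_le_nhds
    refine squeeze_zero' ?_ ?_ hb
    · filter_upwards [self_mem_nhdsWithin] with t ht
      exact mul_nonneg (div_nonneg (cosh_pos t).le (sinh_nonneg_iff.2 ht)) (eLog_nonneg h1 h2 t)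
    · filter_upwards [self_mem_nhdsWithin] with t ht
      have hs : 0 ≤ sinh t := sinh_nonneg_iff.2 ht
      rcases hs.eq_or_lt with h | h
      · rw [← h]; simp
      · calc _ ≤ cosh t / sinh t * sinh t ^ 2 := by
              gcongr
              exact eLog_le h1 h2 t
          _ = _ := by field_simp
  have hc2 : ContinuousAt (fun t => 2 * t
    - ν * (log (cosh t + ν * sinh t) - log (cosh t - ν * sinh t))) 0 := by
    have a1 : ContinuousAt (fun t => log (cosh t + ν * sinh t)) 0 :=
      ContinuousAt.log (by fun_prop) (ent_pos h1 h2 0).ne'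
    have a2 : ContinuousAt (fun t => log (cosh t - ν * sinh t)) 0 :=
      ContinuousAt.log (by fun_prop) (ent_neg_pos h1 h2 0).ne'
    fun_prop
  have h3 := (hc1.neg).add (hc2.tendsto.mono_left (nhdsWithin_le_nhds (s := Ici 0)))
  unfold ContinuousWithinAt
  rw [ePhi_zero]
  simp only [sinh_zero, cosh_zero, mul_zero, add_zero, log_one, sub_zero, neg_zero] at h3
  refine h3.congr (fun t => ?_)
  unfold ePhi; ring

lemma eAux {a b : ℝ} (ha : 0 ≤ a) (hb : 0 ≤ b) (hab : a + b = 2) :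
    Tendsto (fun t => a * (t - log ((a * exp t + b * exp (-t)) / 2))) atTop (𝓝 (-a * log (a / 2))) := by
  rcases ha.eq_or_lt with h | h
  · subst h; simp
  have e : ∀ t : ℝ, a * (t - log ((a * exp t + b * exp (-t)) / 2)) =
      - a * log ((a + b * exp (-(2 * t))) / 2) := by
    intro t
    have : (a * exp t + b * exp (-t)) / 2 = exp t * ((a + b * exp (-(2 * t))) / 2) := by
      have : exp (-t) = exp t * exp (-(2*t)) := by rw [← exp_add]; congr 1; ring
      rw [this]; ring
    rw [this, log_mul (exp_pos t).ne' (by positivity), log_exp]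
    ring
  simp_rw [e]
  apply Tendsto.const_mul
  apply Tendsto.log _ (by positivity)
  have : Tendsto (fun t : ℝ => exp (-(2 * t))) atTop (𝓝 0) :=
    tendsto_exp_neg_atTop_nhds_zero.comp (tendsto_id.const_mul_atTop (by norm_num : (0:ℝ) < 2))
  simpa using ((this.const_mul b).const_add a).div_const 2

lemma ePhi_lim {ν : ℝ} (h1 : -1 ≤ ν) (h2 : ν ≤ 1) :
    Tendsto (ePhi ν) atTop (𝓝 (2 * log 2 * entBin ν)) := by
  have A := eAux (a := 1 + ν) (b := 1 - ν) (by linarith) (by linarith) (by ring)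
  have B := eAux (a := 1 - ν) (b := 1 + ν) (by linarith) (by linarith) (by ring)
  have hC : Tendsto (fun t => (cosh t / sinh t - 1) * (log (cosh t + ν * sinh t) + log (cosh t - ν * sinh t)))
      atTop (𝓝 0) := by
    -- bound by  (e^{-t}/sinh t) * 2 t
    have hb : Tendsto (fun t : ℝ => 4 * (t * exp (-t))) atTop (𝓝 0) := by
      have := tendsto_pow_mul_exp_neg_atTop_nhds_zero 1
      simpa using this.const_mul 4
    refine squeeze_zero' ?_ ?_ hb
    · filter_upwards [eventually_gt_atTop 0] with t ht
      have hs : 0 < sinh t := sinh_pos_iff.2 ht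
      refine mul_nonneg ?_ (eLog_nonneg h1 h2 t)
      rw [sub_nonneg, le_div_iff₀ hs]
      linarith [sinh_lt_cosh t]
    · filter_upwards [eventually_gt_atTop 1] with t ht
      have hs1 : 1 ≤ sinh t := ht.le.trans (self_le_sinh_iff.2 (by linarith))
      have hs : 0 < sinh t := by linarith
      have e1 : cosh t / sinh t - 1 = exp (-t) / sinh t := by
        rw [← cosh_sub_sinh]; field_simp
      have e2 : exp (-t) / sinh t ≤ exp (-t) := div_le_self (exp_pos _).le hs1
      have le1 : ∀ ν : ℝ, -1 ≤ ν → ν ≤ 1 → log (cosh t + ν * sinh t) ≤ t := by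
        intro ν h1 h2
        rw [log_le_iff_le_exp (ent_pos h1 h2 t), ← cosh_add_sinh]
        nlinarith
      have e3 : log (cosh t + ν * sinh t) + log (cosh t - ν * sinh t) ≤ 2 * t := by
        have := le1 ν h1 h2
        have h := le1 (-ν) (by linarith) (by linarith)
        rw [neg_mul, ← sub_eq_add_neg] at h
        linarith
      rw [e1]
      calc _ ≤ exp (-t) * (2 * t) := by
            gcongr
            · exact eLog_nonneg h1 h2 t
        _ ≤ _ := by nlinarith [exp_pos (-t), mul_pos (exp_pos (-t)) (by linarith : 0 < t)]
  have := (A.add B).sub hC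
  have e : ∀ t, (1 + ν) * (t - log (((1 + ν) * exp t + (1 - ν) * exp (-t)) / 2)) +
      (1 - ν) * (t - log (((1 - ν) * exp t + (1 + ν) * exp (-t)) / 2)) -
      (cosh t / sinh t - 1) * (log (cosh t + ν * sinh t) + log (cosh t - ν * sinh t)) = ePhi ν t := by
    intro t
    have a1 : ((1 + ν) * exp t + (1 - ν) * exp (-t)) / 2 = cosh t + ν * sinh t := by
      rw [cosh_eq, sinh_eq]; ring
    have a2 : ((1 - ν) * exp t + (1 + ν) * exp (-t)) / 2 = cosh t - ν * sinh t := by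
      rw [cosh_eq, sinh_eq]; ring
    rw [a1, a2]; unfold ePhi; ring
  simp_rw [e] at this
  convert this using 2
  unfold entBin logb
  have : log 2 ≠ 0 := (log_pos (by norm_num)).ne'
  field_simp
  ring

theorem eInt_integrable {ν : ℝ} (h1 : -1 ≤ ν) (h2 : ν ≤ 1) :
    IntegrableOn (eInt ν) (Ioi 0) :=
  integrableOn_Ioi_deriv_of_nonneg (ePhi_cont h1 h2) (fun t ht => ePhi_deriv h1 h2 ht)
    (fun t _ => div_nonneg (eLog_nonneg h1 h2 t) (sq_nonneg _)) (ePhi_lim h1 h2)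

theorem eInt_integral {ν : ℝ} (h1 : -1 ≤ ν) (h2 : ν ≤ 1) :
    ∫ t in Ioi (0:ℝ), eInt ν t = 2 * log 2 * entBin ν := by
  rw [integral_Ioi_of_hasDerivAt_of_nonneg (ePhi_cont h1 h2) (fun t ht => ePhi_deriv h1 h2 ht)
    (fun t _ => div_nonneg (eLog_nonneg h1 h2 t) (sq_nonneg _)) (ePhi_lim h1 h2), ePhi_zero, sub_zero]

end EE
end

noncomputable section
namespace EE
open Finset Matrix

/-- Toeplitz matrix of a real sequence -/
def TM (c : ℤ → ℝ) (n : ℕ) : Matrix (Fin n) (Fin n) ℝ :=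
  Matrix.of fun j k => c ((j : ℤ) - (k : ℤ))

/-- Toeplitz minus Hankel matrix of a real sequence -/
def MM (c : ℤ → ℝ) (n : ℕ) : Matrix (Fin n) (Fin n) ℝ :=
  Matrix.of fun j k => c ((j : ℤ) - (k : ℤ)) - c ((j : ℤ) + (k : ℤ) + 2)

/-- Quadratic form of the Toeplitz matrix -/
def QF (c : ℤ → ℝ) (n : ℕ) (z : ℕ → ℝ) : ℝ :=
  ∑ j ∈ range n, z j * ∑ k ∈ range n, c ((j : ℤ) - (k : ℤ)) * z k

/-- coercivity with constant δ -/
def Coer (c : ℤ → ℝ) (δ : ℝ) : Prop :=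
  ∀ (n : ℕ) (z : ℕ → ℝ), δ * ∑ j ∈ range n, z j ^ 2 ≤ QF c n z

lemma split_sum (m : ℕ) (g : ℕ → ℝ) : ∑ t ∈ range (2 * m + 1), g t =
    ∑ k ∈ range m, g (m - 1 - k) + g m + ∑ k ∈ range m, g (m + 1 + k) := by
  rw [show 2 * m + 1 = (m + 1) + m by ring, sum_range_add, sum_range_succ, sum_range_reflect g m]

/-- extension of a vector by zero -/
def ext0 {n : ℕ} (v : Fin n → ℝ) (k : ℕ) : ℝ := if h : k < n then v ⟨k, h⟩ else 0

lemma ext0_fin {n : ℕ} (v : Fin n → ℝ) (k : Fin n) : ext0 v k = v k := by simp [ext0]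

lemma TM_isHermitian {c : ℤ → ℝ} (hev : ∀ m, c (-m) = c m) (n : ℕ) : (TM c n).IsHermitian := by
  ext j k
  simp only [TM, conjTranspose_apply, of_apply, star_trivial]
  rw [← hev]; congr 1; ring

lemma MM_isHermitian {c : ℤ → ℝ} (hev : ∀ m, c (-m) = c m) (n : ℕ) : (MM c n).IsHermitian := by
  ext j k
  simp only [MM, conjTranspose_apply, of_apply, star_trivial]
  rw [← hev ((k:ℤ) - j)]
  congr 2 <;> ring

lemma TM_form (c : ℤ → ℝ) (n : ℕ) (v : Fin n → ℝ) : v ⬝ᵥ (TM c n *ᵥ v) = QF c n (ext0 v) := by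
  simp only [QF, dotProduct, mulVec, TM, of_apply, Finset.sum_range, ext0_fin]

lemma ext0_sq {n : ℕ} (v : Fin n → ℝ) : ∑ j ∈ range n, ext0 v j ^ 2 = ∑ j, v j ^ 2 := by
  simp only [Finset.sum_range, ext0_fin]

/-- antisymmetric extension -/
def asym (m : ℕ) (u : ℕ → ℝ) (t : ℕ) : ℝ :=
  if t < m then - u (m - 1 - t) else if t = m then 0 else u (t - m - 1)

lemma asym_lo {m k : ℕ} (u : ℕ → ℝ) (h : k < m) : asym m u (m - 1 - k) = - u k := by
  unfold asym
  rw [if_pos (by omega)]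
  congr 2; omega

lemma asym_mid (m : ℕ) (u : ℕ → ℝ) : asym m u m = 0 := by simp [asym]

lemma asym_hi (m k : ℕ) (u : ℕ → ℝ) : asym m u (m + 1 + k) = u k := by
  unfold asym
  rw [if_neg (by omega), if_neg (by omega)]
  congr 1; omega

lemma asym_sq (m : ℕ) (u : ℕ → ℝ) :
    ∑ j ∈ range (2 * m + 1), asym m u j ^ 2 = 2 * ∑ j ∈ range m, u j ^ 2 := by
  rw [split_sum, asym_mid]
  have : ∑ k ∈ range m, asym m u (m - 1 - k) ^ 2 = ∑ k ∈ range m, u k ^ 2 :=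
    sum_congr rfl fun k hk => by rw [asym_lo u (mem_range.1 hk)]; ring
  rw [this]
  simp only [asym_hi]; ring

lemma asym_mul_hi {c : ℤ → ℝ} (m j : ℕ) (v : ℕ → ℝ) (u : ℕ → ℝ)
    (hlo : ∀ k < m, v (m - 1 - k) = - u k) (hmid : v m = 0) (hhi : ∀ k < m, v (m + 1 + k) = u k) :
    ∑ t ∈ range (2 * m + 1), c (((m + 1 + j : ℕ) : ℤ) - (t : ℤ)) * v t =
      ∑ k ∈ range m, (c ((j : ℤ) - k) - c ((j : ℤ) + k + 2)) * u k := by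
  rw [split_sum, hmid, mul_zero, add_zero, ← sum_add_distrib]
  refine sum_congr rfl fun k hk => ?_
  have hk := mem_range.1 hk
  rw [hlo k hk, hhi k hk]
  have e1 : ((m + 1 + j : ℕ) : ℤ) - ((m - 1 - k : ℕ) : ℤ) = (j : ℤ) + k + 2 := by omega
  have e2 : ((m + 1 + j : ℕ) : ℤ) - ((m + 1 + k : ℕ) : ℤ) = (j : ℤ) - k := by omega
  rw [e1, e2]; ring

lemma asym_mul_lo {c : ℤ → ℝ} (hev : ∀ m, c (-m) = c m) (m j : ℕ) (hj : j < m) (u : ℕ → ℝ) :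
    ∑ t ∈ range (2 * m + 1), c (((m - 1 - j : ℕ) : ℤ) - (t : ℤ)) * asym m u t =
      - ∑ k ∈ range m, (c ((j : ℤ) - k) - c ((j : ℤ) + k + 2)) * u k := by
  rw [split_sum, asym_mid, mul_zero, add_zero, ← sum_add_distrib, ← sum_neg_distrib]
  refine sum_congr rfl fun k hk => ?_
  have hk := mem_range.1 hk
  rw [asym_lo u hk, asym_hi]
  have e1 : ((m - 1 - j : ℕ) : ℤ) - ((m - 1 - k : ℕ) : ℤ) = -((j : ℤ) - k) := by omega
  have e2 : ((m - 1 - j : ℕ) : ℤ) - ((m + 1 + k : ℕ) : ℤ) = -((j : ℤ) + k + 2) := by omega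
  rw [e1, e2, hev, hev]; ring

lemma asym_QF {c : ℤ → ℝ} (hev : ∀ m, c (-m) = c m) (m : ℕ) (u : ℕ → ℝ) :
    QF c (2 * m + 1) (asym m u) = 2 * ∑ j ∈ range m, u j *
      ∑ k ∈ range m, (c ((j : ℤ) - k) - c ((j : ℤ) + k + 2)) * u k := by
  unfold QF
  rw [split_sum, asym_mid, zero_mul, add_zero, ← sum_add_distrib, mul_sum]
  refine sum_congr rfl fun k hk => ?_
  have hk := mem_range.1 hk
  rw [asym_mul_lo hev m k hk, asym_mul_hi m k _ u (fun k hk => asym_lo u hk) (asym_mid m u)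
    (fun k _ => asym_hi m k u), asym_lo u hk, asym_hi]
  ring

lemma MM_form {c : ℤ → ℝ} (hev : ∀ m, c (-m) = c m) (n : ℕ) (v : Fin n → ℝ) :
    v ⬝ᵥ (MM c n *ᵥ v) = QF c (2 * n + 1) (asym n (ext0 v)) / 2 := by
  rw [asym_QF hev]
  simp only [dotProduct, mulVec, MM, of_apply, Finset.sum_range, ext0_fin]
  ring

lemma TM_posDef {c : ℤ → ℝ} (hev : ∀ m, c (-m) = c m) {δ : ℝ} (hδ : 0 < δ) (h : Coer c δ) (n : ℕ) :
    (TM c n).PosDef := by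
  refine Matrix.PosDef.of_dotProduct_mulVec_pos (TM_isHermitian hev n) fun v hv => ?_
  rw [star_trivial, TM_form]
  refine lt_of_lt_of_le ?_ (h n _)
  rw [ext0_sq]
  refine mul_pos hδ ?_
  obtain ⟨i, hi⟩ := Function.ne_iff.1 hv
  exact sum_pos' (fun _ _ => sq_nonneg _) ⟨i, mem_univ _, by have hi2 : v i ≠ 0 := hi; positivity⟩

lemma MM_posDef {c : ℤ → ℝ} (hev : ∀ m, c (-m) = c m) {δ : ℝ} (hδ : 0 < δ) (h : Coer c δ) (n : ℕ) :
    (MM c n).PosDef := by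
  refine Matrix.PosDef.of_dotProduct_mulVec_pos (MM_isHermitian hev n) fun v hv => ?_
  rw [star_trivial, MM_form hev]
  have := h (2 * n + 1) (asym n (ext0 v))
  rw [asym_sq, ext0_sq] at this
  obtain ⟨i, hi⟩ := Function.ne_iff.1 hv
  have : 0 < ∑ j, v j ^ 2 := 
    sum_pos' (fun _ _ => sq_nonneg _) ⟨i, mem_univ _, by have hi2 : v i ≠ 0 := hi; positivity⟩
  nlinarith [mul_pos hδ this]

/-- first column of the inverse -/
def xs (c : ℤ → ℝ) (n : ℕ) (k : ℕ) : ℝ :=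
  if h : k < n then (TM c n)⁻¹ ⟨k, h⟩ ⟨0, by omega⟩ else 0

lemma xs_zero_of_le (c : ℤ → ℝ) {n k : ℕ} (h : n ≤ k) : xs c n k = 0 := by
  simp [xs, not_lt.2 h]

lemma xs_eq {c : ℤ → ℝ} (hev : ∀ m, c (-m) = c m) {δ : ℝ} (hδ : 0 < δ) (h : Coer c δ) {n j : ℕ}
    (hj : j < n) : ∑ k ∈ range n, c ((j : ℤ) - k) * xs c n k = if j = 0 then 1 else 0 := by
  have hu : IsUnit (TM c n).det := (TM_posDef hev hδ h n).det_pos.ne'.isUnit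
  have := congrFun (congrFun (Matrix.mul_nonsing_inv _ hu) ⟨j, hj⟩) ⟨0, by omega⟩
  rw [Matrix.mul_apply, Matrix.one_apply] at this
  simp only [Fin.mk.injEq] at this
  rw [← this, Finset.sum_range]
  refine sum_congr rfl fun k _ => ?_
  simp [TM, xs]

lemma QF_zero {c : ℤ → ℝ} {δ : ℝ} (hδ : 0 < δ) (h : Coer c δ) {n : ℕ} {z : ℕ → ℝ}
    (hz : QF c n z = 0) : ∀ k < n, z k = 0 := by
  have h1 := h n z
  rw [hz] at h1
  have h2 : ∑ j ∈ range n, z j ^ 2 = 0 :=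
    le_antisymm (by nlinarith) (sum_nonneg fun _ _ => sq_nonneg _)
  intro k hk
  have := (sum_eq_zero_iff_of_nonneg (fun _ _ => sq_nonneg _)).1 h2 k (mem_range.2 hk)
  exact pow_eq_zero_iff (by norm_num) |>.1 this

lemma xs_pos {c : ℤ → ℝ} (hev : ∀ m, c (-m) = c m) {δ : ℝ} (hδ : 0 < δ) (h : Coer c δ) (n : ℕ) :
    0 < xs c (n + 1) 0 := by
  have := (TM_posDef hev hδ h (n+1)).inv
  have h2 := this.diag_pos (i := 0)
  simpa [xs] using h2

lemma xs_det {c : ℤ → ℝ} (hev : ∀ m, c (-m) = c m) {δ : ℝ} (hδ : 0 < δ) (h : Coer c δ) (n : ℕ) :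
    xs c (n + 1) 0 * (TM c (n + 1)).det = (TM c n).det := by
  have hu : (TM c (n+1)).det ≠ 0 := (TM_posDef hev hδ h (n+1)).det_pos.ne'
  have : xs c (n + 1) 0 = (TM c (n+1))⁻¹ 0 0 := by simp [xs]
  rw [this, Matrix.inv_def, Matrix.smul_apply, Ring.inverse_eq_inv', smul_eq_mul,
    Matrix.adjugate_fin_succ_eq_det_submatrix]
  have e : (TM c (n + 1)).submatrix (Fin.succAbove 0) (Fin.succAbove 0) = TM c n := by
    ext j k
    simp [TM]
  rw [e]
  simp
  field_simp

/-- reflection coefficient-/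
def rs (c : ℤ → ℝ) (n : ℕ) : ℝ := xs c n (n - 1) / xs c n 0

lemma xs_rec {c : ℤ → ℝ} (hev : ∀ m, c (-m) = c m) {δ : ℝ} (hδ : 0 < δ) (h : Coer c δ) (n : ℕ) :
    xs c (n + 1) 0 = xs c (n + 2) 0 * (1 - rs c (n + 2) ^ 2) ∧
    ∀ k < n + 2, xs c (n + 1) 0 * xs c (n + 2) k = xs c (n + 2) 0 * (xs c (n + 1) k +
      rs c (n + 2) * xs c (n + 1) (n + 1 - k)) := by
  set x := xs c (n + 2) with hx
  set y := xs c (n + 1) with hy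
  have x0 : 0 < x 0 := xs_pos hev hδ h _
  have y0 : 0 < y 0 := xs_pos hev hδ h _
  have yn : y (n + 1) = 0 := xs_zero_of_le _ le_rfl
  set s : ℝ := ∑ k ∈ range (n + 1), c ((n + 1 : ℤ) - k) * y k with hs
  set z : ℕ → ℝ := fun k => y 0 * x k - x 0 * y k - x (n + 1) * y (n + 1 - k) with hz
  -- T applied to pieces
  have Ty : ∀ j < n + 2, ∑ k ∈ range (n + 2), c ((j : ℤ) - k) * y k =
      (if j = 0 then 1 else 0) + if j = n + 1 then s else 0 := by
    intro j hj
    rw [sum_range_succ, yn, mul_zero, add_zero]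
    rcases Nat.lt_succ_iff_lt_or_eq.1 hj with h1 | h1
    · rw [xs_eq hev hδ h h1, if_neg (by omega : ¬ j = n + 1), add_zero]
    · subst h1; simp [hs]
  have Twy : ∀ j < n + 2, ∑ k ∈ range (n + 2), c ((j : ℤ) - k) * y (n + 1 - k) =
      (if j = n + 1 then 1 else 0) + if j = 0 then s else 0 := by
    intro j hj
    have := Ty (n + 1 - j) (by omega)
    rw [← sum_range_reflect] at this
    rw [show (if j = n + 1 then (1:ℝ) else 0) = if n + 1 - j = 0 then 1 else 0 by
      congr 1; simp; omega, show (if j = 0 then s else 0) = if n + 1 - j = n + 1 then s else 0 by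
      congr 1; simp; omega, ← this]
    refine sum_congr rfl fun k hk => ?_
    have hk := mem_range.1 hk
    rw [← hev]
    congr 2 
    omega
  have Tx : ∀ j < n + 2, ∑ k ∈ range (n + 2), c ((j : ℤ) - k) * x k = if j = 0 then 1 else 0 :=
    fun j hj => xs_eq hev hδ h hj
  have Tz : ∀ j < n + 2, ∑ k ∈ range (n + 2), c ((j : ℤ) - k) * z k =
      (if j = 0 then y 0 - x 0 - x (n + 1) * s else 0) -
       if j = n + 1 then x 0 * s + x (n + 1) else 0 := by
    intro j hj
    have : ∑ k ∈ range (n + 2), c ((j : ℤ) - k) * z k =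
      y 0 * ∑ k ∈ range (n + 2), c ((j : ℤ) - k) * x k - x 0 * ∑ k ∈ range (n + 2), c ((j : ℤ) - k) * y k
      - x (n + 1) * ∑ k ∈ range (n + 2), c ((j : ℤ) - k) * y (n + 1 - k) := by
      simp only [mul_sum, ← sum_sub_distrib, hz]
      exact sum_congr rfl fun _ _ => by ring
    rw [this, Tx j hj, Ty j hj, Twy j hj]
    by_cases h0 : j = 0
    · subst h0; simp
    · by_cases h1 : j = n + 1
      · subst h1; simp; ring
      · simp [h0, h1]
  have z0 : z 0 = 0 := by simp only [hz, Nat.sub_zero, yn]; ring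
  have zn : z (n + 1) = 0 := by simp only [hz, yn, Nat.sub_self]; ring
  have hQ : QF c (n + 2) z = 0 := by
    unfold QF
    refine sum_eq_zero fun j hj => ?_
    rw [Tz j (mem_range.1 hj)]
    by_cases h0 : j = 0
    · subst h0; rw [z0, zero_mul]
    · by_cases h1 : j = n + 1
      · subst h1; rw [zn, zero_mul]
      · simp [h0, h1]
  have hzz := QF_zero hδ h hQ
  have Tz0 : ∀ j, ∑ k ∈ range (n + 2), c ((j : ℤ) - k) * z k = 0 := fun j =>
    sum_eq_zero fun k hk => by rw [hzz k (mem_range.1 hk), mul_zero]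
  have e0 := Tz 0 (by omega)
  have e1 := Tz (n + 1) (by omega)
  rw [show ((0 : ℕ) : ℤ) = 0 from rfl, Tz0] at e0
  rw [Tz0] at e1
  simp at e0 e1
  have hr : rs c (n + 2) = x (n + 1) / x 0 := rfl
  refine ⟨?_, fun k hk => ?_⟩
  · rw [hr]; field_simp
    have : x (n + 1) = - (x 0 * s) := by linarith
    rw [this]
    rw [this] at e0
    linear_combination x 0 * (-e0)
  · have := hzz k hk
    simp only [hz] at this
    rw [hr]; field_simp
    linarith

lemma rs_sq_lt {c : ℤ → ℝ} (hev : ∀ m, c (-m) = c m) {δ : ℝ} (hδ : 0 < δ) (h : Coer c δ) (n : ℕ) :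
    rs c (n + 2) ^ 2 < 1 := by
  have h1 := (xs_rec hev hδ h n).1
  have h2 := xs_pos hev hδ h n
  have h3 := xs_pos hev hδ h (n + 1)
  by_contra hh
  push Not at hh
  rw [h1] at h2
  nlinarith

/-- sums at ε = ±1 -/
def XS (c : ℤ → ℝ) (ε : ℝ) (n : ℕ) : ℝ := ∑ k ∈ range n, ε ^ k * xs c n k

lemma XS_rec {c : ℤ → ℝ} (hev : ∀ m, c (-m) = c m) {δ : ℝ} (hδ : 0 < δ) (h : Coer c δ)
    {ε : ℝ} (hε : ε ^ 2 = 1) (n : ℕ) :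
    xs c (n + 1) 0 * XS c ε (n + 2) =
      xs c (n + 2) 0 * ((1 + rs c (n + 2) * ε ^ (n + 1)) * XS c ε (n + 1)) := by
  unfold XS
  have e1 : ∑ k ∈ range (n + 2), ε ^ k * xs c (n + 1) k = ∑ k ∈ range (n + 1), ε ^ k * xs c (n + 1) k := by
    rw [sum_range_succ, xs_zero_of_le c le_rfl, mul_zero, add_zero]
  have e2 : ∑ k ∈ range (n + 2), ε ^ k * xs c (n + 1) (n + 1 - k) =
      ε ^ (n + 1) * ∑ k ∈ range (n + 1), ε ^ k * xs c (n + 1) k := by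
    rw [← e1, ← sum_range_reflect, mul_sum]
    refine sum_congr rfl fun k hk => ?_
    have hk := mem_range.1 hk
    have : n + 1 - (n + 2 - 1 - k) = k := by omega
    rw [this, ← mul_assoc, ← pow_add]
    congr 1
    have e : n + 1 + k = (n + 2 - 1 - k) + 2 * k := by omega
    rw [e, pow_add, pow_mul, hε, one_pow, mul_one]
  rw [mul_sum, one_add_mul, mul_assoc, ← e2, ← e1, mul_sum, ← sum_add_distrib, mul_sum]
  refine sum_congr rfl fun k hk => ?_
  have := (xs_rec hev hδ h n).2 k (mem_range.1 hk)
  linear_combination ε ^ k * this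

lemma xs_one {c : ℤ → ℝ} (hev : ∀ m, c (-m) = c m) {δ : ℝ} (hδ : 0 < δ) (h : Coer c δ) :
    c 0 * xs c 1 0 = 1 := by
  have := xs_eq hev hδ h (n := 1) (j := 0) (by omega)
  simpa using this

lemma XS_pos {c : ℤ → ℝ} (hev : ∀ m, c (-m) = c m) {δ : ℝ} (hδ : 0 < δ) (h : Coer c δ)
    {ε : ℝ} (hε : ε ^ 2 = 1) (n : ℕ) : 0 < XS c ε (n + 1) := by
  induction n with
  | zero => simpa [XS] using xs_pos hev hδ h 0
  | succ n ih =>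
    have h1 := XS_rec hev hδ h hε n
    have h2 := xs_pos hev hδ h n
    have h3 := xs_pos hev hδ h (n + 1)
    have h4 := rs_sq_lt hev hδ h n
    have h5 : (rs c (n + 2) * ε ^ (n + 1)) ^ 2 < 1 := by
      rw [mul_pow, ← pow_mul, mul_comm (n+1), pow_mul, hε, one_pow, mul_one]; exact h4
    have h6 : 0 < 1 + rs c (n + 2) * ε ^ (n + 1) := by nlinarith
    have : 0 < xs c (n + 1) 0 * XS c ε (n + 2) := by rw [h1]; positivity
    exact (mul_pos_iff_of_pos_left h2).1 this

lemma MM_step {c : ℤ → ℝ} (hev : ∀ m, c (-m) = c m) {δ : ℝ} (hδ : 0 < δ) (h : Coer c δ) (N : ℕ) :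
    (MM c N).det = xs c (2 * N + 3) 0 * (1 - rs c (2 * N + 3)) * (MM c (N + 1)).det := by
  set m := N + 1 with hm
  set x := xs c (2 * N + 3) with hx
  have x0 : 0 < x 0 := xs_pos hev hδ h _
  have hn : 2 * N + 3 = 2 * m + 1 := by omega
  have Tx : ∀ j < 2 * m + 1, ∑ k ∈ range (2 * m + 1), c ((j : ℤ) - k) * x k = if j = 0 then 1 else 0 := by
    intro j hj; rw [hx, hn]; exact xs_eq hev hδ h hj
  have Twx : ∀ j < 2 * m + 1, ∑ k ∈ range (2 * m + 1), c ((j : ℤ) - k) * x (2 * m - k) =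
      if j = 2 * m then 1 else 0 := by
    intro j hj
    have := Tx (2 * m - j) (by omega)
    rw [← sum_range_reflect] at this
    rw [show (if j = 2 * m then (1:ℝ) else 0) = if 2 * m - j = 0 then 1 else 0 by
      congr 1; simp; omega, ← this]
    refine sum_congr rfl fun k hk => ?_
    have hk := mem_range.1 hk
    rw [← hev]
    congr 2
    omega
  set v : ℕ → ℝ := fun k => x (2 * m - k) - x k with hv
  set u : ℕ → ℝ := fun k => v (m + 1 + k) with hu
  have key : ∀ j < m, ∑ k ∈ range m, (c ((j : ℤ) - k) - c ((j : ℤ) + k + 2)) * u k =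
      if j = N then 1 else 0 := by
    intro j hj
    rw [← asym_mul_hi m j v u ?_ ?_ (fun k _ => rfl)]
    · have : ∀ t : ℕ, c (((m + 1 + j : ℕ) : ℤ) - (t : ℤ)) * v t =
        c (((m + 1 + j : ℕ) : ℤ) - (t : ℤ)) * x (2 * m - t) - c (((m + 1 + j : ℕ) : ℤ) - (t : ℤ)) * x t := by
        intro t; simp only [hv]; ring
      simp only [this]
      rw [sum_sub_distrib, Tx _ (by omega), Twx _ (by omega)]
      simp only [show (m + 1 + j = 0) = False by simp, if_false, sub_zero]
      congr 1
      simp only [eq_iff_iff]; omega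
    · intro k hk
      simp only [hu, hv]
      rw [show 2 * m - (m - 1 - k) = m + 1 + k by omega, show 2 * m - (m + 1 + k) = m - 1 - k by omega]
      ring
    · simp only [hv]; rw [show 2 * m - m = m by omega]; ring
  have hdet : (MM c m).det ≠ 0 := (MM_posDef hev hδ h m).det_pos.ne'
  have hMu : MM c m *ᵥ (fun k : Fin m => u k) = Pi.single (Fin.last N) 1 := by
    ext j
    have := key j j.2
    rw [Finset.sum_range] at this
    simp only [mulVec, dotProduct, MM, of_apply]
    rw [this, Pi.single_apply]
    congr 1
    simp only [eq_iff_iff, Fin.ext_iff, Fin.val_last]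
  have hinv : (fun k : Fin m => u k) = (MM c m)⁻¹ *ᵥ Pi.single (Fin.last N) 1 := by
    rw [← hMu, mulVec_mulVec, Matrix.nonsing_inv_mul _ hdet.isUnit, one_mulVec]
  have h3 := congrFun hinv (Fin.last N)
  rw [mulVec_single_one, Matrix.col_apply, Matrix.inv_def, Matrix.smul_apply, Ring.inverse_eq_inv', smul_eq_mul,
    Matrix.adjugate_fin_succ_eq_det_submatrix] at h3
  have e : (MM c m).submatrix (Fin.succAbove (Fin.last N)) (Fin.succAbove (Fin.last N)) = MM c N := by
    ext j k
    simp [MM]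
  rw [e] at h3
  simp only [hu, hv, Fin.val_last] at h3
  rw [show 2 * m - (m + 1 + N) = 0 by omega] at h3
  have hr : rs c (2 * N + 3) = x (m + 1 + N) / x 0 := by
    unfold rs; rw [← hx, show 2 * N + 3 - 1 = m + 1 + N by omega]
  have e4 : (-1 : ℝ) ^ (N + N) = 1 := by rw [← two_mul, pow_mul]; simp
  rw [e4, one_mul] at h3
  rw [hr]
  have : x 0 * (1 - x (m + 1 + N) / x 0) = x 0 - x (m + 1 + N) := by field_simp
  rw [this, h3]
  field_simp

theorem MM_sq {c : ℤ → ℝ} (hev : ∀ m, c (-m) = c m) {δ : ℝ} (hδ : 0 < δ) (h : Coer c δ) (N : ℕ) :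
    (MM c N).det ^ 2 * xs c (2 * N + 1) 0 =
      (TM c (2 * N + 1)).det * (XS c 1 (2 * N + 1) * XS c (-1) (2 * N + 1)) := by
  induction N with
  | zero =>
    have := xs_one hev hδ h
    simp [XS, TM, Matrix.det_unique]
    linear_combination (- xs c 1 0) * this
  | succ N ih =>
    have s1 := MM_step hev hδ h N
    have a1 := (xs_rec hev hδ h (2 * N)).1
    have a2 := (xs_rec hev hδ h (2 * N + 1)).1
    have d1 := xs_det hev hδ h (2 * N + 1)
    have d2 := xs_det hev hδ h (2 * N + 2)
    have p1 := XS_rec hev hδ h (ε := 1) (by norm_num) (2 * N)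
    have p2 := XS_rec hev hδ h (ε := 1) (by norm_num) (2 * N + 1)
    have q1 := XS_rec hev hδ h (ε := -1) (by norm_num) (2 * N)
    have q2 := XS_rec hev hδ h (ε := -1) (by norm_num) (2 * N + 1)
    have b1 := xs_pos hev hδ h (2 * N)
    have b2 := xs_pos hev hδ h (2 * N + 1)
    have b3 := xs_pos hev hδ h (2 * N + 2)
    have r3 := rs_sq_lt hev hδ h (2 * N + 1)
    have r2 := rs_sq_lt hev hδ h (2 * N)
    have z1 : (-1 : ℝ) ^ (2 * N + 1) = -1 := by rw [pow_succ, pow_mul]; simp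
    have z2 : (-1 : ℝ) ^ (2 * N + 1 + 1) = 1 := by rw [pow_succ, z1]; simp
    rw [z1] at q1
    rw [z2] at q2
    simp only [one_pow, mul_one] at p1 p2 q2
    have i1 : 2 * (N + 1) + 1 = 2 * N + 3 := by ring
    rw [i1]
    have i2 : 2 * N + 1 + 2 = 2 * N + 3 := by ring
    have i3 : 2 * N + 1 + 1 = 2 * N + 2 := by ring
    have i4 : 2 * N + 2 + 1 = 2 * N + 3 := by ring
    rw [i2] at a2 p2 q2 r3
    rw [i3] at a2 d1 p2 q2 b2
    rw [i4] at d2 b3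
    generalize xs c (2 * N + 1) 0 = A1 at *
    generalize xs c (2 * N + 2) 0 = A2 at *
    generalize xs c (2 * N + 3) 0 = A3 at *
    generalize rs c (2 * N + 2) = r at *
    generalize rs c (2 * N + 3) = s at *
    generalize (TM c (2 * N + 1)).det = D1 at *
    generalize (TM c (2 * N + 2)).det = D2 at *
    generalize (TM c (2 * N + 3)).det = D3 at *
    generalize XS c 1 (2 * N + 1) = P1 at *
    generalize XS c 1 (2 * N + 2) = P2 at *
    generalize XS c 1 (2 * N + 3) = P3 at *
    generalize XS c (-1) (2 * N + 1) = Q1 at *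
    generalize XS c (-1) (2 * N + 2) = Q2 at *
    generalize XS c (-1) (2 * N + 3) = Q3 at *
    generalize (MM c (N + 1)).det = M2 at *
    generalize (MM c N).det = M1 at *
    have hs : 1 - s ≠ 0 := by intro h; nlinarith
    have hs' : 1 + s ≠ 0 := by intro h; nlinarith
    have hr2 : 1 - r ^ 2 ≠ 0 := by linarith
    -- express everything
    subst a2
    subst a1
    have hA : A3 ≠ 0 := b3.ne'
    have hP2 : P2 = P1 * (1 + r) / (1 - r ^ 2) := by
      rw [eq_div_iff hr2]
      have : A3 * (1 - s ^ 2) ≠ 0 := b2.ne'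
      apply mul_left_cancel₀ this
      linear_combination p1
    have hQ2 : Q2 = Q1 * (1 - r) / (1 - r ^ 2) := by
      rw [eq_div_iff hr2]
      have : A3 * (1 - s ^ 2) ≠ 0 := b2.ne'
      apply mul_left_cancel₀ this
      linear_combination q1
    have hs2 : 1 - s ^ 2 ≠ 0 := by linarith
    have hP3 : P3 * (1 - s) = P2 := by
      apply mul_left_cancel₀ (mul_ne_zero hA hs')
      linear_combination p2
    have hQ3 : Q3 * (1 - s) = Q2 := by
      apply mul_left_cancel₀ (mul_ne_zero hA hs')
      linear_combination q2
    subst s1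
    have hPQ : P2 * Q2 * (1 - r ^ 2) = P1 * Q1 := by
      rw [hP2, hQ2]; field_simp; ring
    rw [← d1, ← d2, ← hPQ, ← hP3, ← hQ3] at ih
    have hne : A3 ^ 2 * (1 - s) ^ 2 * (1 - s ^ 2) * (1 - r ^ 2) ≠ 0 := by positivity
    apply mul_left_cancel₀ hne
    linear_combination ih

end EE
end

noncomputable section
namespace EE
open MeasureTheory Set Filter Topology AddCircle
open scoped ENNReal ComplexConjugate InnerProductSpace

instance factPi : Fact (0 < 2 * Real.pi) := ⟨by positivity⟩

/-- the circle -/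
abbrev Circ := AddCircle (2 * Real.pi)

/-- normalized Haar measure -/
abbrev hm : Measure Circ := AddCircle.haarAddCircle

/-- the Hilbert space -/
abbrev HH := Lp ℂ 2 hm

/-- the Fourier basis -/
abbrev ee : HilbertBasis ℤ ℂ HH := fourierBasis

/-- transfer to the circle -/
def GG (g : ℝ → ℂ) : Circ → ℂ := fun x => g (AddCircle.equivIoc (2 * Real.pi) 0 x)

/-- Fourier coefficient of a complex valued function -/
def cf (g : ℝ → ℂ) (n : ℤ) : ℂ :=
  (1 / (2 * Real.pi) : ℂ) *
    ∫ t in (0 : ℝ)..(2 * Real.pi), g t * Complex.exp (-Complex.I * (n : ℂ) * (t : ℂ))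

/-- admissible symbols -/
structure Adm (g : ℝ → ℂ) : Prop where
  meas : Measurable g
  bdd : ∃ C : ℝ, 0 ≤ C ∧ ∀ x ∈ Icc 0 (2 * Real.pi), ‖g x‖ ≤ C

lemma GG_range (x : Circ) : (AddCircle.equivIoc (2 * Real.pi) 0 x : ℝ) ∈ Ioc 0 (2 * Real.pi) := by
  have := (AddCircle.equivIoc (2 * Real.pi) 0 x).2
  simpa using this

lemma GG_meas {g : ℝ → ℂ} (hg : Measurable g) : Measurable (GG g) :=
  hg.comp (measurable_subtype_coe.comp (AddCircle.measurableEquivIoc (2 * Real.pi) 0).measurable)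

lemma GG_memLp {g : ℝ → ℂ} (hg : Adm g) : MemLp (GG g) ∞ hm := by
  obtain ⟨C, -, hC⟩ := hg.bdd
  exact memLp_top_of_bound (GG_meas hg.meas).aestronglyMeasurable C
    (Eventually.of_forall fun x => hC _ (Ioc_subset_Icc_self (GG_range x)))

lemma GG_lift (g : ℝ → ℂ) : GG g = AddCircle.liftIoc (2 * Real.pi) 0 g := rfl

lemma GG_coeff (g : ℝ → ℂ) (n : ℤ) : fourierCoeff (GG g) n = cf g n := by
  rw [GG_lift, fourierCoeff_liftIoc_eq, fourierCoeffOn_eq_integral, cf]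
  simp only [zero_add, sub_zero]
  rw [Complex.real_smul]
  push_cast
  congr 1
  refine intervalIntegral.integral_congr fun x _ => ?_
  simp only [smul_eq_mul]
  rw [fourier_coe_apply, mul_comm]
  congr 2
  have : (Real.pi : ℂ) ≠ 0 := by exact_mod_cast Real.pi_ne_zero
  push_cast
  field_simp
  ring

open Classical in
/-- multiplication operator -/
def Mo (g : ℝ → ℂ) : HH →L[ℂ] HH :=
  if h : Adm g then (ContinuousLinearMap.mul ℂ ℂ).holderL hm ∞ 2 2 ((GG_memLp h).toLp (GG g)) else 0

lemma Mo_coe {g : ℝ → ℂ} (hg : Adm g) (u : HH) : Mo g u =ᵐ[hm] fun x => GG g x * u x := by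
  rw [Mo, dif_pos hg]
  have h1 := (ContinuousLinearMap.mul ℂ ℂ).coeFn_holder (r := 2) ((GG_memLp hg).toLp (GG g)) u
  refine h1.trans ?_
  filter_upwards [(GG_memLp hg).coeFn_toLp] with x hx
  simp [hx]

lemma Adm.mul {g h : ℝ → ℂ} (hg : Adm g) (hh : Adm h) : Adm (fun x => g x * h x) := by
  obtain ⟨C, hC0, hC⟩ := hg.bdd
  obtain ⟨D, hD0, hD⟩ := hh.bdd
  refine ⟨hg.meas.mul hh.meas, C * D, mul_nonneg hC0 hD0, fun x hx => ?_⟩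
  rw [norm_mul]
  exact mul_le_mul (hC x hx) (hD x hx) (norm_nonneg _) hC0

lemma Mo_mul {g h : ℝ → ℂ} (hg : Adm g) (hh : Adm h) : Mo (fun x => g x * h x) = Mo g ∘L Mo h := by
  ext1 u
  refine Lp.ext ?_
  have h3 := Mo_coe hg (Mo h u)
  filter_upwards [Mo_coe (hg.mul hh) u, Mo_coe hh u, h3] with x h1 h2 h3
  rw [h1, ContinuousLinearMap.comp_apply, h3, h2]
  simp only [GG]; ring

lemma Mo_norm {g : ℝ → ℂ} (hg : Adm g) {C : ℝ} (hC0 : 0 ≤ C)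
    (hC : ∀ x ∈ Icc 0 (2 * Real.pi), ‖g x‖ ≤ C) : ‖Mo g‖ ≤ C := by
  refine ContinuousLinearMap.opNorm_le_bound _ hC0 fun u => ?_
  refine Lp.norm_le_mul_norm_of_ae_le_mul ?_
  filter_upwards [Mo_coe hg u] with x hx
  rw [hx, norm_mul]
  exact mul_le_mul_of_nonneg_right (hC _ (Ioc_subset_Icc_self (GG_range x))) (norm_nonneg _)

lemma Mo_inner {g : ℝ → ℂ} (hg : Adm g) (u v : HH) :
    ⟪u, Mo g v⟫_ℂ = ∫ x, GG g x * (conj (u x) * v x) ∂hm := by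
  rw [L2.inner_def]
  refine integral_congr_ae ?_
  filter_upwards [Mo_coe hg v] with x hx
  rw [hx]; simp only [RCLike.inner_apply]; ring

lemma Mo_coer {g : ℝ → ℝ} (hg : Adm (fun x => (g x : ℂ))) {δ : ℝ}
    (hδ : ∀ x ∈ Icc 0 (2 * Real.pi), δ ≤ g x) (u : HH) :
    δ * ‖u‖ ^ 2 ≤ (⟪u, Mo (fun x => (g x : ℂ)) u⟫_ℂ).re := by
  rw [Mo_inner hg]
  have e1 : ∀ x, GG (fun x => (g x : ℂ)) x * (conj (u x) * u x) =
      ((g (AddCircle.equivIoc (2 * Real.pi) 0 x) * ‖u x‖ ^ 2 : ℝ) : ℂ) := by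
    intro x
    rw [← Complex.normSq_eq_conj_mul_self, Complex.normSq_eq_norm_sq]
    simp [GG]
  simp only [e1]
  rw [integral_complex_ofReal, Complex.ofReal_re]
  have hu : Integrable (fun x => ‖u x‖ ^ 2) hm := (memLp_two_iff_integrable_sq_norm (Lp.aestronglyMeasurable u)).1 (Lp.memLp u)
  have e2 : ‖u‖ ^ 2 = ∫ x, ‖u x‖ ^ 2 ∂hm := by
    have := @inner_self_eq_norm_sq ℂ HH _ _ _ u
    rw [← this, L2.inner_def]
    have e3 : ∀ x, ⟪u x, u x⟫_ℂ = ((‖u x‖ ^ 2 : ℝ) : ℂ) := by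
      intro x; simp
    simp only [e3]
    rw [integral_complex_ofReal]; rfl
  rw [e2, ← integral_const_mul]
  refine integral_mono (hu.const_mul _) ?_ fun x => ?_
  · obtain ⟨C, hC0, hC⟩ := hg.bdd
    have hm1 : Measurable (fun x : Circ => g (AddCircle.equivIoc (2 * Real.pi) 0 x)) := by
      have := Complex.measurable_re.comp (GG_meas hg.meas)
      simpa [GG, Function.comp_def] using this
    refine Integrable.bdd_mul (c := C) hu hm1.aestronglyMeasurable (Eventually.of_forall fun x => ?_)
    simpa using hC _ (Ioc_subset_Icc_self (GG_range x))
  · exact mul_le_mul_of_nonneg_right (hδ _ (Ioc_subset_Icc_self (GG_range x))) (by positivity)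

lemma ee_coe (n : ℤ) : (ee n : Circ → ℂ) =ᵐ[hm] fourier n := by
  rw [ee, coe_fourierBasis]; exact coeFn_fourierLp 2 n

lemma Mo_coef {g : ℝ → ℂ} (hg : Adm g) (j l : ℤ) : ⟪ee j, Mo g (ee l)⟫_ℂ = cf g (j - l) := by
  rw [Mo_inner hg, ← GG_coeff, fourierCoeff]
  refine integral_congr_ae ?_
  filter_upwards [ee_coe j, ee_coe l] with x h1 h2
  rw [h1, h2, ← fourier_neg, ← fourier_add, smul_eq_mul, mul_comm]
  congr 2; ring_nf

lemma adm_const (c : ℂ) : Adm (fun _ => c) := ⟨measurable_const, ‖c‖, norm_nonneg _, fun _ _ => le_rfl⟩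

lemma cf_congr {g h : ℝ → ℂ} (H : ∀ᵐ t, t ∈ Ioc 0 (2 * Real.pi) → g t = h t) (n : ℤ) :
    cf g n = cf h n := by
  unfold cf
  congr 1
  refine intervalIntegral.integral_congr_ae ?_
  rw [uIoc_of_le (by positivity)]
  filter_upwards [H] with t ht h2
  rw [ht h2]

lemma Adm.intervalIntegrable {g : ℝ → ℂ} (hg : Adm g) :
    IntervalIntegrable g volume 0 (2 * Real.pi) := by
  rw [intervalIntegrable_iff_integrableOn_Ioc_of_le (by positivity)]
  obtain ⟨C, hC0, hC⟩ := hg.bdd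
  exact Measure.integrableOn_of_bounded (M := C) (measure_Ioc_lt_top.ne) hg.meas.aestronglyMeasurable
    ((ae_restrict_iff' measurableSet_Ioc).2 (Eventually.of_forall fun x hx => hC x (Ioc_subset_Icc_self hx)))

lemma Adm.intervalIntegrable_exp {g : ℝ → ℂ} (hg : Adm g) (n : ℤ) :
    IntervalIntegrable (fun t => g t * Complex.exp (-Complex.I * (n : ℂ) * (t : ℂ))) volume 0 (2 * Real.pi) :=
  hg.intervalIntegrable.mul_continuousOn (by fun_prop)

lemma cf_add {g h : ℝ → ℂ} (hg : Adm g) (hh : Adm h) (n : ℤ) :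
    cf (fun x => g x + h x) n = cf g n + cf h n := by
  unfold cf
  simp only [add_mul]
  rw [intervalIntegral.integral_add (hg.intervalIntegrable_exp n) (hh.intervalIntegrable_exp n), mul_add]

lemma cf_smul (c : ℂ) (g : ℝ → ℂ) (n : ℤ) : cf (fun x => c * g x) n = c * cf g n := by
  unfold cf
  simp only [mul_assoc]
  rw [intervalIntegral.integral_const_mul]; ring

lemma Adm.add {g h : ℝ → ℂ} (hg : Adm g) (hh : Adm h) : Adm (fun x => g x + h x) := by
  obtain ⟨C, hC0, hC⟩ := hg.bdd
  obtain ⟨D, hD0, hD⟩ := hh.bdd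
  exact ⟨hg.meas.add hh.meas, C + D, by positivity, fun x hx =>
    (norm_add_le _ _).trans (add_le_add (hC x hx) (hD x hx))⟩

lemma cf_const (c : ℂ) (n : ℤ) : cf (fun _ => c) n = if n = 0 then c else 0 := by
  have h1 := fourierCoeff_fourier (T := 2 * Real.pi) 0
  have h2 := GG_coeff (fun _ => (1 : ℂ)) n
  have h3 : GG (fun _ => (1:ℂ)) = (fourier 0 : C(Circ, ℂ)) := by ext x; simp [GG]
  have h4 := cf_smul c (fun _ => 1) n
  simp only [mul_one] at h4
  rw [h4, ← h2, h3, h1]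
  by_cases hn : n = 0 <;> simp [hn]

lemma cf_sum {ι : Type*} (s : Finset ι) (g : ι → ℝ → ℂ) (hg : ∀ i ∈ s, Adm (g i)) (n : ℤ) :
    cf (fun x => ∑ i ∈ s, g i x) n = ∑ i ∈ s, cf (g i) n := by
  unfold cf
  simp only [Finset.sum_mul]
  rw [intervalIntegral.integral_finsetSum (fun i hi => (hg i hi).intervalIntegrable_exp n), Finset.mul_sum]

end EE
end

noncomputable section
namespace EE
open MeasureTheory Set Filter Topology AddCircle
open scoped ENNReal ComplexConjugate InnerProductSpace

lemma ee_orth (j l : ℤ) : ⟪ee j, ee l⟫_ℂ = if j = l then 1 else 0 :=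
  orthonormal_iff_ite.1 ee.orthonormal j l

lemma ee_norm (j : ℤ) : ‖ee j‖ = 1 := ee.orthonormal.1 j

/-- projection on the first n nonnegative modes -/
def Pn (n : ℕ) : HH →L[ℂ] HH := ∑ k ∈ Finset.range n, (innerSL ℂ (ee (k : ℤ))).smulRight (ee (k : ℤ))

lemma Pn_apply (n : ℕ) (u : HH) : Pn n u = ∑ k ∈ Finset.range n, ⟪ee (k : ℤ), u⟫_ℂ • ee (k : ℤ) := by
  simp [Pn]

lemma Pn_coef (n : ℕ) (u : HH) (j : ℤ) : ⟪ee j, Pn n u⟫_ℂ =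
    if 0 ≤ j ∧ j < n then ⟪ee j, u⟫_ℂ else 0 := by
  rw [Pn_apply, inner_sum]
  simp only [inner_smul_right, ee_orth]
  split_ifs with h
  · obtain ⟨k, rfl⟩ := Int.eq_ofNat_of_zero_le h.1
    rw [Finset.sum_eq_single k]
    · simp
    · intro b _ hb
      rw [if_neg (by exact_mod_cast hb.symm), mul_zero]
    · intro hk; exfalso; apply hk; simpa using h.2
  · refine Finset.sum_eq_zero fun k hk => ?_
    rw [if_neg, mul_zero]
    rintro rfl
    exact h ⟨by positivity, by exact_mod_cast Finset.mem_range.1 hk⟩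

lemma ee_ext {u v : HH} (h : ∀ j, ⟪ee j, u⟫_ℂ = ⟪ee j, v⟫_ℂ) : u = v := by
  apply ee.repr.injective
  ext j
  rw [HilbertBasis.repr_apply_apply, HilbertBasis.repr_apply_apply, h]

lemma Pn_idem (n : ℕ) (u : HH) : Pn n (Pn n u) = Pn n u := by
  refine ee_ext fun j => ?_
  simp only [Pn_coef]; split_ifs <;> rfl

lemma Pn_sa (n : ℕ) (u v : HH) : ⟪Pn n u, v⟫_ℂ = ⟪u, Pn n v⟫_ℂ := by
  rw [Pn_apply, Pn_apply, inner_sum, sum_inner]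
  refine Finset.sum_congr rfl fun k _ => ?_
  rw [inner_smul_left, inner_smul_right, inner_conj_symm, mul_comm]

lemma Pn_pyth (n : ℕ) (u : HH) : ‖u‖ ^ 2 = ‖Pn n u‖ ^ 2 + ‖u - Pn n u‖ ^ 2 := by
  have h : ⟪Pn n u, u - Pn n u⟫_ℂ = 0 := by
    rw [Pn_sa, map_sub, Pn_idem, sub_self, inner_zero_right]
  have := @norm_add_sq ℂ HH _ _ _ (Pn n u) (u - Pn n u)
  rw [h] at this
  simpa using this

lemma Pn_norm_le (n : ℕ) (u : HH) : ‖Pn n u‖ ≤ ‖u‖ := by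
  have := Pn_pyth n u
  exact abs_le_of_sq_le_sq' (by nlinarith [sq_nonneg ‖u - Pn n u‖]) (norm_nonneg _) |>.2

lemma Pn_norm (n : ℕ) : ‖Pn n‖ ≤ 1 :=
  ContinuousLinearMap.opNorm_le_bound _ zero_le_one fun u => by simpa using Pn_norm_le n u

/-- strongly convergent families -/
structure SC (B : ℕ → HH →L[ℂ] HH) : Prop where
  bdd : ∃ C : ℝ, 0 ≤ C ∧ ∀ n, ‖B n‖ ≤ C
  lim : ∀ u, ∃ v, Tendsto (fun n => B n u) atTop (𝓝 v)

lemma SC.comp {A B : ℕ → HH →L[ℂ] HH} (hA : SC A) (hB : SC B) : SC (fun n => A n ∘L B n) := by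
  obtain ⟨C, hC0, hC⟩ := hA.bdd
  obtain ⟨D, hD0, hD⟩ := hB.bdd
  refine ⟨⟨C * D, by positivity, fun n => (ContinuousLinearMap.opNorm_comp_le _ _).trans
    (mul_le_mul (hC n) (hD n) (norm_nonneg _) hC0)⟩, fun u => ?_⟩
  obtain ⟨v, hv⟩ := hB.lim u
  obtain ⟨w, hw⟩ := hA.lim v
  refine ⟨w, ?_⟩
  have h1 : Tendsto (fun n => A n (B n u - v)) atTop (𝓝 0) := by
    refine squeeze_zero_norm (a := fun n => C * ‖B n u - v‖) (fun n => ?_) ?_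
    · exact (ContinuousLinearMap.le_opNorm _ _).trans (mul_le_mul_of_nonneg_right (hC n) (norm_nonneg _))
    · have := (tendsto_iff_norm_sub_tendsto_zero.1 hv).const_mul C
      simpa using this
  have := h1.add hw
  simp only [map_sub, sub_add_cancel, zero_add] at this
  exact this

lemma SC.add {A B : ℕ → HH →L[ℂ] HH} (hA : SC A) (hB : SC B) : SC (fun n => A n + B n) := by
  obtain ⟨C, hC0, hC⟩ := hA.bdd
  obtain ⟨D, hD0, hD⟩ := hB.bdd
  refine ⟨⟨C + D, by positivity, fun n => (norm_add_le _ _).trans (add_le_add (hC n) (hD n))⟩, fun u => ?_⟩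
  obtain ⟨v, hv⟩ := hB.lim u
  obtain ⟨w, hw⟩ := hA.lim u
  exact ⟨w + v, by simpa using hw.add hv⟩

lemma SC.neg {A : ℕ → HH →L[ℂ] HH} (hA : SC A) : SC (fun n => - A n) := by
  obtain ⟨C, hC0, hC⟩ := hA.bdd
  refine ⟨⟨C, hC0, fun n => by rw [norm_neg]; exact hC n⟩, fun u => ?_⟩
  obtain ⟨w, hw⟩ := hA.lim u
  exact ⟨-w, by simpa using hw.neg⟩

lemma SC.const (A : HH →L[ℂ] HH) : SC (fun _ => A) :=
  ⟨⟨‖A‖, norm_nonneg _, fun _ => le_rfl⟩, fun u => ⟨A u, tendsto_const_nhds⟩⟩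

lemma SC_Pn : SC Pn := by
  refine ⟨⟨1, zero_le_one, Pn_norm⟩, fun u => ?_⟩
  have h1 := (ee.hasSum_repr u).summable
  have h2 := h1.comp_injective (i := fun k : ℕ => (k : ℤ)) Nat.cast_injective
  refine ⟨∑' k : ℕ, ⟪ee (k : ℤ), u⟫_ℂ • ee (k : ℤ), ?_⟩
  · simp only [Pn_apply]
    have h3 : Summable fun k : ℕ => ⟪ee (k : ℤ), u⟫_ℂ • ee (k : ℤ) := by
      simpa [Function.comp_def, HilbertBasis.repr_apply_apply] using h2
    exact h3.hasSum.tendsto_sum_nat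

/-- finite section operators -/
def An (A : HH →L[ℂ] HH) (n : ℕ) : HH →L[ℂ] HH := Pn n ∘L A ∘L Pn n + (1 - Pn n)

lemma SC_An (A : HH →L[ℂ] HH) : SC (An A) := by
  have h1 : SC (fun n => Pn n ∘L (A ∘L Pn n) + ((1 : HH →L[ℂ] HH) + - Pn n)) :=
    (SC_Pn.comp ((SC.const A).comp SC_Pn)).add ((SC.const 1).add SC_Pn.neg)
  have : (fun n => Pn n ∘L (A ∘L Pn n) + ((1 : HH →L[ℂ] HH) + - Pn n)) = An A := by
    funext n; rw [An, sub_eq_add_neg]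
  rwa [this] at h1

lemma An_coer {A : HH →L[ℂ] HH} {δ : ℝ} (hδ : ∀ u, δ * ‖u‖ ^ 2 ≤ (⟪u, A u⟫_ℂ).re) (hδ1 : δ ≤ 1)
    (n : ℕ) (u : HH) : δ * ‖u‖ ^ 2 ≤ (⟪u, An A n u⟫_ℂ).re := by
  have e1 : ⟪u, An A n u⟫_ℂ = ⟪Pn n u, A (Pn n u)⟫_ℂ + ⟪u - Pn n u, u - Pn n u⟫_ℂ := by
    simp only [An, _root_.add_apply, ContinuousLinearMap.comp_apply, inner_add_right,
      _root_.sub_apply, one_apply_eq_self]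
    rw [Pn_sa]
    congr 1
    rw [inner_sub_left u, Pn_sa, map_sub, Pn_idem, sub_self, inner_zero_right, sub_zero]
  rw [e1, Complex.add_re]
  have e2 : (⟪u - Pn n u, u - Pn n u⟫_ℂ).re = ‖u - Pn n u‖ ^ 2 := by
    have := @inner_self_eq_norm_sq ℂ HH _ _ _ (u - Pn n u)
    simpa using this
  rw [e2, Pn_pyth n u]
  nlinarith [hδ (Pn n u), sq_nonneg ‖u - Pn n u‖]

lemma coer_unit {A : HH →L[ℂ] HH} {δ : ℝ} (hδ0 : 0 < δ) (hδ : ∀ u, δ * ‖u‖ ^ 2 ≤ (⟪u, A u⟫_ℂ).re) :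
    IsUnit A := by
  refine ContinuousLinearMap.isUnit_of_forall_le_norm_inner_map A (c := ⟨δ, hδ0.le⟩) hδ0 fun u => ?_
  have h1 := hδ u
  have h2 : (⟪u, A u⟫_ℂ).re ≤ ‖⟪u, A u⟫_ℂ‖ := Complex.re_le_norm _
  rw [norm_inner_symm]
  show ‖u‖ ^ 2 * δ ≤ _
  linarith

lemma coer_lower {A : HH →L[ℂ] HH} {δ : ℝ} (hδ : ∀ u, δ * ‖u‖ ^ 2 ≤ (⟪u, A u⟫_ℂ).re)
    (u : HH) : δ * ‖u‖ ≤ ‖A u‖ := by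
  rcases eq_or_ne u 0 with rfl | hu
  · simp
  have h1 := hδ u
  have h2 : (⟪u, A u⟫_ℂ).re ≤ ‖⟪u, A u⟫_ℂ‖ := Complex.re_le_norm _
  have h3 := @norm_inner_le_norm ℂ HH _ _ _ u (A u)
  have h4 : 0 < ‖u‖ := norm_pos_iff.2 hu
  refine le_of_mul_le_mul_left ?_ h4
  calc _ = δ * ‖u‖ ^ 2 := by ring
    _ ≤ _ := h1.trans (h2.trans h3)

lemma inv_apply' {A : HH →L[ℂ] HH} (h : IsUnit A) (u : HH) : A (Ring.inverse A u) = u := by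
  have := Ring.mul_inverse_cancel A h
  exact congrArg (fun B : HH →L[ℂ] HH => B u) this

lemma inv_apply2 {A : HH →L[ℂ] HH} (h : IsUnit A) (u : HH) : Ring.inverse A (A u) = u := by
  have := Ring.inverse_mul_cancel A h
  exact congrArg (fun B : HH →L[ℂ] HH => B u) this

lemma inv_norm_le {A : HH →L[ℂ] HH} {δ : ℝ} (hδ0 : 0 < δ) (hδ : ∀ u, δ * ‖u‖ ^ 2 ≤ (⟪u, A u⟫_ℂ).re)
    : ‖Ring.inverse A‖ ≤ δ⁻¹ := by
  refine ContinuousLinearMap.opNorm_le_bound _ (by positivity) fun u => ?_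
  have := coer_lower hδ (Ring.inverse A u)
  rw [inv_apply' (coer_unit hδ0 hδ)] at this
  rw [inv_mul_eq_div, le_div_iff₀ hδ0]; linarith

lemma SC.inv {A : ℕ → HH →L[ℂ] HH} (hA : SC A) {δ : ℝ} (hδ0 : 0 < δ)
    (hδ : ∀ n u, δ * ‖u‖ ^ 2 ≤ (⟪u, A n u⟫_ℂ).re) : SC (fun n => Ring.inverse (A n)) := by
  refine ⟨⟨δ⁻¹, by positivity, fun n => inv_norm_le hδ0 (hδ n)⟩, fun u => ?_⟩
  choose g hg using hA.lim
  have hT : Tendsto (fun n x => A n x) atTop (𝓝 g) := tendsto_pi_nhds.2 hg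
  let L := continuousLinearMapOfTendsto (fun n => A n) hT
  have hL : ∀ x, L x = g x := fun x => rfl
  have hLc : ∀ x, δ * ‖x‖ ^ 2 ≤ (⟪x, L x⟫_ℂ).re := by
    intro x
    rw [hL]
    have h1 : Tendsto (fun n => (⟪x, A n x⟫_ℂ).re) atTop (𝓝 (⟪x, g x⟫_ℂ).re) :=
      (Complex.continuous_re.tendsto _).comp ((tendsto_const_nhds).inner (hg x))
    exact ge_of_tendsto' h1 fun n => hδ n x
  have hLu := coer_unit hδ0 hLc
  refine ⟨Ring.inverse L u, ?_⟩
  set v := Ring.inverse L u with hv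
  have hgv : g v = u := by rw [← hL, hv, inv_apply' hLu]
  rw [tendsto_iff_norm_sub_tendsto_zero]
  refine squeeze_zero (fun _ => norm_nonneg _) (g := fun n => δ⁻¹ * ‖A n v - u‖) (fun n => ?_) ?_
  · have hu := coer_unit hδ0 (hδ n)
    have e : Ring.inverse (A n) u - v = Ring.inverse (A n) (u - A n v) := by
      rw [map_sub, inv_apply2 hu]
    rw [e, norm_sub_rev (A n v)]
    exact (ContinuousLinearMap.le_opNorm _ _).trans
      (mul_le_mul_of_nonneg_right (inv_norm_le hδ0 (hδ n)) (norm_nonneg _))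
  · have := (tendsto_iff_norm_sub_tendsto_zero.1 (hg v)).const_mul δ⁻¹
    rw [hgv] at this
    simpa using this

/-- matrix of an operator -/
def mat (n : ℕ) (B : HH →L[ℂ] HH) : Matrix (Fin n) (Fin n) ℂ :=
  Matrix.of fun i j => ⟪ee (i : ℤ), B (ee (j : ℤ))⟫_ℂ

lemma mat_comp (n : ℕ) (A B : HH →L[ℂ] HH) : mat n (A ∘L Pn n ∘L B) = mat n A * mat n B := by
  ext i j
  simp only [mat, Matrix.of_apply, Matrix.mul_apply, ContinuousLinearMap.comp_apply]
  rw [Pn_apply, map_sum, inner_sum, Finset.sum_range]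
  refine Finset.sum_congr rfl fun k _ => ?_
  rw [map_smul, inner_smul_right, mul_comm]

lemma Pn_ee (n : ℕ) (j : Fin n) : Pn n (ee (j : ℤ)) = ee (j : ℤ) := by
  refine ee_ext fun k => ?_
  rw [Pn_coef]
  split_ifs with h
  · rfl
  · rw [ee_orth, if_neg]
    rintro rfl
    exact h ⟨by positivity, by exact_mod_cast j.2⟩

lemma mat_An (n : ℕ) (A : HH →L[ℂ] HH) : mat n (An A n) = mat n A := by
  ext i j
  simp only [mat, Matrix.of_apply, An, ContinuousLinearMap.comp_apply, _root_.add_apply,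
    _root_.sub_apply, one_apply_eq_self, Pn_ee, sub_self, add_zero]
  rw [← Pn_sa, Pn_ee]

lemma mat_inv (n : ℕ) (A : HH →L[ℂ] HH) {δ : ℝ} (hδ0 : 0 < δ) (hδ1 : δ ≤ 1)
    (hδ : ∀ u, δ * ‖u‖ ^ 2 ≤ (⟪u, A u⟫_ℂ).re) :
    mat n (Ring.inverse (An A n)) * mat n A = 1 := by
  have hu := coer_unit hδ0 (An_coer hδ hδ1 n)
  rw [← mat_An n A, ← mat_comp]
  ext i j
  simp only [mat, Matrix.of_apply, ContinuousLinearMap.comp_apply]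
  have e : Pn n (An A n (ee (j : ℤ))) = An A n (ee (j : ℤ)) := by
    simp only [An, ContinuousLinearMap.comp_apply, _root_.add_apply,
    _root_.sub_apply, one_apply_eq_self, Pn_ee, sub_self, add_zero, Pn_idem]
  rw [e, inv_apply2 hu, ee_orth, Matrix.one_apply]
  simp [Fin.ext_iff]

/-- nuclear matrices -/
structure TC (X : ℕ → ℕ → ℂ) (C : ℝ) : Prop where
  ex : ∃ (ι : Type) (ξ η : ι → HH), Summable (fun i => ‖ξ i‖ * ‖η i‖) ∧ ∑' i, ‖ξ i‖ * ‖η i‖ ≤ C ∧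
    ∀ j l : ℕ, HasSum (fun i => ⟪ee (j : ℤ), ξ i⟫_ℂ * ⟪η i, ee (l : ℤ)⟫_ℂ) (X j l)

/-- trace pairing -/
def trp (n : ℕ) (X : ℕ → ℕ → ℂ) (B : Matrix (Fin n) (Fin n) ℂ) : ℂ :=
  ∑ j : Fin n, ∑ l : Fin n, X j l * B l j

lemma trp_hasSum {ι : Type} {X : ℕ → ℕ → ℂ} {ξ η : ι → HH} 
    (h : ∀ j l : ℕ, HasSum (fun i => ⟪ee (j : ℤ), ξ i⟫_ℂ * ⟪η i, ee (l : ℤ)⟫_ℂ) (X j l))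
    (n : ℕ) (B : HH →L[ℂ] HH) :
    HasSum (fun i => ⟪η i, Pn n (B (Pn n (ξ i)))⟫_ℂ) (trp n X (mat n B)) := by
  have h1 : HasSum (fun i => ∑ j : Fin n, ∑ l : Fin n,
      (⟪ee (j : ℤ), ξ i⟫_ℂ * ⟪η i, ee (l : ℤ)⟫_ℂ) * mat n B l j) (trp n X (mat n B)) :=
    hasSum_sum fun j _ => hasSum_sum fun l _ => (h j l).mul_right _
  convert h1 using 2 with i
  rw [Pn_apply n (ξ i), Finset.sum_range, map_sum, map_sum, inner_sum]
  refine Finset.sum_congr rfl fun j _ => ?_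
  rw [map_smul, map_smul, inner_smul_right, Pn_apply, Finset.sum_range, inner_sum, Finset.mul_sum]
  refine Finset.sum_congr rfl fun l _ => ?_
  rw [inner_smul_right]
  simp only [mat, Matrix.of_apply]; ring

lemma pair_bound (n : ℕ) (B : HH →L[ℂ] HH) (ξ η : HH) :
    ‖⟪η, Pn n (B (Pn n ξ))⟫_ℂ‖ ≤ ‖B‖ * (‖ξ‖ * ‖η‖) := by
  calc _ ≤ ‖η‖ * ‖Pn n (B (Pn n ξ))‖ := norm_inner_le_norm _ _
    _ ≤ ‖η‖ * (‖B‖ * ‖ξ‖) := by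
      gcongr
      refine (Pn_norm_le _ _).trans ((ContinuousLinearMap.le_opNorm _ _).trans ?_)
      gcongr
      exact Pn_norm_le _ _
    _ = _ := by ring

lemma trp_bound {X : ℕ → ℕ → ℂ} {C : ℝ} (h : TC X C) (n : ℕ) (B : HH →L[ℂ] HH) :
    ‖trp n X (mat n B)‖ ≤ ‖B‖ * C := by
  obtain ⟨ι, ξ, η, hs, hC, hX⟩ := h.ex
  have h1 := trp_hasSum hX n B
  rw [← h1.tsum_eq]
  refine (tsum_of_norm_bounded (hs.hasSum.mul_left ‖B‖) fun i => pair_bound n B _ _).trans ?_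
  gcongr

lemma trp_lim {X : ℕ → ℕ → ℂ} {C : ℝ} (h : TC X C) {B : ℕ → HH →L[ℂ] HH} (hB : SC B) :
    ∃ t, Tendsto (fun n => trp n X (mat n (B n))) atTop (𝓝 t) := by
  obtain ⟨ι, ξ, η, hs, hC, hX⟩ := h.ex
  obtain ⟨D, hD0, hD⟩ := hB.bdd
  have hS := (SC_Pn.comp (hB.comp SC_Pn)).lim
  choose g hg using hS
  refine ⟨∑' i, ⟪η i, g (ξ i)⟫_ℂ, ?_⟩
  have e : (fun n => trp n X (mat n (B n))) = fun n => ∑' i, ⟪η i, Pn n (B n (Pn n (ξ i)))⟫_ℂ := by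
    funext n; exact (trp_hasSum hX n (B n)).tsum_eq.symm
  rw [e]
  refine tendsto_tsum_of_dominated_convergence (bound := fun i => D * (‖ξ i‖ * ‖η i‖)) (hs.mul_left D) ?_ ?_
  · intro i
    exact (tendsto_const_nhds).inner (hg (ξ i))
  · refine Eventually.of_forall fun n i => (pair_bound n (B n) _ _).trans ?_
    exact mul_le_mul_of_nonneg_right (hD n) (by positivity)

end EE
end

noncomputable section
namespace EE
open MeasureTheory Set Filter Topology AddCircle
open scoped ENNReal ComplexConjugate InnerProductSpace

lemma TC.add {X Y : ℕ → ℕ → ℂ} {C D : ℝ} (hX : TC X C) (hY : TC Y D) :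
    TC (fun j l => X j l + Y j l) (C + D) := by
  obtain ⟨ι, ξ, η, hs, hC, hX⟩ := hX.ex
  obtain ⟨ι', ξ', η', hs', hC', hX'⟩ := hY.ex
  have h0 : HasSum (fun i : ι ⊕ ι' => ‖Sum.elim ξ ξ' i‖ * ‖Sum.elim η η' i‖)
      (∑' i, ‖ξ i‖ * ‖η i‖ + ∑' i, ‖ξ' i‖ * ‖η' i‖) :=
    HasSum.sum hs.hasSum hs'.hasSum
  refine ⟨ι ⊕ ι', Sum.elim ξ ξ', Sum.elim η η', h0.summable, ?_, fun j l => ?_⟩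
  · rw [h0.tsum_eq]; exact add_le_add hC hC'
  · exact HasSum.sum (hX j l) (hX' j l)

lemma TC.smul {X : ℕ → ℕ → ℂ} {C : ℝ} (hX : TC X C) (c : ℂ) :
    TC (fun j l => c * X j l) (‖c‖ * C) := by
  obtain ⟨ι, ξ, η, hs, hC, hX⟩ := hX.ex
  have h0 : HasSum (fun i => ‖c • ξ i‖ * ‖η i‖) (‖c‖ * ∑' i, ‖ξ i‖ * ‖η i‖) := by
    simp only [norm_smul, mul_assoc]
    exact hs.hasSum.mul_left _
  refine ⟨ι, fun i => c • ξ i, η, h0.summable, ?_, fun j l => ?_⟩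
  · rw [h0.tsum_eq]; gcongr
  · simp only [inner_smul_right, mul_assoc]
    exact (hX j l).mul_left c

lemma TC.mono {X : ℕ → ℕ → ℂ} {C D : ℝ} (hX : TC X C) (h : C ≤ D) : TC X D := by
  obtain ⟨ι, ξ, η, hs, hC, hX⟩ := hX.ex
  exact ⟨ι, ξ, η, hs, hC.trans h, hX⟩

lemma TC_zero : TC (fun _ _ => 0) 0 :=
  ⟨Empty, fun _ => 0, fun _ => 0, by simp, by simp, fun j l => by simp⟩

lemma TC.sum {ι : Type*} (s : Finset ι) {X : ι → ℕ → ℕ → ℂ} {C : ι → ℝ} (h : ∀ i ∈ s, TC (X i) (C i)) :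
    TC (fun j l => ∑ i ∈ s, X i j l) (∑ i ∈ s, C i) := by
  classical
  induction s using Finset.induction_on with
  | empty => simpa using TC_zero
  | insert a s ha ih =>
    simp only [Finset.sum_insert ha]
    exact (h a (Finset.mem_insert_self _ _)).add (ih fun i hi => h i (Finset.mem_insert_of_mem hi))

lemma vec_ex (s : ℕ → ℂ) (hs : Summable fun j => ‖s j‖ ^ 2) :
    ∃ v : HH, (∀ j : ℕ, ⟪ee (j : ℤ), v⟫_ℂ = s j) ∧ ‖v‖ ^ 2 = ∑' j, ‖s j‖ ^ 2 := by
  let f : ℤ → ℂ := fun j => if 0 ≤ j then s j.toNat else 0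
  have hf : ∀ x, x ∉ range (Nat.cast : ℕ → ℤ) → ‖f x‖ ^ 2 = 0 := by
    intro x hx
    have : ¬ (0 ≤ x) := fun h => hx ⟨x.toNat, by simp [h]⟩
    simp [f, this]
  have e : (fun j : ℤ => ‖f j‖ ^ 2) ∘ (Nat.cast : ℕ → ℤ) = fun j => ‖s j‖ ^ 2 := by
    funext j; simp [f]
  have hsum : Summable fun j => ‖f j‖ ^ 2 := by
    rw [← Function.Injective.summable_iff (Nat.cast_injective (R := ℤ)) hf, e]; exact hs
  have hm : Memℓp f 2 := by
    refine memℓp_gen ?_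
    simpa using hsum
  refine ⟨ee.repr.symm ⟨f, hm⟩, fun j => ?_, ?_⟩
  · rw [← HilbertBasis.repr_apply_apply, LinearIsometryEquiv.apply_symm_apply]
    simp [f]
  · rw [LinearIsometryEquiv.norm_map]
    have := lp.norm_rpow_eq_tsum (p := 2) (by simp) (⟨f, hm⟩ : lp (fun _ : ℤ => ℂ) 2)
    simp only [ENNReal.toReal_ofNat, Real.rpow_ofNat] at this
    rw [this]
    rw [← Function.Injective.tsum_eq (Nat.cast_injective (R := ℤ)) (f := fun j => ‖f j‖ ^ 2)]
    · simp [f]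
    · intro x hx
      by_contra h
      exact hx (hf x h)

lemma TC_family (s t : ℕ → ℕ → ℂ) (A B : ℕ → ℝ) (hA : ∀ k, 0 ≤ A k) (hB : ∀ k, 0 ≤ B k)
    (hs : ∀ k, Summable fun j => ‖s k j‖ ^ 2) (ht : ∀ k, Summable fun j => ‖t k j‖ ^ 2)
    (hsA : ∀ k, ∑' j, ‖s k j‖ ^ 2 ≤ A k) (htB : ∀ k, ∑' j, ‖t k j‖ ^ 2 ≤ B k)
    (D : ℕ → ℝ) (hD0 : ∀ k, 0 ≤ D k) (hAB : ∀ k, A k * B k ≤ D k ^ 2) (hD : Summable D) {C : ℝ} (hC : ∑' k, D k ≤ C)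
    (X : ℕ → ℕ → ℂ) (hX : ∀ j l, HasSum (fun k => s k j * t k l) (X j l)) : TC X C := by
  choose ξ h1 h2 using fun k => vec_ex (s k) (hs k)
  choose η h3 h4 using fun k => vec_ex (fun j => conj (t k j)) (by simpa using ht k)
  have hb : ∀ k, ‖ξ k‖ * ‖η k‖ ≤ D k := by
    intro k
    refine abs_le_of_sq_le_sq' ?_ (hD0 k) |>.2
    rw [mul_pow, h2, h4]
    simp only [RCLike.norm_conj]
    refine le_trans ?_ (hAB k)
    exact mul_le_mul (hsA k) (htB k) (tsum_nonneg fun _ => by positivity) (hA k)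
  have hsum := Summable.of_nonneg_of_le (fun k => by positivity) hb hD
  refine ⟨ℕ, ξ, η, hsum, (hsum.tsum_le_tsum hb hD).trans hC, fun j l => ?_⟩
  convert hX j l using 2 with k
  rw [h1, ← inner_conj_symm, h3, Complex.conj_conj]

lemma sum_inv_sq (k : ℕ) : Summable (fun j : ℕ => 1 / ((j : ℝ) + k + 1) ^ 2) ∧
    ∑' j : ℕ, 1 / ((j : ℝ) + k + 1) ^ 2 ≤ 2 / ((k : ℝ) + 1) := by
  have h : ∀ n : ℕ, ∑ j ∈ Finset.range n, 1 / ((j : ℝ) + k + 1) ^ 2 ≤ 2 / ((k : ℝ) + 1) := by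
    intro n
    have : ∑ j ∈ Finset.range n, 1 / ((j : ℝ) + k + 1) ^ 2 ≤ 2 / ((k : ℝ) + 1) - 2 / ((n : ℝ) + k + 1) := by
      induction n with
      | zero => simp
      | succ n ih =>
        rw [Finset.sum_range_succ]
        have h2 : 1 / ((n : ℝ) + k + 1) ^ 2 ≤ 2 / ((n : ℝ) + k + 1) - 2 / (((n + 1 : ℕ) : ℝ) + k + 1) := by
          push_cast
          rw [div_sub_div _ _ (by positivity) (by positivity), div_le_div_iff₀ (by positivity) (by positivity)]
          have : (0 : ℝ) ≤ n := by positivity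
          have : (0 : ℝ) ≤ k := by positivity
          nlinarith [mul_nonneg ‹(0 : ℝ) ≤ n› ‹(0 : ℝ) ≤ k›, sq_nonneg ((n : ℝ) + k + 1), mul_nonneg (add_nonneg ‹(0 : ℝ) ≤ n› ‹(0 : ℝ) ≤ k›) (sq_nonneg ((n : ℝ) + k + 1))]
        linarith
    have h3 : 0 ≤ 2 / ((n : ℝ) + k + 1) := by positivity
    linarith
  have h0 : ∀ j : ℕ, 0 ≤ 1 / ((j : ℝ) + k + 1) ^ 2 := fun j => by positivity
  exact ⟨summable_of_sum_range_le h0 h, Real.tsum_le_of_sum_range_le h0 h⟩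

lemma sum_tail2 {s : ℕ → ℂ} {C : ℝ} (k : ℕ) (h : ∀ j : ℕ, ‖s j‖ ≤ C / ((j : ℝ) + k + 1)) :
    (Summable fun j => ‖s j‖ ^ 2) ∧ ∑' j, ‖s j‖ ^ 2 ≤ C ^ 2 * (2 / ((k : ℝ) + 1)) := by
  have hb : ∀ j : ℕ, ‖s j‖ ^ 2 ≤ C ^ 2 * (1 / ((j : ℝ) + k + 1) ^ 2) := by
    intro j
    calc ‖s j‖ ^ 2 ≤ (C / ((j : ℝ) + k + 1)) ^ 2 := by gcongr; exact h j
      _ = _ := by rw [div_pow]; ring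
  have h1 := (sum_inv_sq k).1.mul_left (C ^ 2)
  have h2 := Summable.of_nonneg_of_le (fun j => by positivity) hb h1
  refine ⟨h2, (h2.tsum_le_tsum hb h1).trans ?_⟩
  rw [tsum_mul_left]
  exact mul_le_mul_of_nonneg_left (sum_inv_sq k).2 (by positivity)

lemma sum_tail4 {s : ℕ → ℂ} {C : ℝ} (hC : 0 ≤ C) (k : ℕ) (h : ∀ j : ℕ, ‖s j‖ ≤ C / ((j : ℝ) + k + 1) ^ 2) :
    (Summable fun j => ‖s j‖ ^ 2) ∧ ∑' j, ‖s j‖ ^ 2 ≤ C ^ 2 * (2 / ((k : ℝ) + 1) ^ 3) := by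
  have h' : ∀ j : ℕ, ‖s j‖ ≤ (C / ((k : ℝ) + 1)) / ((j : ℝ) + k + 1) := by
    intro j
    refine (h j).trans ?_
    rw [div_div, sq]
    gcongr
    linarith [(Nat.cast_nonneg j : (0 : ℝ) ≤ j)]
  obtain ⟨h1, h2⟩ := sum_tail2 k h'
  refine ⟨h1, h2.trans (le_of_eq ?_)⟩
  field_simp

/-- The kernel lemma -/
lemma TC_kernel {α β : ℕ → ℂ} {C D : ℝ} (hC : 0 ≤ C) (hD : 0 ≤ D) {z₁ z₂ : ℂ} (h1 : ‖z₁‖ = 1) (h2 : ‖z₂‖ = 1) (hz : z₁ * z₂ ≠ 1)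
    (ha : ∀ m : ℕ, ‖α m‖ ≤ C / ((m : ℝ) + 1)) (ha' : ∀ m : ℕ, ‖α (m + 1) - α m‖ ≤ C / ((m : ℝ) + 1) ^ 2)
    (hb : ∀ m : ℕ, ‖β m‖ ≤ D / ((m : ℝ) + 1)) (hb' : ∀ m : ℕ, ‖β (m + 1) - β m‖ ≤ D / ((m : ℝ) + 1) ^ 2) 
    (X : ℕ → ℕ → ℂ)
    (hX : ∀ j l, HasSum (fun k => (α (j + k) * z₁ ^ (j + k)) * (β (l + k) * z₂ ^ (l + k))) (X j l)) :
    TC X (‖(1 - z₁ * z₂)⁻¹‖ * (10 * (C * D))) := by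
  have n1 : ∀ n, ‖z₁ ^ n‖ = 1 := fun n => by rw [norm_pow, h1, one_pow]
  have n2 : ∀ n, ‖z₂ ^ n‖ = 1 := fun n => by rw [norm_pow, h2, one_pow]
  have ta : ∀ k j : ℕ, ‖α (j + k)‖ ≤ C / ((j : ℝ) + k + 1) := fun k j => by
    have := ha (j + k); push_cast at this; exact this
  have tb : ∀ k j : ℕ, ‖β (j + k)‖ ≤ D / ((j : ℝ) + k + 1) := fun k j => by
    have := hb (j + k); push_cast at this; exact this
  have ta1 : ∀ k j : ℕ, ‖α (j + k + 1)‖ ≤ C / ((j : ℝ) + k + 1) := fun k j => by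
    have := ha (j + k + 1); push_cast at this; refine this.trans ?_
    exact div_le_div_of_nonneg_left hC (by positivity) (by linarith)
  have ta' : ∀ k j : ℕ, ‖α (j + k + 1) - α (j + k)‖ ≤ C / ((j : ℝ) + k + 1) ^ 2 := fun k j => by
    have := ha' (j + k); push_cast at this; exact this
  have tb' : ∀ k j : ℕ, ‖β (j + k + 1) - β (j + k)‖ ≤ D / ((j : ℝ) + k + 1) ^ 2 := fun k j => by
    have := hb' (j + k); push_cast at this; exact this
  have hz' : 1 - z₁ * z₂ ≠ 0 := sub_ne_zero.2 (Ne.symm hz)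
  obtain ⟨q1, q2⟩ := sum_inv_sq 0
  simp only [CharP.cast_eq_zero, add_zero, zero_add, div_one] at q1 q2
  -- summability of products
  have hsummable : ∀ (u v : ℕ → ℂ) (E F : ℝ), 0 ≤ E → 0 ≤ F → (∀ k : ℕ, ‖u k‖ ≤ E / ((k : ℝ) + 1)) →
      (∀ k : ℕ, ‖v k‖ ≤ F / ((k : ℝ) + 1)) → Summable (fun k => u k * v k) := by
    intro u v E F hE hF hu hv
    refine Summable.of_norm_bounded (q1.mul_left (E * F)) fun k => ?_
    rw [norm_mul]
    refine (mul_le_mul (hu k) (hv k) (norm_nonneg _) (by positivity)).trans (le_of_eq ?_)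
    field_simp
  have weak : ∀ {E : ℝ} (_ : 0 ≤ E) (j k : ℕ), E / ((j : ℝ) + k + 1) ≤ E / ((k : ℝ) + 1) := by
    intro E hE j k
    gcongr
    linarith [(Nat.cast_nonneg j : (0 : ℝ) ≤ j)]
  have weak2 : ∀ {E : ℝ} (_ : 0 ≤ E) (j k : ℕ), E / ((j : ℝ) + k + 1) ^ 2 ≤ E / ((k : ℝ) + 1) := by
    intro E hE j k
    have : (0 : ℝ) ≤ j := Nat.cast_nonneg j
    have : (0 : ℝ) ≤ k := Nat.cast_nonneg k
    gcongr
    nlinarith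
  -- piece 0
  have P0 : TC (fun j l => (α j * z₁ ^ j) * (β l * z₂ ^ l)) (2 * (C * D)) := by
    refine TC_family (fun k j => if k = 0 then α j * z₁ ^ j else 0) (fun k l => if k = 0 then β l * z₂ ^ l else 0)
      (fun k => if k = 0 then 2 * C ^ 2 else 0) (fun k => if k = 0 then 2 * D ^ 2 else 0) ?_ ?_ ?_ ?_ ?_ ?_
      (fun k => if k = 0 then 2 * (C * D) else 0) ?_ ?_ ?_ ?_ _ ?_
    · intro k; split_ifs <;> positivity
    · intro k; split_ifs <;> positivity
    · intro k; split_ifs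
      · simp only [norm_mul, n1, mul_one]; exact (sum_tail2 0 (by simpa using ta 0)).1
      · simp
    · intro k; split_ifs
      · simp only [norm_mul, n2, mul_one]; exact (sum_tail2 0 (by simpa using tb 0)).1
      · simp
    · intro k; split_ifs
      · simp only [norm_mul, n1, mul_one]; refine (sum_tail2 0 (by simpa using ta 0)).2.trans (le_of_eq ?_); simp; ring
      · simp
    · intro k; split_ifs
      · simp only [norm_mul, n2, mul_one]; refine (sum_tail2 0 (by simpa using tb 0)).2.trans (le_of_eq ?_); simp; ring
      · simp
    · intro k; split_ifs <;> positivity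
    · intro k; split_ifs
      · apply le_of_eq; ring
      · simp
    · exact (hasSum_ite_eq 0 _).summable
    · rw [tsum_ite_eq]
    · intro j l
      have := hasSum_ite_eq (0 : ℕ) ((α j * z₁ ^ j) * (β l * z₂ ^ l))
      convert this using 2 with k
      split_ifs <;> simp
  have D2 : Summable (fun k : ℕ => 2 * (C * D) * (1 / ((k : ℝ) + 1) ^ 2)) := q1.mul_left _
  have D2' : ∑' k : ℕ, 2 * (C * D) * (1 / ((k : ℝ) + 1) ^ 2) ≤ 4 * (C * D) := by
    rw [tsum_mul_left]; nlinarith [mul_nonneg hC hD]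
  have P1s : ∀ j l, Summable (fun k => ((α (j + k + 1) - α (j + k)) * z₁ ^ (j + k + 1)) * (β (l + k) * z₂ ^ (l + k + 1))) := by
    intro j l
    refine hsummable _ _ C D hC hD (fun k => ?_) (fun k => ?_)
    · rw [norm_mul, n1, mul_one]; exact (ta' k j).trans (weak2 hC j k)
    · rw [norm_mul, n2, mul_one]; exact (tb k l).trans (weak hD l k)
  have P1 : TC (fun j l => ∑' k, ((α (j + k + 1) - α (j + k)) * z₁ ^ (j + k + 1)) * (β (l + k) * z₂ ^ (l + k + 1))) (4 * (C * D)) := by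
    refine TC_family (fun k j => (α (j + k + 1) - α (j + k)) * z₁ ^ (j + k + 1)) (fun k l => β (l + k) * z₂ ^ (l + k + 1))
      (fun k => C ^ 2 * (2 / ((k : ℝ) + 1) ^ 3)) (fun k => D ^ 2 * (2 / ((k : ℝ) + 1))) 
      (fun k => by positivity) (fun k => by positivity) ?_ ?_ ?_ ?_ _ (fun k => by positivity) ?_ D2 D2' _ ?_
    · intro k; simp only [norm_mul, n1, mul_one]; exact (sum_tail4 hC k (ta' k)).1
    · intro k; simp only [norm_mul, n2, mul_one]; exact (sum_tail2 k (tb k)).1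
    · intro k; simp only [norm_mul, n1, mul_one]; exact (sum_tail4 hC k (ta' k)).2
    · intro k; simp only [norm_mul, n2, mul_one]; exact (sum_tail2 k (tb k)).2
    · intro k; apply le_of_eq; field_simp
    · intro j l; exact (P1s j l).hasSum
  have P2s : ∀ j l, Summable (fun k => (α (j + k + 1) * z₁ ^ (j + k + 1)) * ((β (l + k + 1) - β (l + k)) * z₂ ^ (l + k + 1))) := by
    intro j l
    refine hsummable _ _ C D hC hD (fun k => ?_) (fun k => ?_)
    · rw [norm_mul, n1, mul_one]; exact (ta1 k j).trans (weak hC j k)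
    · rw [norm_mul, n2, mul_one]; exact (tb' k l).trans (weak2 hD l k)
  have P2 : TC (fun j l => ∑' k, (α (j + k + 1) * z₁ ^ (j + k + 1)) * ((β (l + k + 1) - β (l + k)) * z₂ ^ (l + k + 1))) (4 * (C * D)) := by
    refine TC_family (fun k j => α (j + k + 1) * z₁ ^ (j + k + 1)) (fun k l => (β (l + k + 1) - β (l + k)) * z₂ ^ (l + k + 1))
      (fun k => C ^ 2 * (2 / ((k : ℝ) + 1))) (fun k => D ^ 2 * (2 / ((k : ℝ) + 1) ^ 3)) 
      (fun k => by positivity) (fun k => by positivity) ?_ ?_ ?_ ?_ _ (fun k => by positivity) ?_ D2 D2' _ ?_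
    · intro k; simp only [norm_mul, n1, mul_one]; exact (sum_tail2 k (ta1 k)).1
    · intro k; simp only [norm_mul, n2, mul_one]; exact (sum_tail4 hD k (tb' k)).1
    · intro k; simp only [norm_mul, n1, mul_one]; exact (sum_tail2 k (ta1 k)).2
    · intro k; simp only [norm_mul, n2, mul_one]; exact (sum_tail4 hD k (tb' k)).2
    · intro k; apply le_of_eq; field_simp
    · intro j l; exact (P2s j l).hasSum
  have key := ((P0.add P1).add P2).smul (1 - z₁ * z₂)⁻¹
  have hb : 2 * (C * D) + 4 * (C * D) + 4 * (C * D) = 10 * (C * D) := by ring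
  rw [hb] at key
  convert key using 1
  funext j l
  rw [eq_inv_mul_iff_mul_eq₀ hz']
  have hS := hX j l
  set G : ℕ → ℂ := fun k => (α (j + k) * z₁ ^ (j + k)) * (β (l + k) * z₂ ^ (l + k)) with hG
  have hS1 : HasSum (fun k => G (k + 1)) (X j l - G 0) := by
    have := (hasSum_nat_add_iff' 1).2 hS
    simpa using this
  have hS2 : HasSum (fun k => G (k + 1) - z₁ * z₂ * G k) (X j l - G 0 - z₁ * z₂ * X j l) :=
    hS1.sub (hS.mul_left _)
  have hS3 := ((P1s j l).hasSum.add (P2s j l).hasSum)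
  have e : (fun k => G (k + 1) - z₁ * z₂ * G k) = fun k => ((α (j + k + 1) - α (j + k)) * z₁ ^ (j + k + 1)) * (β (l + k) * z₂ ^ (l + k + 1)) + (α (j + k + 1) * z₁ ^ (j + k + 1)) * ((β (l + k + 1) - β (l + k)) * z₂ ^ (l + k + 1)) := by
    funext k
    simp only [hG, ← add_assoc]
    ring
  rw [e] at hS2
  have := hS2.unique hS3
  rw [add_assoc, ← this]
  simp only [hG, add_zero]
  ring

end EE
end

noncomputable section
namespace EE
open MeasureTheory Set Filter Topology AddCircle
open scoped ENNReal ComplexConjugate InnerProductSpace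

/-- reflected symbol -/
def refl (g : ℝ → ℂ) : ℝ → ℂ := fun x => g (2 * Real.pi - x)

lemma cf_refl (g : ℝ → ℂ) (n : ℤ) : cf (refl g) n = cf g (-n) := by
  unfold cf refl
  congr 1
  have := intervalIntegral.integral_comp_sub_left (a := 0) (b := 2 * Real.pi)
    (fun t => g t * Complex.exp (-Complex.I * ((-n : ℤ) : ℂ) * (t : ℂ))) (2 * Real.pi)
  simp only [sub_self, sub_zero] at this
  rw [← this]
  refine intervalIntegral.integral_congr fun x _ => ?_
  congr 1
  rw [Complex.exp_eq_exp_iff_exists_int]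
  refine ⟨-n, ?_⟩
  push_cast
  ring

lemma Adm.refl {g : ℝ → ℂ} (hg : Adm g) : Adm (refl g) := by
  obtain ⟨C, hC0, hC⟩ := hg.bdd
  refine ⟨hg.meas.comp (measurable_const.sub measurable_id), C, hC0, fun x hx => hC _ ⟨?_, ?_⟩⟩
  · linarith [hx.2]
  · linarith [hx.1]

lemma mat_Mo {g : ℝ → ℂ} (hg : Adm g) (n : ℕ) (i j : Fin n) :
    mat n (Mo g) i j = cf g ((i : ℤ) - (j : ℤ)) := by
  simp only [mat, Matrix.of_apply]; exact Mo_coef hg _ _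

lemma mat_refl {g : ℝ → ℂ} (hg : Adm g) (n : ℕ) :
    mat n (Mo (refl g)) = (mat n (Mo g)).submatrix Fin.rev Fin.rev := by
  ext i j
  rw [Matrix.submatrix_apply, mat_Mo hg, mat_Mo hg.refl, cf_refl]
  congr 1
  rw [Fin.val_rev, Fin.val_rev]
  have := i.2
  have := j.2
  omega

lemma HasSum_conv {a d : ℝ → ℂ} (ha : Adm a) (hd : Adm d) (j l : ℤ) :
    HasSum (fun k : ℤ => cf a (j - k) * cf d (k - l)) (cf (fun x => a x * d x) (j - l)) := by
  have h1 := ee.hasSum_repr (Mo d (ee l))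
  have h2 := (h1.mapL (Mo a)).mapL (innerSL ℂ (ee j))
  rw [← Mo_coef (ha.mul hd), Mo_mul ha hd]
  have e : (fun k : ℤ => cf a (j - k) * cf d (k - l)) =
      fun k => innerSL ℂ (ee j) (Mo a ((ee.repr (Mo d (ee l))) k • ee k)) := by
    funext k
    rw [map_smul, map_smul, smul_eq_mul, HilbertBasis.repr_apply_apply, Mo_coef hd,
      innerSL_apply_apply, Mo_coef ha, mul_comm]
  rw [e]
  exact h2

/-- first Hankel product -/
def X1 (a d : ℝ → ℂ) (j l : ℕ) : ℂ := ∑' k : ℕ, cf a ((j : ℤ) + k + 1) * cf d (-((l : ℤ) + k + 1))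

/-- second Hankel product -/
def X2 (a d : ℝ → ℂ) (j l : ℕ) : ℂ := ∑' k : ℕ, cf a (-((j : ℤ) + k + 1)) * cf d ((l : ℤ) + k + 1)

lemma X1_hasSum {a d : ℝ → ℂ} (ha : Adm a) (hd : Adm d) (j l : ℕ) :
    HasSum (fun k : ℕ => cf a ((j : ℤ) + k + 1) * cf d (-((l : ℤ) + k + 1))) (X1 a d j l) := by
  refine Summable.hasSum ?_
  have h := (HasSum_conv ha hd j l).summable
  have h2 := h.comp_injective (i := fun k : ℕ => -((k : ℤ) + 1)) (fun x y h => by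
    simp only [neg_inj, add_left_inj] at h; exact_mod_cast h)
  refine h2.congr fun k => ?_
  simp only [Function.comp]
  congr 2 <;> ring

lemma X2_hasSum {a d : ℝ → ℂ} (ha : Adm a) (hd : Adm d) (j l : ℕ) :
    HasSum (fun k : ℕ => cf a (-((j : ℤ) + k + 1)) * cf d ((l : ℤ) + k + 1)) (X2 a d j l) := by
  have := X1_hasSum ha.refl hd.refl j l
  simp only [X1, cf_refl, neg_neg] at this
  exact this

lemma K_decomp {a d : ℝ → ℂ} (ha : Adm a) (hd : Adm d) (n : ℕ) (i j : Fin n) :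
    mat n (Mo (fun x => a x * d x)) i j = (mat n (Mo a) * mat n (Mo d)) i j +
      (X1 a d i j + X2 a d i.rev j.rev) := by
  rw [mat_Mo (ha.mul hd), Matrix.mul_apply]
  simp only [mat_Mo ha, mat_Mo hd]
  have h := HasSum_conv ha hd i j
  have s1 : Summable (fun k : ℕ => cf a ((i : ℤ) - k) * cf d ((k : ℤ) - j)) :=
    h.summable.comp_injective (i := fun k : ℕ => (k : ℤ)) Nat.cast_injective
  have h1 := X1_hasSum ha hd i j
  have h2 := X2_hasSum ha hd i.rev j.rev
  have s2 : HasSum (fun k : ℕ => cf a ((i : ℤ) - (k : ℤ)) * cf d ((k : ℤ) - j))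
     (∑ k : Fin n, cf a ((i : ℤ) - (k : ℤ)) * cf d ((k : ℤ) - j) + X2 a d i.rev j.rev) := by
    rw [← Finset.sum_range (fun k : ℕ => cf a ((i : ℤ) - (k : ℤ)) * cf d ((k : ℤ) - j)), add_comm,
      ← hasSum_nat_add_iff n]
    refine Eq.mpr (congrArg (fun F : ℕ → ℂ => HasSum F _) (funext fun k => ?_)) h2
    rw [Fin.val_rev, Fin.val_rev]
    have := i.2
    have := j.2
    congr 2 <;> push_cast <;> omega
  have s3 := HasSum.of_nat_of_neg_add_one (f := fun k : ℤ => cf a ((i : ℤ) - k) * cf d (k - j)) s2 (by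
    refine Eq.mpr (congrArg (fun F : ℕ → ℂ => HasSum F _) (funext fun k => ?_)) h1
    congr 2 <;> ring)
  rw [h.unique s3]; ring

lemma trace_K {a d : ℝ → ℂ} (ha : Adm a) (hd : Adm d) (n : ℕ) (B : Matrix (Fin n) (Fin n) ℂ) :
    ((mat n (Mo (fun x => a x * d x)) - mat n (Mo a) * mat n (Mo d)) * B).trace =
      trp n (X1 a d) B + trp n (X2 a d) (B.submatrix Fin.rev Fin.rev) := by
  have e2 : trp n (X2 a d) (B.submatrix Fin.rev Fin.rev) =
      ∑ j : Fin n, ∑ l : Fin n, X2 a d j.rev l.rev * B l j := by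
    unfold trp
    rw [← Equiv.sum_comp Fin.revPerm]
    refine Finset.sum_congr rfl fun j _ => ?_
    rw [← Equiv.sum_comp Fin.revPerm]
    simp
  rw [e2, trp, ← Finset.sum_add_distrib, Matrix.trace]
  refine Finset.sum_congr rfl fun j _ => ?_
  rw [Matrix.diag_apply, Matrix.mul_apply, ← Finset.sum_add_distrib]
  refine Finset.sum_congr rfl fun l _ => ?_
  rw [Matrix.sub_apply, K_decomp ha hd]; ring

/-- coercive symbol -/
def CoS (g : ℝ → ℂ) (δ : ℝ) : Prop := ∃ h : ℝ → ℝ, g = (fun x => (h x : ℂ)) ∧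
  ∀ x ∈ Icc 0 (2 * Real.pi), δ ≤ h x

lemma CoS.refl {g : ℝ → ℂ} {δ : ℝ} (h : CoS g δ) : CoS (refl g) δ := by
  obtain ⟨h, rfl, hh⟩ := h
  exact ⟨fun x => h (2 * Real.pi - x), rfl, fun x hx => hh _ ⟨by linarith [hx.2], by linarith [hx.1]⟩⟩

lemma CoS.coer {g : ℝ → ℂ} {δ : ℝ} (hc : CoS g δ) (hg : Adm g) (u : HH) :
    δ * ‖u‖ ^ 2 ≤ (⟪u, Mo g u⟫_ℂ).re := by
  obtain ⟨h, rfl, hh⟩ := hc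
  exact Mo_coer hg hh u

/-- inverse of finite section -/
def Io (g : ℝ → ℂ) (n : ℕ) : HH →L[ℂ] HH := Ring.inverse (An (Mo g) n)

lemma Io_mat {g : ℝ → ℂ} {δ : ℝ} (hδ0 : 0 < δ) (hδ1 : δ ≤ 1) (hc : CoS g δ) (hg : Adm g) (n : ℕ) :
    mat n (Io g n) = (mat n (Mo g))⁻¹ :=
  (Matrix.inv_eq_left_inv (mat_inv n (Mo g) hδ0 hδ1 (hc.coer hg))).symm

lemma mat_unit {g : ℝ → ℂ} {δ : ℝ} (hδ0 : 0 < δ) (hδ1 : δ ≤ 1) (hc : CoS g δ) (hg : Adm g) (n : ℕ) :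
    IsUnit (mat n (Mo g)).det :=
  Matrix.isUnit_det_of_left_inverse (mat_inv n (Mo g) hδ0 hδ1 (hc.coer hg))

lemma Io_norm {g : ℝ → ℂ} {δ : ℝ} (hδ0 : 0 < δ) (hδ1 : δ ≤ 1) (hc : CoS g δ) (hg : Adm g) (n : ℕ) :
    ‖Io g n‖ ≤ δ⁻¹ := inv_norm_le hδ0 (An_coer (hc.coer hg) hδ1 n)

lemma Io_SC {g : ℝ → ℂ} {δ : ℝ} (hδ0 : 0 < δ) (hδ1 : δ ≤ 1) (hc : CoS g δ) (hg : Adm g) :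
    SC (Io g) := (SC_An (Mo g)).inv hδ0 (fun n => An_coer (hc.coer hg) hδ1 n)

/-- the triple product -/
def Bo (b d w : ℝ → ℂ) (n : ℕ) : HH →L[ℂ] HH := Io b n ∘L Pn n ∘L (Mo d ∘L Pn n ∘L Io w n)

lemma Bo_mat (b d w : ℝ → ℂ) (n : ℕ) : mat n (Bo b d w n) = mat n (Io b n) * (mat n (Mo d) * mat n (Io w n)) := by
  rw [Bo, mat_comp, mat_comp]

section
variable {a b d w : ℝ → ℂ} {δ : ℝ}

lemma Bo_SC (hδ0 : 0 < δ) (hδ1 : δ ≤ 1) (hb : Adm b) (hw : Adm w) (cb : CoS b δ) (cw : CoS w δ) :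
    SC (Bo b d w) :=
  (Io_SC hδ0 hδ1 cb hb).comp (SC_Pn.comp ((SC.const (Mo d)).comp (SC_Pn.comp (Io_SC hδ0 hδ1 cw hw))))

lemma Bo_norm (hδ0 : 0 < δ) (hδ1 : δ ≤ 1) (hb : Adm b) (hw : Adm w) (cb : CoS b δ) (cw : CoS w δ)
    {D : ℝ} (hD : ‖Mo d‖ ≤ D) (n : ℕ) : ‖Bo b d w n‖ ≤ δ⁻¹ * (D * δ⁻¹) := by
  have h1 := Io_norm hδ0 hδ1 cb hb n
  have h2 := Io_norm hδ0 hδ1 cw hw n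
  have h3 := Pn_norm n
  have hi : 0 < δ⁻¹ := inv_pos.2 hδ0
  have hD0 := (norm_nonneg _).trans hD
  have e1 : ‖Pn n ∘L Io w n‖ ≤ 1 * δ⁻¹ := (ContinuousLinearMap.opNorm_comp_le _ _).trans (by gcongr)
  have e2 : ‖Mo d ∘L Pn n ∘L Io w n‖ ≤ D * (1 * δ⁻¹) := (ContinuousLinearMap.opNorm_comp_le _ _).trans (by gcongr)
  have e3 : ‖Pn n ∘L (Mo d ∘L Pn n ∘L Io w n)‖ ≤ 1 * (D * (1 * δ⁻¹)) := (ContinuousLinearMap.opNorm_comp_le _ _).trans (by gcongr)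
  calc ‖Bo b d w n‖ ≤ δ⁻¹ * (1 * (D * (1 * δ⁻¹))) := (ContinuousLinearMap.opNorm_comp_le _ _).trans (by gcongr)
    _ = _ := by ring

/-- the localized trace difference -/
def Et (a b d w : ℝ → ℂ) (n : ℕ) : ℂ :=
  ((mat n (Mo w))⁻¹ * mat n (Mo (fun x => a x * d x))).trace - ((mat n (Mo b))⁻¹ * mat n (Mo d)).trace

lemma Et_eq (hδ0 : 0 < δ) (hδ1 : δ ≤ 1) (ha : Adm a) (hb : Adm b) (hd : Adm d) (hw : Adm w)
    (cb : CoS b δ) (cw : CoS w δ) (hab : w = fun x => a x * b x) (n : ℕ) :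
    Et a b d w n = (trp n (X1 a d) (mat n (Io w n)) + trp n (X2 a d) (mat n (Io (refl w) n))) -
      (trp n (X1 a b) (mat n (Bo b d w n)) + trp n (X2 a b) (mat n (Bo (refl b) (refl d) (refl w) n))) := by
  have hrev : ∀ g, Adm g → CoS g δ → mat n (Io (refl g) n) = (mat n (Io g n)).submatrix Fin.rev Fin.rev := by
    intro g hg cg
    rw [Io_mat hδ0 hδ1 cg hg, Io_mat hδ0 hδ1 cg.refl hg.refl, mat_refl hg]
    exact Matrix.inv_submatrix_equiv _ Fin.revPerm Fin.revPerm
  have hrevB : mat n (Bo (refl b) (refl d) (refl w) n) = (mat n (Bo b d w n)).submatrix Fin.rev Fin.rev := by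
    rw [Bo_mat, Bo_mat, hrev b hb cb, hrev w hw cw, mat_refl hd]
    rw [← Matrix.submatrix_mul_equiv _ _ Fin.rev Fin.revPerm Fin.rev]
    congr 1
    exact Matrix.submatrix_mul_equiv _ _ Fin.rev Fin.revPerm Fin.rev
  rw [hrevB, hrev w hw cw, ← trace_K ha hd, ← trace_K ha hb, Bo_mat, Io_mat hδ0 hδ1 cb hb, Io_mat hδ0 hδ1 cw hw, ← hab, Et]
  have hu := mat_unit hδ0 hδ1 cw hw n
  have hv := mat_unit hδ0 hδ1 cb hb n
  set W := mat n (Mo w)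
  set A := mat n (Mo a)
  set B := mat n (Mo b)
  set D := mat n (Mo d)
  set F := mat n (Mo fun x => a x * d x)
  have e1 : ((F - A * D) * W⁻¹).trace = (W⁻¹ * F).trace - (W⁻¹ * A * D).trace := by
    rw [Matrix.trace_mul_comm, Matrix.mul_sub, Matrix.trace_sub, Matrix.mul_assoc]
  have e2 : ((W - A * B) * (B⁻¹ * (D * W⁻¹))).trace = (B⁻¹ * D).trace - (W⁻¹ * A * D).trace := by
    rw [← Matrix.mul_assoc, ← Matrix.mul_assoc, Matrix.trace_mul_comm, ← Matrix.trace_sub]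
    congr 1
    rw [Matrix.sub_mul, Matrix.mul_assoc A, Matrix.mul_nonsing_inv _ hv, Matrix.mul_one, Matrix.sub_mul, Matrix.mul_sub,
      Matrix.mul_assoc W, Matrix.nonsing_inv_mul_cancel_left _ _ hu, ← Matrix.mul_assoc]
  rw [e1, e2]; ring

lemma Et_lim (hδ0 : 0 < δ) (hδ1 : δ ≤ 1) (ha : Adm a) (hb : Adm b) (hd : Adm d) (hw : Adm w)
    (cb : CoS b δ) (cw : CoS w δ) (hab : w = fun x => a x * b x) {C : ℝ}
    (t1 : TC (X1 a d) C) (t2 : TC (X2 a d) C) (t3 : TC (X1 a b) C) (t4 : TC (X2 a b) C) :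
    ∃ t, Tendsto (Et a b d w) atTop (𝓝 t) := by
  obtain ⟨r1, h1⟩ := trp_lim t1 (Io_SC hδ0 hδ1 cw hw)
  obtain ⟨r2, h2⟩ := trp_lim t2 (Io_SC hδ0 hδ1 cw.refl hw.refl)
  obtain ⟨r3, h3⟩ := trp_lim t3 (Bo_SC (d := d) hδ0 hδ1 hb hw cb cw)
  obtain ⟨r4, h4⟩ := trp_lim t4 (Bo_SC (d := refl d) hδ0 hδ1 hb.refl hw.refl cb.refl cw.refl)
  refine ⟨(r1 + r2) - (r3 + r4), ?_⟩
  have := (h1.add h2).sub (h3.add h4)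
  refine this.congr fun n => ?_
  rw [Et_eq hδ0 hδ1 ha hb hd hw cb cw hab]

lemma Et_bound (hδ0 : 0 < δ) (hδ1 : δ ≤ 1) (ha : Adm a) (hb : Adm b) (hd : Adm d) (hw : Adm w)
    (cb : CoS b δ) (cw : CoS w δ) (hab : w = fun x => a x * b x) {C D : ℝ} (hC : 0 ≤ C)
    (hD0 : 0 ≤ D) (hD : ∀ x ∈ Icc 0 (2 * Real.pi), ‖d x‖ ≤ D)
    (t1 : TC (X1 a d) C) (t2 : TC (X2 a d) C) (t3 : TC (X1 a b) C) (t4 : TC (X2 a b) C) (n : ℕ) :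
    ‖Et a b d w n‖ ≤ (δ⁻¹ * C + δ⁻¹ * C) + (δ⁻¹ * (D * δ⁻¹) * C + δ⁻¹ * (D * δ⁻¹) * C) := by
  rw [Et_eq hδ0 hδ1 ha hb hd hw cb cw hab]
  refine (norm_sub_le _ _).trans (add_le_add ((norm_add_le _ _).trans (add_le_add ?_ ?_))
    ((norm_add_le _ _).trans (add_le_add ?_ ?_)))
  · exact (trp_bound t1 n _).trans (mul_le_mul_of_nonneg_right (Io_norm hδ0 hδ1 cw hw n) hC)
  · exact (trp_bound t2 n _).trans (mul_le_mul_of_nonneg_right (Io_norm hδ0 hδ1 cw.refl hw.refl n) hC)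
  · exact (trp_bound t3 n _).trans (mul_le_mul_of_nonneg_right (Bo_norm hδ0 hδ1 hb hw cb cw (Mo_norm hd hD0 hD) n) hC)
  · refine (trp_bound t4 n _).trans (mul_le_mul_of_nonneg_right (Bo_norm hδ0 hδ1 hb.refl hw.refl cb.refl cw.refl (Mo_norm hd.refl hD0 ?_) n) hC)
    exact fun x hx => hD _ ⟨by linarith [hx.2], by linarith [hx.1]⟩

end
end EE
end

noncomputable section
namespace EE
open MeasureTheory Set Filter Topology
open scoped ENNReal ComplexConjugate InnerProductSpace

/-- Heaviside function -/
def hv (φ x : ℝ) : ℝ := if φ < x then 1 else 0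

lemma hv_meas (φ : ℝ) : Measurable (hv φ) :=
  Measurable.ite measurableSet_Ioi measurable_const measurable_const

lemma hv_nonneg (φ x : ℝ) : 0 ≤ hv φ x := by unfold hv; split_ifs <;> norm_num
lemma hv_le (φ x : ℝ) : hv φ x ≤ 1 := by unfold hv; split_ifs <;> norm_num

/-- step function -/
def Fs (J : Finset ℝ) (σ : ℝ → ℝ) (s x : ℝ) : ℝ := s + 2 * ∑ φ ∈ J, σ φ * hv φ x

/-- sawtooth -/
def saw (φ x : ℝ) : ℝ := x - φ + Real.pi - 2 * Real.pi * hv φ x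

/-- admissible step data -/
structure Step (J : Finset ℝ) (σ : ℝ → ℝ) (s : ℝ) : Prop where
  mem : ∀ φ ∈ J, φ ∈ Ioo 0 (2 * Real.pi)
  sq : ∀ φ ∈ J, σ φ ^ 2 = 1
  sum0 : ∑ φ ∈ J, σ φ = 0
  val : ∀ x, Fs J σ s x ^ 2 = 1
  left : ∀ φ ∈ J, Fs J σ s φ = - σ φ

/-- mean value -/
def f0 (J : Finset ℝ) (σ : ℝ → ℝ) (s : ℝ) : ℝ := s + ∑ φ ∈ J, (-σ φ / Real.pi) * φ

lemma Fs_saw {J : Finset ℝ} {σ : ℝ → ℝ} {s : ℝ} (h : Step J σ s) (x : ℝ) :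
    Fs J σ s x = f0 J σ s + ∑ φ ∈ J, (-σ φ / Real.pi) * saw φ x := by
  have e : ∀ φ ∈ J, (-σ φ / Real.pi) * saw φ x = 2 * (σ φ * hv φ x) - (-σ φ / Real.pi) * φ - σ φ * ((x + Real.pi) / Real.pi) := by
    intro φ _
    unfold saw
    field_simp
    ring
  rw [Finset.sum_congr rfl e, Finset.sum_sub_distrib, Finset.sum_sub_distrib, ← Finset.sum_mul, h.sum0,
    ← Finset.mul_sum, Fs, f0]
  ring

lemma Fs_meas (J : Finset ℝ) (σ : ℝ → ℝ) (s : ℝ) : Measurable (Fs J σ s) := by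
  unfold Fs
  exact measurable_const.add ((Finset.measurable_fun_sum _ fun φ _ => (hv_meas φ).const_mul _).const_mul _)

lemma saw_meas (φ : ℝ) : Measurable (saw φ) := by
  unfold saw
  have := hv_meas φ
  fun_prop

lemma saw_bound {φ x : ℝ} (hφ : φ ∈ Ioo 0 (2 * Real.pi)) (hx : x ∈ Icc 0 (2 * Real.pi)) :
    |saw φ x| ≤ Real.pi := by
  unfold saw hv
  rw [abs_le]
  have := Real.pi_pos
  obtain ⟨h1, h2⟩ := hφ
  obtain ⟨h3, h4⟩ := hx
  split_ifs with h
  · constructor <;> linarith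
  · constructor <;> linarith

lemma sq_eq_one_iff' {x : ℝ} (h : x ^ 2 = 1) : x = 1 ∨ x = -1 := by
  have : (x - 1) * (x + 1) = 0 := by linarith
  rcases mul_eq_zero.1 this with h | h
  · left; linarith
  · right; linarith

lemma Fs_abs {J : Finset ℝ} {σ : ℝ → ℝ} {s : ℝ} (h : Step J σ s) (x : ℝ) : |Fs J σ s x| = 1 := by
  have := h.val x
  rcases sq_eq_one_iff' this with h | h <;> rw [h] <;> norm_num

lemma exp_of_sq {F : ℝ} (h : F ^ 2 = 1) (τ : ℝ) : Real.exp (τ * F) = Real.cosh τ + Real.sinh τ * F := by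
  rcases sq_eq_one_iff' h with h | h <;> rw [h]
  · rw [mul_one, mul_one, Real.cosh_add_sinh]
  · rw [mul_neg_one, mul_neg_one, ← sub_eq_add_neg, Real.cosh_sub_sinh]

lemma int_exp {ν : ℂ} (hν : ν ≠ 0) (a b : ℝ) :
    ∫ x in a..b, Complex.exp (ν * x) = (Complex.exp (ν * b) - Complex.exp (ν * a)) / ν :=
  integral_exp_mul_complex hν

lemma int_hv {ν : ℂ} (hν : ν ≠ 0) {φ : ℝ} (hφ : φ ∈ Ioo 0 (2 * Real.pi)) :
    ∫ x in (0:ℝ)..(2 * Real.pi), (hv φ x : ℂ) * Complex.exp (ν * x) =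
      (Complex.exp (ν * (2 * Real.pi : ℝ)) - Complex.exp (ν * φ)) / ν := by
  rw [← int_exp hν]
  have i1 : IntervalIntegrable (fun x : ℝ => (hv φ x : ℂ) * Complex.exp (ν * x)) volume 0 φ := by
    refine (IntervalIntegrable.congr (f := fun _ => 0) ?_ (by simp))
    intro x hx
    rw [uIoc_of_le hφ.1.le] at hx
    simp [hv, not_lt.2 hx.2]
  have i2 : IntervalIntegrable (fun x : ℝ => (hv φ x : ℂ) * Complex.exp (ν * x)) volume φ (2 * Real.pi) := by
    refine (IntervalIntegrable.congr (f := fun x : ℝ => Complex.exp (ν * x)) ?_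
      (Continuous.intervalIntegrable (by fun_prop) _ _))
    intro x hx
    rw [uIoc_of_le hφ.2.le] at hx
    simp [hv, hx.1]
  rw [← intervalIntegral.integral_add_adjacent_intervals i1 i2]
  have e1 : ∫ x in (0:ℝ)..φ, (hv φ x : ℂ) * Complex.exp (ν * x) = 0 := by
    rw [intervalIntegral.integral_of_le hφ.1.le]
    refine setIntegral_eq_zero_of_forall_eq_zero fun x hx => ?_
    simp [hv, not_lt.2 hx.2]
  rw [e1, zero_add, intervalIntegral.integral_of_le hφ.2.le, intervalIntegral.integral_of_le hφ.2.le]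
  refine setIntegral_congr_fun measurableSet_Ioc fun x hx => ?_
  simp [hv, hx.1]

lemma den_ne {n : ℤ} (hn : n ≠ 0) (μ : ℝ) : (μ : ℂ) - Complex.I * n ≠ 0 := by
  intro h
  have := congrArg Complex.im h
  simp at this
  exact hn this

lemma exp_2pi (μ : ℝ) (n : ℤ) : Complex.exp (((μ : ℂ) - Complex.I * n) * (2 * Real.pi : ℝ)) =
    Complex.exp (μ * (2 * Real.pi : ℝ)) := by
  rw [Complex.exp_eq_exp_iff_exists_int]
  exact ⟨-n, by push_cast; ring⟩

lemma cfE (J : Finset ℝ) (hJ : ∀ φ ∈ J, φ ∈ Ioo 0 (2 * Real.pi)) (K : ℂ) (k : ℝ → ℂ) (μ : ℝ) {n : ℤ} (hn : (μ : ℂ) - Complex.I * n ≠ 0) :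
    cf (fun x => Complex.exp (μ * x) * (K + ∑ φ ∈ J, k φ * hv φ x)) n =
      (1 / (2 * Real.pi) : ℂ) * ((μ : ℂ) - Complex.I * n)⁻¹ *
        ((K + ∑ φ ∈ J, k φ) * Complex.exp (μ * (2 * Real.pi : ℝ)) - K
          - ∑ φ ∈ J, k φ * Complex.exp (((μ : ℂ) - Complex.I * n) * φ)) := by
  unfold cf
  set ν := (μ : ℂ) - Complex.I * n with hν
  have hν0 : ν ≠ 0 := hn
  have e : ∀ x : ℝ, Complex.exp (μ * x) * (K + ∑ φ ∈ J, k φ * hv φ x) * Complex.exp (-Complex.I * n * x) =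
      K * Complex.exp (ν * x) + ∑ φ ∈ J, k φ * (hv φ x * Complex.exp (ν * x)) := by
    intro x
    have : Complex.exp (ν * x) = Complex.exp (μ * x) * Complex.exp (-Complex.I * n * x) := by
      rw [← Complex.exp_add, hν]; congr 1; ring
    rw [this, mul_add, add_mul, Finset.mul_sum, Finset.sum_mul]
    congr 1
    · ring
    · exact Finset.sum_congr rfl fun φ _ => by ring
  simp only [e]
  have ii : ∀ φ ∈ J, IntervalIntegrable (fun x : ℝ => k φ * ((hv φ x : ℂ) * Complex.exp (ν * x))) volume 0 (2 * Real.pi) := by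
    intro φ _
    refine IntervalIntegrable.const_mul (IntervalIntegrable.mul_continuousOn ?_ (by fun_prop)) _
    exact Adm.intervalIntegrable ⟨Complex.measurable_ofReal.comp (hv_meas φ), 1, zero_le_one, fun x _ => by
      rw [Complex.norm_real, Real.norm_eq_abs, abs_of_nonneg (hv_nonneg _ _)]; exact hv_le _ _⟩
  have ii' : IntervalIntegrable (fun x : ℝ => ∑ φ ∈ J, k φ * ((hv φ x : ℂ) * Complex.exp (ν * x))) volume 0 (2 * Real.pi) := by
    have := IntervalIntegrable.sum _ ii
    simpa only [Finset.sum_fn] using this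
  rw [intervalIntegral.integral_add (Continuous.intervalIntegrable (by fun_prop) _ _)
    ii', intervalIntegral.integral_const_mul, intervalIntegral.integral_finsetSum ii,
    int_exp hν0]
  have : ∀ φ ∈ J, ∫ x in (0:ℝ)..(2 * Real.pi), k φ * ((hv φ x : ℂ) * Complex.exp (ν * x)) =
      ν⁻¹ * (k φ * Complex.exp (μ * (2 * Real.pi : ℝ)) - k φ * Complex.exp (ν * φ)) := by
    intro φ hφ
    rw [intervalIntegral.integral_const_mul, int_hv hν0 (hJ φ hφ), hν, exp_2pi]
    field_simp
  rw [Finset.sum_congr rfl this, ← Finset.mul_sum, Finset.sum_sub_distrib, ← Finset.sum_mul, hν, exp_2pi]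
  simp only [Complex.ofReal_zero, mul_zero, Complex.exp_zero]
  field_simp
  ring

/-- slowly decaying sequences -/
structure Good (α : ℕ → ℂ) (C : ℝ) : Prop where
  nn : 0 ≤ C
  bd : ∀ m : ℕ, ‖α m‖ ≤ C / ((m : ℝ) + 1)
  df : ∀ m : ℕ, ‖α (m + 1) - α m‖ ≤ C / ((m : ℝ) + 1) ^ 2

lemma Good.smul {α : ℕ → ℂ} {C : ℝ} (h : Good α C) (c : ℂ) : Good (fun m => c * α m) (‖c‖ * C) := by
  refine ⟨mul_nonneg (norm_nonneg _) h.nn, fun m => ?_, fun m => ?_⟩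
  · rw [norm_mul, mul_div_assoc]; exact mul_le_mul_of_nonneg_left (h.bd m) (norm_nonneg _)
  · rw [← mul_sub, norm_mul, mul_div_assoc]; exact mul_le_mul_of_nonneg_left (h.df m) (norm_nonneg _)

lemma Good.add {α β : ℕ → ℂ} {C D : ℝ} (h : Good α C) (h' : Good β D) : Good (fun m => α m + β m) (C + D) := by
  refine ⟨add_nonneg h.nn h'.nn, fun m => ?_, fun m => ?_⟩
  · rw [add_div]; exact (norm_add_le _ _).trans (add_le_add (h.bd m) (h'.bd m))
  · rw [add_div, add_sub_add_comm]; exact (norm_add_le _ _).trans (add_le_add (h.df m) (h'.df m))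

/-- basic denominators -/
def dq (c ε : ℝ) (m : ℕ) : ℂ := ((c : ℂ) + Complex.I * (ε * (m + 1)))⁻¹

lemma dq_norm (c : ℝ) {ε : ℝ} (hε : |ε| = 1) (m : ℕ) : ‖dq c ε m‖ ≤ 1 / ((m : ℝ) + 1) := by
  rw [dq, norm_inv, one_div]
  have h1 : (m : ℝ) + 1 ≤ ‖(c : ℂ) + Complex.I * (ε * (m + 1))‖ := by
    have := Complex.abs_im_le_norm ((c : ℂ) + Complex.I * (ε * (m + 1)))
    refine le_trans (le_of_eq ?_) this
    have : ((c : ℂ) + Complex.I * (ε * (m + 1))).im = ε * (m + 1) := by simp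
    rw [this, abs_mul, hε, one_mul, abs_of_nonneg (by positivity)]
  gcongr

lemma dq_ne (c : ℝ) {ε : ℝ} (hε : |ε| = 1) (m : ℕ) : (c : ℂ) + Complex.I * (ε * (m + 1)) ≠ 0 := by
  intro h
  have h2 := congrArg Complex.im h
  have : ((c : ℂ) + Complex.I * (ε * (m + 1))).im = ε * (m + 1) := by simp
  rw [this] at h2
  have h3 : ε ≠ 0 := by rintro rfl; simp at hε
  have h4 : (m : ℝ) + 1 ≠ 0 := by positivity
  exact mul_ne_zero h3 h4 h2

lemma dq_sub (c : ℝ) {ε : ℝ} (hε : |ε| = 1) (m : ℕ) : ‖dq c ε (m + 1) - dq c ε m‖ ≤ 1 / ((m : ℝ) + 1) ^ 2 := by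
  have h1 := dq_ne c hε m
  have h2 := dq_ne c hε (m + 1)
  have e : dq c ε (m + 1) - dq c ε m = - (Complex.I * ε) * (dq c ε (m + 1) * dq c ε m) := by
    unfold dq
    rw [inv_sub_inv h2 h1, div_eq_mul_inv, mul_inv]
    push_cast
    ring
  rw [e, norm_mul, norm_neg, norm_mul, Complex.norm_I, Complex.norm_real, Real.norm_eq_abs, hε, norm_mul, one_mul, one_mul]
  have h3 := dq_norm c hε m
  have h4 := dq_norm c hε (m + 1)
  have h5 : 1 / (((m + 1 : ℕ) : ℝ) + 1) ≤ 1 / ((m : ℝ) + 1) := by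
    push_cast; gcongr; linarith
  calc _ ≤ (1 / ((m : ℝ) + 1)) * (1 / ((m : ℝ) + 1)) :=
        mul_le_mul (h4.trans h5) h3 (norm_nonneg _) (by positivity)
    _ = _ := by field_simp

lemma Good_dq (c : ℝ) {ε : ℝ} (hε : |ε| = 1) : Good (dq c ε) 1 := ⟨zero_le_one, dq_norm c hε, dq_sub c hε⟩

lemma Good_dq2 (c : ℝ) {ε : ℝ} (hε : |ε| = 1) : Good (fun m => dq c ε m ^ 2) 2 := by
  have hl : ∀ m, ‖dq c ε m‖ ≤ 1 := fun m => (dq_norm c hε m).trans (by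
    rw [div_le_one (by positivity)]; linarith [(Nat.cast_nonneg m : (0:ℝ) ≤ m)])
  refine ⟨by norm_num, fun m => ?_, fun m => ?_⟩
  · rw [norm_pow, sq]
    calc _ ≤ 1 * (1 / ((m : ℝ) + 1)) := mul_le_mul (hl m) (dq_norm c hε m) (norm_nonneg _) zero_le_one
      _ ≤ _ := by rw [one_mul]; gcongr; norm_num
  · rw [sq_sub_sq, norm_mul]
    calc _ ≤ 2 * (1 / ((m : ℝ) + 1) ^ 2) := mul_le_mul
          ((norm_add_le _ _).trans (by linarith [hl m, hl (m + 1)])) (dq_sub c hε m) (norm_nonneg _) (by norm_num)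
      _ = _ := by ring

lemma Good.summable {α β : ℕ → ℂ} {C D : ℝ} (h : Good α C) (h' : Good β D) {z₁ z₂ : ℂ} (h1 : ‖z₁‖ = 1) (h2 : ‖z₂‖ = 1)
    (j l : ℕ) : Summable (fun k => (α (j + k) * z₁ ^ (j + k)) * (β (l + k) * z₂ ^ (l + k))) := by
  refine Summable.of_norm_bounded (g := fun k : ℕ => C * D * (1 / ((k + 1 : ℕ) : ℝ) ^ 2)) ?_ fun k => ?_
  · refine Summable.mul_left _ ?_
    exact (summable_nat_add_iff 1 (f := fun k : ℕ => 1 / (k : ℝ) ^ 2)).2 (Real.summable_one_div_nat_pow.2 (by norm_num))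
  · rw [norm_mul, norm_mul, norm_mul, norm_pow, norm_pow, h1, h2, one_pow, one_pow, mul_one, mul_one]
    have h3 := h.nn
    have h4 := h'.nn
    have e1 : ‖α (j + k)‖ ≤ C / ((k : ℝ) + 1) := (h.bd _).trans (by push_cast; gcongr; linarith [(Nat.cast_nonneg j : (0:ℝ) ≤ j)])
    have e2 : ‖β (l + k)‖ ≤ D / ((k : ℝ) + 1) := (h'.bd _).trans (by push_cast; gcongr; linarith [(Nat.cast_nonneg l : (0:ℝ) ≤ l)])
    calc _ ≤ (C / ((k : ℝ) + 1)) * (D / ((k : ℝ) + 1)) := mul_le_mul e1 e2 (norm_nonneg _) (by positivity)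
      _ = _ := by push_cast; field_simp

/-- kernels built from several phases -/
lemma TC_multi (J : Finset ℝ) (α : ℝ → ℕ → ℂ) (β : ℕ → ℂ) {C D : ℝ} (z₁ : ℝ → ℂ) (z₂ : ℂ)
    (hα : ∀ φ ∈ J, Good (α φ) C) (hβ : Good β D) (h1 : ∀ φ ∈ J, ‖z₁ φ‖ = 1) (h2 : ‖z₂‖ = 1)
    (hz : ∀ φ ∈ J, z₁ φ * z₂ ≠ 1) (X : ℕ → ℕ → ℂ)
    (hX : ∀ j l, HasSum (fun k => (∑ φ ∈ J, α φ (j + k) * z₁ φ ^ (j + k)) * (β (l + k) * z₂ ^ (l + k))) (X j l)) :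
    TC X (∑ φ ∈ J, ‖(1 - z₁ φ * z₂)⁻¹‖ * (10 * (C * D))) := by
  have t : ∀ φ ∈ J, TC (fun j l => ∑' k, (α φ (j + k) * z₁ φ ^ (j + k)) * (β (l + k) * z₂ ^ (l + k)))
      (‖(1 - z₁ φ * z₂)⁻¹‖ * (10 * (C * D))) := fun φ hφ =>
    TC_kernel (hα φ hφ).nn hβ.nn (h1 φ hφ) h2 (hz φ hφ) (hα φ hφ).bd (hα φ hφ).df hβ.bd hβ.df _
      (fun j l => ((hα φ hφ).summable hβ (h1 φ hφ) h2 j l).hasSum)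
  have := TC.sum J t
  have e : X = fun j l => ∑ φ ∈ J, ∑' k, (α φ (j + k) * z₁ φ ^ (j + k)) * (β (l + k) * z₂ ^ (l + k)) := by
    funext j l
    refine (hX j l).unique ?_
    simp only [Finset.sum_mul]
    exact hasSum_sum fun φ hφ => ((hα φ hφ).summable hβ (h1 φ hφ) h2 j l).hasSum
  rw [e]; exact this

end EE
end

noncomputable section
namespace EE
open MeasureTheory Set Filter Topology
open scoped ENNReal ComplexConjugate InnerProductSpace

/-- exponential symbol -/
def eS (h : ℝ → ℝ) (τ : ℝ) : ℝ → ℂ := fun x => (Real.exp (τ * h x) : ℂ)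

/-- derivative of the exponential symbol -/
def eD (h : ℝ → ℝ) (τ : ℝ) : ℝ → ℂ := fun x => (h x : ℂ) * (Real.exp (τ * h x) : ℂ)

lemma exp_bd {τ y B : ℝ} (h : |y| ≤ B) : Real.exp (τ * y) ≤ Real.exp (|τ| * B) := by
  refine Real.exp_le_exp.2 ((le_abs_self _).trans ?_)
  rw [abs_mul]; exact mul_le_mul_of_nonneg_left h (abs_nonneg _)

lemma exp_bd' {τ y B : ℝ} (h : |y| ≤ B) : Real.exp (-(|τ| * B)) ≤ Real.exp (τ * y) := by
  refine Real.exp_le_exp.2 (neg_le_of_abs_le ?_)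
  rw [abs_mul]; exact mul_le_mul_of_nonneg_left h (abs_nonneg _)

lemma eS_adm {h : ℝ → ℝ} (hm : Measurable h) {B : ℝ} (hB : ∀ x ∈ Icc 0 (2 * Real.pi), |h x| ≤ B) (τ : ℝ) :
    Adm (eS h τ) := by
  refine ⟨Complex.measurable_ofReal.comp (Real.measurable_exp.comp (hm.const_mul _)), Real.exp (|τ| * B),
    (Real.exp_pos _).le, fun x hx => ?_⟩
  rw [eS, Complex.norm_real, Real.norm_eq_abs, abs_of_pos (Real.exp_pos _)]
  exact exp_bd (hB x hx)

lemma re_adm {h : ℝ → ℝ} (hm : Measurable h) {B : ℝ} (hB : ∀ x ∈ Icc 0 (2 * Real.pi), |h x| ≤ B) :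
    Adm (fun x => (h x : ℂ)) := by
  refine ⟨Complex.measurable_ofReal.comp hm, B, (abs_nonneg _).trans (hB 0 ⟨le_rfl, by positivity⟩), fun x hx => ?_⟩
  rw [Complex.norm_real]; exact hB x hx

lemma eD_adm {h : ℝ → ℝ} (hm : Measurable h) {B : ℝ} (hB : ∀ x ∈ Icc 0 (2 * Real.pi), |h x| ≤ B) (τ : ℝ) :
    Adm (eD h τ) := (re_adm hm hB).mul (eS_adm hm hB τ)

lemma eS_cos {h : ℝ → ℝ} {B : ℝ} (hB : ∀ x ∈ Icc 0 (2 * Real.pi), |h x| ≤ B) (τ : ℝ) :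
    CoS (eS h τ) (Real.exp (-(|τ| * B))) := ⟨fun x => Real.exp (τ * h x), rfl, fun x hx => exp_bd' (hB x hx)⟩

lemma cf_deriv {h : ℝ → ℝ} (hm : Measurable h) {B : ℝ} (hB : ∀ x ∈ Icc 0 (2 * Real.pi), |h x| ≤ B) (n : ℤ) (τ : ℝ) :
    HasDerivAt (fun τ => cf (eS h τ) n) (cf (eD h τ) n) τ := by
  unfold cf
  refine HasDerivAt.const_mul _ ?_
  have hB0 : 0 ≤ B := (abs_nonneg _).trans (hB 0 ⟨le_rfl, by positivity⟩)
  refine (intervalIntegral.hasDerivAt_integral_of_dominated_loc_of_deriv_le (s := Metric.ball τ 1)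
    (F' := fun τ t => eD h τ t * Complex.exp (-Complex.I * n * t))
    (bound := fun _ => B * Real.exp ((|τ| + 1) * B))
    (Metric.ball_mem_nhds τ one_pos) ?_ ?_ ?_ ?_ ?_ ?_).2
  · refine Eventually.of_forall fun y => ?_
    exact ((eS_adm hm hB y).meas.mul (by fun_prop)).aestronglyMeasurable
  · exact (eS_adm hm hB τ).intervalIntegrable_exp n
  · exact ((eD_adm hm hB τ).meas.mul (by fun_prop)).aestronglyMeasurable
  · refine Eventually.of_forall fun t ht y hy => ?_
    rw [uIoc_of_le (by positivity)] at ht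
    have ht' := hB t (Ioc_subset_Icc_self ht)
    have : ‖Complex.exp (-Complex.I * n * t)‖ = 1 := by
      rw [Complex.norm_exp]; simp
    rw [norm_mul, this, mul_one, eD, norm_mul, Complex.norm_real, Complex.norm_real, Real.norm_eq_abs, Real.norm_eq_abs,
      abs_of_pos (Real.exp_pos _)]
    refine mul_le_mul ht' ((exp_bd ht').trans (Real.exp_le_exp.2 (mul_le_mul_of_nonneg_right ?_ hB0))) (Real.exp_pos _).le hB0
    rw [Metric.mem_ball, Real.dist_eq] at hy
    have := abs_sub_abs_le_abs_sub y τ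
    linarith
  · exact intervalIntegrable_const
  · refine Eventually.of_forall fun t _ y _ => ?_
    refine HasDerivAt.mul_const ?_ _
    have : HasDerivAt (fun y : ℝ => Real.exp (y * h t)) (Real.exp (y * h t) * (1 * h t)) y :=
      ((hasDerivAt_id y).mul_const (h t)).exp
    have := this.ofReal_comp
    simp only [eS, eD]
    refine this.congr_deriv ?_
    push_cast; ring

/-- Fourier coefficients of the basic symbol -/
lemma cf_b {φ : ℝ} (hφ : φ ∈ Ioo 0 (2 * Real.pi)) (c : ℝ) {n : ℤ} (hn : (c : ℂ) - Complex.I * n ≠ 0) :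
    cf (eS (saw φ) c) n = (1 / (2 * Real.pi) : ℂ) * ((Real.exp (Real.pi * c) - Real.exp (-(Real.pi * c)) : ℝ) : ℂ)
      * ((c : ℂ) - Complex.I * n)⁻¹ * Complex.exp (-Complex.I * n * φ) := by
  have e : eS (saw φ) c = fun x : ℝ => Complex.exp (c * x) * ((Real.exp (c * (Real.pi - φ)) : ℂ) +
      ∑ ψ ∈ ({φ} : Finset ℝ), ((Real.exp (c * (-Real.pi - φ)) - Real.exp (c * (Real.pi - φ)) : ℝ) : ℂ) * hv ψ x) := by
    funext x
    rw [Finset.sum_singleton, eS]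
    have : Complex.exp (c * x) = (Real.exp (c * x) : ℂ) := by push_cast; rfl
    rw [this, ← Complex.ofReal_mul, ← Complex.ofReal_add, ← Complex.ofReal_mul]
    congr 1
    unfold saw hv
    split_ifs
    · rw [mul_one, mul_one, add_sub_cancel, ← Real.exp_add]; congr 1; ring
    · rw [mul_zero, mul_zero, add_zero, ← Real.exp_add]; congr 1; ring
  rw [e, cfE {φ} (by simpa using hφ) (Real.exp (c * (Real.pi - φ)) : ℂ)
    (fun _ => ((Real.exp (c * (-Real.pi - φ)) - Real.exp (c * (Real.pi - φ)) : ℝ) : ℂ)) c hn]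
  simp only [Finset.sum_singleton]
  have h1 : ((Real.exp (c * (Real.pi - φ)) : ℂ) + ((Real.exp (c * (-Real.pi - φ)) - Real.exp (c * (Real.pi - φ)) : ℝ) : ℂ))
      * Complex.exp (c * (2 * Real.pi : ℝ)) - (Real.exp (c * (Real.pi - φ)) : ℂ) = 0 := by
    push_cast
    rw [add_sub_cancel, ← Complex.exp_add, sub_eq_zero]
    congr 1; ring
  rw [h1]
  have h2 : Complex.exp ((c - Complex.I * n) * φ) = Complex.exp (c * φ) * Complex.exp (-Complex.I * n * φ) := by
    rw [← Complex.exp_add]; congr 1; ring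
  have h3 : ((Real.exp (c * (-Real.pi - φ)) - Real.exp (c * (Real.pi - φ)) : ℝ) : ℂ) * Complex.exp (c * φ) =
      - ((Real.exp (Real.pi * c) - Real.exp (-(Real.pi * c)) : ℝ) : ℂ) := by
    push_cast
    rw [sub_mul, ← Complex.exp_add, ← Complex.exp_add, neg_sub]
    congr 2 <;> ring
  rw [h2, ← mul_assoc _ (Complex.exp (c * φ)), h3]
  ring

lemma cf_d {φ : ℝ} (hφ : φ ∈ Ioo 0 (2 * Real.pi)) (c : ℝ) {n : ℤ} (hn : n ≠ 0) :
    cf (eD (saw φ) c) n = ((1 / 2 : ℂ) * ((Real.exp (Real.pi * c) + Real.exp (-(Real.pi * c)) : ℝ) : ℂ)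
      * ((c : ℂ) - Complex.I * n)⁻¹ - (1 / (2 * Real.pi) : ℂ) * ((Real.exp (Real.pi * c) - Real.exp (-(Real.pi * c)) : ℝ) : ℂ)
      * ((c : ℂ) - Complex.I * n)⁻¹ ^ 2) * Complex.exp (-Complex.I * n * φ) := by
  have h1 := cf_deriv (saw_meas φ) (fun x hx => saw_bound hφ hx) n c
  refine h1.unique ?_
  have e : (fun c => cf (eS (saw φ) c) n) = fun c : ℝ => (1 / (2 * Real.pi) : ℂ) * ((Real.exp (Real.pi * c) - Real.exp (-(Real.pi * c)) : ℝ) : ℂ)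
      * ((c : ℂ) - Complex.I * n)⁻¹ * Complex.exp (-Complex.I * n * φ) := funext fun c => cf_b hφ c (den_ne hn c)
  rw [e]
  refine HasDerivAt.mul_const ?_ _
  have d1 : HasDerivAt (fun c : ℝ => Real.exp (Real.pi * c) - Real.exp (-(Real.pi * c)))
      (Real.exp (Real.pi * c) * (Real.pi * 1) - Real.exp (-(Real.pi * c)) * (-(Real.pi * 1))) c :=
    ((hasDerivAt_id c).const_mul _).exp.sub ((hasDerivAt_id c).const_mul _).neg.exp
  have d2 : HasDerivAt (fun c : ℝ => (c : ℂ) - Complex.I * n) 1 c := by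
    have := (hasDerivAt_id c).ofReal_comp
    simpa using this.sub_const (Complex.I * n)
  have d3 : HasDerivAt (fun c : ℝ => ((c : ℂ) - Complex.I * n)⁻¹) (-1 / ((c : ℂ) - Complex.I * n) ^ 2) c := d2.inv (den_ne hn c)
  have d4 := (d1.ofReal_comp.const_mul (1 / (2 * Real.pi) : ℂ)).mul d3
  refine d4.congr_deriv ?_
  have : (Real.pi : ℂ) ≠ 0 := by exact_mod_cast Real.pi_ne_zero
  have hd := den_ne hn c
  push_cast
  field_simp
  ring

/-- exponent attached to a jump -/
def cφ (σ : ℝ → ℝ) (φ : ℝ) : ℝ := -σ φ / Real.pi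

/-- jump coefficients of the complementary factor -/
def kap (σ : ℝ → ℝ) (τ φ ψ : ℝ) : ℝ :=
  Real.exp (τ * cφ σ φ * (φ - Real.pi)) * (2 * Real.sinh τ * σ ψ) * (if ψ < φ then 1 else Real.exp (2 * Real.pi * (τ * cφ σ φ)))

/-- complementary factor -/
def aS (J : Finset ℝ) (σ : ℝ → ℝ) (s τ φ : ℝ) : ℝ → ℂ :=
  fun x => (Real.exp (τ * Fs J σ s x - τ * cφ σ φ * saw φ x) : ℂ)

lemma aS_point {J : Finset ℝ} {σ : ℝ → ℝ} {s : ℝ} (h : Step J σ s) (τ : ℝ) {φ : ℝ} (hφ : φ ∈ J) (x : ℝ) :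
    Real.exp (τ * Fs J σ s x - τ * cφ σ φ * saw φ x) = Real.exp (-(τ * cφ σ φ) * x) *
      (Real.exp (τ * cφ σ φ * (φ - Real.pi)) * (Real.cosh τ + s * Real.sinh τ) + ∑ ψ ∈ J.erase φ, kap σ τ φ ψ * hv ψ x) := by
  set c := τ * cφ σ φ with hc
  have hcπ : 2 * Real.pi * c = - (2 * (τ * σ φ)) := by
    rw [hc, cφ]; field_simp
  have hF : ∀ y, Fs J σ s y = s + 2 * ∑ ψ ∈ J.erase φ, σ ψ * hv ψ y + 2 * (σ φ * hv φ y) := by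
    intro y
    rw [Fs, ← Finset.add_sum_erase _ _ hφ]; ring
  have hk : ∀ y, ∑ ψ ∈ J.erase φ, kap σ τ φ ψ * hv ψ y = Real.exp (c * (φ - Real.pi)) * (2 * Real.sinh τ *
      ∑ ψ ∈ J.erase φ, (if ψ < φ then 1 else Real.exp (2 * Real.pi * c)) * (σ ψ * hv ψ y)) := by
    intro y
    rw [Finset.mul_sum, Finset.mul_sum]
    refine Finset.sum_congr rfl fun ψ _ => ?_
    rw [kap, ← hc]; ring
  rw [hk, Real.exp_sub, exp_of_sq (h.val x)]
  by_cases hx : φ < x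
  · have h1 : hv φ x = 1 := by simp [hv, hx]
    have e1 : ∑ ψ ∈ J.erase φ, (if ψ < φ then 1 else Real.exp (2 * Real.pi * c)) * (σ ψ * hv ψ x) =
        Real.exp (2 * Real.pi * c) * ∑ ψ ∈ J.erase φ, (σ ψ * hv ψ x) + (1 - Real.exp (2 * Real.pi * c)) *
          ∑ ψ ∈ J.erase φ, (σ ψ * hv ψ φ) := by
      rw [Finset.mul_sum, Finset.mul_sum, ← Finset.sum_add_distrib]
      refine Finset.sum_congr rfl fun ψ _ => ?_
      by_cases hψ : ψ < φ
      · simp [hv, hψ, hψ.trans hx]; ring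
      · simp [hv, hψ]
    have h2 := hF φ
    rw [h.left φ hφ] at h2
    have h3 : hv φ φ = 0 := by simp [hv]
    rw [h3] at h2
    have e2 : ∑ ψ ∈ J.erase φ, (σ ψ * hv ψ φ) = (-σ φ - s) / 2 := by linarith
    rw [e1, e2, hF x, h1]
    have e3 : Real.exp (c * saw φ x) = Real.exp (c * x) * (Real.exp (c * (φ - Real.pi)))⁻¹ * (Real.exp (2 * Real.pi * c))⁻¹ := by
      rw [← Real.exp_neg, ← Real.exp_neg, ← Real.exp_add, ← Real.exp_add]; congr 1; unfold saw; rw [h1]; ring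
    rw [e3, neg_mul, Real.exp_neg]
    have e4 : Real.exp (2 * Real.pi * c) * (Real.cosh τ + Real.sinh τ * σ φ) = Real.cosh τ - Real.sinh τ * σ φ := by
      have a1 := exp_of_sq (h.sq φ hφ) τ
      have a2 := exp_of_sq (F := - σ φ) (by rw [neg_sq]; exact h.sq φ hφ) τ
      rw [← a1, hcπ, ← Real.exp_add]
      rw [show -(2 * (τ * σ φ)) + τ * σ φ = τ * (-σ φ) by ring, a2]; ring
    have p1 := (Real.exp_pos (c * x)).ne'
    have p2 := (Real.exp_pos (c * (φ - Real.pi))).ne'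
    have p3 := (Real.exp_pos (2 * Real.pi * c)).ne'
    generalize Real.exp (2 * Real.pi * c) = E at *
    field_simp
    linear_combination e4
  · have h1 : hv φ x = 0 := by simp [hv, hx]
    have e1 : ∑ ψ ∈ J.erase φ, (if ψ < φ then 1 else Real.exp (2 * Real.pi * c)) * (σ ψ * hv ψ x) =
        ∑ ψ ∈ J.erase φ, (σ ψ * hv ψ x) := by
      refine Finset.sum_congr rfl fun ψ _ => ?_
      by_cases hψ : ψ < φ
      · simp [hψ]
      · have : ¬ ψ < x := fun hh => hψ (hh.trans_le (not_lt.1 hx))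
        simp [hv, this]
    rw [e1, hF x, h1]
    have e3 : Real.exp (c * saw φ x) = Real.exp (c * x) * (Real.exp (c * (φ - Real.pi)))⁻¹ := by
      rw [← Real.exp_neg, ← Real.exp_add]; congr 1; unfold saw; rw [h1]; ring
    rw [e3, neg_mul, Real.exp_neg]
    have p1 := (Real.exp_pos (c * x)).ne'
    have p2 := (Real.exp_pos (c * (φ - Real.pi))).ne'
    field_simp
    ring

lemma cf_a {J : Finset ℝ} {σ : ℝ → ℝ} {s : ℝ} (h : Step J σ s) (τ : ℝ) {φ : ℝ} (hφ : φ ∈ J) {n : ℤ} (hn : n ≠ 0) :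
    cf (aS J σ s τ φ) n = ∑ ψ ∈ J.erase φ, ((-(1 / (2 * Real.pi)) * (kap σ τ φ ψ * Real.exp (-(τ * cφ σ φ) * ψ)) : ℝ) : ℂ) *
      (((-(τ * cφ σ φ) : ℝ) : ℂ) - Complex.I * n)⁻¹ * Complex.exp (-Complex.I * n * ψ) := by
  set c := τ * cφ σ φ with hc
  set K := Real.exp (c * (φ - Real.pi)) * (Real.cosh τ + s * Real.sinh τ) with hK
  have e : aS J σ s τ φ = fun x : ℝ => Complex.exp ((-c : ℝ) * x) * ((K : ℂ) + ∑ ψ ∈ J.erase φ, (kap σ τ φ ψ : ℂ) * hv ψ x) := by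
    funext x
    rw [aS, aS_point h τ hφ x, ← hc, ← hK]
    push_cast
    rfl
  have hJ : ∀ ψ ∈ J.erase φ, ψ ∈ Ioo 0 (2 * Real.pi) := fun ψ hψ => h.mem ψ (Finset.mem_of_mem_erase hψ)
  rw [e, cfE (J.erase φ) hJ (K : ℂ) (fun ψ => (kap σ τ φ ψ : ℂ)) (-c) (den_ne hn _)]
  have hb : (K + ∑ ψ ∈ J.erase φ, kap σ τ φ ψ) * Real.exp (-c * (2 * Real.pi)) - K = 0 := by
    have h1 := aS_point h τ hφ (2 * Real.pi)
    have h2 := aS_point h τ hφ 0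
    have v1 : ∀ ψ ∈ J, hv ψ (2 * Real.pi) = 1 := fun ψ hψ => by simp [hv, (h.mem ψ hψ).2]
    have v2 : ∀ ψ ∈ J, hv ψ 0 = 0 := fun ψ hψ => by simp [hv, (h.mem ψ hψ).1.le]
    have s1 : Fs J σ s (2 * Real.pi) = s := by
      rw [Fs, Finset.sum_congr rfl (fun ψ hψ => by rw [v1 ψ hψ, mul_one]), h.sum0]; ring
    have s2 : Fs J σ s 0 = s := by
      rw [Fs, Finset.sum_eq_zero (fun ψ hψ => by rw [v2 ψ hψ, mul_zero])]; ring
    have w1 : saw φ (2 * Real.pi) = saw φ 0 := by rw [saw, saw, v1 φ hφ, v2 φ hφ]; ring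
    rw [s1, w1, Finset.sum_congr rfl (fun ψ hψ => by rw [v1 ψ (Finset.mem_of_mem_erase hψ), mul_one])] at h1
    rw [s2, Finset.sum_eq_zero (fun ψ hψ => by rw [v2 ψ (Finset.mem_of_mem_erase hψ), mul_zero]), h1, mul_zero, Real.exp_zero] at h2
    rw [← hc, ← hK] at h2
    linarith
  have hb' : ((K : ℂ) + ∑ ψ ∈ J.erase φ, (kap σ τ φ ψ : ℂ)) * Complex.exp ((-c : ℝ) * (2 * Real.pi : ℝ)) - K = 0 := by
    have := congrArg (fun x : ℝ => (x : ℂ)) hb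
    push_cast at this
    push_cast
    exact this
  rw [hb', zero_sub, mul_neg, Finset.mul_sum, ← Finset.sum_neg_distrib]
  refine Finset.sum_congr rfl fun ψ _ => ?_
  have : Complex.exp ((((-c : ℝ) : ℂ) - Complex.I * n) * ψ) = (Real.exp (-c * ψ) : ℂ) * Complex.exp (-Complex.I * n * ψ) := by
    push_cast
    rw [← Complex.exp_add]; congr 1; ring
  rw [this]
  push_cast
  ring

end EE
end

noncomputable section
namespace EE
open MeasureTheory Set Filter Topology
open scoped ENNReal ComplexConjugate InnerProductSpace

/-- phases -/
def zz (ε : ℤ) (φ : ℝ) : ℂ := Complex.exp (-Complex.I * ε * φ)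

lemma zz_norm (ε : ℤ) (φ : ℝ) : ‖zz ε φ‖ = 1 := by rw [zz, Complex.norm_exp]; simp

lemma zz_pow (ε : ℤ) (φ : ℝ) (m : ℕ) : Complex.exp (-Complex.I * ((ε * ((m : ℤ) + 1) : ℤ) : ℂ) * φ) = zz ε φ * zz ε φ ^ m := by
  rw [← pow_succ', zz, ← Complex.exp_nat_mul]
  congr 1
  push_cast; ring

lemma dq_eq (c : ℝ) (ε : ℤ) (m : ℕ) : ((c : ℂ) - Complex.I * ((ε * ((m : ℤ) + 1) : ℤ) : ℂ))⁻¹ = dq c (-(ε : ℝ)) m := by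
  rw [dq]; congr 1; push_cast; ring

lemma zz_ne {ε : ℤ} (hε : |(ε : ℝ)| = 1) {φ ψ : ℝ} (hφ : φ ∈ Ioo 0 (2 * Real.pi)) (hψ : ψ ∈ Ioo 0 (2 * Real.pi))
    (h : ψ ≠ φ) : zz ε ψ * zz (-ε) φ ≠ 1 := by
  rw [zz, zz, ← Complex.exp_add]
  intro h1
  rw [Complex.exp_eq_one_iff] at h1
  obtain ⟨n, hn⟩ := h1
  have h2 := congrArg Complex.im hn
  simp at h2
  have h3 : (ε : ℝ) * (φ - ψ) = n * (2 * Real.pi) := by linarith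
  have h4 : |φ - ψ| = |(n : ℝ)| * (2 * Real.pi) := by
    have := congrArg abs h3
    rwa [abs_mul, hε, one_mul, abs_mul, abs_of_pos (by positivity : 0 < 2 * Real.pi)] at this
  have h5 : |φ - ψ| < 2 * Real.pi := by
    rw [abs_lt]; constructor <;> linarith [hφ.1, hφ.2, hψ.1, hψ.2]
  have h6 : |(n : ℝ)| < 1 := by
    rw [h4] at h5
    have := Real.pi_pos
    nlinarith
  have h7 : n = 0 := by
    have : |n| < 1 := by exact_mod_cast h6
    exact Int.abs_lt_one_iff.1 this
  rw [h7] at h4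
  simp at h4
  exact h (by linarith)

lemma n_ne {ε : ℤ} (hε : |(ε : ℝ)| = 1) (m : ℕ) : ε * ((m : ℤ) + 1) ≠ 0 := by
  have : ε ≠ 0 := by rintro rfl; simp at hε
  exact mul_ne_zero this (by omega)

lemma inv2pi : 1 / (2 * Real.pi) ≤ 1 / 2 := by
  have := Real.two_le_pi
  rw [div_le_div_iff₀ (by positivity) (by norm_num)]; linarith

lemma exp_le_of {x T : ℝ} (h : |x| ≤ T) : Real.exp x ≤ Real.exp T := Real.exp_le_exp.2 ((le_abs_self x).trans h)

lemma Good.mono {α : ℕ → ℂ} {C D : ℝ} (h : Good α C) (hCD : C ≤ D) : Good α D :=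
  ⟨h.nn.trans hCD, fun m => (h.bd m).trans (by gcongr), fun m => (h.df m).trans (by gcongr)⟩

lemma norm_sh {c T : ℝ} (hc : |Real.pi * c| ≤ T) :
    ‖(1 / (2 * Real.pi) : ℂ) * ((Real.exp (Real.pi * c) - Real.exp (-(Real.pi * c)) : ℝ) : ℂ)‖ ≤ Real.exp T := by
  have h1 := exp_le_of hc
  have h2 : Real.exp (-(Real.pi * c)) ≤ Real.exp T := exp_le_of (by rwa [abs_neg])
  have e : (1 / (2 * Real.pi) : ℂ) * ((Real.exp (Real.pi * c) - Real.exp (-(Real.pi * c)) : ℝ) : ℂ) =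
    ((1 / (2 * Real.pi) * (Real.exp (Real.pi * c) - Real.exp (-(Real.pi * c))) : ℝ) : ℂ) := by push_cast; ring
  rw [e, Complex.norm_real, norm_mul, Real.norm_eq_abs, Real.norm_eq_abs, abs_of_pos (by positivity)]
  have h3 := Real.exp_pos (Real.pi * c)
  have h4 := Real.exp_pos (-(Real.pi * c))
  have h5 : |Real.exp (Real.pi * c) - Real.exp (-(Real.pi * c))| ≤ Real.exp T := by
    rw [abs_le]; constructor <;> linarith
  calc _ ≤ 1 / 2 * Real.exp T := mul_le_mul inv2pi h5 (abs_nonneg _) (by norm_num)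
    _ ≤ _ := by linarith [Real.exp_pos T]

lemma norm_ch {c T : ℝ} (hc : |Real.pi * c| ≤ T) :
    ‖(1 / 2 : ℂ) * ((Real.exp (Real.pi * c) + Real.exp (-(Real.pi * c)) : ℝ) : ℂ)‖ ≤ Real.exp T := by
  have h1 := exp_le_of hc
  have h2 : Real.exp (-(Real.pi * c)) ≤ Real.exp T := exp_le_of (by rwa [abs_neg])
  have h3 := Real.exp_pos (Real.pi * c)
  have h4 := Real.exp_pos (-(Real.pi * c))
  rw [norm_mul, Complex.norm_real, Real.norm_eq_abs, abs_of_pos (by positivity)]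
  norm_num
  linarith

lemma good_b {φ : ℝ} (hφ : φ ∈ Ioo 0 (2 * Real.pi)) {ε : ℤ} (hε : |(ε : ℝ)| = 1) {c T : ℝ} (hc : |Real.pi * c| ≤ T) :
    ∃ β, Good β (3 * Real.exp T) ∧ ∀ m : ℕ, cf (eS (saw φ) c) (ε * ((m : ℤ) + 1)) = β m * zz ε φ ^ m := by
  have hε' : |-(ε : ℝ)| = 1 := by rwa [abs_neg]
  refine ⟨_, ((Good_dq c hε').smul ((1 / (2 * Real.pi) : ℂ) * ((Real.exp (Real.pi * c) - Real.exp (-(Real.pi * c)) : ℝ) : ℂ) * zz ε φ)).mono ?_, fun m => ?_⟩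
  · rw [norm_mul, zz_norm, mul_one, mul_one]
    exact (norm_sh hc).trans (by linarith [Real.exp_pos T])
  · rw [cf_b hφ c (den_ne (n_ne hε m) c), zz_pow, dq_eq]; ring

lemma good_d {φ : ℝ} (hφ : φ ∈ Ioo 0 (2 * Real.pi)) {ε : ℤ} (hε : |(ε : ℝ)| = 1) {c T : ℝ} (hc : |Real.pi * c| ≤ T) :
    ∃ β, Good β (3 * Real.exp T) ∧ ∀ m : ℕ, cf (eD (saw φ) c) (ε * ((m : ℤ) + 1)) = β m * zz ε φ ^ m := by
  have hε' : |-(ε : ℝ)| = 1 := by rwa [abs_neg]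
  refine ⟨_, (((Good_dq c hε').smul ((1 / 2 : ℂ) * ((Real.exp (Real.pi * c) + Real.exp (-(Real.pi * c)) : ℝ) : ℂ) * zz ε φ)).add
    ((Good_dq2 c hε').smul (-((1 / (2 * Real.pi) : ℂ) * ((Real.exp (Real.pi * c) - Real.exp (-(Real.pi * c)) : ℝ) : ℂ)) * zz ε φ))).mono ?_, fun m => ?_⟩
  · rw [norm_mul, norm_mul _ (zz ε φ), norm_neg, zz_norm, mul_one, mul_one, mul_one]
    linarith [norm_sh hc, norm_ch hc]
  · rw [cf_d hφ c (n_ne hε m), zz_pow, dq_eq]; ring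

lemma cφ_bound {σ : ℝ → ℝ} {φ : ℝ} (h : σ φ ^ 2 = 1) (τ : ℝ) : |Real.pi * (τ * cφ σ φ)| = |τ| := by
  have : Real.pi * (τ * cφ σ φ) = τ * (- σ φ) := by rw [cφ]; field_simp
  rw [this, abs_mul, abs_neg]
  rcases sq_eq_one_iff' h with h | h <;> rw [h] <;> simp

lemma exp_c_bound {c y k T : ℝ} (hc : |Real.pi * c| ≤ T) (hy : |y| ≤ k * Real.pi) (hk : 0 ≤ k) : Real.exp (c * y) ≤ Real.exp T ^ k := by
  rw [← Real.exp_mul]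
  refine exp_le_of ?_
  have hp := Real.pi_pos
  rw [abs_mul, abs_of_pos hp] at hc
  calc |c * y| = |c| * |y| := abs_mul _ _
    _ ≤ |c| * (k * Real.pi) := by gcongr
    _ = (Real.pi * |c|) * k := by ring
    _ ≤ T * k := by gcongr

lemma kap_bound {J : Finset ℝ} {σ : ℝ → ℝ} {s : ℝ} (h : Step J σ s) {τ T : ℝ} (hτ : |τ| ≤ T) {φ ψ : ℝ} (hφ : φ ∈ J) (hψ : ψ ∈ J) :
    |-(1 / (2 * Real.pi)) * (kap σ τ φ ψ * Real.exp (-(τ * cφ σ φ) * ψ))| ≤ Real.exp T ^ 6 := by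
  have hT : 0 ≤ T := (abs_nonneg _).trans hτ
  have hp := Real.pi_pos
  have hc := (cφ_bound (h.sq φ hφ) τ).le.trans hτ
  set c := τ * cφ σ φ with hcd
  obtain ⟨f1, f2⟩ := h.mem φ hφ
  obtain ⟨p1, p2⟩ := h.mem ψ hψ
  have E1 : 1 ≤ Real.exp T := Real.one_le_exp hT
  have b1 : Real.exp (c * (φ - Real.pi)) ≤ Real.exp T := by
    have := exp_c_bound (k := 1) (y := φ - Real.pi) hc (by rw [one_mul, abs_le]; constructor <;> linarith) zero_le_one
    rwa [Real.rpow_one] at this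
  have b2 : Real.exp (-c * ψ) ≤ Real.exp T ^ 2 := by
    have := exp_c_bound (c := -c) (k := 2) (y := ψ) (T := T) (by rwa [mul_neg, abs_neg]) (by rw [abs_le]; constructor <;> linarith) (by norm_num)
    exact_mod_cast this
  have b3 : (if ψ < φ then 1 else Real.exp (2 * Real.pi * c)) ≤ Real.exp T ^ 2 := by
    split_ifs
    · exact one_le_pow₀ E1
    · have := exp_c_bound (k := 2) (y := 2 * Real.pi) hc (by rw [abs_of_pos (by positivity)]) (by norm_num)
      rw [mul_comm]
      exact_mod_cast this
  have b3' : 0 ≤ (if ψ < φ then 1 else Real.exp (2 * Real.pi * c)) := by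
    split_ifs
    · norm_num
    · positivity
  have b4 : |2 * Real.sinh τ * σ ψ| ≤ 2 * Real.exp T := by
    have hs : |σ ψ| = 1 := by rcases sq_eq_one_iff' (h.sq ψ hψ) with h | h <;> rw [h] <;> simp
    rw [abs_mul, hs, mul_one, abs_mul, abs_two, Real.sinh_eq]
    have q1 := exp_le_of hτ
    have q2 : Real.exp (-τ) ≤ Real.exp T := exp_le_of (by rwa [abs_neg])
    have := Real.exp_pos τ
    have := Real.exp_pos (-τ)
    gcongr
    rw [abs_le]; constructor <;> linarith
  rw [kap, ← hcd, abs_mul, abs_neg, abs_of_pos (by positivity : 0 < 1 / (2 * Real.pi)), abs_mul, abs_mul, abs_mul,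
    abs_of_pos (Real.exp_pos _), abs_of_pos (Real.exp_pos (-c * ψ)), abs_of_nonneg b3']
  calc _ ≤ 1 / 2 * (Real.exp T * (2 * Real.exp T) * Real.exp T ^ 2 * Real.exp T ^ 2) := by
        gcongr
        linarith [Real.two_le_pi]
    _ = _ := by ring

lemma good_a {J : Finset ℝ} {σ : ℝ → ℝ} {s : ℝ} (h : Step J σ s) {τ T : ℝ} (hτ : |τ| ≤ T) {φ : ℝ} (hφ : φ ∈ J)
    {ε : ℤ} (hε : |(ε : ℝ)| = 1) :
    ∃ α : ℝ → ℕ → ℂ, (∀ ψ ∈ J.erase φ, Good (α ψ) (Real.exp T ^ 6)) ∧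
      ∀ m : ℕ, cf (aS J σ s τ φ) (ε * ((m : ℤ) + 1)) = ∑ ψ ∈ J.erase φ, α ψ m * zz ε ψ ^ m := by
  have hε' : |-(ε : ℝ)| = 1 := by rwa [abs_neg]
  refine ⟨fun ψ m => ((-(1 / (2 * Real.pi)) * (kap σ τ φ ψ * Real.exp (-(τ * cφ σ φ) * ψ)) : ℝ) : ℂ) * zz ε ψ *
    dq (-(τ * cφ σ φ)) (-(ε : ℝ)) m, fun ψ hψ => ((Good_dq _ hε').smul _).mono ?_, fun m => ?_⟩
  · rw [norm_mul, zz_norm, mul_one, mul_one, Complex.norm_real]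
    exact kap_bound h hτ hφ (Finset.mem_of_mem_erase hψ)
  · rw [cf_a h τ hφ (n_ne hε m)]
    refine Finset.sum_congr rfl fun ψ _ => ?_
    rw [zz_pow, dq_eq]; ring

/-- geometric constant -/
def Kg (J : Finset ℝ) (φ T : ℝ) (ε : ℤ) : ℝ :=
  ∑ ψ ∈ J.erase φ, ‖(1 - zz ε ψ * zz (-ε) φ)⁻¹‖ * (10 * (Real.exp T ^ 6 * (3 * Real.exp T)))

lemma Kg_nonneg (J : Finset ℝ) (φ T : ℝ) (ε : ℤ) : 0 ≤ Kg J φ T ε := Finset.sum_nonneg fun _ _ => by positivity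

lemma TC_gen {J : Finset ℝ} {σ : ℝ → ℝ} {s : ℝ} (h : Step J σ s) {τ T : ℝ} (hτ : |τ| ≤ T) {φ : ℝ} (hφ : φ ∈ J)
    {ε : ℤ} (hε : |(ε : ℝ)| = 1) {g : ℝ → ℂ}
    (hg : ∃ β, Good β (3 * Real.exp T) ∧ ∀ m : ℕ, cf g (-ε * ((m : ℤ) + 1)) = β m * zz (-ε) φ ^ m)
    (X : ℕ → ℕ → ℂ) (hX : ∀ j l, HasSum (fun k : ℕ => cf (aS J σ s τ φ) (ε * (((j + k : ℕ) : ℤ) + 1)) *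
      cf g (-ε * (((l + k : ℕ) : ℤ) + 1))) (X j l)) : TC X (Kg J φ T ε) := by
  obtain ⟨α, hα, hα'⟩ := good_a h hτ hφ hε
  obtain ⟨β, hβ, hβ'⟩ := hg
  refine TC_multi (J.erase φ) α β (fun ψ => zz ε ψ) (zz (-ε) φ) hα hβ (fun _ _ => zz_norm _ _) (zz_norm _ _)
    (fun ψ hψ => zz_ne hε (h.mem φ hφ) (h.mem ψ (Finset.mem_of_mem_erase hψ)) (Finset.ne_of_mem_erase hψ)) X fun j l => ?_
  have := hX j l
  simp only [hα', hβ'] at this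
  exact this

lemma TC_X1 {J : Finset ℝ} {σ : ℝ → ℝ} {s : ℝ} (h : Step J σ s) {τ T : ℝ} (hτ : |τ| ≤ T) {φ : ℝ} (hφ : φ ∈ J)
    {g : ℝ → ℂ} (ha : Adm (aS J σ s τ φ)) (hga : Adm g)
    (hg : ∀ ε : ℤ, |(ε : ℝ)| = 1 → ∃ β, Good β (3 * Real.exp T) ∧ ∀ m : ℕ, cf g (ε * ((m : ℤ) + 1)) = β m * zz ε φ ^ m) :
    TC (X1 (aS J σ s τ φ) g) (Kg J φ T 1) ∧ TC (X2 (aS J σ s τ φ) g) (Kg J φ T (-1)) := by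
  constructor
  · refine TC_gen h hτ hφ (ε := 1) (by simp) (hg (-1) (by simp)) _ fun j l => ?_
    have := X1_hasSum ha hga j l
    refine Eq.mpr (congrArg (fun F : ℕ → ℂ => HasSum F _) (funext fun k => ?_)) this
    congr 2 <;> push_cast <;> ring
  · refine TC_gen h hτ hφ (ε := -1) (by simp) (by simpa using hg 1 (by simp)) _ fun j l => ?_
    have := X2_hasSum ha hga j l
    refine Eq.mpr (congrArg (fun F : ℕ → ℂ => HasSum F _) (funext fun k => ?_)) this
    congr 2 <;> push_cast <;> ring

end EE
end

noncomputable section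
namespace EE
open MeasureTheory Set Filter Topology
open scoped ENNReal ComplexConjugate InnerProductSpace

/-- derivative of the determinant -/
lemma det_deriv {n : ℕ} {A : ℝ → Matrix (Fin n) (Fin n) ℂ} {A' : Matrix (Fin n) (Fin n) ℂ} {t : ℝ}
    (h : ∀ i j, HasDerivAt (fun s => A s i j) (A' i j) t) :
    HasDerivAt (fun s => (A s).det) (((A t).adjugate * A').trace) t := by
  simp only [Matrix.det_apply']
  have h1 := HasDerivAt.fun_sum (u := (Finset.univ : Finset (Equiv.Perm (Fin n)))) (x := t)
    (A := fun σ s => ((Equiv.Perm.sign σ : ℤ) : ℂ) * ∏ i, A s (σ i) i)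
    (fun σ _ => HasDerivAt.const_mul ((Equiv.Perm.sign σ : ℤ) : ℂ)
      (HasDerivAt.fun_finsetProd (u := Finset.univ) (fun i _ => h (σ i) i)))
  refine h1.congr_deriv ?_
  simp only [Matrix.trace, Matrix.diag_apply]
  have h2 : ∀ i, ((A t).adjugate * A') i i = ((A t).updateCol i (fun k => A' k i)).det := by
    intro i
    rw [← Matrix.cramer_apply, Matrix.cramer_eq_adjugate_mulVec]
    rfl
  simp only [h2, Matrix.det_apply', Finset.mul_sum]
  rw [Finset.sum_comm]
  refine Finset.sum_congr rfl fun i _ => Finset.sum_congr rfl fun σ _ => ?_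
  rw [← Finset.mul_prod_erase Finset.univ _ (Finset.mem_univ i), smul_eq_mul, mul_comm (∏ j ∈ _, _)]
  congr 2
  · simp
  · refine Finset.prod_congr rfl fun j hj => ?_
    rw [Matrix.updateCol_ne (Finset.ne_of_mem_erase hj)]

/-- logarithm of the Toeplitz determinant of the exponential symbol -/
def LL (h : ℝ → ℝ) (n : ℕ) (τ : ℝ) : ℝ := Real.log ‖(mat n (Mo (eS h τ))).det‖

lemma log_norm_deriv {D : ℝ → ℂ} {D' : ℂ} {t : ℝ} (h : HasDerivAt D D' t) (h0 : D t ≠ 0) :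
    HasDerivAt (fun s => Real.log ‖D s‖) ((D t)⁻¹ * D').re t := by
  have e : (fun s => Real.log ‖D s‖) = fun s => (1 / 2) * Real.log ((D s).re * (D s).re + (D s).im * (D s).im) := by
    funext s
    rw [← Complex.normSq_apply, Complex.normSq_eq_norm_sq, Real.log_pow]; push_cast; ring
  rw [e]
  have hr : HasDerivAt (fun s => (D s).re) D'.re t := Complex.reCLM.hasFDerivAt.comp_hasDerivAt t h
  have hi : HasDerivAt (fun s => (D s).im) D'.im t := Complex.imCLM.hasFDerivAt.comp_hasDerivAt t h
  have hn : (D t).re * (D t).re + (D t).im * (D t).im ≠ 0 := by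
    rw [← Complex.normSq_apply]; simpa using h0
  have := (((hr.mul hr).add (hi.mul hi)).log hn).const_mul (1 / 2)
  refine this.congr_deriv ?_
  rw [Complex.mul_re, Complex.inv_re, Complex.inv_im, Complex.normSq_apply]
  simp only [Pi.add_apply, Pi.mul_apply]
  field_simp
  ring

lemma LL_deriv {h : ℝ → ℝ} (hm : Measurable h) {B : ℝ} (hB : ∀ x ∈ Icc 0 (2 * Real.pi), |h x| ≤ B) (n : ℕ) (τ : ℝ) :
    HasDerivAt (LL h n) ((((mat n (Mo (eS h τ)))⁻¹ * mat n (Mo (eD h τ))).trace).re) τ := by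
  have hB0 : 0 ≤ B := (abs_nonneg _).trans (hB 0 ⟨le_rfl, by positivity⟩)
  have hu := mat_unit (Real.exp_pos _) (Real.exp_le_one_iff.2 (by nlinarith [abs_nonneg τ])) (eS_cos hB τ) (eS_adm hm hB τ) n
  have hd := det_deriv (A := fun s => mat n (Mo (eS h s))) (A' := mat n (Mo (eD h τ))) (t := τ) (fun i j => by
    have : (fun s => mat n (Mo (eS h s)) i j) = fun s => cf (eS h s) ((i : ℤ) - j) :=
      funext fun s => mat_Mo (eS_adm hm hB s) n i j
    rw [this, mat_Mo (eD_adm hm hB τ) n i j]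
    exact cf_deriv hm hB _ τ)
  have := log_norm_deriv hd hu.ne_zero
  refine this.congr_deriv ?_
  rw [Matrix.inv_def, Ring.inverse_eq_inv', Matrix.smul_mul, Matrix.trace_smul, smul_eq_mul]

lemma CoS.mono {g : ℝ → ℂ} {δ δ' : ℝ} (h : CoS g δ) (hd : δ' ≤ δ) : CoS g δ' := by
  obtain ⟨k, e, hk⟩ := h
  exact ⟨k, e, fun x hx => hd.trans (hk x hx)⟩

section
variable {J : Finset ℝ} {σ : ℝ → ℝ} {s : ℝ}

lemma aS_adm (h : Step J σ s) (τ : ℝ) {φ : ℝ} (hφ : φ ∈ J) : Adm (aS J σ s τ φ) := by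
  refine ⟨Complex.measurable_ofReal.comp (Real.measurable_exp.comp (((Fs_meas J σ s).const_mul _).sub ((saw_meas φ).const_mul _))),
    Real.exp (|τ| + |τ * cφ σ φ| * Real.pi), (Real.exp_pos _).le, fun x hx => ?_⟩
  rw [aS, Complex.norm_real, Real.norm_eq_abs, abs_of_pos (Real.exp_pos _)]
  refine Real.exp_le_exp.2 ((le_abs_self _).trans ((abs_sub _ _).trans ?_))
  rw [abs_mul, Fs_abs h, mul_one, abs_mul (τ * cφ σ φ)]
  have := saw_bound (h.mem φ hφ) hx
  gcongr

lemma aS_mul (τ φ : ℝ) : eS (Fs J σ s) τ = fun x => aS J σ s τ φ x * eS (saw φ) (τ * cφ σ φ) x := by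
  funext x
  rw [eS, aS, eS, ← Complex.ofReal_mul, ← Real.exp_add]
  congr 2; ring

/-- localized trace at a jump -/
def EtF (J : Finset ℝ) (σ : ℝ → ℝ) (s τ φ : ℝ) (n : ℕ) : ℂ :=
  Et (aS J σ s τ φ) (eS (saw φ) (τ * cφ σ φ)) (eD (saw φ) (τ * cφ σ φ)) (eS (Fs J σ s) τ) n

lemma EtF_data (h : Step J σ s) {T : ℝ} {φ : ℝ} (hφ : φ ∈ J) :
    ∃ K : ℝ, 0 ≤ K ∧ ∀ τ, |τ| ≤ T → (∀ n, ‖EtF J σ s τ φ n‖ ≤ K) ∧ ∃ t, Tendsto (EtF J σ s τ φ) atTop (𝓝 t) := by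
  set C := Kg J φ T 1 + Kg J φ T (-1) with hC
  have k1 := Kg_nonneg J φ T 1
  have k2 := Kg_nonneg J φ T (-1)
  have hC0 : 0 ≤ C := by positivity
  set δ := Real.exp (-T)
  have hδ0 : 0 < δ := Real.exp_pos _
  set D := Real.pi * Real.exp T
  have hD0 : 0 ≤ D := by positivity
  refine ⟨(δ⁻¹ * C + δ⁻¹ * C) + (δ⁻¹ * (D * δ⁻¹) * C + δ⁻¹ * (D * δ⁻¹) * C), by positivity, fun τ hτ => ?_⟩
  have hT : 0 ≤ T := (abs_nonneg _).trans hτ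
  have hδ1 : δ ≤ 1 := Real.exp_le_one_iff.2 (by linarith)
  have hφm := h.mem φ hφ
  have hsb : ∀ x ∈ Icc 0 (2 * Real.pi), |saw φ x| ≤ Real.pi := fun x hx => saw_bound hφm hx
  have hFb : ∀ x ∈ Icc 0 (2 * Real.pi), |Fs J σ s x| ≤ 1 := fun x _ => (Fs_abs h x).le
  have hcb := cφ_bound (h.sq φ hφ) τ
  have hcb2 : |τ * cφ σ φ| * Real.pi = |τ| := by
    rw [← hcb, abs_mul Real.pi, abs_of_pos Real.pi_pos, mul_comm]
  have hcT : |Real.pi * (τ * cφ σ φ)| ≤ T := hcb.trans_le hτ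
  have cb : CoS (eS (saw φ) (τ * cφ σ φ)) δ := (eS_cos hsb _).mono (Real.exp_le_exp.2 (by rw [hcb2]; linarith))
  have cw : CoS (eS (Fs J σ s) τ) δ := (eS_cos hFb _).mono (Real.exp_le_exp.2 (by linarith))
  have ha := aS_adm h τ hφ
  have hb := eS_adm (saw_meas φ) hsb (τ * cφ σ φ)
  have hd := eD_adm (saw_meas φ) hsb (τ * cφ σ φ)
  have hw := eS_adm (Fs_meas J σ s) hFb τ
  obtain ⟨t1, t2⟩ := TC_X1 h hτ hφ ha hd (fun ε hε => good_d hφm hε hcT)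
  obtain ⟨t3, t4⟩ := TC_X1 h hτ hφ ha hb (fun ε hε => good_b hφm hε hcT)
  have m1 : Kg J φ T 1 ≤ C := by linarith
  have m2 : Kg J φ T (-1) ≤ C := by linarith
  refine ⟨fun n => ?_, ?_⟩
  · refine Et_bound hδ0 hδ1 ha hb hd hw cb cw (aS_mul τ φ) hC0 hD0 (fun x hx => ?_) (t1.mono m1) (t2.mono m2) (t3.mono m1) (t4.mono m2) n
    rw [eD, norm_mul, Complex.norm_real, Complex.norm_real, Real.norm_eq_abs, Real.norm_eq_abs, abs_of_pos (Real.exp_pos _)]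
    refine mul_le_mul (hsb x hx) ((exp_bd (hsb x hx)).trans (Real.exp_le_exp.2 (by rw [hcb2]; exact hτ))) (Real.exp_pos _).le Real.pi_pos.le
  · exact Et_lim hδ0 hδ1 ha hb hd hw cb cw (aS_mul τ φ) (t1.mono m1) (t2.mono m2) (t3.mono m1) (t4.mono m2)

/-- the localization error -/
def Fn (J : Finset ℝ) (σ : ℝ → ℝ) (s : ℝ) (n : ℕ) (τ : ℝ) : ℝ :=
  LL (Fs J σ s) n τ - n * (τ * f0 J σ s) - ∑ φ ∈ J, LL (saw φ) n (τ * cφ σ φ)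

lemma Fn_deriv (h : Step J σ s) (n : ℕ) (τ : ℝ) :
    HasDerivAt (Fn J σ s n) (∑ φ ∈ J, cφ σ φ * (EtF J σ s τ φ n).re) τ := by
  have hFb : ∀ x ∈ Icc 0 (2 * Real.pi), |Fs J σ s x| ≤ 1 := fun x _ => (Fs_abs h x).le
  have d1 := LL_deriv (Fs_meas J σ s) hFb n τ
  have d2 : HasDerivAt (fun τ : ℝ => (n : ℝ) * (τ * f0 J σ s)) (n * f0 J σ s) τ := by
    simpa using ((hasDerivAt_id τ).mul_const (f0 J σ s)).const_mul (n : ℝ)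
  have hin : ∀ φ, HasDerivAt (fun τ : ℝ => τ * cφ σ φ) (cφ σ φ) τ := fun φ => by
    simpa using (hasDerivAt_id τ).mul_const (cφ σ φ)
  have d3 := HasDerivAt.fun_sum (u := J) (A := fun φ τ => LL (saw φ) n (τ * cφ σ φ)) (fun φ hφ =>
    HasDerivAt.comp (h₂ := LL (saw φ) n) τ (LL_deriv (saw_meas φ) (fun x hx => saw_bound (h.mem φ hφ) hx) n (τ * cφ σ φ)) (hin φ))
  refine ((d1.sub d2).sub d3).congr_deriv ?_
  set W := mat n (Mo (eS (Fs J σ s) τ)) with hW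
  have hw := eS_adm (Fs_meas J σ s) hFb τ
  have hu : IsUnit W.det := mat_unit (Real.exp_pos _) (Real.exp_le_one_iff.2 (by linarith [abs_nonneg τ])) (eS_cos hFb τ) hw n
  have had : ∀ φ ∈ J, Adm (fun x => aS J σ s τ φ x * eD (saw φ) (τ * cφ σ φ) x) := fun φ hφ =>
    (aS_adm h τ hφ).mul (eD_adm (saw_meas φ) (fun x hx => saw_bound (h.mem φ hφ) hx) _)
  have key : mat n (Mo (eD (Fs J σ s) τ)) = (f0 J σ s : ℂ) • W + ∑ φ ∈ J, (cφ σ φ : ℂ) •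
      mat n (Mo (fun x => aS J σ s τ φ x * eD (saw φ) (τ * cφ σ φ) x)) := by
    ext i j
    rw [mat_Mo (eD_adm (Fs_meas J σ s) hFb τ), Matrix.add_apply, Matrix.smul_apply, Matrix.sum_apply, hW, mat_Mo hw]
    simp only [Matrix.smul_apply, smul_eq_mul]
    rw [Finset.sum_congr rfl (fun φ hφ => by rw [mat_Mo (had φ hφ), ← cf_smul]), ← cf_smul,
      ← cf_sum J (fun φ x => (cφ σ φ : ℂ) * (aS J σ s τ φ x * eD (saw φ) (τ * cφ σ φ) x))
        (fun φ hφ => (adm_const _).mul (had φ hφ)), ← cf_add ((adm_const _).mul hw)]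
    · congr 1
      funext x
      have e : ∀ φ ∈ J, (cφ σ φ : ℂ) * (aS J σ s τ φ x * eD (saw φ) (τ * cφ σ φ) x) =
          ((-σ φ / Real.pi * saw φ x : ℝ) : ℂ) * eS (Fs J σ s) τ x := by
        intro φ _
        rw [congrFun (aS_mul (J := J) (σ := σ) (s := s) τ φ) x, eD, eS, cφ]; push_cast; ring
      rw [Finset.sum_congr rfl e, ← Finset.sum_mul, ← add_mul, eD, eS]
      congr 1
      rw [Fs_saw h x]; push_cast; rfl
    · have : Adm (eD (Fs J σ s) τ) := eD_adm (Fs_meas J σ s) hFb τ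
      have h2 := this.add ((adm_const (-(f0 J σ s : ℂ))).mul hw)
      refine Eq.mpr (congrArg Adm (funext fun x => ?_)) h2
      have e : ∀ φ ∈ J, (cφ σ φ : ℂ) * (aS J σ s τ φ x * eD (saw φ) (τ * cφ σ φ) x) =
          ((-σ φ / Real.pi * saw φ x : ℝ) : ℂ) * eS (Fs J σ s) τ x := by
        intro φ _
        rw [congrFun (aS_mul (J := J) (σ := σ) (s := s) τ φ) x, eD, eS, cφ]; push_cast; ring
      rw [Finset.sum_congr rfl e, ← Finset.sum_mul]
      have e2 : (Fs J σ s x : ℂ) = (f0 J σ s : ℂ) + ∑ φ ∈ J, ((-σ φ / Real.pi * saw φ x : ℝ) : ℂ) := by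
        rw [Fs_saw h x]; push_cast; rfl
      have e3 : eD (Fs J σ s) τ x = (Fs J σ s x : ℂ) * eS (Fs J σ s) τ x := rfl
      rw [e3, e2]; ring
  have e1 : (W⁻¹ * mat n (Mo (eD (Fs J σ s) τ))).trace = f0 J σ s * n + ∑ φ ∈ J, (cφ σ φ : ℂ) *
      (W⁻¹ * mat n (Mo (fun x => aS J σ s τ φ x * eD (saw φ) (τ * cφ σ φ) x))).trace := by
    rw [key, Matrix.mul_add, Matrix.trace_add, Matrix.mul_smul, Matrix.trace_smul, Matrix.nonsing_inv_mul _ hu, Matrix.trace_one,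
      Finset.mul_sum, Matrix.trace_sum]
    simp [Matrix.trace_smul]
  rw [e1, Complex.add_re, Complex.re_sum]
  simp only [Complex.re_ofReal_mul, Complex.natCast_re]
  rw [add_comm, mul_comm (f0 J σ s), add_sub_cancel_right, ← Finset.sum_sub_distrib]
  refine Finset.sum_congr rfl fun φ _ => ?_
  rw [EtF, Et, Complex.sub_re]; ring

lemma Fn_zero (n : ℕ) : Fn J σ s n 0 = 0 := by
  have e : ∀ g : ℝ → ℝ, LL g n 0 = 0 := by
    intro g
    have : mat n (Mo (eS g 0)) = 1 := by
      have e1 : eS g 0 = fun _ => (1 : ℂ) := by funext x; simp [eS]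
      ext i j
      rw [e1, mat_Mo (adm_const 1), cf_const, Matrix.one_apply]
      simp [Fin.ext_iff, sub_eq_zero]
    rw [LL, this]; simp
  simp [Fn, e]

lemma Fn_lim (h : Step J σ s) (τ : ℝ) : ∃ t, Tendsto (fun n => Fn J σ s n τ) atTop (𝓝 t) := by
  choose! K hK0 hK using fun φ (hφ : φ ∈ J) => EtF_data h (T := |τ|) hφ
  set g : ℕ → ℝ → ℝ := fun n τ => ∑ φ ∈ J, cφ σ φ * (EtF J σ s τ φ n).re with hg
  have hm : ∀ n, Measurable (g n) := by
    intro n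
    have : g n = deriv (Fn J σ s n) := funext fun τ => (Fn_deriv h n τ).deriv.symm
    rw [this]; exact measurable_deriv _
  have hsub : ∀ t ∈ uIoc 0 τ, |t| ≤ |τ| := by
    intro t ht
    rcases le_total 0 τ with h0 | h0
    · rw [uIoc_of_le h0] at ht
      rw [abs_of_pos ht.1, abs_of_nonneg h0]; exact ht.2
    · rw [uIoc_of_ge h0] at ht
      rw [abs_of_nonpos ht.2, abs_of_nonpos h0]; linarith [ht.1]
  set K' := ∑ φ ∈ J, |cφ σ φ| * K φ
  have hb : ∀ n, ∀ t ∈ uIoc 0 τ, ‖g n t‖ ≤ K' := by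
    intro n t ht
    refine (norm_sum_le _ _).trans (Finset.sum_le_sum fun φ hφ => ?_)
    rw [norm_mul]
    refine mul_le_mul_of_nonneg_left ?_ (norm_nonneg _)
    exact (Complex.abs_re_le_norm _).trans ((hK φ hφ t (hsub t ht)).1 n)
  have hl : ∀ t, |t| ≤ |τ| → ∃ l, Tendsto (fun n => g n t) atTop (𝓝 l) := by
    intro t ht
    choose! l hl using fun φ (hφ : φ ∈ J) => (hK φ hφ t ht).2
    refine ⟨∑ φ ∈ J, cφ σ φ * (l φ).re, tendsto_finsetSum _ fun φ hφ => ?_⟩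
    exact ((Complex.continuous_re.tendsto _).comp (hl φ hφ)).const_mul _
  choose! l hl using hl
  have hiv : ∀ n, IntervalIntegrable (g n) volume 0 τ := by
    intro n
    refine (intervalIntegrable_const (c := K')).mono_fun' (hm n).aestronglyMeasurable ?_
    exact (ae_restrict_mem measurableSet_uIoc).mono fun t ht => hb n t ht
  refine ⟨∫ t in (0:ℝ)..τ, l t, ?_⟩
  have e : (fun n => Fn J σ s n τ) = fun n => ∫ t in (0:ℝ)..τ, g n t := by
    funext n
    rw [intervalIntegral.integral_eq_sub_of_hasDerivAt (fun t _ => Fn_deriv h n t) (hiv n), Fn_zero, sub_zero]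
  rw [e]
  refine intervalIntegral.tendsto_integral_filter_of_dominated_convergence (fun _ => K') ?_ ?_ intervalIntegrable_const ?_
  · exact Eventually.of_forall fun n => (hm n).aestronglyMeasurable
  · exact Eventually.of_forall fun n => Eventually.of_forall fun t ht => hb n t ht
  · exact Eventually.of_forall fun t ht => hl t (hsub t ht)

end
end EE
end

noncomputable section
namespace EE
open MeasureTheory Set Filter Topology
open scoped ENNReal ComplexConjugate InnerProductSpace

/-- Cauchy matrix -/
def CM (x y : ℕ → ℂ) (n : ℕ) : Matrix (Fin n) (Fin n) ℂ := Matrix.of fun i j => (x i + y j)⁻¹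

lemma CM_det (x y : ℕ → ℂ) (n : ℕ) (h : ∀ i j, x i + y j ≠ 0) :
    (CM x y (n + 1)).det = (x n + y n)⁻¹ * ((∏ k : Fin n, ((x k - x n) / (x k + y n))) * (CM x y n).det *
      ∏ k : Fin n, ((y k - y n) / (x n + y k))) := by
  have e : (CM x y (n + 1)).submatrix finSumFinEquiv finSumFinEquiv = Matrix.fromBlocks (CM x y n)
      (Matrix.of fun (i : Fin n) (_ : Fin 1) => (x i + y n)⁻¹) (Matrix.of fun (_ : Fin 1) (j : Fin n) => (x n + y j)⁻¹)
      (Matrix.diagonal fun _ : Fin 1 => (x n + y n)⁻¹) := by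
    ext i j
    rcases i with i | i <;> rcases j with j | j <;> simp [CM]
    rw [Subsingleton.elim i 0, Subsingleton.elim j 0]; simp
  rw [← Matrix.det_submatrix_equiv_self finSumFinEquiv, e]
  have hi : Invertible (fun _ : Fin 1 => (x n + y n)⁻¹) :=
    ⟨fun _ => (x n + y n), by funext i; simp [h], by funext i; simp [h]⟩
  let _ := Matrix.diagonalInvertible (fun _ : Fin 1 => (x n + y n)⁻¹)
  rw [Matrix.det_fromBlocks₂₂, Matrix.det_diagonal]
  simp only [Finset.prod_const, Finset.card_univ, Fintype.card_fin, pow_one]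
  congr 1
  rw [← Matrix.det_diagonal, ← Matrix.det_diagonal, ← Matrix.det_mul, ← Matrix.det_mul]
  congr 1
  rw [Matrix.invOf_eq_nonsing_inv, Matrix.inv_diagonal]
  ext i j
  have hr : Ring.inverse (fun _ : Fin 1 => (x n + y n)⁻¹) = fun _ => x n + y n := by
    rw [Ring.inverse_invertible]; 
    exact (invOf_eq_right_inv (by funext i; simp [h]))
  rw [hr, Matrix.mul_diagonal, Matrix.diagonal_mul, Matrix.sub_apply, Matrix.mul_apply]
  simp only [Finset.univ_unique, Fin.default_eq_zero, Finset.sum_singleton, Matrix.mul_diagonal, Matrix.of_apply, CM]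
  have h1 := h i j
  have h2 := h i n
  have h3 := h n j
  field_simp
  ring

lemma CM_unit_ratio (γ : ℝ) (hγ : γ ≠ 0) (n : ℕ) :
    ‖(CM (fun i => (γ : ℂ) - Complex.I * i) (fun j => Complex.I * j) (n + 1)).det‖ =
      |γ|⁻¹ * (∏ k ∈ Finset.range n, (1 + γ ^ 2 / ((k : ℝ) + 1) ^ 2))⁻¹ *
      ‖(CM (fun i => (γ : ℂ) - Complex.I * i) (fun j => Complex.I * j) n).det‖ := by
  have hne : ∀ i j : ℕ, ((γ : ℂ) - Complex.I * i) + Complex.I * j ≠ 0 := by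
    intro i j h
    have := congrArg Complex.re h
    simp at this
    exact hγ this
  rw [CM_det _ _ n hne, norm_mul, norm_mul, norm_mul, norm_prod, norm_prod]
  have e1 : ‖((γ : ℂ) - Complex.I * n + Complex.I * n)⁻¹‖ = |γ|⁻¹ := by
    rw [sub_add_cancel, norm_inv, Complex.norm_real, Real.norm_eq_abs]
  have e2 : (∏ i : Fin n, ‖((γ : ℂ) - Complex.I * i - (γ - Complex.I * n)) / (γ - Complex.I * i + Complex.I * n)‖) *
      (∏ i : Fin n, ‖(Complex.I * i - Complex.I * n) / (γ - Complex.I * n + Complex.I * i)‖) =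
      (∏ k ∈ Finset.range n, (1 + γ ^ 2 / ((k : ℝ) + 1) ^ 2))⁻¹ := by
    rw [← Finset.prod_mul_distrib, ← Finset.prod_inv_distrib, ← Finset.prod_range_reflect,
      Fin.prod_univ_eq_prod_range (fun i : ℕ => ‖((γ : ℂ) - Complex.I * i - (γ - Complex.I * n)) / (γ - Complex.I * i + Complex.I * n)‖ *
        ‖(Complex.I * i - Complex.I * n) / (γ - Complex.I * n + Complex.I * i)‖)]
    refine Finset.prod_congr rfl fun i hi => ?_
    have hi := Finset.mem_range.1 hi
    have hc : (((n - 1 - i : ℕ) : ℝ) + 1) = (n : ℝ) - i := by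
      rw [Nat.cast_sub (by omega), Nat.cast_sub (by omega)]; push_cast; ring
    rw [hc]
    have hd : (0 : ℝ) < n - i := by
      have : (i : ℝ) < n := by exact_mod_cast hi
      linarith
    set d : ℝ := n - i with hdd
    have hdc : (d : ℂ) = n - i := by rw [hdd]; push_cast; rfl
    have a1 : (γ : ℂ) - Complex.I * i - (γ - Complex.I * n) = Complex.I * d := by rw [hdc]; ring
    have a2 : (γ : ℂ) - Complex.I * i + Complex.I * n = γ + d * Complex.I := by rw [hdc]; ring
    have a3 : Complex.I * i - Complex.I * n = - (Complex.I * d) := by rw [hdc]; ring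
    have a4 : (γ : ℂ) - Complex.I * n + Complex.I * i = (γ : ℝ) + (-d : ℝ) * Complex.I := by push_cast; rw [hdc]; ring
    rw [a1, a2, a3, a4, norm_div, norm_div, norm_neg, norm_mul, Complex.norm_I, one_mul, Complex.norm_add_mul_I, Complex.norm_add_mul_I,
      Complex.norm_real, Real.norm_eq_abs, abs_of_pos hd, neg_sq, div_mul_div_comm, Real.mul_self_sqrt (by positivity)]
    field_simp
    ring
  rw [e1, ← e2]; ring

/-- the step of the logarithmic determinant of a pure jump -/
def dl (γ : ℝ) (n : ℕ) : ℝ := Real.log (Real.sinh (Real.pi * γ) / (Real.pi * γ)) -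
  ∑ k ∈ Finset.range n, Real.log (1 + γ ^ 2 / ((k : ℝ) + 1) ^ 2)

lemma sinhc_pos {γ : ℝ} (hγ : γ ≠ 0) : 0 < Real.sinh (Real.pi * γ) / (Real.pi * γ) := by
  have hp := Real.pi_pos
  rcases lt_or_gt_of_ne hγ with h | h
  · exact div_pos_of_neg_of_neg (Real.sinh_neg_iff.2 (by nlinarith)) (by nlinarith)
  · exact div_pos (Real.sinh_pos_iff.2 (by positivity)) (by positivity)

lemma LL_saw_CM {φ : ℝ} (hφ : φ ∈ Ioo 0 (2 * Real.pi)) {γ : ℝ} (hγ : γ ≠ 0) (n : ℕ) :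
    ‖(mat n (Mo (eS (saw φ) γ))).det‖ = |Real.sinh (Real.pi * γ) / Real.pi| ^ n *
      ‖(CM (fun i => (γ : ℂ) - Complex.I * i) (fun j => Complex.I * j) n).det‖ := by
  set κ : ℂ := ((Real.sinh (Real.pi * γ) / Real.pi : ℝ) : ℂ) with hκ
  have hκ2 : κ = (1 / (2 * Real.pi) : ℂ) * ((Real.exp (Real.pi * γ) - Real.exp (-(Real.pi * γ)) : ℝ) : ℂ) := by
    rw [hκ, Real.sinh_eq]; push_cast
    have : (Real.pi : ℂ) ≠ 0 := by exact_mod_cast Real.pi_ne_zero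
    field_simp
  have e : mat n (Mo (eS (saw φ) γ)) = κ • (Matrix.diagonal (fun i : Fin n => Complex.exp (-Complex.I * i * φ)) *
      CM (fun i => (γ : ℂ) - Complex.I * i) (fun j => Complex.I * j) n *
      Matrix.diagonal (fun i : Fin n => Complex.exp (Complex.I * i * φ))) := by
    ext i j
    rw [mat_Mo (eS_adm (saw_meas φ) (fun x hx => saw_bound hφ hx) γ), cf_b hφ γ]
    · rw [Matrix.smul_apply, Matrix.mul_diagonal, Matrix.diagonal_mul, CM, Matrix.of_apply, smul_eq_mul, ← hκ2]
      have h1 : Complex.exp (-Complex.I * (((i : ℤ) - (j : ℤ) : ℤ) : ℂ) * φ) = Complex.exp (-Complex.I * i * φ) * Complex.exp (Complex.I * j * φ) := by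
        rw [← Complex.exp_add]; congr 1; push_cast; ring
      rw [h1]
      have h2 : (γ : ℂ) - Complex.I * (((i : ℤ) - (j : ℤ) : ℤ) : ℂ) = γ - Complex.I * i + Complex.I * j := by push_cast; ring
      rw [h2]; ring
    · intro h
      have := congrArg Complex.re h
      simp at this
      exact hγ this
  have hn : ∀ i : ℕ, ‖Complex.exp (-Complex.I * i * φ)‖ = 1 := by intro i; rw [Complex.norm_exp]; simp
  have hn' : ∀ i : ℕ, ‖Complex.exp (Complex.I * i * φ)‖ = 1 := by intro i; rw [Complex.norm_exp]; simp
  rw [e, Matrix.det_smul, Matrix.det_mul, Matrix.det_mul, Matrix.det_diagonal, Matrix.det_diagonal, norm_mul, norm_mul, norm_mul,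
    norm_prod, norm_prod, norm_pow, hκ, Complex.norm_real, Real.norm_eq_abs]
  simp only [hn, hn', Finset.prod_const_one, one_mul, mul_one, Fintype.card_fin]

lemma LL_saw_step {φ : ℝ} (hφ : φ ∈ Ioo 0 (2 * Real.pi)) {γ : ℝ} (hγ : γ ≠ 0) (n : ℕ) :
    LL (saw φ) (n + 1) γ - LL (saw φ) n γ = dl γ n := by
  have hp := Real.pi_pos
  have hB : ∀ x ∈ Icc 0 (2 * Real.pi), |saw φ x| ≤ Real.pi := fun x hx => saw_bound hφ hx
  have hu := mat_unit (Real.exp_pos _) (Real.exp_le_one_iff.2 (by nlinarith [abs_nonneg γ])) (eS_cos hB γ) (eS_adm (saw_meas φ) hB γ) n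
  have hu0 : 0 < ‖(mat n (Mo (eS (saw φ) γ))).det‖ := norm_pos_iff.2 hu.ne_zero
  have e : ‖(mat (n + 1) (Mo (eS (saw φ) γ))).det‖ = (Real.sinh (Real.pi * γ) / (Real.pi * γ)) *
      (∏ k ∈ Finset.range n, (1 + γ ^ 2 / ((k : ℝ) + 1) ^ 2))⁻¹ * ‖(mat n (Mo (eS (saw φ) γ))).det‖ := by
    rw [LL_saw_CM hφ hγ, LL_saw_CM hφ hγ, CM_unit_ratio γ hγ n, pow_succ]
    have : Real.sinh (Real.pi * γ) / (Real.pi * γ) = |Real.sinh (Real.pi * γ) / Real.pi| * |γ|⁻¹ := by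
      rw [← abs_inv, ← abs_mul, ← abs_of_pos (sinhc_pos hγ)]
      congr 1; field_simp
    rw [this]; ring
  have hpos : 0 < ∏ k ∈ Finset.range n, (1 + γ ^ 2 / ((k : ℝ) + 1) ^ 2) := Finset.prod_pos fun k _ => by positivity
  rw [LL, LL, e, Real.log_mul (mul_pos (sinhc_pos hγ) (inv_pos.2 hpos)).ne' hu0.ne', Real.log_mul (sinhc_pos hγ).ne' (inv_pos.2 hpos).ne',
    Real.log_inv, Real.log_prod (fun k _ => by positivity), dl]
  ring

lemma dl_lim {γ : ℝ} (hγ : γ ≠ 0) (n : ℕ) :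
    Tendsto (fun m : ℕ => ∑ k ∈ Finset.Ico n m, Real.log (1 + γ ^ 2 / ((k : ℝ) + 1) ^ 2)) atTop (𝓝 (dl γ n)) := by
  have h1 : Tendsto (fun m : ℕ => ∏ k ∈ Finset.range m, (1 + γ ^ 2 / ((k : ℝ) + 1) ^ 2)) atTop (𝓝 (Real.sinh (Real.pi * γ) / (Real.pi * γ))) := by
    have h := Complex.tendsto_euler_sin_prod ((γ : ℂ) * Complex.I)
    have hne : (Real.pi : ℂ) * (γ * Complex.I) ≠ 0 := by
      simp [hγ, Real.pi_ne_zero]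
    have h2 := (h.div_const ((Real.pi : ℂ) * (γ * Complex.I)))
    have h3 := (Complex.continuous_re.tendsto _).comp h2
    have e1 : (Complex.sin ((Real.pi : ℂ) * (γ * Complex.I)) / ((Real.pi : ℂ) * (γ * Complex.I))).re = Real.sinh (Real.pi * γ) / (Real.pi * γ) := by
      rw [← mul_assoc, Complex.sin_mul_I, mul_div_mul_right _ _ Complex.I_ne_zero, ← Complex.ofReal_mul, ← Complex.ofReal_sinh,
        ← Complex.ofReal_div, Complex.ofReal_re]
    rw [e1] at h3
    refine h3.congr fun m => ?_
    simp only [Function.comp_apply]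
    rw [mul_div_cancel_left₀ _ hne]
    have : ∏ j ∈ Finset.range m, ((1 : ℂ) - (γ * Complex.I) ^ 2 / ((j : ℂ) + 1) ^ 2) = ((∏ k ∈ Finset.range m, (1 + γ ^ 2 / ((k : ℝ) + 1) ^ 2) : ℝ) : ℂ) := by
      push_cast
      refine Finset.prod_congr rfl fun j _ => ?_
      rw [mul_pow, Complex.I_sq]; ring
    rw [this, Complex.ofReal_re]
  have h2 := (h1.log (sinhc_pos hγ).ne').sub_const (∑ k ∈ Finset.range n, Real.log (1 + γ ^ 2 / ((k : ℝ) + 1) ^ 2))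
  refine h2.congr' ?_
  filter_upwards [eventually_ge_atTop n] with m hm
  rw [Real.log_prod (fun k _ => by positivity), Finset.sum_Ico_eq_sub _ hm]

lemma dl_upper {γ : ℝ} (hγ : γ ≠ 0) {n : ℕ} (hn : 1 ≤ n) : dl γ n ≤ γ ^ 2 / n := by
  refine le_of_tendsto (dl_lim hγ n) ?_
  filter_upwards [eventually_ge_atTop n] with m hm
  have hn0 : (0 : ℝ) < n := by exact_mod_cast hn
  have : ∀ m, n ≤ m → ∑ k ∈ Finset.Ico n m, Real.log (1 + γ ^ 2 / ((k : ℝ) + 1) ^ 2) ≤ γ ^ 2 / n - γ ^ 2 / m := by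
    intro m hm
    induction m, hm using Nat.le_induction with
    | base => simp
    | succ m hm ih =>
      rw [Finset.sum_Ico_succ_top hm]
      have hm0 : (0 : ℝ) < m := lt_of_lt_of_le hn0 (by exact_mod_cast hm)
      have h1 : Real.log (1 + γ ^ 2 / ((m : ℝ) + 1) ^ 2) ≤ γ ^ 2 / ((m : ℝ) + 1) ^ 2 := by
        have := Real.log_le_sub_one_of_pos (x := 1 + γ ^ 2 / ((m : ℝ) + 1) ^ 2) (by positivity)
        linarith
      have h2 : γ ^ 2 / ((m : ℝ) + 1) ^ 2 ≤ γ ^ 2 / m - γ ^ 2 / (m + 1) := by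
        have : γ ^ 2 / (m : ℝ) - γ ^ 2 / (m + 1) = γ ^ 2 / (m * (m + 1)) := by field_simp; ring
        rw [this]
        gcongr
        nlinarith
      push_cast
      linarith
  have h := this m hm
  have : 0 ≤ γ ^ 2 / (m : ℝ) := by positivity
  linarith

lemma dl_lower {γ : ℝ} (hγ : γ ≠ 0) (n : ℕ) : γ ^ 2 / (n + 1 + γ ^ 2) ≤ dl γ n := by
  set a := γ ^ 2 with ha
  have ha0 : 0 ≤ a := by positivity
  have key : ∀ m, n ≤ m → a / (n + 1 + a) - a / (m + 1 + a) ≤ ∑ k ∈ Finset.Ico n m, Real.log (1 + a / ((k : ℝ) + 1) ^ 2) := by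
    intro m hm
    induction m, hm using Nat.le_induction with
    | base => simp
    | succ m hm ih =>
      rw [Finset.sum_Ico_succ_top hm]
      have h1 : 1 - (1 + a / ((m : ℝ) + 1) ^ 2)⁻¹ ≤ Real.log (1 + a / ((m : ℝ) + 1) ^ 2) :=
        Real.one_sub_inv_le_log_of_pos (by positivity)
      have h2 : a / (m + 1 + a) - a / (m + 1 + 1 + a) ≤ 1 - (1 + a / ((m : ℝ) + 1) ^ 2)⁻¹ := by
        have e1 : 1 - (1 + a / ((m : ℝ) + 1) ^ 2)⁻¹ = a / ((m + 1) ^ 2 + a) := by field_simp; ring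
        have e2 : a / ((m : ℝ) + 1 + a) - a / (m + 1 + 1 + a) = a / ((m + 1 + a) * (m + 1 + 1 + a)) := by
          field_simp; ring
        rw [e1, e2]
        gcongr
        have : (0 : ℝ) ≤ m := by positivity
        nlinarith [mul_nonneg this ha0]
      push_cast
      linarith
  have hl : Tendsto (fun m : ℕ => a / (n + 1 + a) - a / ((m : ℝ) + 1 + a)) atTop (𝓝 (a / (n + 1 + a) - 0)) := by
    refine Tendsto.sub tendsto_const_nhds ?_
    refine Tendsto.div_atTop tendsto_const_nhds ?_
    exact tendsto_atTop_add_const_right _ _ (tendsto_atTop_add_const_right _ _ tendsto_natCast_atTop_atTop)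
  rw [sub_zero] at hl
  refine le_of_tendsto_of_tendsto hl (dl_lim hγ n) ?_
  filter_upwards [eventually_ge_atTop n] with m hm
  exact key m hm

lemma dl_zero {γ : ℝ} (hγ : γ ≠ 0) : Tendsto (dl γ) atTop (𝓝 0) := by
  refine tendsto_of_tendsto_of_tendsto_of_le_of_le' tendsto_const_nhds
    (tendsto_const_nhds.div_atTop tendsto_natCast_atTop_atTop : Tendsto (fun n : ℕ => γ ^ 2 / (n : ℝ)) atTop (𝓝 0)) ?_ ?_
  · exact Eventually.of_forall fun n => le_trans (by positivity) (dl_lower hγ n)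
  · filter_upwards [eventually_ge_atTop 1] with n hn using dl_upper hγ hn

lemma LL_saw_diff {φ : ℝ} (hφ : φ ∈ Ioo 0 (2 * Real.pi)) {γ : ℝ} (hγ : γ ≠ 0) :
    Tendsto (fun N : ℕ => LL (saw φ) (2 * N + 1) γ - LL (saw φ) N γ) atTop (𝓝 (γ ^ 2 * Real.log 2)) := by
  set a := γ ^ 2 with ha
  have ha0 : 0 ≤ a := by positivity
  have e : ∀ N m, N ≤ m → LL (saw φ) m γ - LL (saw φ) N γ = ∑ k ∈ Finset.Ico N m, dl γ k := by
    intro N m hm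
    induction m, hm using Nat.le_induction with
    | base => simp
    | succ m hm ih => rw [Finset.sum_Ico_succ_top hm, ← ih, ← LL_saw_step hφ hγ]; ring
  have up : ∀ N m : ℕ, 2 ≤ N → N ≤ m → ∑ k ∈ Finset.Ico N m, dl γ k ≤ a * (Real.log ((m : ℝ) - 1) - Real.log ((N : ℝ) - 1)) := by
    intro N m hN hm
    induction m, hm using Nat.le_induction with
    | base => simp
    | succ m hm ih =>
      rw [Finset.sum_Ico_succ_top hm]
      have hm2 : (2 : ℝ) ≤ m := by exact_mod_cast hN.trans hm
      have h1 := dl_upper hγ (n := m) (by omega)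
      have h2 : (1 : ℝ) / m ≤ Real.log m - Real.log (m - 1) := by
        rw [← Real.log_div (by linarith) (by linarith)]
        have := Real.one_sub_inv_le_log_of_pos (x := (m : ℝ) / (m - 1)) (div_pos (by linarith) (by linarith))
        refine le_trans (le_of_eq ?_) this
        rw [inv_div]; field_simp; ring
      have h3 := mul_le_mul_of_nonneg_left h2 ha0
      have h4 : a * (1 / m) = γ ^ 2 / m := by rw [ha]; ring
      push_cast
      rw [add_sub_cancel_right]
      linarith
  have lo : ∀ N m : ℕ, N ≤ m → a * (Real.log ((m : ℝ) + 1 + a) - Real.log ((N : ℝ) + 1 + a)) ≤ ∑ k ∈ Finset.Ico N m, dl γ k := by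
    intro N m hm
    induction m, hm using Nat.le_induction with
    | base => simp
    | succ m hm ih =>
      rw [Finset.sum_Ico_succ_top hm]
      have h1 := dl_lower hγ m
      have hm0 : (0 : ℝ) ≤ m := by positivity
      have h2 : Real.log ((m : ℝ) + 1 + 1 + a) - Real.log (m + 1 + a) ≤ 1 / (m + 1 + a) := by
        rw [← Real.log_div (by positivity) (by positivity)]
        have := Real.log_le_sub_one_of_pos (x := ((m : ℝ) + 1 + 1 + a) / (m + 1 + a)) (by positivity)
        refine this.trans (le_of_eq ?_)
        field_simp; ring
      have h3 := mul_le_mul_of_nonneg_left h2 ha0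
      have h4 : a * (1 / (m + 1 + a)) = γ ^ 2 / (m + 1 + γ ^ 2) := by rw [ha]; ring
      push_cast
      linarith
  have hN : Tendsto (fun N : ℕ => (N : ℝ)) atTop atTop := tendsto_natCast_atTop_atTop
  have aux : ∀ b c d : ℝ, Tendsto (fun N : ℕ => a * (Real.log (2 * (N : ℝ) + c) - Real.log ((N : ℝ) + d))) atTop (𝓝 (a * Real.log 2)) := by
    intro b c d
    refine Tendsto.const_mul _ ?_
    have t1 : Tendsto (fun N : ℕ => (2 + (c - 2 * d) / ((N : ℝ) + d))) atTop (𝓝 (2 + 0)) :=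
      tendsto_const_nhds.add (tendsto_const_nhds.div_atTop (tendsto_atTop_add_const_right _ _ hN))
    rw [add_zero] at t1
    refine (t1.log two_ne_zero).congr' ?_
    filter_upwards [hN.eventually_gt_atTop (-d), hN.eventually_gt_atTop (-c), hN.eventually_gt_atTop 0] with N h1 h2 h3
    rw [← Real.log_div (by linarith) (by linarith)]
    congr 1
    have : (N : ℝ) + d ≠ 0 := by linarith
    field_simp; ring
  refine tendsto_of_tendsto_of_tendsto_of_le_of_le' (aux 0 (2 + a) (1 + a)) (aux 0 0 (-1)) ?_ ?_
  · refine Eventually.of_forall fun N => ?_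
    rw [e N (2 * N + 1) (by omega)]
    refine le_trans (le_of_eq ?_) (lo N (2 * N + 1) (by omega))
    push_cast; ring_nf
  · filter_upwards [eventually_ge_atTop 2] with N h2
    rw [e N (2 * N + 1) (by omega)]
    refine (up N (2 * N + 1) h2 (by omega)).trans (le_of_eq ?_)
    push_cast; ring_nf

end EE
end

noncomputable section
namespace EE
open MeasureTheory Set Filter Topology
open scoped ENNReal ComplexConjugate InnerProductSpace

/-- real Fourier coefficients -/
def rc (h : ℝ → ℝ) (n : ℤ) : ℝ := (cf (fun x => (h x : ℂ)) n).re

/-- reflection symmetry -/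
def Sym (h : ℝ → ℝ) : Prop := ∀ᵐ x, x ∈ Ioc 0 (2 * Real.pi) → h (2 * Real.pi - x) = h x

lemma cf_even {h : ℝ → ℝ} (hs : Sym h) (n : ℤ) : cf (fun x => (h x : ℂ)) (-n) = cf (fun x => (h x : ℂ)) n := by
  rw [← cf_refl]
  refine cf_congr ?_ n
  filter_upwards [hs] with x hx hx2
  rw [refl, hx hx2]

lemma cf_conj (h : ℝ → ℝ) (n : ℤ) : conj (cf (fun x => (h x : ℂ)) n) = cf (fun x => (h x : ℂ)) (-n) := by
  unfold cf
  rw [map_mul, ← intervalIntegral.intervalIntegral_conj]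
  congr 1
  · rw [map_div₀, map_mul, Complex.conj_ofReal, map_one, map_ofNat]
  · refine intervalIntegral.integral_congr fun x _ => ?_
    simp only [map_mul, Complex.conj_ofReal, ← Complex.exp_conj, map_neg, Complex.conj_I, map_intCast]
    push_cast
    congr 2; ring

lemma rc_real {h : ℝ → ℝ} (hs : Sym h) (n : ℤ) : (rc h n : ℂ) = cf (fun x => (h x : ℂ)) n := by
  have := cf_conj h n
  rw [cf_even hs] at this
  exact Complex.conj_eq_iff_re.1 this

lemma rc_even {h : ℝ → ℝ} (hs : Sym h) (n : ℤ) : rc h (-n) = rc h n := by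
  rw [rc, cf_even hs]; rfl

/-- polynomial with real coefficients -/
def pv (n : ℕ) (z : ℕ → ℝ) : HH := ∑ j ∈ Finset.range n, (z j : ℂ) • ee (j : ℤ)

lemma pv_coef (n : ℕ) (z : ℕ → ℝ) (v : HH) : ⟪pv n z, v⟫_ℂ = ∑ j ∈ Finset.range n, (z j : ℂ) * ⟪ee (j : ℤ), v⟫_ℂ := by
  rw [pv, sum_inner]
  refine Finset.sum_congr rfl fun j _ => ?_
  rw [inner_smul_left, Complex.conj_ofReal]

lemma pv_norm (n : ℕ) (z : ℕ → ℝ) : ‖pv n z‖ ^ 2 = ∑ j ∈ Finset.range n, z j ^ 2 := by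
  have := @inner_self_eq_norm_sq ℂ HH _ _ _ (pv n z)
  rw [← this, pv_coef]
  have e : ∀ j ∈ Finset.range n, (z j : ℂ) * ⟪ee (j : ℤ), pv n z⟫_ℂ = ((z j ^ 2 : ℝ) : ℂ) := by
    intro j hj
    rw [pv, inner_sum, Finset.sum_eq_single j]
    · rw [inner_smul_right, ee_orth, if_pos rfl]; push_cast; ring
    · intro b _ hb
      rw [inner_smul_right, ee_orth, if_neg (by exact_mod_cast hb.symm), mul_zero]
    · intro h; exact absurd hj h
  rw [Finset.sum_congr rfl e, ← Complex.ofReal_sum]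
  exact Complex.ofReal_re _

lemma rc_QF {h : ℝ → ℝ} (ha : Adm (fun x => (h x : ℂ))) (hs : Sym h) (n : ℕ) (z : ℕ → ℝ) :
    QF (rc h) n z = (⟪pv n z, Mo (fun x => (h x : ℂ)) (pv n z)⟫_ℂ).re := by
  have e : ⟪pv n z, Mo (fun x => (h x : ℂ)) (pv n z)⟫_ℂ = ((QF (rc h) n z : ℝ) : ℂ) := by
    rw [pv_coef, QF, Complex.ofReal_sum]
    refine Finset.sum_congr rfl fun j _ => ?_
    rw [Complex.ofReal_mul, Complex.ofReal_sum]
    congr 1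
    conv_lhs => rw [pv]
    rw [map_sum, inner_sum]
    refine Finset.sum_congr rfl fun k _ => ?_
    rw [map_smul, inner_smul_right, Mo_coef ha, Complex.ofReal_mul, rc_real hs]; ring
  rw [e, Complex.ofReal_re]

lemma rc_coer {h : ℝ → ℝ} (ha : Adm (fun x => (h x : ℂ))) (hs : Sym h) {δ : ℝ} (hδ : ∀ x ∈ Icc 0 (2 * Real.pi), δ ≤ h x) :
    Coer (rc h) δ := by
  intro n z
  rw [rc_QF ha hs, ← pv_norm]
  exact Mo_coer ha hδ _

lemma rc_neg (h : ℝ → ℝ) (n : ℤ) : rc (fun x => - h x) n = - rc h n := by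
  have : (fun x => ((- h x : ℝ) : ℂ)) = fun x => (-1 : ℂ) * (h x : ℂ) := by funext x; push_cast; ring
  rw [rc, this, cf_smul, rc]; simp

lemma QF_neg (c : ℤ → ℝ) (n : ℕ) (z : ℕ → ℝ) : QF (fun m => - c m) n z = - QF c n z := by
  unfold QF
  rw [← Finset.sum_neg_distrib]
  refine Finset.sum_congr rfl fun j _ => ?_
  rw [← mul_neg, ← Finset.sum_neg_distrib]
  congr 1
  exact Finset.sum_congr rfl fun k _ => by ring

lemma rc_upper {h : ℝ → ℝ} (ha : Adm (fun x => (h x : ℂ))) (hs : Sym h) {M : ℝ} (hM : ∀ x ∈ Icc 0 (2 * Real.pi), h x ≤ M)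
    (n : ℕ) (z : ℕ → ℝ) : QF (rc h) n z ≤ M * ∑ j ∈ Finset.range n, z j ^ 2 := by
  have ha' : Adm (fun x => ((- h x : ℝ) : ℂ)) := by
    have := (adm_const (-1)).mul ha
    refine Eq.mpr (congrArg Adm (funext fun x => ?_)) this
    push_cast; ring
  have hs' : Sym (fun x => - h x) := by
    filter_upwards [hs] with x hx hx2
    rw [hx hx2]
  have := rc_coer ha' hs' (δ := -M) (fun x hx => neg_le_neg (hM x hx)) n z
  have e : rc (fun x => - h x) = fun m => - rc h m := funext fun m => rc_neg h m
  rw [e, QF_neg] at this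
  linarith

lemma mat_TM {h : ℝ → ℝ} (ha : Adm (fun x => (h x : ℂ))) (hs : Sym h) (n : ℕ) :
    mat n (Mo (fun x => (h x : ℂ))) = (TM (rc h) n).map Complex.ofReal := by
  ext i j
  rw [mat_Mo ha, Matrix.map_apply, TM, Matrix.of_apply, rc_real hs]

/-- coefficients of the exponential symbol -/
def wc (h : ℝ → ℝ) (τ : ℝ) : ℤ → ℝ := rc (fun x => Real.exp (τ * h x))

lemma wSym {h : ℝ → ℝ} (hs : Sym h) (τ : ℝ) : Sym (fun x => Real.exp (τ * h x)) := by
  filter_upwards [hs] with x hx hx2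
  rw [hx hx2]

lemma wc_even {h : ℝ → ℝ} (hs : Sym h) (τ : ℝ) (n : ℤ) : wc h τ (-n) = wc h τ n := rc_even (wSym hs τ) n

lemma wc_coer {h : ℝ → ℝ} (hm : Measurable h) {B : ℝ} (hB : ∀ x ∈ Icc 0 (2 * Real.pi), |h x| ≤ B) (hs : Sym h) (τ : ℝ) : Coer (wc h τ) (Real.exp (-(|τ| * B))) :=
  rc_coer (eS_adm hm hB τ) (wSym hs τ) (fun x hx => exp_bd' (hB x hx))

lemma wc_det_pos {h : ℝ → ℝ} (hm : Measurable h) {B : ℝ} (hB : ∀ x ∈ Icc 0 (2 * Real.pi), |h x| ≤ B) (hs : Sym h) (τ : ℝ) (n : ℕ) : 0 < (TM (wc h τ) n).det :=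
  (TM_posDef (wc_even hs τ) (Real.exp_pos _) (wc_coer hm hB hs τ) n).det_pos

lemma LL_TM {h : ℝ → ℝ} (hm : Measurable h) {B : ℝ} (hB : ∀ x ∈ Icc 0 (2 * Real.pi), |h x| ≤ B) (hs : Sym h) (τ : ℝ) (n : ℕ) : LL h n τ = Real.log (TM (wc h τ) n).det := by
  have e : mat n (Mo (eS h τ)) = (TM (wc h τ) n).map Complex.ofReal := mat_TM (eS_adm hm hB τ) (wSym hs τ) n
  have e2 : ((TM (wc h τ) n).map Complex.ofReal).det = (((TM (wc h τ) n).det : ℝ) : ℂ) :=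
    (RingHom.map_det Complex.ofRealHom (TM (wc h τ) n)).symm
  rw [LL, e, e2, Complex.norm_real, Real.norm_eq_abs, abs_of_pos (wc_det_pos hm hB hs τ n)]

lemma LL_step {h : ℝ → ℝ} (hm : Measurable h) {B : ℝ} (hB : ∀ x ∈ Icc 0 (2 * Real.pi), |h x| ≤ B) (hs : Sym h) (τ : ℝ) (n : ℕ) : LL h (n + 1) τ - LL h n τ = - Real.log (xs (wc h τ) (n + 1) 0) := by
  have h1 := xs_det (wc_even hs τ) (Real.exp_pos _) (wc_coer hm hB hs τ) n
  have h2 := xs_pos (wc_even hs τ) (Real.exp_pos _) (wc_coer hm hB hs τ) n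
  rw [LL_TM hm hB hs, LL_TM hm hB hs, ← h1, Real.log_mul h2.ne' (wc_det_pos hm hB hs τ (n + 1)).ne']; ring

lemma LL_anti {h : ℝ → ℝ} (hm : Measurable h) {B : ℝ} (hB : ∀ x ∈ Icc 0 (2 * Real.pi), |h x| ≤ B) (hs : Sym h) (τ : ℝ) : Antitone (fun n => LL h (n + 1) τ - LL h n τ) := by
  refine antitone_nat_of_succ_le fun n => ?_
  rw [LL_step hm hB hs, LL_step hm hB hs, neg_le_neg_iff]
  have h1 := (xs_rec (wc_even hs τ) (Real.exp_pos _) (wc_coer hm hB hs τ) n).1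
  have h2 := xs_pos (wc_even hs τ) (Real.exp_pos _) (wc_coer hm hB hs τ) n
  have h3 := xs_pos (wc_even hs τ) (Real.exp_pos _) (wc_coer hm hB hs τ) (n + 1)
  refine Real.log_le_log h2 ?_
  rw [h1]
  nlinarith [sq_nonneg (rs (wc h τ) (n + 2))]

/-- the boundary factor -/
def Zn (h : ℝ → ℝ) (τ : ℝ) (n : ℕ) : ℝ := Real.log (XS (wc h τ) 1 n * XS (wc h τ) (-1) n / xs (wc h τ) n 0)

lemma MM_log {h : ℝ → ℝ} (hm : Measurable h) {B : ℝ} (hB : ∀ x ∈ Icc 0 (2 * Real.pi), |h x| ≤ B) (hs : Sym h) (τ : ℝ) (N : ℕ) : 2 * Real.log (MM (wc h τ) N).det = LL h (2 * N + 1) τ + Zn h τ (2 * N + 1) := by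
  have h1 := MM_sq (wc_even hs τ) (Real.exp_pos _) (wc_coer hm hB hs τ) N
  have h2 := xs_pos (wc_even hs τ) (Real.exp_pos _) (wc_coer hm hB hs τ) (2 * N)
  have h3 := XS_pos (wc_even hs τ) (Real.exp_pos _) (wc_coer hm hB hs τ) (ε := 1) (by norm_num) (2 * N)
  have h4 := XS_pos (wc_even hs τ) (Real.exp_pos _) (wc_coer hm hB hs τ) (ε := -1) (by norm_num) (2 * N)
  have h5 := wc_det_pos hm hB hs τ (2 * N + 1)
  rw [LL_TM hm hB hs, Zn, ← Real.log_mul h5.ne' (by positivity)]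
  have : (2 : ℝ) * Real.log (MM (wc h τ) N).det = Real.log ((MM (wc h τ) N).det ^ 2) := by rw [Real.log_pow]; push_cast; ring
  rw [this]
  congr 1
  rw [mul_div_assoc', eq_div_iff h2.ne', h1]


section
variable {J : Finset ℝ} {σ : ℝ → ℝ} {s : ℝ}

lemma cφ_ne (h : Step J σ s) {φ : ℝ} (hφ : φ ∈ J) : cφ σ φ ≠ 0 := by
  have := h.sq φ hφ
  rw [cφ]
  refine div_ne_zero (neg_ne_zero.2 fun h0 => ?_) Real.pi_ne_zero
  rw [h0] at this; norm_num at this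

lemma cφ_sq (h : Step J σ s) {φ : ℝ} (hφ : φ ∈ J) : cφ σ φ ^ 2 = 1 / Real.pi ^ 2 := by
  rw [cφ, div_pow, neg_sq, h.sq φ hφ]

lemma Fn_split (n m : ℕ) (τ : ℝ) : LL (Fs J σ s) n τ - LL (Fs J σ s) m τ - ((n : ℝ) - m) * (τ * f0 J σ s) =
    (Fn J σ s n τ - Fn J σ s m τ) + ∑ φ ∈ J, (LL (saw φ) n (τ * cφ σ φ) - LL (saw φ) m (τ * cφ σ φ)) := by
  rw [Finset.sum_sub_distrib, Fn, Fn]; ring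

/-- bulk difference -/
def BN (J : Finset ℝ) (σ : ℝ → ℝ) (s τ : ℝ) (N : ℕ) : ℝ :=
  LL (Fs J σ s) (2 * N + 1) τ - LL (Fs J σ s) N τ - ((N : ℝ) + 1) * (τ * f0 J σ s)

lemma BN_lim (h : Step J σ s) {τ : ℝ} (hτ : τ ≠ 0) :
    Tendsto (BN J σ s τ) atTop (𝓝 (J.card * (τ / Real.pi) ^ 2 * Real.log 2)) := by
  obtain ⟨t, ht⟩ := Fn_lim h τ
  have e : BN J σ s τ = fun N => (Fn J σ s (2 * N + 1) τ - Fn J σ s N τ) +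
      ∑ φ ∈ J, (LL (saw φ) (2 * N + 1) (τ * cφ σ φ) - LL (saw φ) N (τ * cφ σ φ)) := by
    funext N
    rw [← Fn_split, BN]; push_cast; ring
  rw [e]
  have h1 : Tendsto (fun N : ℕ => 2 * N + 1) atTop atTop := by
    refine tendsto_atTop_mono (fun n => ?_) tendsto_id
    simp only [id]; omega
  have h2 := (ht.comp h1).sub ht
  rw [sub_self] at h2
  have h3 := tendsto_finsetSum J (fun φ hφ => LL_saw_diff (h.mem φ hφ) (mul_ne_zero hτ (cφ_ne h hφ)))
  have h4 := h2.add h3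
  rw [zero_add, Finset.sum_congr rfl (fun φ hφ => by rw [mul_pow, cφ_sq h hφ]), Finset.sum_const, nsmul_eq_mul] at h4
  refine Eq.mpr ?_ h4
  congr 2
  ring

lemma LL_step_lim (h : Step J σ s) {τ : ℝ} (hτ : τ ≠ 0) :
    Tendsto (fun n => LL (Fs J σ s) (n + 1) τ - LL (Fs J σ s) n τ) atTop (𝓝 (τ * f0 J σ s)) := by
  obtain ⟨t, ht⟩ := Fn_lim h τ
  have e : (fun n => LL (Fs J σ s) (n + 1) τ - LL (Fs J σ s) n τ) = fun n => (Fn J σ s (n + 1) τ - Fn J σ s n τ) +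
      ∑ φ ∈ J, dl (τ * cφ σ φ) n + τ * f0 J σ s := by
    funext n
    rw [Finset.sum_congr rfl (fun φ hφ => (LL_saw_step (h.mem φ hφ) (mul_ne_zero hτ (cφ_ne h hφ)) n).symm), ← Fn_split]
    push_cast; ring
  rw [e]
  have h2 := (ht.comp (tendsto_add_atTop_nat 1)).sub ht
  rw [sub_self] at h2
  have h3 := tendsto_finsetSum J (fun φ hφ => dl_zero (mul_ne_zero hτ (cφ_ne h hφ)))
  rw [Finset.sum_const_zero] at h3
  simpa using (h2.add h3).add_const (τ * f0 J σ s)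

lemma LL_step_ge (h : Step J σ s) (hs : Sym (Fs J σ s)) {τ : ℝ} (hτ : τ ≠ 0) (n : ℕ) :
    τ * f0 J σ s ≤ LL (Fs J σ s) (n + 1) τ - LL (Fs J σ s) n τ :=
  (LL_anti (Fs_meas J σ s) (fun x _ => (Fs_abs h x).le) hs τ).le_of_tendsto (LL_step_lim h hτ) n

lemma BN_bound (h : Step J σ s) (hs : Sym (Fs J σ s)) {τ : ℝ} (hτ : τ ≠ 0) (N : ℕ) :
    0 ≤ BN J σ s τ N ∧ BN J σ s τ N ≤ ((N : ℝ) + 1) * (LL (Fs J σ s) (N + 1) τ - LL (Fs J σ s) N τ - τ * f0 J σ s) := by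
  have hanti := LL_anti (Fs_meas J σ s) (fun x _ => (Fs_abs h x).le) hs τ
  have e : ∀ k : ℕ, LL (Fs J σ s) (N + k) τ - LL (Fs J σ s) N τ - k * (τ * f0 J σ s) =
      ∑ i ∈ Finset.range k, (LL (Fs J σ s) (N + i + 1) τ - LL (Fs J σ s) (N + i) τ - τ * f0 J σ s) := by
    intro k
    induction k with
    | zero => simp
    | succ k ih => rw [Finset.sum_range_succ, ← ih]; push_cast; rw [← add_assoc]; ring
  have e2 := e (N + 1)
  rw [show N + (N + 1) = 2 * N + 1 by ring] at e2
  push_cast at e2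
  rw [BN, e2]
  constructor
  · refine Finset.sum_nonneg fun i _ => ?_
    linarith [LL_step_ge h hs hτ (N + i)]
  · have : ∀ i ∈ Finset.range (N + 1), LL (Fs J σ s) (N + i + 1) τ - LL (Fs J σ s) (N + i) τ - τ * f0 J σ s ≤
        LL (Fs J σ s) (N + 1) τ - LL (Fs J σ s) N τ - τ * f0 J σ s := by
      intro i _
      have := hanti (show N ≤ N + i by omega)
      simp only at this
      linarith
    refine (Finset.sum_le_card_nsmul _ _ _ this).trans (le_of_eq ?_)
    rw [Finset.card_range, nsmul_eq_mul]; push_cast; rfl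

end
end EE
end

noncomputable section
namespace EE
open MeasureTheory Set Filter Topology

lemma anti_key {c : ℤ → ℝ} {A : ℤ → ℝ} (hA : ∀ m, A (m + 1) - A m = c m)
    (hA' : ∀ m, A (1 - m) = - A m) {n : ℕ} (hn : 0 < n) {d : ℕ → ℝ}
    (hd : ∀ j < n, ∑ k ∈ Finset.range n, c ((j : ℤ) - k) * d k = if j = 0 then 1 else 0) :
    (∑ k ∈ Finset.range n, d k) * (∑ k ∈ Finset.range n, d k * A ((n : ℤ) - k)) = d 0 / 2 := by
  have tele : ∀ (k i : ℕ), i ≤ n → ∑ j ∈ Finset.Ico i n, c ((j : ℤ) - k) = A ((n : ℤ) - k) - A ((i : ℤ) - k) := by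
    intro k i hi
    rw [← Finset.sum_Ico_sub (fun j : ℕ => A ((j : ℤ) - k)) hi]
    refine Finset.sum_congr rfl fun j _ => ?_
    rw [← hA]; push_cast
    rw [show (j : ℤ) + 1 - k = j - k + 1 by ring]
  have h1 : ∀ i < n, ∑ k ∈ Finset.range n, d k * (A ((n : ℤ) - k) - A ((i : ℤ) - k)) = if i = 0 then 1 else 0 := by
    intro i hi
    have e1 : ∑ k ∈ Finset.range n, d k * (A ((n : ℤ) - k) - A ((i : ℤ) - k)) =
        ∑ j ∈ Finset.Ico i n, ∑ k ∈ Finset.range n, c ((j : ℤ) - k) * d k := by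
      rw [Finset.sum_comm]
      refine Finset.sum_congr rfl fun k _ => ?_
      rw [← Finset.sum_mul, tele k i hi.le]; ring
    rw [e1, Finset.sum_congr rfl (fun j hj => hd j (Finset.mem_Ico.1 hj).2)]
    by_cases h0 : i = 0
    · subst h0
      rw [Finset.sum_ite_eq' , if_pos (Finset.mem_Ico.2 ⟨le_rfl, hn⟩), if_pos rfl]
    · rw [Finset.sum_ite_eq', if_neg (fun h => h0 (by have := (Finset.mem_Ico.1 h).1; omega)), if_neg h0]
  have h2 : ∑ i ∈ Finset.range n, d i * ∑ k ∈ Finset.range n, d k * (A ((n : ℤ) - k) - A ((i : ℤ) - k)) = d 0 := by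
    rw [Finset.sum_congr rfl (fun i hi => by rw [h1 i (Finset.mem_range.1 hi)])]
    simp [hn.ne']
  have h3 : ∑ i ∈ Finset.range n, d i * ∑ k ∈ Finset.range n, d k * A ((i : ℤ) - k) = - (d 0 / 2) := by
    have e1 : ∑ i ∈ Finset.range n, d i * ∑ k ∈ Finset.range n, c ((i : ℤ) - k) * d k = d 0 := by
      rw [Finset.sum_congr rfl (fun i hi => by rw [hd i (Finset.mem_range.1 hi)])]
      simp [hn.ne']
    have e2 : ∑ i ∈ Finset.range n, d i * ∑ k ∈ Finset.range n, d k * A ((i : ℤ) - k) =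
        ∑ i ∈ Finset.range n, d i * ∑ k ∈ Finset.range n, d k * A ((k : ℤ) - i) := by
      simp_rw [Finset.mul_sum]
      rw [Finset.sum_comm]
      refine Finset.sum_congr rfl fun i _ => Finset.sum_congr rfl fun k _ => by ring
    have e3 : ∑ i ∈ Finset.range n, d i * ∑ k ∈ Finset.range n, d k * A ((i : ℤ) - k) +
        ∑ i ∈ Finset.range n, d i * ∑ k ∈ Finset.range n, d k * A ((k : ℤ) - i) = - d 0 := by
      rw [← e1, ← Finset.sum_add_distrib, ← Finset.sum_neg_distrib]
      refine Finset.sum_congr rfl fun i _ => ?_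
      rw [← mul_add, ← mul_neg, ← Finset.sum_add_distrib, ← Finset.sum_neg_distrib]
      congr 1
      refine Finset.sum_congr rfl fun k _ => ?_
      have := hA' ((i : ℤ) - k + 1)
      rw [show 1 - ((i : ℤ) - k + 1) = k - i by ring] at this
      rw [this, ← hA]; ring
    linarith
  have h4 : ∑ i ∈ Finset.range n, d i * ∑ k ∈ Finset.range n, d k * (A ((n : ℤ) - k) - A ((i : ℤ) - k)) =
      (∑ k ∈ Finset.range n, d k) * (∑ k ∈ Finset.range n, d k * A ((n : ℤ) - k)) -
      ∑ i ∈ Finset.range n, d i * ∑ k ∈ Finset.range n, d k * A ((i : ℤ) - k) := by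
    rw [Finset.sum_mul, ← Finset.sum_sub_distrib]
    refine Finset.sum_congr rfl fun i _ => ?_
    rw [← mul_sub, ← Finset.sum_sub_distrib]
    congr 1
    exact Finset.sum_congr rfl fun k _ => by ring
  linarith

/-- half partial sums -/
def Am (c : ℤ → ℝ) (ε : ℝ) (k : ℕ) : ℝ := c 0 / 2 + ∑ m ∈ Finset.Ico 1 k, ε ^ m * c m

lemma Am_succ (c : ℤ → ℝ) (ε : ℝ) {k : ℕ} (hk : 1 ≤ k) : Am c ε (k + 1) - Am c ε k = ε ^ k * c k := by
  rw [Am, Am, Finset.sum_Ico_succ_top hk]; ring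

lemma Am_one (c : ℤ → ℝ) (ε : ℝ) : Am c ε 1 = c 0 / 2 := by simp [Am]

lemma eps_pow {ε : ℝ} (hε : ε ^ 2 = 1) (j k : ℕ) : ε ^ ((j : ℤ) - k).natAbs * ε ^ k = ε ^ j := by
  rcases le_total k j with h | h
  · obtain ⟨i, rfl⟩ := Nat.exists_eq_add_of_le h
    rw [show ((k + i : ℕ) : ℤ) - k = i by push_cast; ring, Int.natAbs_natCast, pow_add, mul_comm]
  · obtain ⟨i, rfl⟩ := Nat.exists_eq_add_of_le h
    rw [show (j : ℤ) - ((j + i : ℕ) : ℤ) = -(i : ℤ) by push_cast; ring, Int.natAbs_neg, Int.natAbs_natCast, pow_add]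
    have : ε ^ i * ε ^ i = 1 := by rw [← mul_pow, ← pow_two, hε, one_pow]
    linear_combination ε ^ j * this

lemma XS_key {c : ℤ → ℝ} (hev : ∀ m, c (-m) = c m) {δ : ℝ} (hδ : 0 < δ) (h : Coer c δ) {ε : ℝ} (hε : ε ^ 2 = 1)
    {n : ℕ} (hn : 0 < n) :
    XS c ε n * (∑ k ∈ Finset.range n, ε ^ k * xs c n k * Am c ε (n - k)) = xs c n 0 / 2 := by
  set A : ℤ → ℝ := fun m => if 1 ≤ m then Am c ε m.toNat else - Am c ε (1 - m).toNat with hAd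
  set c' : ℤ → ℝ := fun m => ε ^ m.natAbs * c m with hc'
  have pos : ∀ k : ℕ, 1 ≤ k → A k = Am c ε k := by
    intro k hk
    simp only [hAd]
    rw [if_pos (by exact_mod_cast hk), Int.toNat_natCast]
  have neg : ∀ k : ℕ, 1 ≤ k → A (1 - (k : ℤ)) = - Am c ε k := by
    intro k hk
    simp only [hAd]
    rw [if_neg (by omega), show (1 - (1 - (k : ℤ))) = k by ring, Int.toNat_natCast]
  have hA : ∀ m, A (m + 1) - A m = c' m := by
    intro m
    rcases lt_trichotomy m 0 with hm | hm | hm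
    · obtain ⟨k, rfl⟩ : ∃ k : ℕ, m = -((k : ℤ) + 1) := ⟨(-m - 1).toNat, by omega⟩
      have e1 := neg (k + 1) (by omega)
      have e2 := neg (k + 2) (by omega)
      push_cast at e1 e2
      rw [show -((k : ℤ) + 1) + 1 = 1 - (k + 1) by ring, e1, show -((k : ℤ) + 1) = 1 - (k + 2) by ring, e2]
      have := Am_succ c ε (k := k + 1) (by omega)
      simp only [hc']
      rw [show (1 - ((k : ℤ) + 2)) = -((k + 1 : ℕ) : ℤ) by push_cast; ring, hev, Int.natAbs_neg, Int.natAbs_natCast, ← this]; ring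
    · subst hm
      have e1 := pos 1 le_rfl
      have e2 := neg 1 le_rfl
      norm_num at e1 e2
      rw [zero_add, e1, e2, Am_one]
      simp [hc']
    · obtain ⟨k, rfl⟩ : ∃ k : ℕ, m = (k : ℤ) := ⟨m.toNat, by omega⟩
      have hk : 1 ≤ k := by omega
      have := pos (k + 1) (by omega)
      push_cast at this
      rw [this, pos k hk, Am_succ c ε hk]
      simp only [hc', Int.natAbs_natCast]
  have hA' : ∀ m, A (1 - m) = - A m := by
    intro m
    by_cases hm : 1 ≤ m
    · obtain ⟨k, rfl⟩ : ∃ k : ℕ, m = (k : ℤ) := ⟨m.toNat, by omega⟩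
      have hk : 1 ≤ k := by omega
      rw [neg k hk, pos k hk]
    · obtain ⟨k, rfl⟩ : ∃ k : ℕ, m = 1 - (k : ℤ) := ⟨(1 - m).toNat, by omega⟩
      have hk : 1 ≤ k := by omega
      rw [show 1 - (1 - (k : ℤ)) = k by ring, neg k hk, pos k hk, neg_neg]
  have hd : ∀ j < n, ∑ k ∈ Finset.range n, c' ((j : ℤ) - k) * (ε ^ k * xs c n k) = if j = 0 then 1 else 0 := by
    intro j hj
    have := xs_eq hev hδ h hj
    have e : ∀ k ∈ Finset.range n, c' ((j : ℤ) - k) * (ε ^ k * xs c n k) = ε ^ j * (c ((j : ℤ) - k) * xs c n k) := by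
      intro k _
      simp only [hc']
      rw [← eps_pow hε j k]; ring
    rw [Finset.sum_congr rfl e, ← Finset.mul_sum, this]
    split_ifs with h0
    · rw [h0]; simp
    · simp
  have := anti_key hA hA' hn hd
  rw [pow_zero, one_mul] at this
  rw [← this, XS]
  congr 1
  refine Finset.sum_congr rfl fun k hk => ?_
  have hk := Finset.mem_range.1 hk
  rw [← pos (n - k) (by omega), Nat.cast_sub hk.le]

lemma xs_diff {c : ℤ → ℝ} (hev : ∀ m, c (-m) = c m) {δ : ℝ} (hδ : 0 < δ) (h : Coer c δ) {m n : ℕ} (hm : 0 < m) (hmn : m ≤ n) :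
    QF c n (fun k => xs c n k - xs c m k) = xs c n 0 - xs c m 0 := by
  set t : ℕ → ℝ := fun j => ∑ k ∈ Finset.range n, c ((j : ℤ) - k) * xs c m k with ht
  have t1 : ∀ j < m, t j = if j = 0 then 1 else 0 := by
    intro j hj
    rw [← xs_eq hev hδ h hj]
    simp only [ht]
    symm
    refine Finset.sum_subset (Finset.range_mono hmn) fun k _ hk => ?_
    rw [xs_zero_of_le c (by simpa using hk), mul_zero]
  have a1 : ∑ j ∈ Finset.range n, xs c m j * t j = xs c m 0 := by
    have : ∀ j ∈ Finset.range n, xs c m j * t j = if j = 0 then xs c m 0 else 0 := by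
      intro j _
      by_cases hj : j < m
      · rw [t1 j hj]; split_ifs with h0
        · rw [h0, mul_one]
        · rw [mul_zero]
      · rw [xs_zero_of_le c (by omega), zero_mul, if_neg (by omega)]
    rw [Finset.sum_congr rfl this, Finset.sum_ite_eq', if_pos (Finset.mem_range.2 (by omega))]
  have a2 : ∑ j ∈ Finset.range n, xs c n j * t j = xs c m 0 := by
    simp only [ht, Finset.mul_sum]
    rw [Finset.sum_comm]
    have : ∀ k ∈ Finset.range n, ∑ j ∈ Finset.range n, xs c n j * (c ((j : ℤ) - k) * xs c m k) = if k = 0 then xs c m 0 else 0 := by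
      intro k hk
      have := xs_eq hev hδ h (Finset.mem_range.1 hk)
      rw [Finset.sum_congr rfl (g := fun j : ℕ => xs c m k * (c ((k : ℤ) - (j : ℤ)) * xs c n j)) (fun j _ => by
        rw [← hev, neg_sub]; ring), ← Finset.mul_sum, this]
      split_ifs with h0
      · rw [h0, mul_one]
      · rw [mul_zero]
    rw [Finset.sum_congr rfl this, Finset.sum_ite_eq', if_pos (Finset.mem_range.2 (by omega))]
  have a3 : ∑ j ∈ Finset.range n, (xs c n j - xs c m j) * (if j = 0 then (1 : ℝ) else 0) = xs c n 0 - xs c m 0 := by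
    simp only [mul_ite, mul_one, mul_zero]
    rw [Finset.sum_ite_eq', if_pos (Finset.mem_range.2 (by omega))]
  have : QF c n (fun k => xs c n k - xs c m k) = ∑ j ∈ Finset.range n, (xs c n j - xs c m j) * ((if j = 0 then (1 : ℝ) else 0) - t j) := by
    unfold QF
    refine Finset.sum_congr rfl fun j hj => ?_
    rw [← xs_eq hev hδ h (Finset.mem_range.1 hj)]
    simp only [ht]
    rw [← Finset.sum_sub_distrib]
    congr 1
    exact Finset.sum_congr rfl fun k _ => by ring
  rw [this]
  have e : ∀ j ∈ Finset.range n, (xs c n j - xs c m j) * ((if j = 0 then (1 : ℝ) else 0) - t j) =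
     (xs c n j - xs c m j) * (if j = 0 then (1 : ℝ) else 0) - xs c n j * t j + xs c m j * t j := fun j _ => by ring
  rw [Finset.sum_congr rfl e, Finset.sum_add_distrib, Finset.sum_sub_distrib, a1, a2, a3]; ring

end EE
end

noncomputable section
namespace EE
open MeasureTheory Set Filter Topology

/-- partial sums of the sawtooth series -/
def gk (k : ℕ) (t : ℝ) : ℝ := ∑ m ∈ Finset.range k, Real.sin ((m + 1 : ℝ) * t) / (m + 1)

lemma dirichlet (k : ℕ) (t : ℝ) : (1 / 2 + ∑ m ∈ Finset.range k, Real.cos ((m + 1 : ℝ) * t)) * (2 * Real.sin (t / 2)) =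
    Real.sin ((k + 1 / 2) * t) := by
  induction k with
  | zero => simp only [Finset.range_zero, Finset.sum_empty]; push_cast; ring_nf
  | succ k ih =>
    rw [Finset.sum_range_succ, ← add_assoc, add_mul, ih]
    push_cast
    have e1 : ((k : ℝ) + 1 + 1 / 2) * t = (k + 1) * t + t / 2 := by ring
    have e2 : ((k : ℝ) + 1 / 2) * t = (k + 1) * t - t / 2 := by ring
    rw [e1, e2, Real.sin_add, Real.sin_sub]; ring

lemma gk_rate {φ : ℝ} (hφ : φ ∈ Ioo 0 (2 * Real.pi)) : ∃ C, 0 ≤ C ∧ ∀ k : ℕ, |gk k φ - (Real.pi - φ) / 2| ≤ C / (k + 1) := by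
  have hs0 : 0 < Real.sin (φ / 2) := Real.sin_pos_of_pos_of_lt_pi (by linarith [hφ.1]) (by linarith [hφ.2])
  set s0 := Real.sin (φ / 2) with hs0d
  have hmin : ∀ t ∈ uIcc φ Real.pi, s0 ≤ Real.sin (t / 2) := by
    intro t ht
    rcases le_total φ Real.pi with h | h
    · rw [uIcc_of_le h] at ht
      exact Real.sin_le_sin_of_le_of_le_pi_div_two (by linarith [hφ.1, Real.pi_pos]) (by linarith [ht.2]) (by linarith [ht.1])
    · rw [uIcc_of_ge h] at ht
      rw [hs0d, ← Real.sin_pi_sub (φ / 2), ← Real.sin_pi_sub (t / 2)]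
      exact Real.sin_le_sin_of_le_of_le_pi_div_two (by linarith [hφ.2, Real.pi_pos]) (by linarith [ht.1]) (by linarith [ht.2])
  refine ⟨Real.pi / (2 * s0 ^ 2) + 1 / s0, by positivity, fun k => ?_⟩
  set E : ℝ → ℝ := fun t => gk k t - (Real.pi - t) / 2 + Real.cos ((k + 1 / 2) * t) / ((2 * k + 1) * Real.sin (t / 2)) with hE
  set E' : ℝ → ℝ := fun t => - (Real.cos ((k + 1 / 2) * t) * Real.cos (t / 2)) / (2 * (2 * k + 1) * Real.sin (t / 2) ^ 2) with hE'
  have hd : ∀ t ∈ uIcc φ Real.pi, HasDerivWithinAt E (E' t) (uIcc φ Real.pi) t := by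
    intro t ht
    have hst : 0 < Real.sin (t / 2) := hs0.trans_le (hmin t ht)
    have d1 : HasDerivAt (gk k) (∑ m ∈ Finset.range k, Real.cos ((m + 1 : ℝ) * t)) t := by
      unfold gk
      refine (HasDerivAt.fun_sum (u := Finset.range k) (A := fun (m : ℕ) t => Real.sin ((m + 1 : ℝ) * t) / (m + 1)) (A' := fun m => Real.cos ((m + 1 : ℝ) * t)) fun m _ => ?_)
      have := (((hasDerivAt_id t).const_mul ((m : ℝ) + 1)).sin).div_const ((m : ℝ) + 1)
      refine this.congr_deriv ?_
      have : (m : ℝ) + 1 ≠ 0 := by positivity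
      simp only [id]
      field_simp
    have d2 : HasDerivAt (fun t : ℝ => (Real.pi - t) / 2) (-1 / 2) t := by
      simpa using ((hasDerivAt_id t).const_sub Real.pi).div_const 2
    have d3 : HasDerivAt (fun t : ℝ => Real.cos ((k + 1 / 2) * t)) (-Real.sin ((k + 1 / 2) * t) * (k + 1 / 2)) t := by
      simpa using ((hasDerivAt_id t).const_mul ((k : ℝ) + 1 / 2)).cos
    have d4 : HasDerivAt (fun t : ℝ => (2 * k + 1) * Real.sin (t / 2)) ((2 * k + 1) * (Real.cos (t / 2) * (1 / 2))) t := by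
      simpa using ((((hasDerivAt_id t).div_const 2).sin).const_mul ((2 : ℝ) * k + 1))
    have hk : (2 * (k : ℝ) + 1) ≠ 0 := by positivity
    have d := (d1.sub d2).add (d3.div d4 (mul_ne_zero hk hst.ne'))
    refine (d.congr_deriv ?_).hasDerivWithinAt
    have hD := dirichlet k t
    rw [← hD]
    simp only [hE']
    have := hst.ne'
    generalize ∑ m ∈ Finset.range k, Real.cos ((m + 1 : ℝ) * t) = D
    field_simp
    ring
  have hb : ∀ t ∈ uIcc φ Real.pi, ‖E' t‖ ≤ 1 / (2 * (2 * k + 1) * s0 ^ 2) := by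
    intro t ht
    have hst := hmin t ht
    have h2 : 0 < Real.sin (t / 2) := hs0.trans_le hst
    simp only [hE']
    rw [norm_div, norm_neg, norm_mul, Real.norm_eq_abs, Real.norm_eq_abs, Real.norm_eq_abs, abs_of_pos (a := 2 * (2 * (k : ℝ) + 1) * Real.sin (t / 2) ^ 2) (by positivity)]
    have h3 : |Real.cos ((k + 1 / 2) * t)| * |Real.cos (t / 2)| ≤ 1 :=
      mul_le_one₀ (Real.abs_cos_le_one _) (abs_nonneg _) (Real.abs_cos_le_one _)
    gcongr
  have hmv := (convex_uIcc φ Real.pi).norm_image_sub_le_of_norm_hasDerivWithin_le hd hb left_mem_uIcc right_mem_uIcc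
  have hEpi : E Real.pi = 0 := by
    simp only [hE]
    have e1 : gk k Real.pi = 0 := by
      unfold gk
      refine Finset.sum_eq_zero fun m _ => ?_
      have := Real.sin_nat_mul_pi (m + 1)
      push_cast at this
      rw [this, zero_div]
    have e2 : Real.cos ((k + 1 / 2) * Real.pi) = 0 := by
      rw [show ((k : ℝ) + 1 / 2) * Real.pi = k * Real.pi + Real.pi / 2 by ring, Real.cos_add_pi_div_two, Real.sin_nat_mul_pi, neg_zero]
    rw [e1, e2]; simp
  rw [hEpi, zero_sub, norm_neg, Real.norm_eq_abs, Real.norm_eq_abs] at hmv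
  have hpi : |Real.pi - φ| ≤ Real.pi := by rw [abs_le]; constructor <;> linarith [hφ.1, hφ.2]
  have hF : gk k φ - (Real.pi - φ) / 2 = E φ - Real.cos ((k + 1 / 2) * φ) / ((2 * k + 1) * s0) := by simp only [hE]; ring
  have hc : |Real.cos ((k + 1 / 2) * φ) / ((2 * k + 1) * s0)| ≤ 1 / ((2 * k + 1) * s0) := by
    rw [abs_div, abs_of_pos (a := (2 * (k : ℝ) + 1) * s0) (by positivity)]
    have := Real.abs_cos_le_one ((k + 1 / 2) * φ)
    gcongr
  rw [hF]
  refine (abs_sub _ _).trans ?_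
  have h1 : |E φ| ≤ 1 / (2 * (2 * k + 1) * s0 ^ 2) * Real.pi := hmv.trans (by gcongr)
  have h2 : 1 / (2 * (2 * k + 1) * s0 ^ 2) * Real.pi = Real.pi / (2 * s0 ^ 2) / (2 * k + 1) := by field_simp
  have h3 : 1 / ((2 * (k : ℝ) + 1) * s0) = 1 / s0 / (2 * k + 1) := by field_simp
  rw [h2] at h1; rw [h3] at hc
  have h4 : (Real.pi / (2 * s0 ^ 2) + 1 / s0) / (2 * k + 1) ≤ (Real.pi / (2 * s0 ^ 2) + 1 / s0) / (k + 1) := by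
    gcongr; linarith [(Nat.cast_nonneg k : (0 : ℝ) ≤ k)]
  rw [add_div] at h4
  linarith

lemma hv_adm (φ : ℝ) : Adm (fun x => (hv φ x : ℂ)) :=
  re_adm (hv_meas φ) (B := 1) (fun x _ => by rw [abs_of_nonneg (hv_nonneg φ x)]; exact hv_le φ x)

lemma cf_hv0 {φ : ℝ} (hφ : φ ∈ Ioo 0 (2 * Real.pi)) : cf (fun x => (hv φ x : ℂ)) 0 = ((2 * Real.pi - φ) / (2 * Real.pi) : ℝ) := by
  unfold cf
  have e : ∫ t in (0 : ℝ)..(2 * Real.pi), (hv φ t : ℂ) * Complex.exp (-Complex.I * ((0 : ℤ) : ℂ) * (t : ℂ)) = ((2 * Real.pi - φ : ℝ) : ℂ) := by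
    have e1 : ∫ t in (0 : ℝ)..(2 * Real.pi), (hv φ t : ℂ) * Complex.exp (-Complex.I * ((0 : ℤ) : ℂ) * (t : ℂ)) =
        ∫ t in (0 : ℝ)..(2 * Real.pi), (hv φ t : ℂ) := intervalIntegral.integral_congr fun t _ => by simp
    rw [e1, intervalIntegral.integral_of_le (by positivity)]
    have e2 : ∀ t, (hv φ t : ℂ) = (Ioi φ).indicator (fun _ => (1 : ℂ)) t := by
      intro t; unfold hv; by_cases h : φ < t <;> simp [h]
    simp_rw [e2]
    rw [setIntegral_indicator measurableSet_Ioi]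
    have : Ioc 0 (2 * Real.pi) ∩ Ioi φ = Ioc φ (2 * Real.pi) := by
      ext x; simp only [mem_inter_iff, mem_Ioc, mem_Ioi]
      constructor
      · rintro ⟨⟨_, h⟩, h'⟩; exact ⟨h', h⟩
      · rintro ⟨h, h'⟩; exact ⟨⟨hφ.1.trans h, h'⟩, h⟩
    rw [this, setIntegral_const, measureReal_def, Real.volume_Ioc, ENNReal.toReal_ofReal (by linarith [hφ.2])]
    simp
  rw [e]; push_cast; field_simp

lemma cf_hv {φ : ℝ} (hφ : φ ∈ Ioo 0 (2 * Real.pi)) {n : ℤ} (hn : n ≠ 0) : (cf (fun x => (hv φ x : ℂ)) n).re = - Real.sin (n * φ) / (2 * Real.pi * n) := by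
  unfold cf
  have hν : -Complex.I * (n : ℂ) ≠ 0 := by simp [hn]
  rw [int_hv hν hφ]
  have e1 : Complex.exp (-Complex.I * (n : ℂ) * ((2 * Real.pi : ℝ) : ℂ)) = 1 := by
    have := exp_2pi 0 n
    simpa using this
  have e2 : Complex.exp (-Complex.I * (n : ℂ) * φ) = Complex.cos (n * φ : ℝ) - Complex.sin (n * φ : ℝ) * Complex.I := by
    rw [show -Complex.I * (n : ℂ) * φ = (-((n * φ : ℝ) : ℂ)) * Complex.I by push_cast; ring, Complex.exp_mul_I, Complex.cos_neg, Complex.sin_neg]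
    ring
  rw [e1, e2, ← Complex.ofReal_cos, ← Complex.ofReal_sin]
  have hn' : (n : ℂ) ≠ 0 := by exact_mod_cast hn
  have hpi : (Real.pi : ℂ) ≠ 0 := by exact_mod_cast Real.pi_ne_zero
  have : (1 / (2 * Real.pi) : ℂ) * ((1 - (((Real.cos (n * φ) : ℝ) : ℂ) - (Real.sin (n * φ) : ℝ) * Complex.I)) / (-Complex.I * n)) =
     ((- Real.sin (n * φ) / (2 * Real.pi * n) : ℝ) : ℂ) + ((1 - Real.cos (n * φ)) / (2 * Real.pi * n) : ℝ) * Complex.I := by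
    push_cast
    field_simp
    ring_nf
    rw [Complex.I_sq]; ring
  rw [this, Complex.add_re, Complex.ofReal_re, Complex.re_ofReal_mul, Complex.I_re, mul_zero, add_zero]

section
variable {J : Finset ℝ} {σ : ℝ → ℝ} {s : ℝ}

lemma rc_Fs (n : ℤ) : rc (Fs J σ s) n = (if n = 0 then s else 0) + 2 * ∑ φ ∈ J, σ φ * (cf (fun x => (hv φ x : ℂ)) n).re := by
  have e : (fun x => (Fs J σ s x : ℂ)) = fun x => (s : ℂ) + (∑ φ ∈ J, (2 * σ φ : ℂ) * (hv φ x : ℂ)) := by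
    funext x
    rw [Fs]; push_cast
    rw [Finset.mul_sum]
    simp only [mul_assoc]
  have ha : ∀ φ ∈ J, Adm (fun x => (2 * σ φ : ℂ) * (hv φ x : ℂ)) := fun φ _ => (adm_const _).mul (hv_adm φ)
  have hsum : Adm (fun x => ∑ φ ∈ J, (2 * σ φ : ℂ) * (hv φ x : ℂ)) := by
    clear e
    revert ha
    refine Finset.induction_on J ?_ ?_
    · intro _; simpa using adm_const 0
    · intro a S haS ih h
      have := (h a (Finset.mem_insert_self a S)).add (ih fun φ hφ => h φ (Finset.mem_insert_of_mem hφ))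
      refine Eq.mpr (congrArg Adm (funext fun x => ?_)) this
      rw [Finset.sum_insert haS]
  rw [rc, e, cf_add (adm_const _) hsum, cf_const, cf_sum _ _ ha, Complex.add_re, Complex.re_sum, Finset.mul_sum]
  congr 1
  · split_ifs <;> simp
  · refine Finset.sum_congr rfl fun φ _ => ?_
    rw [cf_smul, show (2 * σ φ : ℂ) = ((2 * σ φ : ℝ) : ℂ) by push_cast; ring, Complex.re_ofReal_mul]; ring

lemma rc_Fs0 (h : Step J σ s) : rc (Fs J σ s) 0 = f0 J σ s := by
  rw [rc_Fs, if_pos rfl, f0, Finset.mul_sum]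
  congr 1
  have e : ∀ φ ∈ J, 2 * (σ φ * (cf (fun x => (hv φ x : ℂ)) 0).re) = 2 * σ φ + (-σ φ / Real.pi) * φ := by
    intro φ hφ
    rw [cf_hv0 (h.mem φ hφ), Complex.ofReal_re]
    have := Real.pi_ne_zero
    field_simp; ring
  rw [Finset.sum_congr rfl e, Finset.sum_add_distrib, ← Finset.mul_sum, h.sum0]; ring

lemma rc_Fsn (h : Step J σ s) {n : ℤ} (hn : n ≠ 0) : rc (Fs J σ s) n = - (1 / Real.pi) * ∑ φ ∈ J, σ φ * (Real.sin (n * φ) / n) := by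
  rw [rc_Fs, if_neg hn, zero_add, Finset.mul_sum, Finset.mul_sum]
  refine Finset.sum_congr rfl fun φ hφ => ?_
  rw [cf_hv (h.mem φ hφ) hn]
  have := Real.pi_ne_zero
  have : (n : ℝ) ≠ 0 := by exact_mod_cast hn
  field_simp

lemma rc_Fs_bound (h : Step J σ s) {n : ℕ} (hn : 1 ≤ n) : |rc (Fs J σ s) n| ≤ J.card / n := by
  rw [rc_Fsn h (by omega), abs_mul, abs_neg, abs_of_pos (by positivity)]
  have h1 : |∑ φ ∈ J, σ φ * (Real.sin (((n : ℤ) : ℝ) * φ) / ((n : ℤ) : ℝ))| ≤ ∑ φ ∈ J, 1 / (n : ℝ) := by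
    refine (Finset.abs_sum_le_sum_abs _ _).trans (Finset.sum_le_sum fun φ hφ => ?_)
    have : |σ φ| = 1 := by
      rcases sq_eq_one_iff' (h.sq φ hφ) with h | h <;> rw [h] <;> norm_num
    rw [abs_mul, this, one_mul, abs_div]
    push_cast
    rw [Nat.abs_cast]
    have := Real.abs_sin_le_one (n * φ)
    gcongr
  rw [Finset.sum_const, nsmul_eq_mul] at h1
  have h3 : 1 / Real.pi ≤ 1 := by rw [div_le_one Real.pi_pos]; linarith [Real.pi_gt_three]
  calc _ ≤ 1 * (J.card * (1 / (n : ℝ))) := by gcongr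
    _ = _ := by ring

lemma Am_rate (h : Step J σ s) {ε : ℝ} (χ : ℝ → ℝ) (hχ : ∀ φ ∈ J, χ φ ∈ Ioo 0 (2 * Real.pi))
    (hχ2 : ∀ φ ∈ J, ∀ m : ℕ, ε ^ m * Real.sin (m * φ) = Real.sin (m * χ φ)) :
    ∃ C, 0 ≤ C ∧ ∀ k : ℕ, 1 ≤ k → |Am (rc (Fs J σ s)) ε k - (f0 J σ s + (1 / Real.pi) * ∑ φ ∈ J, σ φ * χ φ) / 2| ≤ C / k := by
  choose! Cf hC0 hC using fun φ (hφ : φ ∈ J) => gk_rate (hχ φ hφ)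
  refine ⟨∑ φ ∈ J, Cf φ, Finset.sum_nonneg hC0, fun k hk => ?_⟩
  obtain ⟨j, rfl⟩ : ∃ j, k = j + 1 := ⟨k - 1, by omega⟩
  have e1 : Am (rc (Fs J σ s)) ε (j + 1) = f0 J σ s / 2 - (1 / Real.pi) * ∑ φ ∈ J, σ φ * gk j (χ φ) := by
    rw [Am, rc_Fs0 h, Finset.sum_Ico_eq_sum_range, add_tsub_cancel_right, sub_eq_add_neg]
    congr 1
    rw [Finset.sum_congr rfl (g := fun m : ℕ => ∑ φ ∈ J, -(1 / Real.pi) * (σ φ * (Real.sin ((m + 1 : ℝ) * χ φ) / (m + 1)))), Finset.sum_comm]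
    · rw [← neg_mul, Finset.mul_sum]
      refine Finset.sum_congr rfl fun φ _ => ?_
      rw [gk, Finset.mul_sum, Finset.mul_sum]
    · intro m _
      rw [rc_Fsn h (by omega), Finset.mul_sum, Finset.mul_sum]
      refine Finset.sum_congr rfl fun φ hφ => ?_
      have := hχ2 φ hφ (1 + m)
      push_cast at this ⊢
      rw [add_comm (m : ℝ) 1, ← this]; ring
  have e2 : Am (rc (Fs J σ s)) ε (j + 1) - (f0 J σ s + (1 / Real.pi) * ∑ φ ∈ J, σ φ * χ φ) / 2 =
      - (1 / Real.pi) * ∑ φ ∈ J, σ φ * (gk j (χ φ) - (Real.pi - χ φ) / 2) := by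
    have : ∑ φ ∈ J, σ φ * (gk j (χ φ) - (Real.pi - χ φ) / 2) = ∑ φ ∈ J, σ φ * gk j (χ φ) - (Real.pi / 2) * ∑ φ ∈ J, σ φ + (1 / 2) * ∑ φ ∈ J, σ φ * χ φ := by
      rw [Finset.mul_sum, Finset.mul_sum, ← Finset.sum_sub_distrib, ← Finset.sum_add_distrib]
      exact Finset.sum_congr rfl fun φ _ => by ring
    rw [e1, this, h.sum0]; ring
  rw [e2, abs_mul, abs_neg, abs_of_pos (by positivity)]
  have h3 : 1 / Real.pi ≤ 1 := by rw [div_le_one Real.pi_pos]; linarith [Real.pi_gt_three]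
  have h1 : |∑ φ ∈ J, σ φ * (gk j (χ φ) - (Real.pi - χ φ) / 2)| ≤ ∑ φ ∈ J, Cf φ / (j + 1) := by
    refine (Finset.abs_sum_le_sum_abs _ _).trans (Finset.sum_le_sum fun φ hφ => ?_)
    have : |σ φ| = 1 := by
      rcases sq_eq_one_iff' (h.sq φ hφ) with h | h <;> rw [h] <;> norm_num
    rw [abs_mul, this, one_mul]
    exact hC φ hφ j
  rw [← Finset.sum_div] at h1
  push_cast
  calc _ ≤ 1 * ((∑ φ ∈ J, Cf φ) / (j + 1)) := by gcongr
    _ = _ := one_mul _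

/-- The two boundary values -/
lemma Am_rate_one (h : Step J σ s) : ∃ C, 0 ≤ C ∧ ∀ k : ℕ, 1 ≤ k → |Am (rc (Fs J σ s)) 1 k - s / 2| ≤ C / k := by
  obtain ⟨C, h0, hC⟩ := Am_rate h (ε := 1) id (fun φ hφ => h.mem φ hφ) (fun φ _ m => by simp)
  refine ⟨C, h0, fun k hk => ?_⟩
  have e : f0 J σ s + (1 / Real.pi) * ∑ φ ∈ J, σ φ * id φ = s := by
    rw [f0, Finset.mul_sum, add_assoc, ← Finset.sum_add_distrib, Finset.sum_eq_zero, add_zero]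
    intro φ _
    simp only [id]; ring
  have := hC k hk
  rwa [e] at this

lemma Am_rate_neg (h : Step J σ s) (hpi : Real.pi ∉ J) : ∃ C, 0 ≤ C ∧ ∀ k : ℕ, 1 ≤ k → |Am (rc (Fs J σ s)) (-1) k - Fs J σ s Real.pi / 2| ≤ C / k := by
  have hm : ∀ φ ∈ J, φ < Real.pi ∨ Real.pi < φ := fun φ hφ => lt_or_gt_of_ne (fun e => hpi (e ▸ hφ))
  obtain ⟨C, h0, hC⟩ := Am_rate h (ε := -1) (fun φ => if φ < Real.pi then φ + Real.pi else φ - Real.pi) (fun φ hφ => by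
      have h1 := h.mem φ hφ
      rcases hm φ hφ with h2 | h2
      · simp only [if_pos h2]; exact ⟨by linarith [h1.1, Real.pi_pos], by linarith⟩
      · simp only [if_neg (not_lt.2 h2.le)]; exact ⟨by linarith, by linarith [h1.2, Real.pi_pos]⟩) (fun φ hφ m => by
      rcases hm φ hφ with h2 | h2
      · simp only [if_pos h2]
        rw [mul_add, Real.sin_add_nat_mul_pi]
      · simp only [if_neg (not_lt.2 h2.le)]
        rw [mul_sub, Real.sin_sub_nat_mul_pi])
  refine ⟨C, h0, fun k hk => ?_⟩
  have e : f0 J σ s + (1 / Real.pi) * ∑ φ ∈ J, σ φ * (if φ < Real.pi then φ + Real.pi else φ - Real.pi) = Fs J σ s Real.pi := by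
    have e1 : ∀ φ ∈ J, (-σ φ / Real.pi) * φ + (1 / Real.pi) * (σ φ * (if φ < Real.pi then φ + Real.pi else φ - Real.pi)) = 2 * (σ φ * hv φ Real.pi) - σ φ := by
      intro φ hφ
      have := Real.pi_ne_zero
      rcases hm φ hφ with h2 | h2
      · rw [if_pos h2, hv, if_pos h2]; field_simp; ring
      · rw [if_neg (not_lt.2 h2.le), hv, if_neg (not_lt.2 h2.le)]; field_simp; ring
    rw [f0, Finset.mul_sum, add_assoc, ← Finset.sum_add_distrib, Finset.sum_congr rfl e1, Finset.sum_sub_distrib, h.sum0, Fs, Finset.mul_sum, sub_zero]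
  have := hC k hk
  rwa [e] at this

end
end EE
end

noncomputable section
namespace EE
open MeasureTheory Set Filter Topology

lemma arsinh_lip (a b : ℝ) : |Real.arsinh a - Real.arsinh b| ≤ |a - b| := by
  have := (convex_univ (E := ℝ) (𝕜 := ℝ)).norm_image_sub_le_of_norm_hasDerivWithin_le (f := Real.arsinh) (C := 1)
    (fun x _ => (Real.hasDerivAt_arsinh x).hasDerivWithinAt) (fun x _ => by
      rw [norm_inv, Real.norm_eq_abs, abs_of_nonneg (Real.sqrt_nonneg _)]
      refine inv_le_one_of_one_le₀ ?_
      rw [Real.one_le_sqrt]; nlinarith [sq_nonneg x]) (mem_univ b) (mem_univ a)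
  simpa [Real.norm_eq_abs] using this

lemma arsinh_add_le (a b : ℝ) : |Real.arsinh a + Real.arsinh b| ≤ |a + b| := by
  have := arsinh_lip a (-b)
  rwa [Real.arsinh_neg, sub_neg_eq_add, sub_neg_eq_add] at this

lemma arsinh_big {b τ U : ℝ} (hτ : 0 ≤ τ) (hU : 0 ≤ U) (hb : |b| ≤ U * Real.exp (2 * τ)) :
    |Real.arsinh b| ≤ 2 * τ + Real.log (2 * U + 1) := by
  set A := 2 * τ + Real.log (2 * U + 1) with hA
  have hA0 : 0 ≤ A := add_nonneg (by positivity) (Real.log_nonneg (by linarith))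
  have h1 : U * Real.exp (2 * τ) ≤ Real.sinh A := by
    rw [Real.sinh_eq, hA, Real.exp_add, Real.exp_log (by positivity)]
    have h2 : Real.exp (-(2 * τ + Real.log (2 * U + 1))) ≤ 1 := Real.exp_le_one_iff.2 (by linarith)
    have h3 : 1 ≤ Real.exp (2 * τ) := Real.one_le_exp (by positivity)
    nlinarith
  rw [abs_le]
  have h4 := abs_le.1 (hb.trans h1)
  constructor
  · rw [← Real.arsinh_sinh A, ← Real.arsinh_neg]; exact Real.arsinh_le_arsinh.2 h4.1
  · rw [← Real.arsinh_sinh A]; exact Real.arsinh_le_arsinh.2 h4.2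

lemma arsinh_quad {p b : ℝ} (hp : 0 < p) (h : p * (p / 2 - b) = 1 / 2) : Real.log p = Real.arsinh b := by
  have : Real.sqrt (1 + b ^ 2) = p - b := by
    rw [Real.sqrt_eq_iff_mul_self_eq_of_pos]
    · nlinarith
    · nlinarith
  rw [Real.arsinh, this]; congr 1; ring

lemma exp_sq_one {l : ℝ} (hl : l ^ 2 = 1) (τ : ℝ) : Real.exp (τ * l) ≤ Real.exp |τ| := by
  have : |l| ≤ 1 := by
    rcases sq_eq_one_iff' hl with h | h <;> rw [h] <;> norm_num
  have := exp_bd (τ := τ) this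
  rwa [mul_one] at this

section
variable {J : Finset ℝ} {σ : ℝ → ℝ} {s : ℝ}

lemma Fs_adm (h : Step J σ s) : Adm (fun x => (Fs J σ s x : ℂ)) :=
  re_adm (Fs_meas J σ s) (B := 1) (fun x _ => (Fs_abs h x).le)

lemma wc_eq (h : Step J σ s) (τ : ℝ) (m : ℤ) : wc (Fs J σ s) τ m = (if m = 0 then Real.cosh τ else 0) + Real.sinh τ * rc (Fs J σ s) m := by
  have e : (fun x => ((Real.exp (τ * Fs J σ s x) : ℝ) : ℂ)) = fun x => (Real.cosh τ : ℂ) + (Real.sinh τ : ℂ) * (Fs J σ s x : ℂ) := by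
    funext x
    rw [exp_of_sq (h.val x)]; push_cast; ring
  rw [wc, rc, e, cf_add (adm_const _) ((adm_const _).mul (Fs_adm h)), cf_const, cf_smul, Complex.add_re, Complex.re_ofReal_mul, rc]
  congr 1
  split_ifs <;> simp

lemma Am_wc (h : Step J σ s) (τ ε : ℝ) (k : ℕ) : Am (wc (Fs J σ s) τ) ε k = Real.cosh τ / 2 + Real.sinh τ * Am (rc (Fs J σ s)) ε k := by
  rw [Am, Am, wc_eq h, if_pos rfl, mul_add, Finset.mul_sum]
  rw [Finset.sum_congr rfl (g := fun m : ℕ => Real.sinh τ * (ε ^ m * rc (Fs J σ s) m))]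
  · ring
  · intro m hm
    have := (Finset.mem_Ico.1 hm).1
    rw [wc_eq h, if_neg (by omega)]; ring

/-- deviation of the partial sums -/
def uh (J : Finset ℝ) (σ : ℝ → ℝ) (s ε l : ℝ) (k : ℕ) : ℝ := Am (rc (Fs J σ s)) ε k - l / 2

/-- pairing with the solution vector -/
def Bs (J : Finset ℝ) (σ : ℝ → ℝ) (s ε l τ : ℝ) (n : ℕ) : ℝ :=
  ∑ k ∈ Finset.range n, ε ^ k * xs (wc (Fs J σ s) τ) n k * uh J σ s ε l (n - k)

/-- normalising factor -/
def kp (J : Finset ℝ) (σ : ℝ → ℝ) (s l τ : ℝ) (n : ℕ) : ℝ := Real.exp (-(τ * l / 2)) / Real.sqrt (xs (wc (Fs J σ s) τ) n 0)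

/-- argument of arsinh -/
def bb (J : Finset ℝ) (σ : ℝ → ℝ) (s ε l τ : ℝ) (n : ℕ) : ℝ := - (kp J σ s l τ n * Real.sinh τ * Bs J σ s ε l τ n)

lemma wco (h : Step J σ s) (hs : Sym (Fs J σ s)) (τ : ℝ) : Coer (wc (Fs J σ s) τ) (Real.exp (-|τ|)) := by
  have := wc_coer (Fs_meas J σ s) (B := 1) (fun x _ => (Fs_abs h x).le) hs τ
  rwa [mul_one] at this

lemma x0_pos (h : Step J σ s) (hs : Sym (Fs J σ s)) (τ : ℝ) {n : ℕ} (hn : 0 < n) : 0 < xs (wc (Fs J σ s) τ) n 0 := by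
  obtain ⟨m, rfl⟩ : ∃ m, n = m + 1 := ⟨n - 1, by omega⟩
  exact xs_pos (wc_even hs τ) (Real.exp_pos _) (wco h hs τ) m

lemma XS_log (h : Step J σ s) (hs : Sym (Fs J σ s)) {ε l : ℝ} (hε : ε ^ 2 = 1) (hl : l ^ 2 = 1) (τ : ℝ) {n : ℕ} (hn : 0 < n) :
    0 < XS (wc (Fs J σ s) τ) ε n ∧
    Real.log (XS (wc (Fs J σ s) τ) ε n) = Real.arsinh (bb J σ s ε l τ n) - τ * l / 2 + Real.log (xs (wc (Fs J σ s) τ) n 0) / 2 := by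
  have hx := x0_pos h hs τ hn
  have hX : 0 < XS (wc (Fs J σ s) τ) ε n := by
    obtain ⟨m, rfl⟩ : ∃ m, n = m + 1 := ⟨n - 1, by omega⟩
    exact XS_pos (wc_even hs τ) (Real.exp_pos _) (wco h hs τ) hε m
  refine ⟨hX, ?_⟩
  have key := XS_key (wc_even hs τ) (Real.exp_pos _) (wco h hs τ) hε hn
  have e1 : ∑ k ∈ Finset.range n, ε ^ k * xs (wc (Fs J σ s) τ) n k * Am (wc (Fs J σ s) τ) ε (n - k) =
      Real.exp (τ * l) / 2 * XS (wc (Fs J σ s) τ) ε n + Real.sinh τ * Bs J σ s ε l τ n := by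
    rw [XS, Bs, Finset.mul_sum, Finset.mul_sum, ← Finset.sum_add_distrib]
    refine Finset.sum_congr rfl fun k _ => ?_
    rw [Am_wc h, exp_of_sq hl, uh]; ring
  rw [e1] at key
  set x0 := xs (wc (Fs J σ s) τ) n 0
  set X := XS (wc (Fs J σ s) τ) ε n
  set r := Real.sqrt x0 with hr
  have hr0 : 0 < r := Real.sqrt_pos.2 hx
  have hrr : r * r = x0 := Real.mul_self_sqrt hx.le
  set E := Real.exp (τ * l / 2) with hE
  have hE0 : 0 < E := Real.exp_pos _
  have hEE : Real.exp (τ * l) = E * E := by rw [hE, ← Real.exp_add]; ring_nf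
  have hEn : Real.exp (-(τ * l / 2)) = E⁻¹ := Real.exp_neg _
  have hq := arsinh_quad (p := E * X / r) (b := bb J σ s ε l τ n) (by positivity) (by
    rw [bb, kp, hEn, ← hr]
    rw [hEE, ← hrr] at key
    have h1 : E * X / r * (E * X / r / 2 - -(E⁻¹ / r * Real.sinh τ * Bs J σ s ε l τ n)) = (X * (E * E / 2 * X + Real.sinh τ * Bs J σ s ε l τ n)) / (r * r) := by
      field_simp
      ring
    rw [h1, key]; field_simp)
  rw [← hq, Real.log_div (by positivity) hr0.ne', Real.log_mul hE0.ne' hX.ne', hE, Real.log_exp, hr, Real.log_sqrt hx.le]; ring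

lemma xs_sq_le (h : Step J σ s) (hs : Sym (Fs J σ s)) (τ : ℝ) {n : ℕ} (hn : 0 < n) :
    ∑ k ∈ Finset.range n, xs (wc (Fs J σ s) τ) n k ^ 2 ≤ Real.exp |τ| * xs (wc (Fs J σ s) τ) n 0 := by
  have h1 := wco h hs τ n (xs (wc (Fs J σ s) τ) n)
  have h2 : QF (wc (Fs J σ s) τ) n (xs (wc (Fs J σ s) τ) n) = xs (wc (Fs J σ s) τ) n 0 := by
    unfold QF
    rw [Finset.sum_congr rfl (fun j hj => by rw [xs_eq (wc_even hs τ) (Real.exp_pos _) (wco h hs τ) (Finset.mem_range.1 hj)])]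
    simp [hn.ne']
  rw [h2, Real.exp_neg] at h1
  rwa [inv_mul_le_iff₀ (Real.exp_pos _)] at h1

lemma x0_upper (h : Step J σ s) (hs : Sym (Fs J σ s)) (τ : ℝ) {n : ℕ} (hn : 0 < n) : xs (wc (Fs J σ s) τ) n 0 ≤ Real.exp |τ| := by
  have h1 := xs_sq_le h hs τ hn
  have h2 : xs (wc (Fs J σ s) τ) n 0 ^ 2 ≤ ∑ k ∈ Finset.range n, xs (wc (Fs J σ s) τ) n k ^ 2 :=
    Finset.single_le_sum (f := fun k => xs (wc (Fs J σ s) τ) n k ^ 2) (fun k _ => sq_nonneg _) (Finset.mem_range.2 hn)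
  have h3 := x0_pos h hs τ hn
  nlinarith

lemma x0_mono (h : Step J σ s) (hs : Sym (Fs J σ s)) (τ : ℝ) {m n : ℕ} (hm : 0 < m) (hmn : m ≤ n) :
    Real.exp (-|τ|) * ∑ k ∈ Finset.range n, (xs (wc (Fs J σ s) τ) n k - xs (wc (Fs J σ s) τ) m k) ^ 2 ≤
      xs (wc (Fs J σ s) τ) n 0 - xs (wc (Fs J σ s) τ) m 0 := by
  rw [← xs_diff (wc_even hs τ) (Real.exp_pos _) (wco h hs τ) hm hmn]
  exact wco h hs τ n _

lemma x0_lower (h : Step J σ s) (hs : Sym (Fs J σ s)) (τ : ℝ) {n : ℕ} (hn : 0 < n) : Real.exp (-|τ|) ≤ xs (wc (Fs J σ s) τ) n 0 := by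
  have h1 := x0_mono h hs τ (m := 1) one_pos hn
  have h2 : 0 ≤ Real.exp (-|τ|) * ∑ k ∈ Finset.range n, (xs (wc (Fs J σ s) τ) n k - xs (wc (Fs J σ s) τ) 1 k) ^ 2 :=
    mul_nonneg (Real.exp_pos _).le (Finset.sum_nonneg fun _ _ => sq_nonneg _)
  have h3 := xs_one (wc_even hs τ) (Real.exp_pos _) (wco h hs τ)
  have h4 := rc_upper (eS_adm (Fs_meas J σ s) (fun x _ => (Fs_abs h x).le) τ) (wSym hs τ) (M := Real.exp |τ|) (fun x _ => exp_sq_one (h.val x) τ) 1 (fun _ => 1)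
  have h5 : wc (Fs J σ s) τ 0 ≤ Real.exp |τ| := by simpa [QF, wc] using h4
  have h6 := x0_pos h hs τ one_pos
  have h7 : 1 ≤ Real.exp |τ| * xs (wc (Fs J σ s) τ) 1 0 := by rw [← h3]; gcongr
  have h8 : Real.exp (-|τ|) ≤ xs (wc (Fs J σ s) τ) 1 0 := by
    rw [Real.exp_neg, inv_le_iff_one_le_mul₀ (Real.exp_pos _), mul_comm]; exact h7
  linarith

end
end EE
end

noncomputable section
namespace EE
open MeasureTheory Set Filter Topology

lemma inv_sq_le (n : ℕ) : ∑ j ∈ Finset.range n, 1 / ((j : ℝ) + 1) ^ 2 ≤ 2 := by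
  obtain ⟨h1, h2⟩ := sum_inv_sq 0
  norm_num at h1 h2
  refine le_trans ?_ h2
  simp only [one_div]
  exact h1.sum_le_tsum _ (fun j _ => by positivity)

section
variable {J : Finset ℝ} {σ : ℝ → ℝ} {s : ℝ}

lemma uh_sq {ε l C : ℝ} (hC : ∀ k : ℕ, 1 ≤ k → |uh J σ s ε l k| ≤ C / k) (n : ℕ) :
    ∑ k ∈ Finset.range n, uh J σ s ε l (n - k) ^ 2 ≤ 2 * C ^ 2 := by
  have e : ∑ k ∈ Finset.range n, uh J σ s ε l (n - k) ^ 2 = ∑ k ∈ Finset.range n, uh J σ s ε l (k + 1) ^ 2 := by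
    rw [← Finset.sum_range_reflect]
    refine Finset.sum_congr rfl fun k hk => ?_
    have := Finset.mem_range.1 hk
    rw [show n - (n - 1 - k) = k + 1 by omega]
  rw [e]
  calc _ ≤ ∑ k ∈ Finset.range n, C ^ 2 * (1 / ((k : ℝ) + 1) ^ 2) := by
        refine Finset.sum_le_sum fun k _ => ?_
        have := hC (k + 1) (by omega)
        push_cast at this
        rw [← sq_abs]
        calc _ ≤ (C / (k + 1)) ^ 2 := by gcongr
          _ = _ := by rw [div_pow]; ring
    _ ≤ _ := by
        rw [← Finset.mul_sum, mul_comm]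
        exact mul_le_mul_of_nonneg_right (inv_sq_le n) (sq_nonneg C)

lemma pair_le {ε l C : ℝ} (hε : ε ^ 2 = 1) (hC : ∀ k : ℕ, 1 ≤ k → |uh J σ s ε l k| ≤ C / k) (n : ℕ) (a : ℕ → ℝ) :
    (∑ k ∈ Finset.range n, ε ^ k * a k * uh J σ s ε l (n - k)) ^ 2 ≤ 2 * C ^ 2 * ∑ k ∈ Finset.range n, a k ^ 2 := by
  refine (Finset.sum_mul_sq_le_sq_mul_sq _ _ _).trans ?_
  rw [mul_comm]
  refine mul_le_mul (uh_sq hC n) (le_of_eq ?_) (Finset.sum_nonneg fun _ _ => sq_nonneg _) (by positivity)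
  refine Finset.sum_congr rfl fun k _ => ?_
  rw [mul_pow, ← pow_mul, mul_comm k 2, pow_mul, hε, one_pow, one_mul]

lemma Bs_lim (h : Step J σ s) (hs : Sym (Fs J σ s)) {ε l C : ℝ} (hε : ε ^ 2 = 1)
    (hC : ∀ k : ℕ, 1 ≤ k → |uh J σ s ε l k| ≤ C / k) (τ : ℝ) : Tendsto (Bs J σ s ε l τ) atTop (𝓝 0) := by
  set c := wc (Fs J σ s) τ with hc
  set x : ℕ → ℕ → ℝ := fun n => xs c n with hx
  -- convergence of the leading coefficient
  have hmono : Monotone (fun n => x (n + 1) 0) := by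
    intro m n hmn
    have := x0_mono h hs τ (m := m + 1) (n := n + 1) (by omega) (by omega)
    have h2 : 0 ≤ Real.exp (-|τ|) * ∑ k ∈ Finset.range (n + 1), (xs c (n + 1) k - xs c (m + 1) k) ^ 2 :=
      mul_nonneg (Real.exp_pos _).le (Finset.sum_nonneg fun _ _ => sq_nonneg _)
    simp only [hx]
    linarith
  have hbd : BddAbove (range fun n => x (n + 1) 0) := ⟨Real.exp |τ|, by
    rintro _ ⟨n, rfl⟩
    exact x0_upper h hs τ (by omega)⟩
  have hlim := tendsto_atTop_ciSup hmono hbd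
  set L := ⨆ n, x (n + 1) 0
  have hu0 : Tendsto (fun j : ℕ => uh J σ s ε l (j + 1)) atTop (𝓝 0) := by
    refine squeeze_zero_norm (a := fun j : ℕ => C * (1 / ((j : ℝ) + 1))) (fun j => ?_) ?_
    · have := hC (j + 1) (by omega)
      push_cast at this
      rw [Real.norm_eq_abs]
      refine this.trans (le_of_eq (by ring))
    · simpa using tendsto_one_div_add_atTop_nhds_zero_nat.const_mul C
  rw [Metric.tendsto_atTop]
  intro η hη
  set K := 2 * C ^ 2 * Real.exp |τ| + 1 with hK
  have hK0 : 0 < K := by positivity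
  obtain ⟨m, hm⟩ := (Metric.tendsto_atTop.1 hlim) ((η / 2) ^ 2 / K) (by positivity)
  have hm := hm m le_rfl
  -- finite part
  have hfin : Tendsto (fun n => ∑ k ∈ Finset.range (m + 1), ε ^ k * x (m + 1) k * uh J σ s ε l (n - k)) atTop (𝓝 0) := by
    have : Tendsto (fun n => ∑ k ∈ Finset.range (m + 1), ε ^ k * x (m + 1) k * uh J σ s ε l (n - k)) atTop
        (𝓝 (∑ k ∈ Finset.range (m + 1), ε ^ k * x (m + 1) k * 0)) := by
      refine tendsto_finsetSum _ fun k _ => Tendsto.const_mul _ ?_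
      refine (tendsto_add_atTop_iff_nat (k + 1)).1 ?_
      refine hu0.congr fun n => ?_
      rw [show n + (k + 1) - k = n + 1 by omega]
    simpa using this
  obtain ⟨N, hN⟩ := (Metric.tendsto_atTop.1 hfin) (η / 2) (by positivity)
  refine ⟨max N (m + 1), fun n hn => ?_⟩
  have hn1 : N ≤ n := (le_max_left _ _).trans hn
  have hn2 : m + 1 ≤ n := (le_max_right _ _).trans hn
  have hfn := hN n hn1
  rw [Real.dist_eq, sub_zero] at hfn ⊢
  have hsplit : Bs J σ s ε l τ n = ∑ k ∈ Finset.range n, ε ^ k * (x n k - x (m + 1) k) * uh J σ s ε l (n - k) +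
      ∑ k ∈ Finset.range (m + 1), ε ^ k * x (m + 1) k * uh J σ s ε l (n - k) := by
    have e : ∑ k ∈ Finset.range (m + 1), ε ^ k * x (m + 1) k * uh J σ s ε l (n - k) = ∑ k ∈ Finset.range n, ε ^ k * x (m + 1) k * uh J σ s ε l (n - k) := by
      refine Finset.sum_subset (Finset.range_mono hn2) fun k _ hk => ?_
      simp only [hx]
      rw [xs_zero_of_le c (by simpa using hk)]; ring
    rw [e, ← Finset.sum_add_distrib, Bs]
    refine Finset.sum_congr rfl fun k _ => ?_
    simp only [hx]; ring
  have hpl := pair_le hε hC n (fun k => x n k - x (m + 1) k)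
  have hx1 := x0_mono h hs τ (m := m + 1) (n := n) (by omega) hn2
  have hxn : x n 0 ≤ L := by
    obtain ⟨p, rfl⟩ : ∃ p, n = p + 1 := ⟨n - 1, by omega⟩
    exact le_ciSup hbd p
  have hd : x n 0 - x (m + 1) 0 < (η / 2) ^ 2 / K := by
    rw [Real.dist_eq] at hm
    have := (abs_lt.1 hm).1
    linarith
  have hS : ∑ k ∈ Finset.range n, (x n k - x (m + 1) k) ^ 2 ≤ Real.exp |τ| * ((η / 2) ^ 2 / K) := by
    have : Real.exp (-|τ|) * ∑ k ∈ Finset.range n, (x n k - x (m + 1) k) ^ 2 ≤ (η / 2) ^ 2 / K := hx1.trans hd.le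
    rw [Real.exp_neg] at this
    rwa [inv_mul_le_iff₀ (Real.exp_pos _)] at this
  have hsq : (∑ k ∈ Finset.range n, ε ^ k * (x n k - x (m + 1) k) * uh J σ s ε l (n - k)) ^ 2 ≤ (η / 2) ^ 2 := by
    refine hpl.trans ?_
    calc 2 * C ^ 2 * ∑ k ∈ Finset.range n, (x n k - x (m + 1) k) ^ 2 ≤ 2 * C ^ 2 * (Real.exp |τ| * ((η / 2) ^ 2 / K)) := by gcongr
      _ = (2 * C ^ 2 * Real.exp |τ|) / K * (η / 2) ^ 2 := by ring
      _ ≤ 1 * (η / 2) ^ 2 := by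
          gcongr
          rw [div_le_one hK0, hK]; linarith
      _ = _ := one_mul _
  have hab := abs_le_of_sq_le_sq hsq (by positivity)
  rw [hsplit]
  refine (abs_add_le _ _).trans_lt ?_
  linarith

lemma kp_le (h : Step J σ s) (hs : Sym (Fs J σ s)) {l : ℝ} (hl : l ^ 2 = 1) (τ : ℝ) {n : ℕ} (hn : 0 < n) :
    0 < kp J σ s l τ n ∧ Real.exp (-|τ|) ≤ kp J σ s l τ n ∧ kp J σ s l τ n ≤ Real.exp |τ| := by
  have h1 := x0_lower h hs τ hn
  have h2 := x0_upper h hs τ hn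
  have h0 := x0_pos h hs τ hn
  have hsq := Real.sqrt_pos.2 h0
  have hl1 : |l| ≤ 1 := by
    rcases sq_eq_one_iff' hl with h | h <;> rw [h] <;> norm_num
  have a1 : Real.exp (-(τ * l / 2)) ≤ Real.exp (|τ| / 2) := by
    apply Real.exp_le_exp.2
    have : |τ * l| ≤ |τ| := by rw [abs_mul]; nlinarith [abs_nonneg τ]
    linarith [(abs_le.1 this).1]
  have a2 : Real.exp (-(|τ| / 2)) ≤ Real.exp (-(τ * l / 2)) := by
    apply Real.exp_le_exp.2
    have : |τ * l| ≤ |τ| := by rw [abs_mul]; nlinarith [abs_nonneg τ]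
    linarith [(abs_le.1 this).2]
  have a3 : Real.exp (-(|τ| / 2)) ≤ Real.sqrt (xs (wc (Fs J σ s) τ) n 0) := by
    apply Real.le_sqrt_of_sq_le
    rw [← Real.exp_nat_mul]
    refine le_trans (le_of_eq ?_) h1
    congr 1; push_cast; ring
  have a4 : Real.sqrt (xs (wc (Fs J σ s) τ) n 0) ≤ Real.exp (|τ| / 2) := by
    apply Real.sqrt_le_iff.2 ⟨(Real.exp_pos _).le, ?_⟩
    rw [← Real.exp_nat_mul]
    refine le_trans h2 (le_of_eq ?_)
    congr 1; push_cast; ring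
  refine ⟨div_pos (Real.exp_pos _) hsq, ?_, ?_⟩
  · rw [kp, le_div_iff₀ hsq]
    calc _ ≤ Real.exp (-|τ|) * Real.exp (|τ| / 2) := by gcongr
      _ = Real.exp (-(|τ| / 2)) := by rw [← Real.exp_add]; ring_nf
      _ ≤ _ := a2
  · rw [kp, div_le_iff₀ hsq]
    calc _ ≤ Real.exp (|τ| / 2) := a1
      _ = Real.exp |τ| * Real.exp (-(|τ| / 2)) := by rw [← Real.exp_add]; ring_nf
      _ ≤ _ := by gcongr

lemma bb_lim (h : Step J σ s) (hs : Sym (Fs J σ s)) {ε l C : ℝ} (hε : ε ^ 2 = 1) (hl : l ^ 2 = 1)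
    (hC : ∀ k : ℕ, 1 ≤ k → |uh J σ s ε l k| ≤ C / k) (τ : ℝ) : Tendsto (bb J σ s ε l τ) atTop (𝓝 0) := by
  have h1 := (Bs_lim h hs hε hC τ).norm.const_mul (Real.exp |τ| * |Real.sinh τ|)
  rw [norm_zero, mul_zero] at h1
  refine squeeze_zero_norm' ?_ h1
  filter_upwards [eventually_gt_atTop 0] with n hn
  obtain ⟨h2, _, h3⟩ := kp_le h hs hl τ hn
  rw [bb, norm_neg, norm_mul, norm_mul, Real.norm_eq_abs, Real.norm_eq_abs, abs_of_pos h2]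
  gcongr

lemma bb_big (h : Step J σ s) (hs : Sym (Fs J σ s)) {ε l C : ℝ} (hε : ε ^ 2 = 1) (hl : l ^ 2 = 1) (hC0 : 0 ≤ C)
    (hC : ∀ k : ℕ, 1 ≤ k → |uh J σ s ε l k| ≤ C / k) (τ : ℝ) {n : ℕ} (hn : 0 < n) :
    |bb J σ s ε l τ n| ≤ 2 * C * Real.exp (2 * |τ|) := by
  have h0 := x0_pos h hs τ hn
  have hsq := Real.sqrt_pos.2 h0
  have h1 := (pair_le hε hC n (xs (wc (Fs J σ s) τ) n)).trans (mul_le_mul_of_nonneg_left (xs_sq_le h hs τ hn) (by positivity))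
  have hB : |Bs J σ s ε l τ n| ≤ 2 * C * Real.exp (|τ| / 2) * Real.sqrt (xs (wc (Fs J σ s) τ) n 0) := by
    refine abs_le_of_sq_le_sq ?_ (by positivity)
    refine h1.trans ?_
    rw [mul_pow, Real.sq_sqrt h0.le, mul_pow, ← Real.exp_nat_mul]
    push_cast
    rw [show 2 * (|τ| / 2) = |τ| by ring]
    have : 0 ≤ C ^ 2 * (Real.exp |τ| * xs (wc (Fs J σ s) τ) n 0) := by positivity
    nlinarith
  have hl1 : Real.exp (-(τ * l / 2)) ≤ Real.exp (|τ| / 2) := by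
    apply Real.exp_le_exp.2
    have : |l| ≤ 1 := by
      rcases sq_eq_one_iff' hl with h | h <;> rw [h] <;> norm_num
    have : |τ * l| ≤ |τ| := by rw [abs_mul]; nlinarith [abs_nonneg τ]
    linarith [(abs_le.1 this).1]
  have hsh : |Real.sinh τ| ≤ Real.exp |τ| := by
    rw [Real.abs_sinh, Real.sinh_eq]
    have := Real.exp_pos (-|τ|)
    have := Real.exp_pos |τ|
    linarith
  rw [bb, abs_neg, abs_mul, abs_mul, kp, abs_of_pos (div_pos (Real.exp_pos _) hsq)]
  calc _ ≤ Real.exp (|τ| / 2) / Real.sqrt (xs (wc (Fs J σ s) τ) n 0) * Real.exp |τ| * (2 * C * Real.exp (|τ| / 2) * Real.sqrt (xs (wc (Fs J σ s) τ) n 0)) := by gcongr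
    _ = 2 * C * (Real.exp (|τ| / 2) * Real.exp |τ| * Real.exp (|τ| / 2)) := by field_simp
    _ = _ := by rw [← Real.exp_add, ← Real.exp_add]; ring_nf

end
end EE
end

noncomputable section
namespace EE
open MeasureTheory Set Filter Topology

section
variable {J : Finset ℝ} {σ : ℝ → ℝ} {s : ℝ}

lemma exp_abs_small {τ : ℝ} (hτ : |τ| ≤ 1) : Real.exp (2 * |τ|) ≤ 9 := by
  have h1 : Real.exp (2 * |τ|) ≤ Real.exp 2 := Real.exp_le_exp.2 (by linarith)
  have h2 : Real.exp 2 = Real.exp 1 * Real.exp 1 := by rw [← Real.exp_add]; norm_num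
  have h3 := Real.exp_one_lt_d9
  have h4 := Real.exp_pos 1
  nlinarith

lemma sinh_small {τ : ℝ} (hτ : |τ| ≤ 1) : Real.sinh τ ^ 2 ≤ 4 * τ ^ 2 := by
  have h1 := abs_le.1 (Real.abs_exp_sub_one_le hτ)
  have h2 := abs_le.1 (Real.abs_exp_sub_one_le (x := -τ) (by rwa [abs_neg]))
  rw [abs_neg] at h2
  have : |Real.sinh τ| ≤ 2 * |τ| := by
    rw [Real.sinh_eq]
    refine abs_le.2 ⟨?_, ?_⟩ <;> linarith [h1.1, h1.2, h2.1, h2.2]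
  calc _ = |Real.sinh τ| ^ 2 := (sq_abs _).symm
    _ ≤ (2 * |τ|) ^ 2 := by gcongr
    _ = _ := by rw [mul_pow, sq_abs]; norm_num

lemma cosh_small {τ : ℝ} (hτ : |τ| ≤ 1) : (1 - Real.cosh τ) ^ 2 ≤ 4 * τ ^ 2 := by
  have h1 := sinh_small hτ
  have h2 := Real.cosh_sq τ
  have h3 := Real.one_le_cosh τ
  nlinarith

lemma rc_sq_sum (h : Step J σ s) (n : ℕ) : ∑ j ∈ Finset.range n, rc (Fs J σ s) (j : ℤ) ^ 2 ≤ f0 J σ s ^ 2 + 2 * (J.card : ℝ) ^ 2 := by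
  rcases n with _ | n
  · simp; positivity
  rw [Finset.sum_range_succ', Nat.cast_zero, rc_Fs0 h, add_comm]
  gcongr
  calc _ ≤ ∑ k ∈ Finset.range n, (J.card : ℝ) ^ 2 * (1 / ((k : ℝ) + 1) ^ 2) := by
        refine Finset.sum_le_sum fun k _ => ?_
        have := rc_Fs_bound h (n := k + 1) (by omega)
        push_cast at this ⊢
        rw [← sq_abs]
        calc _ ≤ ((J.card : ℝ) / (k + 1)) ^ 2 := by gcongr
          _ = _ := by rw [div_pow]; ring
    _ ≤ _ := by
        rw [← Finset.mul_sum, mul_comm]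
        exact mul_le_mul_of_nonneg_right (inv_sq_le n) (sq_nonneg _)

lemma xs_small (h : Step J σ s) (hs : Sym (Fs J σ s)) {τ : ℝ} (hτ : |τ| ≤ 1) {n : ℕ} (hn : 0 < n) :
    ∑ k ∈ Finset.range n, (xs (wc (Fs J σ s) τ) n k - if k = 0 then 1 else 0) ^ 2 ≤
      72 * (1 + (f0 J σ s ^ 2 + 2 * (J.card : ℝ) ^ 2)) * τ ^ 2 := by
  set c := wc (Fs J σ s) τ with hc
  set d : ℕ → ℝ := fun k => xs c n k - if k = 0 then 1 else 0 with hd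
  set g : ℕ → ℝ := fun j => (if j = 0 then 1 else 0) - c j with hg
  set S := ∑ k ∈ Finset.range n, d k ^ 2 with hS
  have hS0 : 0 ≤ S := Finset.sum_nonneg fun _ _ => sq_nonneg _
  have h1 := wco h hs τ n d
  have h2 : QF c n d = ∑ j ∈ Finset.range n, d j * g j := by
    unfold QF
    refine Finset.sum_congr rfl fun j hj => ?_
    congr 1
    simp only [hd, mul_sub, Finset.sum_sub_distrib]
    rw [xs_eq (wc_even hs τ) (Real.exp_pos _) (wco h hs τ) (Finset.mem_range.1 hj)]
    simp [hg, hn]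
  have h3 : (∑ j ∈ Finset.range n, d j * g j) ^ 2 ≤ S * ∑ j ∈ Finset.range n, g j ^ 2 := Finset.sum_mul_sq_le_sq_mul_sq _ _ _
  set F := f0 J σ s ^ 2 + 2 * (J.card : ℝ) ^ 2 with hF
  have hG : ∑ j ∈ Finset.range n, g j ^ 2 ≤ 8 * (1 + F) * τ ^ 2 := by
    calc _ ≤ ∑ j ∈ Finset.range n, (2 * (if j = 0 then (1 - Real.cosh τ) ^ 2 else 0) + 2 * Real.sinh τ ^ 2 * rc (Fs J σ s) (j : ℤ) ^ 2) := by
          refine Finset.sum_le_sum fun j _ => ?_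
          simp only [hg, hc, wc_eq h]
          rcases eq_or_ne j 0 with rfl | hj
          · simp only [if_true, Nat.cast_zero]
            nlinarith [sq_nonneg ((1 - Real.cosh τ) + Real.sinh τ * rc (Fs J σ s) 0)]
          · have : (j : ℤ) ≠ 0 := by exact_mod_cast hj
            simp only [if_neg hj, if_neg this]
            nlinarith [sq_nonneg (Real.sinh τ * rc (Fs J σ s) j)]
      _ = 2 * (1 - Real.cosh τ) ^ 2 + 2 * Real.sinh τ ^ 2 * ∑ j ∈ Finset.range n, rc (Fs J σ s) (j : ℤ) ^ 2 := by
          rw [Finset.sum_add_distrib, ← Finset.mul_sum, ← Finset.mul_sum]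
          simp [hn]
      _ ≤ 2 * (4 * τ ^ 2) + 2 * (4 * τ ^ 2) * F := by
          gcongr
          · exact cosh_small hτ
          · exact sinh_small hτ
          · exact rc_sq_sum h n
      _ = _ := by ring
  rw [← hc, h2] at h1
  have h4 : S ≤ Real.exp |τ| * ∑ j ∈ Finset.range n, d j * g j := by
    rw [Real.exp_neg] at h1
    rwa [inv_mul_le_iff₀ (Real.exp_pos _)] at h1
  have h5 : S ^ 2 ≤ 9 * (S * (8 * (1 + F) * τ ^ 2)) := by
    calc S ^ 2 ≤ (Real.exp |τ| * ∑ j ∈ Finset.range n, d j * g j) ^ 2 := by gcongr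
      _ = Real.exp (2 * |τ|) * (∑ j ∈ Finset.range n, d j * g j) ^ 2 := by rw [mul_pow, ← Real.exp_nat_mul, Nat.cast_ofNat]
      _ ≤ 9 * (S * (8 * (1 + F) * τ ^ 2)) := by
          refine mul_le_mul (exp_abs_small hτ) (h3.trans (by gcongr)) (sq_nonneg _) (by norm_num)
  have hRp : 0 ≤ 72 * (1 + F) * τ ^ 2 := by positivity
  rcases hS0.eq_or_lt with h0 | h0
  · exact h0.symm.trans_le hRp
  · refine le_of_mul_le_mul_left (a := S) ?_ h0
    calc S * S = S ^ 2 := by ring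
      _ ≤ _ := h5
      _ = _ := by ring

lemma kx_small (h : Step J σ s) (hs : Sym (Fs J σ s)) {l : ℝ} (hl : l ^ 2 = 1) : ∃ D : ℝ, 0 ≤ D ∧ ∀ τ : ℝ, |τ| ≤ 1 → ∀ n : ℕ, 0 < n →
    ∑ k ∈ Finset.range n, (kp J σ s l τ n * xs (wc (Fs J σ s) τ) n k - if k = 0 then 1 else 0) ^ 2 ≤ D * τ ^ 2 := by
  set F := f0 J σ s ^ 2 + 2 * (J.card : ℝ) ^ 2 with hF
  refine ⟨72 + 2 * (72 * (1 + F)), by positivity, fun τ hτ n hn => ?_⟩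
  obtain ⟨_, k1, k2⟩ := kp_le h hs hl τ hn
  have k3 := abs_le.1 (Real.abs_exp_sub_one_le (x := |τ|) (by rwa [abs_abs]))
  rw [abs_abs] at k3
  have k4 := Real.add_one_le_exp (-|τ|)
  have hx : ∑ k ∈ Finset.range n, xs (wc (Fs J σ s) τ) n k ^ 2 ≤ 9 := by
    refine (xs_sq_le h hs τ hn).trans ?_
    calc _ ≤ Real.exp |τ| * Real.exp |τ| := by gcongr; exact x0_upper h hs τ hn
      _ = Real.exp (2 * |τ|) := by rw [← Real.exp_add]; ring_nf
      _ ≤ 9 := exp_abs_small hτ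
  have hk : (kp J σ s l τ n - 1) ^ 2 ≤ 4 * τ ^ 2 := by
    have : |kp J σ s l τ n - 1| ≤ 2 * |τ| := abs_le.2 ⟨by linarith [abs_nonneg τ], by linarith [k3.2]⟩
    calc _ = |kp J σ s l τ n - 1| ^ 2 := (sq_abs _).symm
      _ ≤ (2 * |τ|) ^ 2 := by gcongr
      _ = _ := by rw [mul_pow, sq_abs]; norm_num
  have hx2 := xs_small h hs hτ hn
  calc _ ≤ ∑ k ∈ Finset.range n, (2 * (kp J σ s l τ n - 1) ^ 2 * xs (wc (Fs J σ s) τ) n k ^ 2 + 2 * (xs (wc (Fs J σ s) τ) n k - if k = 0 then 1 else 0) ^ 2) := by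
        refine Finset.sum_le_sum fun k _ => ?_
        nlinarith [sq_nonneg ((kp J σ s l τ n - 1) * xs (wc (Fs J σ s) τ) n k - (xs (wc (Fs J σ s) τ) n k - if k = 0 then 1 else 0))]
    _ = 2 * (kp J σ s l τ n - 1) ^ 2 * ∑ k ∈ Finset.range n, xs (wc (Fs J σ s) τ) n k ^ 2 + 2 * ∑ k ∈ Finset.range n, (xs (wc (Fs J σ s) τ) n k - if k = 0 then 1 else 0) ^ 2 := by
        rw [Finset.sum_add_distrib, ← Finset.mul_sum, ← Finset.mul_sum]
    _ ≤ 2 * (4 * τ ^ 2) * 9 + 2 * (72 * (1 + F) * τ ^ 2) := by gcongr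
    _ = _ := by ring

lemma bb_small (h : Step J σ s) (hs : Sym (Fs J σ s)) {ε l C : ℝ} (hε : ε ^ 2 = 1) (hl : l ^ 2 = 1) (hC0 : 0 ≤ C)
    (hC : ∀ k : ℕ, 1 ≤ k → |uh J σ s ε l k| ≤ C / k) : ∃ K : ℝ, 0 ≤ K ∧ ∀ τ : ℝ, |τ| ≤ 1 → ∀ n : ℕ, 0 < n →
    |bb J σ s ε l τ n + bb J σ s ε l (-τ) n| ≤ K * τ ^ 2 := by
  obtain ⟨D, hD0, hD⟩ := kx_small h hs hl
  refine ⟨6 * C * (1 + D), by positivity, fun τ hτ n hn => ?_⟩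
  refine abs_le_of_sq_le_sq ?_ (by positivity)
  set a : ℕ → ℝ := fun k => kp J σ s l τ n * xs (wc (Fs J σ s) τ) n k - kp J σ s l (-τ) n * xs (wc (Fs J σ s) (-τ)) n k with ha
  have e : bb J σ s ε l τ n + bb J σ s ε l (-τ) n = - Real.sinh τ * ∑ k ∈ Finset.range n, ε ^ k * a k * uh J σ s ε l (n - k) := by
    rw [bb, bb, Bs, Bs, Real.sinh_neg]
    have : ∑ k ∈ Finset.range n, ε ^ k * a k * uh J σ s ε l (n - k) =
      kp J σ s l τ n * ∑ k ∈ Finset.range n, ε ^ k * xs (wc (Fs J σ s) τ) n k * uh J σ s ε l (n - k)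
      - kp J σ s l (-τ) n * ∑ k ∈ Finset.range n, ε ^ k * xs (wc (Fs J σ s) (-τ)) n k * uh J σ s ε l (n - k) := by
      rw [Finset.mul_sum, Finset.mul_sum, ← Finset.sum_sub_distrib]
      refine Finset.sum_congr rfl fun k _ => ?_
      simp only [ha]; ring
    rw [this]; ring
  have h1 := hD τ hτ n hn
  have h2 := hD (-τ) (by rwa [abs_neg]) n hn
  rw [neg_sq] at h2
  have h3 : ∑ k ∈ Finset.range n, a k ^ 2 ≤ 4 * D * τ ^ 2 := by
    calc _ ≤ ∑ k ∈ Finset.range n, (2 * (kp J σ s l τ n * xs (wc (Fs J σ s) τ) n k - if k = 0 then 1 else 0) ^ 2 + 2 * (kp J σ s l (-τ) n * xs (wc (Fs J σ s) (-τ)) n k - if k = 0 then 1 else 0) ^ 2) := by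
          refine Finset.sum_le_sum fun k _ => ?_
          simp only [ha]
          set u := if k = 0 then (1 : ℝ) else 0
          nlinarith [sq_nonneg ((kp J σ s l τ n * xs (wc (Fs J σ s) τ) n k - u) + (kp J σ s l (-τ) n * xs (wc (Fs J σ s) (-τ)) n k - u))]
      _ ≤ 2 * (D * τ ^ 2) + 2 * (D * τ ^ 2) := by
          rw [Finset.sum_add_distrib, ← Finset.mul_sum, ← Finset.mul_sum]; gcongr
      _ = _ := by ring
  have h4 := pair_le hε hC n a
  rw [e, mul_pow, neg_sq]
  calc _ ≤ (4 * τ ^ 2) * (2 * C ^ 2 * (4 * D * τ ^ 2)) := by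
        refine mul_le_mul (sinh_small hτ) (h4.trans (by gcongr)) (sq_nonneg _) (by positivity)
    _ = 32 * D * (C ^ 2 * τ ^ 4) := by ring
    _ ≤ (36 * (1 + D) ^ 2) * (C ^ 2 * τ ^ 4) := by
        refine mul_le_mul_of_nonneg_right ?_ (by positivity)
        nlinarith
    _ = _ := by ring

lemma ar_bound (h : Step J σ s) (hs : Sym (Fs J σ s)) {ε l C : ℝ} (hε : ε ^ 2 = 1) (hl : l ^ 2 = 1) (hC0 : 0 ≤ C)
    (hC : ∀ k : ℕ, 1 ≤ k → |uh J σ s ε l k| ≤ C / k) : ∃ K : ℝ, 0 ≤ K ∧ ∀ τ : ℝ, ∀ n : ℕ, 0 < n →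
    |Real.arsinh (bb J σ s ε l τ n) + Real.arsinh (bb J σ s ε l (-τ) n)| ≤ K * τ ^ 2 := by
  obtain ⟨K, hK0, hK⟩ := bb_small h hs hε hl hC0 hC
  have hlog : 0 ≤ Real.log (2 * (2 * C) + 1) := Real.log_nonneg (by linarith)
  refine ⟨K + 4 + 2 * Real.log (2 * (2 * C) + 1), by positivity, fun τ n hn => ?_⟩
  rcases le_or_gt |τ| 1 with hτ | hτ
  · refine (arsinh_add_le _ _).trans ((hK τ hτ n hn).trans ?_)
    gcongr
    linarith
  · have h1 := arsinh_big (abs_nonneg τ) (by positivity) (bb_big h hs hε hl hC0 hC τ hn)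
    have h2 := arsinh_big (abs_nonneg (-τ)) (by positivity) (bb_big h hs hε hl hC0 hC (-τ) hn)
    rw [abs_neg] at h2
    have h3 : |τ| ≤ τ ^ 2 := by rw [← sq_abs]; nlinarith
    have h4 : 1 ≤ τ ^ 2 := by linarith
    refine (abs_add_le _ _).trans ?_
    nlinarith [mul_nonneg hK0 (sq_nonneg τ)]

lemma Zn_eq (h : Step J σ s) (hs : Sym (Fs J σ s)) (hl : s ^ 2 = 1) (τ : ℝ) {n : ℕ} (hn : 0 < n) :
    Zn (Fs J σ s) τ n = Real.arsinh (bb J σ s 1 s τ n) + Real.arsinh (bb J σ s (-1) (Fs J σ s Real.pi) τ n) - τ * (s + Fs J σ s Real.pi) / 2 := by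
  obtain ⟨p1, e1⟩ := XS_log h hs (ε := 1) (by norm_num) hl τ hn
  obtain ⟨p2, e2⟩ := XS_log h hs (ε := -1) (by norm_num) (h.val Real.pi) τ hn
  have h0 := x0_pos h hs τ hn
  rw [Zn, Real.log_div (by positivity) h0.ne', Real.log_mul p1.ne' p2.ne', e1, e2]; ring

lemma Zn_final (h : Step J σ s) (hs : Sym (Fs J σ s)) (hl : s ^ 2 = 1) (hpi : Real.pi ∉ J) :
    (∃ K : ℝ, 0 ≤ K ∧ ∀ τ : ℝ, ∀ n : ℕ, 0 < n → |Zn (Fs J σ s) τ n + Zn (Fs J σ s) (-τ) n| ≤ K * τ ^ 2) ∧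
    ∀ τ : ℝ, Tendsto (fun n => Zn (Fs J σ s) τ n + Zn (Fs J σ s) (-τ) n) atTop (𝓝 0) := by
  obtain ⟨C1, hC1, H1⟩ := Am_rate_one h
  obtain ⟨C2, hC2, H2⟩ := Am_rate_neg h hpi
  obtain ⟨K1, k1, B1⟩ := ar_bound h hs (ε := 1) (l := s) (by norm_num) hl hC1 H1
  obtain ⟨K2, k2, B2⟩ := ar_bound h hs (ε := -1) (l := Fs J σ s Real.pi) (by norm_num) (h.val _) hC2 H2
  have key : ∀ τ : ℝ, ∀ n : ℕ, 0 < n → Zn (Fs J σ s) τ n + Zn (Fs J σ s) (-τ) n =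
      (Real.arsinh (bb J σ s 1 s τ n) + Real.arsinh (bb J σ s 1 s (-τ) n)) + (Real.arsinh (bb J σ s (-1) (Fs J σ s Real.pi) τ n) + Real.arsinh (bb J σ s (-1) (Fs J σ s Real.pi) (-τ) n)) := by
    intro τ n hn
    rw [Zn_eq h hs hl τ hn, Zn_eq h hs hl (-τ) hn]; ring
  refine ⟨⟨K1 + K2, by positivity, fun τ n hn => ?_⟩, fun τ => ?_⟩
  · rw [key τ n hn, add_mul]
    exact (abs_add_le _ _).trans (add_le_add (B1 τ n hn) (B2 τ n hn))
  · have t : ∀ {ε l C : ℝ} (hε : ε ^ 2 = 1) (hl : l ^ 2 = 1) (hC : ∀ k : ℕ, 1 ≤ k → |uh J σ s ε l k| ≤ C / k) (τ : ℝ),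
        Tendsto (fun n => Real.arsinh (bb J σ s ε l τ n)) atTop (𝓝 0) := by
      intro ε l C hε hl hC τ
      have := (Real.continuous_arsinh.tendsto 0).comp (bb_lim h hs hε hl hC τ)
      rwa [Real.arsinh_zero] at this
    have T := ((t (ε := 1) (by norm_num) hl H1 τ).add (t (ε := 1) (by norm_num) hl H1 (-τ))).add
      ((t (ε := -1) (by norm_num) (h.val _) H2 τ).add (t (ε := -1) (by norm_num) (h.val _) H2 (-τ)))
    simp only [add_zero] at T
    refine T.congr' ?_
    filter_upwards [eventually_gt_atTop 0] with n hn
    rw [key τ n hn]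

end
end EE
end

noncomputable section
namespace EE
open MeasureTheory Set Filter Topology

/-- point of the unit circle -/
def ex (x : ℝ) : ℂ := Complex.exp (Complex.I * x)

lemma ex_cont : Continuous ex := by unfold ex; fun_prop

lemma ex_norm (x : ℝ) : ‖ex x‖ = 1 := by rw [ex, mul_comm, Complex.norm_exp_ofReal_mul_I]

lemma ex_pow (x : ℝ) (k : ℕ) : ex x ^ k = Complex.exp (Complex.I * k * x) := by
  rw [ex, ← Complex.exp_nat_mul]; congr 1; ring

lemma ex_pow_re (x : ℝ) (k : ℕ) : (ex x ^ k).re = Real.cos (k * x) := by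
  rw [ex_pow, show Complex.I * k * x = ((k * x : ℝ) : ℂ) * Complex.I by push_cast; ring, Complex.exp_ofReal_mul_I_re]

lemma ex_pow_im (x : ℝ) (k : ℕ) : (ex x ^ k).im = Real.sin (k * x) := by
  rw [ex_pow, show Complex.I * k * x = ((k * x : ℝ) : ℂ) * Complex.I by push_cast; ring, Complex.exp_ofReal_mul_I_im]

/-- mean value over a period -/
def av (g : ℝ → ℝ) : ℝ := (1 / (2 * Real.pi)) * ∫ x in (0 : ℝ)..(2 * Real.pi), g x

lemma mean_entire {u : ℂ → ℂ} (hu : Differentiable ℂ u) : cf (fun x => u (ex x)) 0 = u 0 := by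
  have h := circleAverage_of_differentiable_on_off_countable (f := u) (c := 0) (R := 1) (s := ∅) countable_empty
    hu.continuous.continuousOn (fun z _ => hu z)
  rw [Real.circleAverage_def] at h
  rw [← h, cf, Complex.real_smul]
  push_cast
  rw [one_div]
  congr 1
  refine intervalIntegral.integral_congr fun x _ => ?_
  simp only [Int.cast_zero, mul_zero, zero_mul, Complex.exp_zero, mul_one, ex, circleMap, zero_add, Complex.ofReal_one, one_mul]
  rw [mul_comm]

lemma cf_neg_pow (u : ℂ → ℂ) (k : ℕ) : cf (fun x => u (ex x)) (-(k : ℤ)) = cf (fun x => (fun z => u z * z ^ k) (ex x)) 0 := by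
  unfold cf
  congr 1
  refine intervalIntegral.integral_congr fun x _ => ?_
  simp only [Int.cast_neg, Int.cast_natCast, Int.cast_zero, mul_zero, zero_mul, Complex.exp_zero, mul_one]
  rw [ex_pow]; congr 2; ring

lemma cf_neg_entire {u : ℂ → ℂ} (hu : Differentiable ℂ u) {k : ℤ} (hk : k < 0) : cf (fun x => u (ex x)) k = 0 := by
  obtain ⟨j, rfl⟩ : ∃ j : ℕ, k = -((j + 1 : ℕ) : ℤ) := ⟨(-k - 1).toNat, by omega⟩
  rw [cf_neg_pow, mean_entire (u := fun z => u z * z ^ (j + 1)) (hu.mul (differentiable_id.pow _))]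
  simp

lemma adm_cont {g : ℝ → ℂ} (hg : Continuous g) : Adm g := by
  obtain ⟨C, hC⟩ := (isCompact_Icc (a := (0 : ℝ)) (b := 2 * Real.pi)).exists_bound_of_continuousOn hg.continuousOn
  exact ⟨hg.measurable, C, (norm_nonneg _).trans (hC 0 ⟨le_rfl, by positivity⟩), hC⟩

lemma parseval {g : ℝ → ℂ} (hg : Adm g) : HasSum (fun n : ℤ => ‖cf g n‖ ^ 2) (av fun x => ‖g x‖ ^ 2) := by
  obtain ⟨C, hC0, hC⟩ := hg.bdd
  have hp : (0 : ℝ) < 2 * Real.pi := by positivity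
  have hL : MemLp g 2 (volume.restrict (Ioc 0 (2 * Real.pi))) := by
    refine MemLp.of_bound hg.meas.aestronglyMeasurable C ?_
    refine (ae_restrict_iff' measurableSet_Ioc).2 (Eventually.of_forall fun x hx => hC x (Ioc_subset_Icc_self hx))
  have h := hasSum_sq_fourierCoeffOn hp hL
  rw [sub_zero, smul_eq_mul, ← one_div] at h
  refine Eq.mpr (congrArg (fun F => HasSum F _) (funext fun n => ?_)) h
  have := GG_coeff g n
  rw [GG_lift] at this
  rw [← this]
  have h3 := fourierCoeff_liftIoc_eq (T := 2 * Real.pi) (a := 0) g n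
  rw [h3]
  simp only [zero_add]

lemma ex_deriv (x : ℝ) : HasDerivAt ex (Complex.I * ex x) x := by
  unfold ex
  have h1 : HasDerivAt (fun x : ℝ => Complex.I * (x : ℂ)) (Complex.I * 1) x := (Complex.ofRealCLM.hasDerivAt (x := x)).const_mul Complex.I
  exact (h1.cexp).congr_deriv (by ring)

lemma ex_two_pi : ex (2 * Real.pi) = 1 := by
  rw [ex, show Complex.I * ((2 * Real.pi : ℝ) : ℂ) = 2 * Real.pi * Complex.I by push_cast; ring, Complex.exp_two_pi_mul_I]

lemma ex_zero : ex 0 = 1 := by simp [ex]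

lemma cf_ex_deriv {u : ℂ → ℂ} (hu : Differentiable ℂ u) (hd : Continuous (deriv u)) (k : ℤ) :
    cf (fun x => ex x * deriv u (ex x)) k = k * cf (fun x => u (ex x)) k := by
  have hD : ∀ x ∈ uIcc 0 (2 * Real.pi), HasDerivAt (fun x : ℝ => u (ex x) * Complex.exp (-Complex.I * k * x))
      (Complex.I * (ex x * deriv u (ex x) * Complex.exp (-Complex.I * k * x)) - Complex.I * k * (u (ex x) * Complex.exp (-Complex.I * k * x))) x := by
    intro x _
    have h1 : HasDerivAt (fun x : ℝ => u (ex x)) (deriv u (ex x) * (Complex.I * ex x)) x :=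
      HasDerivAt.comp x (hu (ex x)).hasDerivAt (ex_deriv x)
    have h2 : HasDerivAt (fun x : ℝ => -Complex.I * k * (x : ℂ)) (-Complex.I * k * 1) x :=
      (Complex.ofRealCLM.hasDerivAt (x := x)).const_mul _
    exact (h1.mul h2.cexp).congr_deriv (by ring)
  have c1 : Continuous fun x : ℝ => ex x * deriv u (ex x) * Complex.exp (-Complex.I * k * x) :=
    (ex_cont.mul (hd.comp ex_cont)).mul (by fun_prop)
  have c2 : Continuous fun x : ℝ => u (ex x) * Complex.exp (-Complex.I * k * x) :=
    (hu.continuous.comp ex_cont).mul (by fun_prop)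
  have hI := intervalIntegral.integral_eq_sub_of_hasDerivAt hD (((c1.const_mul _).sub (c2.const_mul _)).intervalIntegrable _ _)
  rw [intervalIntegral.integral_sub ((c1.const_mul _).intervalIntegrable _ _) ((c2.const_mul _).intervalIntegrable _ _),
    intervalIntegral.integral_const_mul, intervalIntegral.integral_const_mul] at hI
  have e1 : Complex.exp (-Complex.I * k * ((2 * Real.pi : ℝ) : ℂ)) = 1 := by
    rw [Complex.exp_eq_one_iff]; exact ⟨-k, by push_cast; ring⟩
  rw [ex_two_pi, ex_zero, e1] at hI
  simp only [Complex.ofReal_zero, mul_zero, Complex.exp_zero, sub_self] at hI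
  rw [mul_assoc, ← mul_sub, mul_eq_zero] at hI
  have h2 := hI.resolve_left Complex.I_ne_zero
  unfold cf
  rw [sub_eq_zero.1 h2]; ring

lemma av_mono {g h : ℝ → ℝ} (hg : IntervalIntegrable g volume 0 (2 * Real.pi)) (hh : IntervalIntegrable h volume 0 (2 * Real.pi))
    (H : ∀ᵐ x, x ∈ Ioc 0 (2 * Real.pi) → g x ≤ h x) : av g ≤ av h := by
  unfold av
  have := intervalIntegral.integral_mono_ae_restrict (μ := volume) (a := 0) (b := 2 * Real.pi) (by positivity) hg hh
    (by
      rw [← restrict_Ioc_eq_restrict_Icc]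
      exact (ae_restrict_iff' measurableSet_Ioc).2 H)
  gcongr

lemma rc_av {h : ℝ → ℝ} (ha : Adm (fun x => (h x : ℂ))) (m : ℤ) : rc h m = av (fun x => h x * Real.cos (m * x)) := by
  rw [rc, cf, av]
  have e : (1 / (2 * Real.pi) : ℂ) = ((1 / (2 * Real.pi) : ℝ) : ℂ) := by push_cast; rfl
  rw [e, Complex.re_ofReal_mul]
  congr 1
  have h1 := Complex.reCLM.intervalIntegral_comp_comm (ha.intervalIntegrable_exp m)
  rw [Complex.reCLM_apply] at h1
  rw [← h1]
  refine intervalIntegral.integral_congr fun x _ => ?_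
  simp only [Complex.reCLM_apply]
  rw [Complex.re_ofReal_mul, show -Complex.I * (m : ℂ) * (x : ℂ) = ((-(m * x) : ℝ) : ℂ) * Complex.I by push_cast; ring,
    Complex.exp_ofReal_mul_I_re, Real.cos_neg]

lemma normsq_sum (n : ℕ) (z : ℕ → ℝ) (x : ℝ) : ‖∑ j ∈ Finset.range n, (z j : ℂ) * ex x ^ j‖ ^ 2 =
    ∑ j ∈ Finset.range n, z j * ∑ k ∈ Finset.range n, z k * Real.cos (((j : ℤ) - k : ℤ) * x) := by
  rw [← Complex.normSq_eq_norm_sq, Complex.normSq_apply, Complex.re_sum, Complex.im_sum]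
  simp only [Complex.re_ofReal_mul, Complex.im_ofReal_mul, ex_pow_re, ex_pow_im]
  rw [Finset.sum_mul, Finset.sum_mul, ← Finset.sum_add_distrib]
  refine Finset.sum_congr rfl fun j _ => ?_
  rw [mul_assoc, mul_assoc, ← mul_add, Finset.mul_sum, Finset.mul_sum, ← Finset.sum_add_distrib]
  congr 1
  refine Finset.sum_congr rfl fun k _ => ?_
  push_cast
  rw [sub_mul, Real.cos_sub]; ring

lemma ii_cos {h : ℝ → ℝ} (ha : Adm (fun x => (h x : ℂ))) {g : ℝ → ℝ} (hg : Continuous g) :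
    IntervalIntegrable (fun x => h x * g x) volume 0 (2 * Real.pi) := by
  have h1 : IntervalIntegrable h volume 0 (2 * Real.pi) := by
    have := ha.intervalIntegrable
    rw [intervalIntegrable_iff] at this ⊢
    exact this.re
  exact h1.mul_continuousOn hg.continuousOn

lemma QF_av {h : ℝ → ℝ} (ha : Adm (fun x => (h x : ℂ))) (n : ℕ) (z : ℕ → ℝ) :
    QF (rc h) n z = av (fun x => h x * ‖∑ j ∈ Finset.range n, (z j : ℂ) * ex x ^ j‖ ^ 2) := by
  unfold QF av
  simp only [normsq_sum, Finset.mul_sum]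
  rw [intervalIntegral.integral_finsetSum, Finset.mul_sum]
  · refine Finset.sum_congr rfl fun j _ => ?_
    rw [intervalIntegral.integral_finsetSum, Finset.mul_sum]
    · refine Finset.sum_congr rfl fun k _ => ?_
      rw [rc_av ha, av, ← intervalIntegral.integral_const_mul, ← intervalIntegral.integral_mul_const, ← intervalIntegral.integral_const_mul, ← intervalIntegral.integral_const_mul]
      refine intervalIntegral.integral_congr fun x _ => ?_
      ring
    · intro k _
      exact ii_cos ha (by fun_prop)
  · intro j _
    have : Continuous fun x : ℝ => ∑ k ∈ Finset.range n, z j * (z k * Real.cos (((j : ℤ) - k : ℤ) * x)) := by fun_prop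
    have h2 := ii_cos ha this
    simpa only [Finset.mul_sum] using h2

end EE
end

noncomputable section
namespace EE
open MeasureTheory Set Filter Topology

variable {J : Finset ℝ} {σ : ℝ → ℝ} {s : ℝ}

lemma dsum {c : ℤ → ℝ} (hc : ∀ m, c (-m) = c m) (M : ℕ) :
    ∑ j ∈ Finset.range M, ∑ k ∈ Finset.range M, c ((j : ℤ) - k) =
      M * c 0 + 2 * ∑ k ∈ Finset.range M, if k = 0 then 0 else ((M : ℝ) - k) * c k := by
  induction M with
  | zero => simp
  | succ M ih =>
    have e1 : ∑ j ∈ Finset.range (M + 1), ∑ k ∈ Finset.range (M + 1), c ((j : ℤ) - k) =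
        ∑ j ∈ Finset.range M, ∑ k ∈ Finset.range M, c ((j : ℤ) - k) + 2 * ∑ j ∈ Finset.range M, c ((M : ℤ) - j) + c 0 := by
      rw [Finset.sum_range_succ]
      simp only [Finset.sum_range_succ, Finset.sum_add_distrib, sub_self]
      have : ∑ j ∈ Finset.range M, c ((j : ℤ) - M) = ∑ j ∈ Finset.range M, c ((M : ℤ) - j) :=
        Finset.sum_congr rfl fun j _ => by rw [← hc]; congr 1; ring
      rw [this]; ring
    have e2 : ∑ j ∈ Finset.range M, c ((M : ℤ) - j) = ∑ k ∈ Finset.range (M + 1), if k = 0 then 0 else c k := by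
      rw [Finset.sum_range_succ', ← Finset.sum_range_reflect]
      simp only [Nat.add_eq_zero_iff, one_ne_zero, and_false, if_false, if_true, add_zero]
      refine Finset.sum_congr rfl fun j hj => ?_
      rw [Finset.mem_range] at hj
      congr 1
      push_cast [Nat.sub_sub, Nat.cast_sub (show 1 + j ≤ M by omega)]
      ring
    have e3 : ∑ k ∈ Finset.range (M + 1), (if k = 0 then 0 else (((M + 1 : ℕ) : ℝ) - k) * c k) =
        ∑ k ∈ Finset.range M, (if k = 0 then 0 else ((M : ℝ) - k) * c k) + ∑ k ∈ Finset.range (M + 1), if k = 0 then 0 else c k := by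
      have : ∑ k ∈ Finset.range M, (if k = 0 then 0 else ((M : ℝ) - k) * c k) = ∑ k ∈ Finset.range (M + 1), (if k = 0 then 0 else ((M : ℝ) - k) * c k) := by
        rw [Finset.sum_range_succ]; split_ifs <;> simp
      rw [this, ← Finset.sum_add_distrib]
      refine Finset.sum_congr rfl fun k _ => ?_
      split_ifs
      · simp
      · push_cast; ring
    rw [e1, ih, e2, e3]; push_cast; ring

/-- Fejer kernel -/
def KF (M : ℕ) (t : ℝ) : ℝ := (1 / (M : ℝ)) * ‖∑ j ∈ Finset.range M, ex t ^ j‖ ^ 2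

lemma KF_eq (M : ℕ) (t : ℝ) : KF M t = (1 / (M : ℝ)) * ∑ j ∈ Finset.range M, ∑ k ∈ Finset.range M, Real.cos (((j : ℤ) - k : ℤ) * t) := by
  have := normsq_sum M (fun _ => 1) t
  simp only [Complex.ofReal_one, one_mul] at this
  rw [KF, this]

lemma KF_nonneg (M : ℕ) (t : ℝ) : 0 ≤ KF M t := by unfold KF; positivity

lemma KF_cont (M : ℕ) : Continuous (KF M) := by
  have := ex_cont
  unfold KF; fun_prop

lemma KF_neg (M : ℕ) (t : ℝ) : KF M (-t) = KF M t := by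
  rw [KF_eq, KF_eq]; simp only [mul_neg, Real.cos_neg]

lemma KF_per (M : ℕ) (t : ℝ) : KF M (t + 2 * Real.pi) = KF M t := by
  unfold KF
  have : ex (t + 2 * Real.pi) = ex t := by
    rw [ex, ex]; push_cast
    rw [mul_add, Complex.exp_add, show Complex.I * (2 * Real.pi) = 2 * Real.pi * Complex.I by ring, Complex.exp_two_pi_mul_I, mul_one]
  rw [this]

lemma KF_cos (M : ℕ) (t : ℝ) : KF M t * (1 - Real.cos t) ≤ 2 / M := by
  have h1 : ‖∑ j ∈ Finset.range M, ex t ^ j‖ * ‖ex t - 1‖ = ‖ex t ^ M - 1‖ := by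
    rw [← norm_mul, geom_sum_mul]
  have h2 : ‖ex t - 1‖ ^ 2 = 2 * (1 - Real.cos t) := by
    rw [← Complex.normSq_eq_norm_sq, Complex.normSq_apply]
    have a := ex_pow_re t 1
    have b := ex_pow_im t 1
    simp only [pow_one, Nat.cast_one, one_mul] at a b
    simp only [Complex.sub_re, Complex.sub_im, Complex.one_re, Complex.one_im, a, b]
    nlinarith [Real.sin_sq_add_cos_sq t]
  have h3 : ‖ex t ^ M - 1‖ ≤ 2 := by
    refine (norm_sub_le _ _).trans ?_
    rw [norm_pow, ex_norm]; norm_num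
  have h4 : ‖∑ j ∈ Finset.range M, ex t ^ j‖ ^ 2 * (2 * (1 - Real.cos t)) ≤ 4 := by
    rw [← h2, ← mul_pow, h1]; nlinarith [norm_nonneg (ex t ^ M - 1)]
  unfold KF
  have h5 : (0 : ℝ) ≤ 1 / M := by positivity
  have := mul_le_mul_of_nonneg_left h4 h5
  calc _ = (1 / (M : ℝ) * (‖∑ j ∈ Finset.range M, ex t ^ j‖ ^ 2 * (2 * (1 - Real.cos t)))) / 2 := by ring
    _ ≤ 1 / (M : ℝ) * 4 / 2 := by linarith
    _ = _ := by ring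

/-- Fejer mean -/
def gF (J : Finset ℝ) (σ : ℝ → ℝ) (s : ℝ) (M : ℕ) (x : ℝ) : ℝ :=
  (1 / (M : ℝ)) * ∑ j ∈ Finset.range M, ∑ k ∈ Finset.range M, rc (Fs J σ s) ((j : ℤ) - k) * Real.cos (((j : ℤ) - k : ℤ) * x)

lemma av_sin {h : ℝ → ℝ} (ha : Adm (fun x => (h x : ℂ))) (hs : Sym h) (m : ℤ) : av (fun x => h x * Real.sin (m * x)) = 0 := by
  have h0 := congrArg Complex.im (rc_real hs m)
  rw [Complex.ofReal_im, cf] at h0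
  have e : (1 / (2 * Real.pi) : ℂ) = ((1 / (2 * Real.pi) : ℝ) : ℂ) := by push_cast; rfl
  rw [e, Complex.im_ofReal_mul] at h0
  have h1 := Complex.imCLM.intervalIntegral_comp_comm (ha.intervalIntegrable_exp m)
  rw [Complex.imCLM_apply] at h1
  rw [← h1] at h0
  have h2 : ∫ x in (0:ℝ)..(2 * Real.pi), Complex.imCLM ((h x : ℂ) * Complex.exp (-Complex.I * m * x)) = ∫ x in (0:ℝ)..(2 * Real.pi), -(h x * Real.sin (m * x)) := by
    refine intervalIntegral.integral_congr fun x _ => ?_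
    simp only [Complex.imCLM_apply]
    rw [Complex.im_ofReal_mul, show -Complex.I * (m : ℂ) * (x : ℂ) = ((-(m * x) : ℝ) : ℂ) * Complex.I by push_cast; ring,
      Complex.exp_ofReal_mul_I_im, Real.sin_neg, mul_neg]
  rw [h2, intervalIntegral.integral_neg] at h0
  rw [av]; linarith

lemma rc_shift {h : ℝ → ℝ} (ha : Adm (fun x => (h x : ℂ))) (hs : Sym h) (m : ℤ) (x : ℝ) :
    rc h m * Real.cos (m * x) = av (fun y => h y * Real.cos (m * (y - x))) := by
  have e : (fun y => h y * Real.cos (m * (y - x))) = fun y => Real.cos (m * x) * (h y * Real.cos (m * y)) + Real.sin (m * x) * (h y * Real.sin (m * y)) := by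
    funext y; rw [mul_sub, Real.cos_sub]; ring
  have h1 := rc_av ha m
  have h2 := av_sin ha hs m
  rw [e]
  unfold av at h1 h2 ⊢
  rw [intervalIntegral.integral_add ((ii_cos ha (by fun_prop)).const_mul _) ((ii_cos ha (by fun_prop)).const_mul _),
    intervalIntegral.integral_const_mul, intervalIntegral.integral_const_mul, h1]
  linear_combination (-Real.sin (m * x)) * h2

lemma gF_conv (h : Step J σ s) (hs : Sym (Fs J σ s)) (M : ℕ) (x : ℝ) :
    gF J σ s M x = av (fun y => Fs J σ s y * KF M (y - x)) := by
  simp only [gF, KF_eq, rc_shift (Fs_adm h) hs]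
  unfold av
  have e : ∀ y, Fs J σ s y * (1 / (M : ℝ) * ∑ j ∈ Finset.range M, ∑ k ∈ Finset.range M, Real.cos (((j : ℤ) - k : ℤ) * (y - x))) =
      ∑ j ∈ Finset.range M, ∑ k ∈ Finset.range M, (1 / (M : ℝ)) * (Fs J σ s y * Real.cos (((j : ℤ) - k : ℤ) * (y - x))) := by
    intro y
    simp only [Finset.mul_sum]
    refine Finset.sum_congr rfl fun j _ => Finset.sum_congr rfl fun k _ => by ring
  simp only [e]
  have I1 : ∀ j k : ℕ, IntervalIntegrable (fun y => (1 / (M : ℝ)) * (Fs J σ s y * Real.cos (((j : ℤ) - k : ℤ) * (y - x)))) volume 0 (2 * Real.pi) :=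
    fun j k => (ii_cos (Fs_adm h) (by fun_prop)).const_mul _
  rw [intervalIntegral.integral_finsetSum]
  · rw [Finset.mul_sum, Finset.mul_sum]
    refine Finset.sum_congr rfl fun j _ => ?_
    rw [intervalIntegral.integral_finsetSum fun k _ => I1 j k, Finset.mul_sum, Finset.mul_sum]
    refine Finset.sum_congr rfl fun k _ => ?_
    rw [intervalIntegral.integral_const_mul]; ring
  · intro j _
    have h2 := IntervalIntegrable.sum (Finset.range M) (fun k _ => I1 j k)
    rwa [Finset.sum_fn] at h2

/-- periodic extension -/
def fp (J : Finset ℝ) (σ : ℝ → ℝ) (s y : ℝ) : ℝ := Fs J σ s (toIocMod Real.two_pi_pos 0 y)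

lemma fp_per (y : ℝ) : fp J σ s (y + 2 * Real.pi) = fp J σ s y := by
  rw [fp, toIocMod_add_right]; rfl

lemma fp_eq {y : ℝ} (hy : y ∈ Ioc 0 (2 * Real.pi)) : fp J σ s y = Fs J σ s y := by
  rw [fp, (toIocMod_eq_self Real.two_pi_pos).2 (by simpa using hy)]

lemma fp_meas : Measurable (fp J σ s) := by
  have : Measurable (toIocMod Real.two_pi_pos 0) := by
    have e : toIocMod Real.two_pi_pos 0 = fun y => y - ((-⌊(0 + 2 * Real.pi - y) / (2 * Real.pi)⌋ : ℤ) : ℝ) * (2 * Real.pi) := by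
      funext y
      rw [← toIocDiv_eq_neg_floor, ← zsmul_eq_mul]; rfl
    rw [e]
    have h1 : Measurable fun y : ℝ => ⌊(0 + 2 * Real.pi - y) / (2 * Real.pi)⌋ := Int.measurable_floor.comp (by fun_prop)
    have h2 : Measurable fun y : ℝ => ((-⌊(0 + 2 * Real.pi - y) / (2 * Real.pi)⌋ : ℤ) : ℝ) :=
      (measurable_from_top (f := fun n : ℤ => ((-n : ℤ) : ℝ))).comp h1
    exact measurable_id.sub (h2.mul_const _)
  exact (Fs_meas J σ s).comp this

lemma gF_fp (h : Step J σ s) (hs : Sym (Fs J σ s)) (M : ℕ) (x : ℝ) :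
    gF J σ s M x = (1 / (2 * Real.pi)) * ∫ t in (-Real.pi)..Real.pi, fp J σ s (x + t) * KF M t := by
  rw [gF_conv h hs, av]
  congr 1
  have h1 : ∫ y in (0:ℝ)..(2 * Real.pi), Fs J σ s y * KF M (y - x) = ∫ y in (0:ℝ)..(0 + 2 * Real.pi), fp J σ s y * KF M (y - x) := by
    rw [zero_add]
    refine intervalIntegral.integral_congr_ae (Eventually.of_forall fun y hy => ?_)
    rw [uIoc_of_le (by positivity)] at hy
    rw [fp_eq hy]
  have hp : Function.Periodic (fun y => fp J σ s y * KF M (y - x)) (2 * Real.pi) := by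
    intro y
    simp only
    rw [fp_per, add_sub_right_comm, KF_per]
  rw [h1, hp.intervalIntegral_add_eq 0 (x - Real.pi)]
  have := intervalIntegral.integral_comp_add_left (a := -Real.pi) (b := Real.pi) (fun y => fp J σ s y * KF M (y - x)) x
  simp only [add_sub_cancel_left] at this
  rw [this]
  congr 1 <;> ring

lemma gF_fp' (h : Step J σ s) (hs : Sym (Fs J σ s)) (M : ℕ) (x : ℝ) :
    gF J σ s M x = (1 / (2 * Real.pi)) * ∫ t in (-Real.pi)..Real.pi, fp J σ s (x - t) * KF M t := by
  rw [gF_fp h hs]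
  congr 1
  have := intervalIntegral.integral_comp_neg (a := -Real.pi) (b := Real.pi) (fun t => fp J σ s (x + t) * KF M t)
  rw [neg_neg] at this
  rw [← this]
  refine intervalIntegral.integral_congr fun t _ => ?_
  simp only [KF_neg]; rfl

lemma KF_int {M : ℕ} (hM : 0 < M) : ∫ t in (-Real.pi)..Real.pi, KF M t = 2 * Real.pi := by
  have hp : Function.Periodic (KF M) (2 * Real.pi) := KF_per M
  have h1 := hp.intervalIntegral_add_eq (-Real.pi) 0
  rw [show -Real.pi + 2 * Real.pi = Real.pi by ring, zero_add] at h1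
  rw [h1]
  have h2 := QF_av (h := fun _ => 1) (by simpa using adm_const 1) M (fun _ => 1)
  simp only [Complex.ofReal_one, one_mul] at h2
  have h3 : QF (rc fun _ => 1) M (fun _ => 1) = M := by
    unfold QF rc
    simp only [Complex.ofReal_one, cf_const, one_mul, mul_one]
    have : ∀ j ∈ Finset.range M, ∑ k ∈ Finset.range M, (if (j : ℤ) - k = 0 then (1 : ℂ) else 0).re = 1 := by
      intro j hj
      rw [Finset.sum_eq_single j]
      · simp
      · intro k _ hk
        rw [if_neg (by omega)]; simp
      · exact fun h => absurd hj h
    rw [Finset.sum_congr rfl this]; simp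
  rw [h3, av] at h2
  unfold KF
  rw [intervalIntegral.integral_const_mul]
  have hM' : (0 : ℝ) < M := by exact_mod_cast hM
  have := Real.pi_pos
  field_simp at h2 ⊢
  linarith

end EE
end

noncomputable section
namespace EE
open MeasureTheory Set Filter Topology

variable {J : Finset ℝ} {σ : ℝ → ℝ} {s : ℝ}

lemma sep (K : Finset ℝ) : ∃ δ : ℝ, 0 < δ ∧ ∀ a ∈ K, ∀ b ∈ K, a ≠ b → δ ≤ |a - b| := by
  have : ∀ᶠ δ : ℝ in 𝓝[>] 0, ∀ a ∈ K, ∀ b ∈ K, a ≠ b → δ ≤ |a - b| := by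
    refine (Filter.eventually_all_finset K).2 fun a _ => (Filter.eventually_all_finset K).2 fun b _ => ?_
    by_cases hab : a = b
    · exact Eventually.of_forall fun δ h => absurd hab h
    · have : 0 < |a - b| := abs_pos.2 (sub_ne_zero.2 hab)
      filter_upwards [nhdsWithin_le_nhds (Iio_mem_nhds this)] with δ hδ _
      exact le_of_lt hδ
  obtain ⟨δ, h1, h2⟩ := (this.and self_mem_nhdsWithin).exists
  exact ⟨δ, h2, h1⟩

lemma Fs_ne {x y : ℝ} (hxy : x ≤ y) (h : Fs J σ s y ≠ Fs J σ s x) : ∃ φ ∈ J, x ≤ φ ∧ φ < y := by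
  by_contra! hc
  apply h
  unfold Fs
  congr 2
  refine Finset.sum_congr rfl fun φ hφ => ?_
  congr 1
  unfold hv
  by_cases h1 : x ≤ φ
  · rw [if_neg (not_lt.2 (hc φ hφ h1)), if_neg (not_lt.2 h1)]
  · rw [if_pos (by linarith), if_pos (by linarith)]

lemma Fs_left (h : Step J σ s) {y : ℝ} (hy : y ≤ 0) : Fs J σ s y = s := by
  unfold Fs
  rw [Finset.sum_eq_zero, mul_zero, add_zero]
  intro φ hφ
  rw [hv, if_neg (by linarith [(h.mem φ hφ).1]), mul_zero]

lemma Fs_right (h : Step J σ s) {y : ℝ} (hy : 2 * Real.pi ≤ y) : Fs J σ s y = s := by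
  unfold Fs
  have : ∑ φ ∈ J, σ φ * hv φ y = ∑ φ ∈ J, σ φ := by
    refine Finset.sum_congr rfl fun φ hφ => ?_
    rw [hv, if_pos (by linarith [(h.mem φ hφ).2]), mul_one]
  rw [this, h.sum0, mul_zero, add_zero]

/-- uniform one-sided constancy -/
lemma one_side (h : Step J σ s) : ∃ δ : ℝ, 0 < δ ∧ δ < Real.pi ∧ ∀ x ∈ Ioc 0 (2 * Real.pi), ∀ t : ℝ, |t| < δ →
    fp J σ s (x + t) = Fs J σ s x ∨ fp J σ s (x - t) = Fs J σ s x := by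
  obtain ⟨d, hd, hsep⟩ := sep (insert 0 (insert (2 * Real.pi) J))
  have hpi := Real.pi_pos
  refine ⟨min (d / 2) 1, by positivity, (min_le_right _ _).trans_lt (by linarith [Real.pi_gt_three]), fun x hx => ?_⟩
  have hfp : ∀ y ∈ Ioo (-d) (2 * Real.pi + d), y ∈ Ioc (-(2 * Real.pi)) (4 * Real.pi) → fp J σ s y = Fs J σ s y := by
    intro y hy hy2
    by_cases h0 : y ≤ 0
    · rw [Fs_left h h0, ← fp_per, fp_eq ⟨by linarith [hy2.1], by linarith⟩]
      by_contra hc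
      replace hc : Fs J σ s (y + 2 * Real.pi) ≠ Fs J σ s (2 * Real.pi) := by rw [Fs_right h le_rfl]; exact hc
      obtain ⟨φ, hφ, a, b⟩ := Fs_ne (x := y + 2 * Real.pi) (y := 2 * Real.pi) (by linarith) (Ne.symm hc)
      have := hsep (2 * Real.pi) (by simp) φ (by simp [hφ]) b.ne'
      rw [abs_of_pos (by linarith)] at this
      linarith [hy.1]
    · by_cases h1 : y ≤ 2 * Real.pi
      · exact fp_eq ⟨by linarith, h1⟩
      · have e := fp_per (J := J) (σ := σ) (s := s) (y - 2 * Real.pi)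
        rw [sub_add_cancel] at e
        rw [Fs_right h (by linarith), e, fp_eq ⟨by linarith, by linarith [hy2.2]⟩]
        by_contra hc
        replace hc : Fs J σ s (y - 2 * Real.pi) ≠ Fs J σ s 0 := by rw [Fs_left h le_rfl]; exact hc
        obtain ⟨φ, hφ, a, b⟩ := Fs_ne (x := 0) (y := y - 2 * Real.pi) (by linarith) hc
        have := hsep φ (by simp [hφ]) 0 (by simp) (h.mem φ hφ).1.ne'
        rw [sub_zero, abs_of_pos (h.mem φ hφ).1] at this
        linarith [hy.2]
  have key : ∀ t : ℝ, 0 ≤ t → t < min (d / 2) 1 → fp J σ s (x + t) = Fs J σ s x ∨ fp J σ s (x - t) = Fs J σ s x := by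
    intro t ht0 ht
    have t1 := ht.trans_le (min_le_left _ _)
    have t2 := ht.trans_le (min_le_right _ _)
    have hx1 := hx.1
    have hx2 := hx.2
    have := Real.pi_gt_three
    rw [hfp (x + t) ⟨by linarith, by linarith⟩ ⟨by linarith, by linarith⟩, hfp (x - t) ⟨by linarith, by linarith⟩ ⟨by linarith, by linarith⟩]
    by_contra! hc
    obtain ⟨φ, hφ, a, b⟩ := Fs_ne (by linarith) hc.1
    obtain ⟨ψ, hψ, a', b'⟩ := Fs_ne (by linarith) (Ne.symm hc.2)
    have := hsep φ (by simp [hφ]) ψ (by simp [hψ]) (by intro e; linarith)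
    rw [abs_of_pos (by linarith)] at this
    linarith
  intro t ht
  rcases abs_cases t with ⟨e, _⟩ | ⟨e, _⟩
  · exact key t (by linarith) (by rwa [e] at ht)
  · have := key (-t) (by linarith) (by rwa [e] at ht)
    rw [sub_neg_eq_add, ← sub_eq_add_neg] at this
    exact this.symm

lemma fp_abs (h : Step J σ s) (y : ℝ) : |fp J σ s y| = 1 := Fs_abs h _

lemma fpK_int (h : Step J σ s) (M : ℕ) (x c : ℝ) (hc : c ^ 2 = 1) : IntervalIntegrable (fun t => fp J σ s (x + c * t) * KF M t) volume (-Real.pi) Real.pi := by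
  have h1 : IntervalIntegrable (fun t => fp J σ s (x + c * t)) volume (-Real.pi) Real.pi := by
    refine (intervalIntegrable_const (c := (1 : ℝ))).mono_fun ((fp_meas.comp (by fun_prop)).aestronglyMeasurable) ?_
    refine Eventually.of_forall fun t => ?_
    simp only [Real.norm_eq_abs, fp_abs h]; norm_num
  exact h1.mul_continuousOn (KF_cont M).continuousOn

lemma gF_abs (h : Step J σ s) (hs : Sym (Fs J σ s)) {M : ℕ} (hM : 0 < M) (x : ℝ) : |gF J σ s M x| ≤ 1 := by
  have hpi := Real.pi_pos
  rw [gF_fp h hs, abs_mul, abs_of_pos (by positivity)]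
  have h1 : |∫ t in (-Real.pi)..Real.pi, fp J σ s (x + t) * KF M t| ≤ 2 * Real.pi := by
    rw [← KF_int hM, ← Real.norm_eq_abs]
    refine intervalIntegral.norm_integral_le_of_norm_le (by linarith) ?_ ((KF_cont M).intervalIntegrable _ _)
    refine Eventually.of_forall fun t _ => ?_
    rw [Real.norm_eq_abs, abs_mul, fp_abs h, one_mul, abs_of_nonneg (KF_nonneg M t)]
  calc _ ≤ 1 / (2 * Real.pi) * (2 * Real.pi) := by gcongr
    _ = 1 := by field_simp

lemma gF_local (h : Step J σ s) (hs : Sym (Fs J σ s)) : ∃ C : ℝ, 0 ≤ C ∧ ∀ M : ℕ, 0 < M → ∀ x ∈ Ioc 0 (2 * Real.pi),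
    - (C / M) ≤ Fs J σ s x * gF J σ s M x := by
  obtain ⟨δ, hδ, hδ2, H⟩ := one_side h
  have hcos : 0 < 1 - Real.cos δ := by
    have := Real.cos_lt_cos_of_nonneg_of_le_pi le_rfl hδ2.le hδ
    rw [Real.cos_zero] at this; linarith
  have hpi := Real.pi_pos
  refine ⟨2 / (1 - Real.cos δ), by positivity, fun M hM x hx => ?_⟩
  have hM' : (0 : ℝ) < M := by exact_mod_cast hM
  have e1 := gF_fp h hs M x
  have e2 := gF_fp' h hs M x
  have i1 := fpK_int h M x 1 (by norm_num)
  have i2 := fpK_int h M x (-1) (by norm_num)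
  simp only [one_mul, neg_mul, ← sub_eq_add_neg] at i1 i2
  have e3 : Fs J σ s x * gF J σ s M x = (1 / (4 * Real.pi)) * ∫ t in (-Real.pi)..Real.pi,
      Fs J σ s x * (fp J σ s (x + t) * KF M t + fp J σ s (x - t) * KF M t) := by
    rw [intervalIntegral.integral_const_mul, intervalIntegral.integral_add i1 i2]
    have : gF J σ s M x = (gF J σ s M x + gF J σ s M x) / 2 := by ring
    rw [this]
    nth_rw 1 [e1]
    rw [e2]
    field_simp
    ring
  have hF := Fs_abs h x
  have h2 : ∀ t ∈ Icc (-Real.pi) Real.pi, -(4 / (1 - Real.cos δ) / M) ≤ Fs J σ s x * (fp J σ s (x + t) * KF M t + fp J σ s (x - t) * KF M t) := by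
    intro t ht
    have hK := KF_nonneg M t
    have ha := abs_le.1 (show |Fs J σ s x * fp J σ s (x + t)| ≤ 1 by rw [abs_mul, hF, fp_abs h]; norm_num)
    have hb := abs_le.1 (show |Fs J σ s x * fp J σ s (x - t)| ≤ 1 by rw [abs_mul, hF, fp_abs h]; norm_num)
    have hsq := h.val x
    have e : Fs J σ s x * (fp J σ s (x + t) * KF M t + fp J σ s (x - t) * KF M t) = (Fs J σ s x * fp J σ s (x + t) + Fs J σ s x * fp J σ s (x - t)) * KF M t := by ring
    have hpos : 0 ≤ 4 / (1 - Real.cos δ) / M := by positivity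
    rw [e]
    by_cases hd : |t| < δ
    · have : 0 ≤ Fs J σ s x * fp J σ s (x + t) + Fs J σ s x * fp J σ s (x - t) := by
        rcases H x hx t hd with h1 | h1 <;> rw [h1] <;> nlinarith
      linarith [mul_nonneg this hK]
    · have hc : Real.cos t ≤ Real.cos δ := by
        rw [← Real.cos_abs t]
        exact Real.cos_le_cos_of_nonneg_of_le_pi hδ.le (abs_le.2 ht) (not_lt.1 hd)
      have h3 : KF M t * (1 - Real.cos δ) ≤ 2 / M := (mul_le_mul_of_nonneg_left (by linarith) hK).trans (KF_cos M t)
      have h4 : KF M t ≤ 2 / M / (1 - Real.cos δ) := by rwa [le_div_iff₀ hcos]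
      have h5 : 4 / (1 - Real.cos δ) / M = 2 * (2 / M / (1 - Real.cos δ)) := by ring
      rw [h5]
      nlinarith
  have h3 := intervalIntegral.integral_mono_on (μ := volume) (a := -Real.pi) (b := Real.pi) (by linarith) intervalIntegrable_const ((i1.add i2).const_mul (Fs J σ s x)) h2
  rw [intervalIntegral.integral_const] at h3
  rw [e3]
  have h4 := mul_le_mul_of_nonneg_left h3 (show (0:ℝ) ≤ 1 / (4 * Real.pi) by positivity)
  refine le_trans (le_of_eq ?_) h4
  rw [smul_eq_mul]
  field_simp
  ring

end EE
end

noncomputable section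
namespace EE
open MeasureTheory Set Filter Topology ComplexConjugate

variable {J : Finset ℝ} {σ : ℝ → ℝ} {s : ℝ}

/-- coefficients of the Fejer mean -/
def gam (J : Finset ℝ) (σ : ℝ → ℝ) (s : ℝ) (M k : ℕ) : ℝ := if k = 0 then 0 else (1 - (k : ℝ) / M) * rc (Fs J σ s) k

lemma gF_poly (h : Step J σ s) (hs : Sym (Fs J σ s)) {M : ℕ} (hM : 0 < M) (x : ℝ) :
    gF J σ s M x = f0 J σ s + 2 * ∑ k ∈ Finset.range M, gam J σ s M k * Real.cos (k * x) := by
  have hM' : (M : ℝ) ≠ 0 := by positivity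
  have := dsum (c := fun m => rc (Fs J σ s) m * Real.cos (m * x))
    (fun m => by rw [rc_even hs]; push_cast; rw [neg_mul, Real.cos_neg]) M
  rw [gF, this, rc_Fs0 h, mul_add]
  congr 1
  · simp [hM']
  · rw [mul_left_comm, Finset.mul_sum (s := Finset.range M)]
    congr 1
    refine Finset.sum_congr rfl fun k _ => ?_
    unfold gam
    split_ifs
    · simp
    · push_cast; field_simp

lemma conj_ex (x : ℝ) : conj (ex x) = ex (2 * Real.pi - x) := by
  rw [ex, ex, ← Complex.exp_conj]
  simp only [map_mul, Complex.conj_I, Complex.conj_ofReal]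
  push_cast
  rw [mul_sub, sub_eq_add_neg, Complex.exp_add, show Complex.I * (2 * Real.pi) = 2 * Real.pi * Complex.I by ring, Complex.exp_two_pi_mul_I, one_mul, neg_mul]

lemma cf_pow (j : ℕ) (k : ℤ) : cf (fun x => ex x ^ j) k = if k = j then 1 else 0 := by
  have h := cf_const 1 (k - j)
  simp only [sub_eq_zero] at h
  rw [← h]
  unfold cf
  congr 1
  refine intervalIntegral.integral_congr fun x _ => ?_
  simp only [one_mul]
  rw [ex_pow, ← Complex.exp_add]
  congr 1; push_cast; ring

lemma cf_pow_conj (j : ℕ) (k : ℤ) : cf (fun x => conj (ex x ^ j)) k = if k = -j then 1 else 0 := by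
  have e : (fun x => conj (ex x ^ j)) = refl (fun x => ex x ^ j) := by
    funext x; rw [map_pow, conj_ex]; rfl
  rw [e, cf_refl, cf_pow]
  simp only [neg_eq_iff_eq_neg]

lemma gam_bound (h : Step J σ s) {M k : ℕ} (hk : k < M) : |gam J σ s M k| * k ≤ J.card := by
  unfold gam
  split_ifs with h0
  · simp
  · have hk' : (0 : ℝ) < k := by exact_mod_cast Nat.pos_of_ne_zero h0
    have hM : (0 : ℝ) < M := by exact_mod_cast (Nat.zero_le k).trans_lt hk
    have := rc_Fs_bound h (n := k) (by omega)
    have h1 : (k : ℝ) / M ≤ 1 := by rw [div_le_one hM]; exact_mod_cast hk.le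
    have h2 : 0 ≤ (k : ℝ) / M := by positivity
    rw [abs_mul, abs_of_nonneg (by linarith)]
    rw [le_div_iff₀ hk'] at this
    have h3 : 0 ≤ |rc (Fs J σ s) k| := abs_nonneg _

    nlinarith [mul_nonneg h3 hk'.le]

lemma gam_sq (h : Step J σ s) (M : ℕ) : ∑ k ∈ Finset.range M, (k * gam J σ s M k) ^ 2 ≤ J.card ^ 2 * M := by
  calc _ ≤ ∑ k ∈ Finset.range M, (J.card : ℝ) ^ 2 := by
        refine Finset.sum_le_sum fun k hk => ?_
        have := gam_bound h (Finset.mem_range.1 hk)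
        rw [← sq_abs, abs_mul, Nat.abs_cast, mul_comm]
        exact pow_le_pow_left₀ (by positivity) this 2
    _ = _ := by rw [Finset.sum_const, Finset.card_range, nsmul_eq_mul]; ring

lemma gF_cont (M : ℕ) : Continuous (gF J σ s M) := by
  unfold gF; fun_prop

lemma gF_cplx (h : Step J σ s) (hs : Sym (Fs J σ s)) {M : ℕ} (hM : 0 < M) (x : ℝ) :
    (gF J σ s M x : ℂ) = f0 J σ s + (∑ k ∈ Finset.range M, (gam J σ s M k : ℂ) * ex x ^ k + ∑ k ∈ Finset.range M, (gam J σ s M k : ℂ) * conj (ex x ^ k)) := by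
  rw [gF_poly h hs hM, ← Finset.sum_add_distrib]
  push_cast
  rw [Finset.mul_sum]
  congr 1
  refine Finset.sum_congr rfl fun k _ => ?_
  rw [← mul_add, Complex.add_conj, ex_pow_re]; push_cast; ring

lemma cf_gF (h : Step J σ s) (hs : Sym (Fs J σ s)) {M : ℕ} (hM : 0 < M) (n : ℕ) :
    cf (fun x => (gF J σ s M x : ℂ)) n = if n = 0 then (f0 J σ s : ℂ) else if n < M then (gam J σ s M n : ℂ) else 0 := by
  have hc := ex_cont
  have e : (fun x => (gF J σ s M x : ℂ)) = fun x => (f0 J σ s : ℂ) + (∑ k ∈ Finset.range M, (gam J σ s M k : ℂ) * ex x ^ k + ∑ k ∈ Finset.range M, (gam J σ s M k : ℂ) * conj (ex x ^ k)) :=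
    funext fun x => gF_cplx h hs hM x
  have a1 : ∀ k ∈ Finset.range M, Adm (fun x => (gam J σ s M k : ℂ) * ex x ^ k) := fun k _ => adm_cont (by fun_prop)
  have a2 : ∀ k ∈ Finset.range M, Adm (fun x => (gam J σ s M k : ℂ) * conj (ex x ^ k)) := fun k _ => adm_cont (by fun_prop)
  rw [e, cf_add (adm_const _) (adm_cont (by fun_prop)), cf_add (adm_cont (by fun_prop)) (adm_cont (by fun_prop)), cf_const, cf_sum _ _ a1, cf_sum _ _ a2]
  simp only [cf_smul, cf_pow, cf_pow_conj]
  have z2 : ∑ k ∈ Finset.range M, (gam J σ s M k : ℂ) * (if (n : ℤ) = -(k : ℤ) then 1 else 0) = 0 := by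
    refine Finset.sum_eq_zero fun k _ => ?_
    by_cases hk : k = 0
    · simp [gam, hk]
    · rw [if_neg (by omega), mul_zero]
  have z1 : ∑ k ∈ Finset.range M, (gam J σ s M k : ℂ) * (if (n : ℤ) = (k : ℤ) then 1 else 0) = if n < M then (gam J σ s M n : ℂ) else 0 := by
    simp only [Nat.cast_inj, mul_ite, mul_one, mul_zero, Finset.sum_ite_eq, Finset.mem_range]
  rw [z1, z2, add_zero]
  by_cases h0 : n = 0
  · subst h0
    simp [hM, gam]
  · simp [h0]

lemma gF_sym (h : Step J σ s) (hs : Sym (Fs J σ s)) {M : ℕ} (hM : 0 < M) : Sym (gF J σ s M) := by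
  refine Eventually.of_forall fun x _ => ?_
  rw [gF_poly h hs hM, gF_poly h hs hM]
  congr 2
  refine Finset.sum_congr rfl fun k _ => ?_
  congr 1
  rw [mul_sub, show (k : ℝ) * (2 * Real.pi) - k * x = -(k * x) + k * (2 * Real.pi) by ring, Real.cos_add_nat_mul_two_pi, Real.cos_neg]

lemma cf_D (h : Step J σ s) (hs : Sym (Fs J σ s)) {M : ℕ} (hM : 0 < M) (n : ℕ) :
    ‖cf (fun x => ((Fs J σ s x - gF J σ s M x : ℝ) : ℂ)) n‖ ^ 2 ≤
      if n = 0 then 0 else if n < M then (J.card : ℝ) ^ 2 / M ^ 2 else (J.card : ℝ) ^ 2 / n ^ 2 := by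
  have hM' : (0 : ℝ) < M := by exact_mod_cast hM
  have e : (fun x => ((Fs J σ s x - gF J σ s M x : ℝ) : ℂ)) = fun x => (Fs J σ s x : ℂ) + (-1) * (gF J σ s M x : ℂ) := by
    funext x; push_cast; ring
  have a : Adm (fun x => (gF J σ s M x : ℂ)) := adm_cont (Complex.continuous_ofReal.comp (gF_cont M))
  rw [e, cf_add (Fs_adm h) ((adm_const _).mul a), cf_smul, cf_gF h hs hM, ← rc_real hs]
  by_cases h0 : n = 0
  · subst h0
    simp only [if_true, Nat.cast_zero, rc_Fs0 h]; simp
  simp only [h0, if_false]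
  have hn : (0 : ℝ) < n := by exact_mod_cast Nat.pos_of_ne_zero h0
  have hb := rc_Fs_bound h (n := n) (by omega)
  have hb2 : rc (Fs J σ s) n ^ 2 ≤ (J.card : ℝ) ^ 2 / n ^ 2 := by
    rw [← div_pow, ← sq_abs]; exact pow_le_pow_left₀ (abs_nonneg _) hb 2
  by_cases hnM : n < M
  · simp only [hnM, if_true]
    rw [gam, if_neg h0]
    have : (rc (Fs J σ s) (n : ℤ) : ℂ) + -1 * (((1 - (n : ℝ) / M) * rc (Fs J σ s) n : ℝ) : ℂ) = (((n : ℝ) / M * rc (Fs J σ s) n : ℝ) : ℂ) := by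
      push_cast; ring
    rw [this, Complex.norm_real, Real.norm_eq_abs, sq_abs, mul_pow]
    calc _ ≤ ((n : ℝ) / M) ^ 2 * ((J.card : ℝ) ^ 2 / n ^ 2) := by gcongr
      _ = _ := by field_simp
  · simp only [hnM, if_false, mul_zero, add_zero]
    rw [Complex.norm_real, Real.norm_eq_abs, sq_abs]
    exact hb2

lemma D_adm (h : Step J σ s) (M : ℕ) : Adm (fun x => ((Fs J σ s x - gF J σ s M x : ℝ) : ℂ)) := by
  have a : Adm (fun x => (gF J σ s M x : ℂ)) := adm_cont (Complex.continuous_ofReal.comp (gF_cont M))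
  have := (Fs_adm h).add ((adm_const (-1)).mul a)
  refine Eq.mpr (congrArg Adm (funext fun x => ?_)) this
  push_cast; ring

lemma D_sym (h : Step J σ s) (hs : Sym (Fs J σ s)) {M : ℕ} (hM : 0 < M) : Sym (fun x => Fs J σ s x - gF J σ s M x) := by
  filter_upwards [hs, gF_sym h hs hM] with x h1 h2 hx
  rw [h1 hx, h2 hx]

lemma D_mean (h : Step J σ s) (hs : Sym (Fs J σ s)) {M : ℕ} (hM : 0 < M) : av (fun x => Fs J σ s x - gF J σ s M x) = 0 := by
  have h1 := rc_av (D_adm h M) 0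
  simp only [Int.cast_zero, zero_mul, Real.cos_zero, mul_one] at h1
  rw [← h1, rc]
  have h2 := cf_D h hs hM 0
  simp only [if_true] at h2
  have h3 : ‖cf (fun x => ((Fs J σ s x - gF J σ s M x : ℝ) : ℂ)) ((0 : ℕ) : ℤ)‖ = 0 := by
    nlinarith [norm_nonneg (cf (fun x => ((Fs J σ s x - gF J σ s M x : ℝ) : ℂ)) ((0 : ℕ) : ℤ))]
  rw [norm_eq_zero] at h3
  rw [Nat.cast_zero] at h3
  rw [h3]; rfl

lemma D_sq (h : Step J σ s) (hs : Sym (Fs J σ s)) {M : ℕ} (hM : 0 < M) :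
    av (fun x => (Fs J σ s x - gF J σ s M x) ^ 2) ≤ 6 * (J.card : ℝ) ^ 2 / M := by
  have hM' : (1 : ℝ) ≤ M := by exact_mod_cast hM
  have hp := (parseval (D_adm h M)).nat_add_neg
  have e1 : (fun x => ‖((Fs J σ s x - gF J σ s M x : ℝ) : ℂ)‖ ^ 2) = fun x => (Fs J σ s x - gF J σ s M x) ^ 2 := by
    funext x; rw [Complex.norm_real, Real.norm_eq_abs, sq_abs]
  rw [e1] at hp
  have ht := hp.tendsto_sum_nat
  have hge : av (fun x => (Fs J σ s x - gF J σ s M x) ^ 2) ≤ av (fun x => (Fs J σ s x - gF J σ s M x) ^ 2) + ‖cf (fun x => ((Fs J σ s x - gF J σ s M x : ℝ) : ℂ)) 0‖ ^ 2 := by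
    linarith [sq_nonneg ‖cf (fun x => ((Fs J σ s x - gF J σ s M x : ℝ) : ℂ)) 0‖]
  refine hge.trans (le_of_tendsto ht (Eventually.of_forall fun L => ?_))
  have key : ∀ L : ℕ, ∑ n ∈ Finset.range L, (‖cf (fun x => ((Fs J σ s x - gF J σ s M x : ℝ) : ℂ)) n‖ ^ 2 + ‖cf (fun x => ((Fs J σ s x - gF J σ s M x : ℝ) : ℂ)) (-n)‖ ^ 2) ≤
      2 * (J.card : ℝ) ^ 2 * (if L ≤ M then (L : ℝ) / M ^ 2 else 3 / M - 2 / L) := by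
    intro L
    induction L with
    | zero => simp
    | succ L ih =>
      rw [Finset.sum_range_succ, cf_even (D_sym h hs hM)]
      have hD := cf_D h hs hM L
      have hJ : (0 : ℝ) ≤ (J.card : ℝ) ^ 2 := by positivity
      by_cases hL : L < M
      · rw [if_pos hL.le] at ih
        rw [if_pos (by omega)]
        have : ‖cf (fun x => ((Fs J σ s x - gF J σ s M x : ℝ) : ℂ)) L‖ ^ 2 ≤ (J.card : ℝ) ^ 2 / M ^ 2 := by
          refine hD.trans ?_
          split_ifs
          · positivity
          · exact le_rfl
        have e : 2 * (J.card : ℝ) ^ 2 * (((L + 1 : ℕ) : ℝ) / M ^ 2) = 2 * (J.card : ℝ) ^ 2 * ((L : ℝ) / M ^ 2) + 2 * ((J.card : ℝ) ^ 2 / M ^ 2) := by push_cast; ring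
        rw [e]; linarith
      · rw [if_neg (by omega)]
        rw [if_neg (by omega), if_neg hL] at hD
        have hL1 : (M : ℝ) ≤ L := by exact_mod_cast not_lt.1 hL
        have hL0 : (0 : ℝ) < L := by linarith
        have ih2 : (if L ≤ M then (L : ℝ) / M ^ 2 else 3 / M - 2 / L) = 3 / M - 2 / L := by
          split_ifs with hh
          · have : L = M := by omega
            subst this
            field_simp
            norm_num
          · rfl
        rw [ih2] at ih
        have e : (1 : ℝ) / L ^ 2 ≤ 2 / L - 2 / ((L + 1 : ℕ) : ℝ) := by
          push_cast
          rw [div_sub_div _ _ hL0.ne' (by positivity), div_le_div_iff₀ (by positivity) (by positivity)]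
          nlinarith
        have e2 : (J.card : ℝ) ^ 2 / L ^ 2 = (J.card : ℝ) ^ 2 * (1 / L ^ 2) := by ring
        rw [e2] at hD
        have := mul_le_mul_of_nonneg_left e hJ
        have e3 : 2 * (J.card : ℝ) ^ 2 * (3 / M - 2 / ((L + 1 : ℕ) : ℝ)) = 2 * (J.card : ℝ) ^ 2 * (3 / M - 2 / L) + 2 * ((J.card : ℝ) ^ 2 * (2 / L - 2 / ((L + 1 : ℕ) : ℝ))) := by ring
        rw [e3]; linarith
  refine (key L).trans ?_
  have : (if L ≤ M then (L : ℝ) / M ^ 2 else 3 / M - 2 / L) ≤ 3 / M := by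
    split_ifs with hh
    · rw [div_le_div_iff₀ (by positivity) (by positivity)]
      have : (L : ℝ) ≤ M := by exact_mod_cast hh
      nlinarith
    · have : (0 : ℝ) ≤ 2 / L := by positivity
      linarith
  calc _ ≤ 2 * (J.card : ℝ) ^ 2 * (3 / M) := by gcongr
    _ = _ := by ring

lemma av_sq (n : ℕ) (z : ℕ → ℝ) : av (fun x => ‖∑ j ∈ Finset.range n, (z j : ℂ) * ex x ^ j‖ ^ 2) = ∑ j ∈ Finset.range n, z j ^ 2 := by
  have h2 := QF_av (h := fun _ => 1) (by simpa using adm_const 1) n z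
  simp only [one_mul] at h2
  rw [← h2]
  unfold QF rc
  simp only [Complex.ofReal_one, cf_const]
  refine Finset.sum_congr rfl fun j hj => ?_
  rw [Finset.sum_eq_single j]
  · simp; ring
  · intro k _ hk
    rw [if_neg (by omega)]; simp
  · exact fun h => absurd hj h

end EE
end

noncomputable section
namespace EE
open MeasureTheory Set Filter Topology ComplexConjugate

variable {J : Finset ℝ} {σ : ℝ → ℝ} {s : ℝ}

/-- variational bound -/
lemma var_bound {c : ℤ → ℝ} (hev : ∀ m, c (-m) = c m) {δ : ℝ} (hδ : 0 < δ) (h : Coer c δ) {n : ℕ} (hn : 0 < n)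
    {z : ℕ → ℝ} (hz : z 0 = 1) : 1 ≤ xs c n 0 * QF c n z := by
  set x := xs c n with hx
  have hx0 : 0 < x 0 := by
    obtain ⟨m, rfl⟩ : ∃ m, n = m + 1 := ⟨n - 1, by omega⟩
    exact xs_pos hev hδ h m
  have h1 := h n (fun k => z k - x k / x 0)
  have h2 : 0 ≤ QF c n (fun k => z k - x k / x 0) := le_trans (mul_nonneg hδ.le (Finset.sum_nonneg fun _ _ => sq_nonneg _)) h1
  have s1 : ∀ w : ℕ → ℝ, ∑ j ∈ Finset.range n, w j * ∑ k ∈ Finset.range n, c ((j : ℤ) - k) * x k = w 0 := by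
    intro w
    rw [Finset.sum_eq_single 0]
    · rw [hx, xs_eq hev hδ h hn]; simp
    · intro j hj hj0
      rw [hx, xs_eq hev hδ h (Finset.mem_range.1 hj), if_neg hj0, mul_zero]
    · intro hh; exact absurd (Finset.mem_range.2 hn) hh
  have s2 : ∑ j ∈ Finset.range n, x j * ∑ k ∈ Finset.range n, c ((j : ℤ) - k) * z k = z 0 := by
    rw [← s1 z]
    simp only [Finset.mul_sum]
    rw [Finset.sum_comm]
    refine Finset.sum_congr rfl fun j _ => Finset.sum_congr rfl fun k _ => ?_
    rw [← hev, neg_sub]; ring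
  have e : QF c n (fun k => z k - x k / x 0) = QF c n z - 1 / x 0 := by
    have a1 := s1 z
    have a2 := s1 x
    have : QF c n (fun k => z k - x k / x 0) = QF c n z - (1 / x 0) * (∑ j ∈ Finset.range n, z j * ∑ k ∈ Finset.range n, c ((j : ℤ) - k) * x k)
        - (1 / x 0) * (∑ j ∈ Finset.range n, x j * ∑ k ∈ Finset.range n, c ((j : ℤ) - k) * z k)
        + (1 / x 0) ^ 2 * (∑ j ∈ Finset.range n, x j * ∑ k ∈ Finset.range n, c ((j : ℤ) - k) * x k) := by
      unfold QF
      simp only [Finset.mul_sum]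
      simp only [← Finset.sum_sub_distrib, ← Finset.sum_add_distrib]
      refine Finset.sum_congr rfl fun j _ => Finset.sum_congr rfl fun k _ => ?_
      ring
    rw [this, a1, a2, s2, hz]
    field_simp
    ring
  rw [e] at h2
  have := mul_nonneg hx0.le h2
  rw [mul_sub, mul_one_div, div_self hx0.ne'] at this
  linarith

/-- analytic polynomial -/
def PF (J : Finset ℝ) (σ : ℝ → ℝ) (s : ℝ) (M : ℕ) (z : ℂ) : ℂ := ∑ k ∈ Finset.range M, (gam J σ s M k : ℂ) * z ^ k

/-- its derivative -/
def PD (J : Finset ℝ) (σ : ℝ → ℝ) (s : ℝ) (M : ℕ) (z : ℂ) : ℂ := ∑ k ∈ Finset.range M, (gam J σ s M k : ℂ) * (k * z ^ (k - 1))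

lemma PF_deriv (M : ℕ) (z : ℂ) : HasDerivAt (PF J σ s M) (PD J σ s M z) z := by
  unfold PF PD
  exact HasDerivAt.fun_sum fun k _ => (hasDerivAt_pow k z).const_mul _

/-- outer function -/
def HF (J : Finset ℝ) (σ : ℝ → ℝ) (s τ : ℝ) (M : ℕ) (z : ℂ) : ℂ := Complex.exp (-τ * PF J σ s M z)

lemma HF_deriv (τ : ℝ) (M : ℕ) (z : ℂ) : HasDerivAt (HF J σ s τ M) (-τ * PD J σ s M z * HF J σ s τ M z) z := by
  unfold HF
  exact ((PF_deriv M z).const_mul _).cexp.congr_deriv (by ring)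

lemma HF_diff (τ : ℝ) (M : ℕ) : Differentiable ℂ (HF J σ s τ M) := fun z => (HF_deriv τ M z).differentiableAt

lemma PD_cont (M : ℕ) : Continuous (PD J σ s M) := by unfold PD; fun_prop

lemma HF_zero (τ : ℝ) (M : ℕ) : HF J σ s τ M 0 = 1 := by
  unfold HF PF
  rw [Finset.sum_eq_zero, mul_zero, Complex.exp_zero]
  intro k _
  by_cases hk : k = 0
  · simp [gam, hk]
  · simp [hk]

lemma PF_re (h : Step J σ s) (hs : Sym (Fs J σ s)) {M : ℕ} (hM : 0 < M) (x : ℝ) :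
    2 * (PF J σ s M (ex x)).re = gF J σ s M x - f0 J σ s := by
  rw [gF_poly h hs hM, PF, Complex.re_sum]
  simp only [Complex.re_ofReal_mul, ex_pow_re]; ring

lemma HF_norm (h : Step J σ s) (hs : Sym (Fs J σ s)) {M : ℕ} (hM : 0 < M) (τ x : ℝ) :
    ‖HF J σ s τ M (ex x)‖ ^ 2 = Real.exp (-(τ * (gF J σ s M x - f0 J σ s))) := by
  rw [HF, Complex.norm_exp, ← Complex.ofReal_neg, Complex.re_ofReal_mul, ← PF_re h hs hM, ← Real.exp_nat_mul]
  congr 1; push_cast; ring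

/-- coefficients of the test polynomial -/
def az (J : Finset ℝ) (σ : ℝ → ℝ) (s τ : ℝ) (M k : ℕ) : ℝ := (cf (fun x => HF J σ s τ M (ex x)) k).re

lemma az_real (τ : ℝ) (M k : ℕ) : (az J σ s τ M k : ℂ) = cf (fun x => HF J σ s τ M (ex x)) k := by
  unfold az
  refine Complex.conj_eq_iff_re.1 ?_
  have e : (fun x => HF J σ s τ M (ex x)) = fun x => conj (refl (fun x => HF J σ s τ M (ex x)) x) := by
    funext x
    rw [refl, ← conj_ex]
    unfold HF PF
    rw [← Complex.exp_conj]
    simp only [map_mul, map_neg, Complex.conj_ofReal, map_sum, map_pow, Complex.conj_conj]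
  have e2 : conj (cf (fun x => HF J σ s τ M (ex x)) k) = cf (fun x => conj (HF J σ s τ M (ex x))) (-k) := by
    unfold cf
    rw [map_mul, ← intervalIntegral.intervalIntegral_conj]
    congr 1
    · rw [map_div₀, map_mul, Complex.conj_ofReal, map_one, map_ofNat]
    · refine intervalIntegral.integral_congr fun x _ => ?_
      simp only [map_mul, ← Complex.exp_conj, map_neg, Complex.conj_I, Complex.conj_ofReal, neg_neg]
      congr 2
      simp
  rw [e2, ← cf_refl]
  congr 1
  funext x
  have := congrFun e (2 * Real.pi - x)
  simp only [refl, sub_sub_cancel] at this ⊢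
  rw [this, Complex.conj_conj]

lemma az_zero (τ : ℝ) (M : ℕ) : az J σ s τ M 0 = 1 := by
  have h1 := az_real (J := J) (σ := σ) (s := s) τ M 0
  rw [Nat.cast_zero, mean_entire (HF_diff τ M), HF_zero] at h1
  exact_mod_cast h1

/-- test polynomial -/
def pT (J : Finset ℝ) (σ : ℝ → ℝ) (s τ : ℝ) (M m : ℕ) (z : ℂ) : ℂ := ∑ k ∈ Finset.range m, (az J σ s τ M k : ℂ) * z ^ k

/-- remainder -/
def qT (J : Finset ℝ) (σ : ℝ → ℝ) (s τ : ℝ) (M m : ℕ) (x : ℝ) : ℂ := HF J σ s τ M (ex x) - pT J σ s τ M m (ex x)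

lemma pT_diff (τ : ℝ) (M m : ℕ) : Differentiable ℂ (pT J σ s τ M m) := by unfold pT; fun_prop

lemma qT_cont (τ : ℝ) (M m : ℕ) : Continuous (qT J σ s τ M m) :=
  ((HF_diff τ M).continuous.comp ex_cont).sub ((pT_diff τ M m).continuous.comp ex_cont)

lemma cf_qT (τ : ℝ) (M m : ℕ) (k : ℤ) : cf (qT J σ s τ M m) k = if k < m then 0 else cf (fun x => HF J σ s τ M (ex x)) k := by
  have c1 : Continuous fun x => HF J σ s τ M (ex x) := (HF_diff (J := J) (σ := σ) (s := s) τ M).continuous.comp ex_cont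
  have c2 : Continuous fun x => pT J σ s τ M m (ex x) := (pT_diff (J := J) (σ := σ) (s := s) τ M m).continuous.comp ex_cont
  have hc := ex_cont
  have e : qT J σ s τ M m = fun x => HF J σ s τ M (ex x) + (-1) * pT J σ s τ M m (ex x) := by
    funext x; rw [qT]; ring
  have e1 : cf (fun x => pT J σ s τ M m (ex x)) k = ∑ j ∈ Finset.range m, (az J σ s τ M j : ℂ) * if k = j then 1 else 0 := by
    unfold pT
    rw [cf_sum _ _ fun j _ => adm_cont (by fun_prop)]
    simp only [cf_smul, cf_pow]
  rw [e, cf_add (adm_cont c1) ((adm_const _).mul (adm_cont c2)), cf_smul, e1]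
  by_cases hk : k < 0
  · rw [cf_neg_entire (HF_diff τ M) hk, if_pos (by omega), Finset.sum_eq_zero]
    · simp
    · intro j _; rw [if_neg (by omega), mul_zero]
  · obtain ⟨n, rfl⟩ : ∃ n : ℕ, k = n := ⟨k.toNat, by omega⟩
    simp only [Nat.cast_inj, mul_ite, mul_one, mul_zero, Finset.sum_ite_eq, Finset.mem_range, Nat.cast_lt]
    split_ifs with hh
    · rw [az_real]; ring
    · simp

lemma PD_av (h : Step J σ s) (M : ℕ) : av (fun x => ‖ex x * PD J σ s M (ex x)‖ ^ 2) ≤ J.card ^ 2 * M := by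
  have e : ∀ x, ex x * PD J σ s M (ex x) = ∑ k ∈ Finset.range M, ((k * gam J σ s M k : ℝ) : ℂ) * ex x ^ k := by
    intro x
    unfold PD
    rw [Finset.mul_sum]
    refine Finset.sum_congr rfl fun k _ => ?_
    rcases k with _ | k
    · simp
    · rw [Nat.add_sub_cancel, pow_succ]; push_cast; ring
  simp only [e]
  rw [av_sq]
  exact gam_sq h M

lemma av_const_mul (c : ℝ) (g : ℝ → ℝ) : av (fun x => c * g x) = c * av g := by
  unfold av; rw [intervalIntegral.integral_const_mul]; ring

lemma qT_av (h : Step J σ s) (hs : Sym (Fs J σ s)) {M m : ℕ} (hM : 0 < M) (hm : 0 < m) (τ : ℝ) :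
    av (fun x => ‖qT J σ s τ M m x‖ ^ 2) ≤ Real.exp (τ * f0 J σ s) * (τ ^ 2 * Real.exp |τ| * J.card ^ 2 * M / m ^ 2) := by
  have hm' : (0 : ℝ) < m := by exact_mod_cast hm
  have hd : deriv (HF J σ s τ M) = fun z => -τ * PD J σ s M z * HF J σ s τ M z := funext fun z => (HF_deriv τ M z).deriv
  have cH := (HF_diff (J := J) (σ := σ) (s := s) τ M).continuous
  have cP := PD_cont (J := J) (σ := σ) (s := s) M
  have cd : Continuous (deriv (HF J σ s τ M)) := by rw [hd]; fun_prop
  have hc := ex_cont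
  have cE : Continuous fun x => ex x * deriv (HF J σ s τ M) (ex x) := hc.mul (cd.comp hc)
  have p1 := parseval (adm_cont (qT_cont (J := J) (σ := σ) (s := s) τ M m))
  have p2 := (parseval (adm_cont cE)).mul_left (1 / (m : ℝ) ^ 2)
  have h1 := hasSum_le (fun k => by
    rw [cf_qT, cf_ex_deriv (HF_diff τ M) cd]
    split_ifs with hk
    · rw [norm_zero, zero_pow two_ne_zero]; positivity
    · have : (m : ℝ) ≤ k := by exact_mod_cast not_lt.1 hk
      rw [norm_mul, Complex.norm_intCast, mul_pow, sq_abs, ← mul_assoc]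
      refine le_mul_of_one_le_left (by positivity) ?_
      rw [one_div, ← div_eq_inv_mul, one_le_div (by positivity)]
      gcongr) p1 p2
  refine h1.trans ?_
  have h2 : av (fun x => ‖ex x * deriv (HF J σ s τ M) (ex x)‖ ^ 2) ≤ av (fun x => (τ ^ 2 * Real.exp |τ| * Real.exp (τ * f0 J σ s)) * ‖ex x * PD J σ s M (ex x)‖ ^ 2) := by
    refine av_mono (Continuous.intervalIntegrable (by fun_prop) _ _) (Continuous.intervalIntegrable (by fun_prop) _ _) (Eventually.of_forall fun x _ => ?_)
    rw [hd]
    simp only [norm_mul, mul_pow, HF_norm h hs hM, norm_neg, Complex.norm_real, Real.norm_eq_abs, sq_abs]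
    have hb : Real.exp (-(τ * (gF J σ s M x - f0 J σ s))) ≤ Real.exp |τ| * Real.exp (τ * f0 J σ s) := by
      rw [← Real.exp_add]
      refine Real.exp_le_exp.2 ?_
      have := gF_abs h hs hM x
      have h3 : |τ * gF J σ s M x| ≤ |τ| := by rw [abs_mul]; exact mul_le_of_le_one_right (abs_nonneg _) this
      have := (abs_le.1 h3).1
      linarith
    have h0 : 0 ≤ τ ^ 2 * (‖ex x‖ ^ 2 * ‖PD J σ s M (ex x)‖ ^ 2) := by positivity
    calc _ = (τ ^ 2 * (‖ex x‖ ^ 2 * ‖PD J σ s M (ex x)‖ ^ 2)) * Real.exp (-(τ * (gF J σ s M x - f0 J σ s))) := by ring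
      _ ≤ (τ ^ 2 * (‖ex x‖ ^ 2 * ‖PD J σ s M (ex x)‖ ^ 2)) * (Real.exp |τ| * Real.exp (τ * f0 J σ s)) := by gcongr
      _ = _ := by ring
  rw [av_const_mul] at h2
  have h3 := PD_av h M
  calc _ ≤ 1 / (m : ℝ) ^ 2 * ((τ ^ 2 * Real.exp |τ| * Real.exp (τ * f0 J σ s)) * (J.card ^ 2 * M)) := by
        gcongr
        exact h2.trans (by gcongr)
    _ = _ := by ring

end EE
end

noncomputable section
namespace EE
open MeasureTheory Set Filter Topology ComplexConjugate

variable {J : Finset ℝ} {σ : ℝ → ℝ} {s : ℝ}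

lemma exp_quad (y : ℝ) : Real.exp y ≤ 1 + y + y ^ 2 * (Real.exp |y| / 2) := by
  rcases le_total 0 y with h0 | h0
  · have d : ∀ x : ℝ, HasDerivAt (fun x : ℝ => 1 + x + x ^ 2 * (Real.exp x / 2) - Real.exp x)
        (1 + x * Real.exp x + x ^ 2 * (Real.exp x / 2) - Real.exp x) x := fun x =>
      ((((hasDerivAt_id' x).const_add 1).add ((hasDerivAt_pow 2 x).mul ((Real.hasDerivAt_exp x).div_const 2))).sub
        (Real.hasDerivAt_exp x)).congr_deriv (by push_cast; ring)
    have m : MonotoneOn (fun x : ℝ => 1 + x + x ^ 2 * (Real.exp x / 2) - Real.exp x) (Ici 0) := by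
      refine monotoneOn_of_deriv_nonneg (convex_Ici 0) (fun x _ => (d x).continuousAt.continuousWithinAt)
        (fun x _ => (d x).differentiableAt.differentiableWithinAt) fun x hx => ?_
      rw [(d x).deriv]
      have h1 := Real.add_one_le_exp (-x)
      have e : Real.exp (-x) * Real.exp x = 1 := by rw [← Real.exp_add]; simp
      have : 0 ≤ x ^ 2 * (Real.exp x / 2) := by positivity
      nlinarith [Real.exp_pos x]
    have := m (mem_Ici.2 le_rfl) (mem_Ici.2 h0) h0
    simp only [Real.exp_zero] at this
    rw [abs_of_nonneg h0]; linarith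
  · have d : ∀ x : ℝ, HasDerivAt (fun x : ℝ => 1 + x + x ^ 2 / 2 - Real.exp x) (1 + x - Real.exp x) x := fun x =>
      ((((hasDerivAt_id' x).const_add 1).add ((hasDerivAt_pow 2 x).div_const 2)).sub
        (Real.hasDerivAt_exp x)).congr_deriv (by push_cast; ring)
    have m : Antitone (fun x : ℝ => 1 + x + x ^ 2 / 2 - Real.exp x) := by
      refine antitone_of_deriv_nonpos (fun x => (d x).differentiableAt) fun x => ?_
      rw [(d x).deriv]
      have h1 := Real.add_one_le_exp x
      linarith
    have := m h0
    simp only [Real.exp_zero] at this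
    have h2 : 1 ≤ Real.exp |y| := Real.one_le_exp (abs_nonneg y)
    nlinarith [sq_nonneg y]

lemma pw_aux {τ f g S : ℝ} (hf : |f| ≤ 1) (hg : |g| ≤ 1) (hD : |f - g| ≤ S) :
    (Real.exp (τ * (f - g)) - 1) ^ 2 * Real.exp (τ * g) ≤ (τ * (f - g)) ^ 2 * Real.exp ((S + 1) * |τ|) := by
  set y := τ * (f - g) with hy
  have hS : 0 ≤ S := (abs_nonneg _).trans hD
  have hyS : |y| ≤ S * |τ| := by rw [hy, abs_mul, mul_comm]; gcongr
  have hτf : |τ * f| ≤ |τ| := by rw [abs_mul]; exact mul_le_of_le_one_right (abs_nonneg _) hf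
  have hτg : |τ * g| ≤ |τ| := by rw [abs_mul]; exact mul_le_of_le_one_right (abs_nonneg _) hg
  have hτ := abs_nonneg τ
  rcases le_total 0 y with h0 | h0
  · have h1 : Real.exp y - 1 ≤ y * Real.exp y := by
      have := Real.add_one_le_exp (-y)
      have e : Real.exp (-y) * Real.exp y = 1 := by rw [← Real.exp_add]; simp
      nlinarith [Real.exp_pos y]
    have h2 : 0 ≤ Real.exp y - 1 := by linarith [Real.add_one_le_exp y]
    calc _ ≤ (y * Real.exp y) ^ 2 * Real.exp (τ * g) := by gcongr
      _ = y ^ 2 * Real.exp (y + τ * f) := by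
          rw [mul_pow, ← Real.exp_nat_mul, mul_assoc, ← Real.exp_add]
          congr 2; rw [hy]; push_cast; ring
      _ ≤ _ := by
          gcongr
          have := (abs_le.1 hyS).2
          have := (abs_le.1 hτf).2
          linarith
  · have h1 : (Real.exp y - 1) ^ 2 ≤ y ^ 2 := by
      have a := Real.add_one_le_exp y
      have b : Real.exp y ≤ 1 := Real.exp_le_one_iff.2 h0
      nlinarith
    have h2 : Real.exp (τ * g) ≤ Real.exp ((S + 1) * |τ|) := by
      refine Real.exp_le_exp.2 ?_
      have := (abs_le.1 hτg).2
      nlinarith [mul_nonneg hS hτ]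
    gcongr

lemma pw {τ f g S l E : ℝ} {H q : ℂ} (hE : 0 < E) (hH : ‖H‖ ^ 2 = E * Real.exp (-(τ * g))) (hf : |f| ≤ 1) (hg : |g| ≤ 1)
    (hD : |f - g| ≤ S) (hl : 0 < l) :
    Real.exp (τ * f) * ‖H - q‖ ^ 2 ≤ E * (1 + τ * (f - g) + τ ^ 2 * (f - g) ^ 2 * (Real.exp (S * |τ|) / 2 + l * Real.exp ((S + 1) * |τ|)))
      - 2 * E * (q / H).re + (1 / l + Real.exp |τ|) * ‖q‖ ^ 2 := by
  have hHp : 0 < ‖H‖ ^ 2 := by rw [hH]; positivity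
  have hHn : 0 < ‖H‖ := by
    rcases (norm_nonneg H).lt_or_eq with h | h
    · exact h
    · rw [← h] at hHp; norm_num at hHp
  have hH0 : H ≠ 0 := norm_pos_iff.1 hHn
  have hτ := abs_nonneg τ
  set r := q / H with hr
  have hq : q = H * r := by rw [hr]; field_simp
  have n1 : ‖H - q‖ ^ 2 = ‖H‖ ^ 2 * (1 - 2 * r.re + ‖r‖ ^ 2) := by
    rw [hq, show H - H * r = H * (1 - r) by ring, norm_mul, mul_pow]
    congr 1
    rw [← Complex.normSq_eq_norm_sq, ← Complex.normSq_eq_norm_sq, Complex.normSq_apply, Complex.normSq_apply]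
    simp only [Complex.sub_re, Complex.sub_im, Complex.one_re, Complex.one_im]; ring
  have n2 : ‖q‖ = ‖H‖ * ‖r‖ := by rw [hq, norm_mul]
  have e1 : Real.exp (τ * f) * ‖H‖ ^ 2 = E * Real.exp (τ * (f - g)) := by
    rw [hH, mul_left_comm, ← Real.exp_add]; congr 2; ring
  set u := Real.exp (τ * (f - g)) with hu
  -- third term
  have t3 : E * u * ‖r‖ ^ 2 ≤ Real.exp |τ| * ‖q‖ ^ 2 := by
    rw [← e1, mul_assoc, ← mul_pow, ← n2]
    gcongr
    exact (le_abs_self _).trans (by rw [abs_mul]; exact mul_le_of_le_one_right hτ hf)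
  -- first term
  have hyS : |τ * (f - g)| ≤ S * |τ| := by rw [abs_mul, mul_comm]; gcongr
  have t1 : u ≤ 1 + τ * (f - g) + τ ^ 2 * (f - g) ^ 2 * (Real.exp (S * |τ|) / 2) := by
    refine (exp_quad _).trans ?_
    rw [mul_pow]
    have := Real.exp_le_exp.2 hyS
    gcongr
  -- cross term
  have t2 : -2 * E * (u - 1) * r.re ≤ E * (τ ^ 2 * (f - g) ^ 2 * (l * Real.exp ((S + 1) * |τ|))) + 1 / l * ‖q‖ ^ 2 := by
    have hre := Complex.abs_re_le_norm r
    have a1 : -2 * E * (u - 1) * r.re ≤ 2 * (E * |u - 1| / ‖H‖) * ‖q‖ := by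
      have e : 2 * (E * |u - 1| / ‖H‖) * ‖q‖ = 2 * E * (|u - 1| * ‖r‖) := by rw [n2]; field_simp
      rw [e]
      have : -((u - 1) * r.re) ≤ |u - 1| * ‖r‖ := by
        refine (neg_le_abs _).trans ?_
        rw [abs_mul]; gcongr
      nlinarith
    have a2 : 2 * (E * |u - 1| / ‖H‖) * ‖q‖ ≤ l * (E * |u - 1| / ‖H‖) ^ 2 + 1 / l * ‖q‖ ^ 2 := by
      have := sq_nonneg (l * (E * |u - 1| / ‖H‖) - ‖q‖)
      have e : l * (E * |u - 1| / ‖H‖) ^ 2 + 1 / l * ‖q‖ ^ 2 - 2 * (E * |u - 1| / ‖H‖) * ‖q‖ = (l * (E * |u - 1| / ‖H‖) - ‖q‖) ^ 2 / l := by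
        field_simp; ring
      have : 0 ≤ (l * (E * |u - 1| / ‖H‖) - ‖q‖) ^ 2 / l := by positivity
      linarith
    have a3 : (E * |u - 1| / ‖H‖) ^ 2 = E * ((u - 1) ^ 2 * Real.exp (τ * g)) := by
      rw [div_pow, mul_pow, sq_abs, hH, Real.exp_neg]
      field_simp
    rw [a3] at a2
    have a4 := pw_aux (τ := τ) hf hg hD
    rw [← hu, mul_pow] at a4
    have a5 := mul_le_mul_of_nonneg_left a4 (mul_pos hl hE).le
    nlinarith
  rw [n1, ← mul_assoc, e1]
  have e : E * u * (1 - 2 * r.re + ‖r‖ ^ 2) = E * u - 2 * E * r.re + (-2 * E * (u - 1) * r.re) + E * u * ‖r‖ ^ 2 := by ring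
  rw [e]
  have := mul_le_mul_of_nonneg_left t1 hE.le
  nlinarith

lemma av_add {g h : ℝ → ℝ} (hg : IntervalIntegrable g volume 0 (2 * Real.pi)) (hh : IntervalIntegrable h volume 0 (2 * Real.pi)) :
    av (fun x => g x + h x) = av g + av h := by
  unfold av; rw [intervalIntegral.integral_add hg hh]; ring

lemma av_const (c : ℝ) : av (fun _ => c) = c := by
  unfold av; rw [intervalIntegral.integral_const, smul_eq_mul]
  have := Real.pi_pos; field_simp; ring

lemma adm_ii {h : ℝ → ℝ} (ha : Adm (fun x => (h x : ℂ))) : IntervalIntegrable h volume 0 (2 * Real.pi) := by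
  simpa using ii_cos ha (continuous_const (y := (1 : ℝ)))

lemma qH_mean {M m : ℕ} (hm : 0 < m) (τ : ℝ) : Continuous (fun x => (qT J σ s τ M m x / HF J σ s τ M (ex x)).re) ∧
    av (fun x => (qT J σ s τ M m x / HF J σ s τ M (ex x)).re) = 0 := by
  set u : ℂ → ℂ := fun z => 1 - pT J σ s τ M m z * Complex.exp (τ * PF J σ s M z) with hu
  have dP : Differentiable ℂ (PF J σ s M) := fun z => (PF_deriv M z).differentiableAt
  have dp := pT_diff (J := J) (σ := σ) (s := s) τ M m
  have du : Differentiable ℂ u := by rw [hu]; fun_prop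
  have e : ∀ x, qT J σ s τ M m x / HF J σ s τ M (ex x) = u (ex x) := by
    intro x
    simp only [qT, hu]
    have h0 : HF J σ s τ M (ex x) ≠ 0 := Complex.exp_ne_zero _
    rw [sub_div, div_self h0]
    congr 1
    rw [HF, div_eq_mul_inv, ← Complex.exp_neg]
    congr 2; ring
  simp only [e]
  have cu : Continuous fun x => u (ex x) := du.continuous.comp ex_cont
  refine ⟨Complex.continuous_re.comp cu, ?_⟩
  have h1 := mean_entire du
  have h2 : u 0 = 0 := by
    have h3 : PF J σ s M 0 = 0 := by
      unfold PF
      refine Finset.sum_eq_zero fun k _ => ?_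
      by_cases hk : k = 0
      · simp [gam, hk]
      · simp [hk]
    have h4 : pT J σ s τ M m 0 = 1 := by
      unfold pT
      rw [Finset.sum_eq_single 0]
      · rw [az_zero]; simp
      · intro k _ hk; simp [hk]
      · intro hh; exact absurd (Finset.mem_range.2 hm) hh
    simp [hu, h3, h4]
  rw [h2, cf] at h1
  simp only [Int.cast_zero, mul_zero, zero_mul, Complex.exp_zero, mul_one] at h1
  have h5 := congrArg Complex.re h1
  rw [show (1 / (2 * Real.pi) : ℂ) = ((1 / (2 * Real.pi) : ℝ) : ℂ) by push_cast; rfl, Complex.re_ofReal_mul] at h5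
  have h6 := Complex.reCLM.intervalIntegral_comp_comm (cu.intervalIntegrable (μ := volume) 0 (2 * Real.pi))
  rw [Complex.reCLM_apply] at h6
  rw [← h6] at h5
  exact h5

/-- main test-function estimate -/
lemma QF_test (h : Step J σ s) (hs : Sym (Fs J σ s)) {M m : ℕ} (hM : 0 < M) (hm : 0 < m) (τ : ℝ) {S l : ℝ} (hl : 0 < l)
    (hS : ∀ x ∈ Ioc 0 (2 * Real.pi), |Fs J σ s x - gF J σ s M x| ≤ S) :
    QF (wc (Fs J σ s) τ) m (az J σ s τ M) ≤ Real.exp (τ * f0 J σ s) * (1 +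
      (τ ^ 2 * (Real.exp (S * |τ|) / 2 + l * Real.exp ((S + 1) * |τ|)) * (6 * (J.card : ℝ) ^ 2 / M) +
      (1 / l + Real.exp |τ|) * (τ ^ 2 * Real.exp |τ| * J.card ^ 2 * M / m ^ 2))) := by
  have hE := Real.exp_pos (τ * f0 J σ s)
  set E := Real.exp (τ * f0 J σ s) with hEd
  set c1 := τ ^ 2 * (Real.exp (S * |τ|) / 2 + l * Real.exp ((S + 1) * |τ|)) with hc1
  set c2 := 1 / l + Real.exp |τ| with hc2
  have aE := eS_adm (Fs_meas J σ s) (B := 1) (fun x _ => (Fs_abs h x).le) τ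
  have hQ := QF_av aE m (az J σ s τ M)
  obtain ⟨qc, q0⟩ := qH_mean (J := J) (σ := σ) (s := s) (M := M) hm τ
  have iD := adm_ii (D_adm h M)
  have iD2 : IntervalIntegrable (fun x => (Fs J σ s x - gF J σ s M x) ^ 2) volume 0 (2 * Real.pi) := by
    refine adm_ii (h := fun x => (Fs J σ s x - gF J σ s M x) ^ 2) ?_
    refine Eq.mpr (congrArg Adm (funext fun x => ?_)) ((D_adm h M).mul (D_adm h M))
    push_cast; ring
  have cq := qT_cont (J := J) (σ := σ) (s := s) τ M m
  have iq : IntervalIntegrable (fun x => ‖qT J σ s τ M m x‖ ^ 2) volume 0 (2 * Real.pi) := Continuous.intervalIntegrable (by fun_prop) _ _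
  have iq2 := qc.intervalIntegrable (μ := volume) 0 (2 * Real.pi)
  have hc := ex_cont
  have hle : QF (wc (Fs J σ s) τ) m (az J σ s τ M) ≤ av (fun x => (E + E * τ * (Fs J σ s x - gF J σ s M x)) + (E * c1 * (Fs J σ s x - gF J σ s M x) ^ 2 +
      (-(2 * E) * (qT J σ s τ M m x / HF J σ s τ M (ex x)).re + c2 * ‖qT J σ s τ M m x‖ ^ 2))) := by
    change QF (rc fun x => Real.exp (τ * Fs J σ s x)) m (az J σ s τ M) ≤ _
    rw [hQ]
    refine av_mono (ii_cos aE (by fun_prop)) ((intervalIntegrable_const.add (iD.const_mul _)).add ((iD2.const_mul _).add ((iq2.const_mul _).add (iq.const_mul _)))) ?_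
    refine Eventually.of_forall fun x hx => ?_
    have := pw (τ := τ) (f := Fs J σ s x) (g := gF J σ s M x) (S := S) (l := l) (E := E) (H := HF J σ s τ M (ex x)) (q := qT J σ s τ M m x) hE
      (by rw [HF_norm h hs hM, hEd, ← Real.exp_add]; congr 1; ring) (Fs_abs h x).le (gF_abs h hs hM x) (hS x hx) hl
    rw [show HF J σ s τ M (ex x) - qT J σ s τ M m x = ∑ j ∈ Finset.range m, (az J σ s τ M j : ℂ) * ex x ^ j by rw [qT, pT]; ring] at this
    refine this.trans (le_of_eq ?_)
    rw [hc1, hc2]; ring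
  refine hle.trans ?_
  rw [av_add (intervalIntegrable_const.add (iD.const_mul _)) ((iD2.const_mul _).add ((iq2.const_mul _).add (iq.const_mul _))),
    av_add intervalIntegrable_const (iD.const_mul _), av_add (iD2.const_mul _) ((iq2.const_mul _).add (iq.const_mul _)), av_add (iq2.const_mul _) (iq.const_mul _),
    av_const, av_const_mul, av_const_mul, av_const_mul, av_const_mul, q0, D_mean h hs hM]
  have g1 := D_sq h hs hM
  have g2 := qT_av h hs hM hm τ
  rw [← hEd] at g2
  have p1 : 0 ≤ c1 := by rw [hc1]; positivity
  have p2 : 0 ≤ c2 := by rw [hc2]; positivity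
  calc _ ≤ E + E * τ * 0 + (E * c1 * (6 * (J.card : ℝ) ^ 2 / M) + (-(2 * E) * 0 + c2 * (E * (τ ^ 2 * Real.exp |τ| * J.card ^ 2 * M / m ^ 2)))) := by gcongr
    _ = _ := by ring

lemma ell_le (h : Step J σ s) (hs : Sym (Fs J σ s)) {M m : ℕ} (hM : 0 < M) (hm : 0 < m) (τ : ℝ) {S l : ℝ} (hl : 0 < l)
    (hS : ∀ x ∈ Ioc 0 (2 * Real.pi), |Fs J σ s x - gF J σ s M x| ≤ S) :
    - Real.log (xs (wc (Fs J σ s) τ) m 0) - τ * f0 J σ s ≤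
      (τ ^ 2 * (Real.exp (S * |τ|) / 2 + l * Real.exp ((S + 1) * |τ|)) * (6 * (J.card : ℝ) ^ 2 / M) +
      (1 / l + Real.exp |τ|) * (τ ^ 2 * Real.exp |τ| * J.card ^ 2 * M / m ^ 2)) := by
  have h1 := QF_test h hs hM hm τ hl hS
  have h2 := var_bound (wc_even hs τ) (Real.exp_pos _) (wco h hs τ) hm (az_zero (J := J) (σ := σ) (s := s) τ M)
  have h3 := x0_pos h hs τ hm
  set X := (τ ^ 2 * (Real.exp (S * |τ|) / 2 + l * Real.exp ((S + 1) * |τ|)) * (6 * (J.card : ℝ) ^ 2 / M) +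
      (1 / l + Real.exp |τ|) * (τ ^ 2 * Real.exp |τ| * J.card ^ 2 * M / m ^ 2)) with hX
  have hX0 : 0 ≤ X := by rw [hX]; positivity
  have h4 : 1 ≤ xs (wc (Fs J σ s) τ) m 0 * (Real.exp (τ * f0 J σ s) * Real.exp X) := by
    refine h2.trans ?_
    gcongr
    refine h1.trans ?_
    gcongr
    linarith [Real.add_one_le_exp X]
  have h5 := Real.log_nonneg h4
  rw [Real.log_mul h3.ne' (by positivity), ← Real.exp_add, Real.log_exp] at h5
  linarith

end EE
end

noncomputable section
namespace EE
open MeasureTheory Set Filter Topology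

variable {J : Finset ℝ} {σ : ℝ → ℝ} {s : ℝ}

lemma f0_abs (h : Step J σ s) (hs : Sym (Fs J σ s)) : |f0 J σ s| ≤ 1 := by
  have h1 := rc_upper (Fs_adm h) hs (M := 1) (fun x _ => (abs_le.1 (Fs_abs h x).le).2) 1 (fun _ => 1)
  have h2 := rc_coer (Fs_adm h) hs (δ := -1) (fun x _ => (abs_le.1 (Fs_abs h x).le).1) 1 (fun _ => 1)
  simp [QF, rc_Fs0 h] at h1 h2
  exact abs_le.2 ⟨h2, h1⟩

lemma dist_eq (h : Step J σ s) (hs : Sym (Fs J σ s)) {M : ℕ} (hM : 0 < M) (x : ℝ) :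
    |Fs J σ s x - gF J σ s M x| = 1 - Fs J σ s x * gF J σ s M x := by
  have h1 := h.val x
  have h2 := abs_le.1 (gF_abs h hs hM x)
  rcases (sq_eq_one_iff' h1) with e | e
  · rw [e, abs_of_nonneg (by linarith)]; ring
  · rw [e, abs_of_nonpos (by linarith)]; ring

lemma dom_small {a τ c m : ℝ} (ha : 0 ≤ a) (ha1 : a ≤ 1) (hm : 0 < m) :
    m * (τ ^ 2 * (Real.exp (2 * a) / 2 + 1 * Real.exp ((2 + 1) * a)) * (6 * c ^ 2 / m) +
      (1 / 1 + Real.exp a) * (τ ^ 2 * Real.exp a * c ^ 2 * m / m ^ 2)) ≤ 11 * Real.exp 3 * c ^ 2 * τ ^ 2 := by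
  have e : m * (τ ^ 2 * (Real.exp (2 * a) / 2 + 1 * Real.exp ((2 + 1) * a)) * (6 * c ^ 2 / m) +
      (1 / 1 + Real.exp a) * (τ ^ 2 * Real.exp a * c ^ 2 * m / m ^ 2)) =
      (c ^ 2 * τ ^ 2) * (6 * (Real.exp (2 * a) / 2 + Real.exp (3 * a)) + (1 + Real.exp a) * Real.exp a) := by
    rw [show ((2 : ℝ) + 1) * a = 3 * a by ring]; field_simp
  rw [e]
  have h1 : Real.exp (2 * a) ≤ Real.exp 3 := Real.exp_le_exp.2 (by linarith)
  have h2 : Real.exp (3 * a) ≤ Real.exp 3 := Real.exp_le_exp.2 (by linarith)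
  have h3 : Real.exp a ≤ Real.exp 3 := Real.exp_le_exp.2 (by linarith)
  have h4 : Real.exp a * Real.exp a ≤ Real.exp 3 := by rw [← Real.exp_add]; exact Real.exp_le_exp.2 (by linarith)
  have : 0 ≤ c ^ 2 * τ ^ 2 := by positivity
  nlinarith

lemma dom_mid {a τ c m M E : ℝ} (hE : E = Real.exp (a / 4)) (hE1 : 1 ≤ E) (hm : 0 < m) (hM : 0 < M) (h1 : m / E ≤ M) (h2 : M ≤ 2 * (m / E)) :
    m * (τ ^ 2 * (Real.exp (3 / 2 * a) / 2 + (M / (m * E ^ 3)) * Real.exp ((3 / 2 + 1) * a)) * (6 * c ^ 2 / M) +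
      (1 / (M / (m * E ^ 3)) + Real.exp a) * (τ ^ 2 * Real.exp a * c ^ 2 * M / m ^ 2)) ≤ 12 * c ^ 2 * τ ^ 2 * E ^ 7 := by
  have e1 : Real.exp (3 / 2 * a) = E ^ 6 := by rw [hE, ← Real.exp_nat_mul]; congr 1; push_cast; ring
  have e2 : Real.exp ((3 / 2 + 1) * a) = E ^ 10 := by rw [hE, ← Real.exp_nat_mul]; congr 1; push_cast; ring
  have e3 : Real.exp a = E ^ 4 := by rw [hE, ← Real.exp_nat_mul]; congr 1; push_cast; ring
  rw [e1, e2, e3]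
  have hE0 : 0 < E := by linarith
  have e : m * (τ ^ 2 * (E ^ 6 / 2 + (M / (m * E ^ 3)) * E ^ 10) * (6 * c ^ 2 / M) +
      (1 / (M / (m * E ^ 3)) + E ^ 4) * (τ ^ 2 * E ^ 4 * c ^ 2 * M / m ^ 2)) =
      (c ^ 2 * τ ^ 2) * (3 * E ^ 6 * (m / M) + 7 * E ^ 7 + E ^ 8 * (M / m)) := by
    field_simp; ring
  rw [e]
  have h3 : m / M ≤ E := by
    rw [div_le_iff₀ hM]; rw [div_le_iff₀ hE0] at h1; linarith
  have h4 : E * (M / m) ≤ 2 := by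
    have : E * (2 * (m / E) / m) = 2 := by field_simp
    rw [← this]; gcongr
  have h5 : 3 * E ^ 6 * (m / M) ≤ 3 * E ^ 7 := by
    calc _ ≤ 3 * E ^ 6 * E := by gcongr
      _ = _ := by ring
  have h6 : E ^ 8 * (M / m) ≤ 2 * E ^ 7 := by
    calc _ = E ^ 7 * (E * (M / m)) := by ring
      _ ≤ E ^ 7 * 2 := by gcongr
      _ = _ := by ring
  have : 0 ≤ c ^ 2 * τ ^ 2 := by positivity
  nlinarith

lemma BN_dom (h : Step J σ s) (hs : Sym (Fs J σ s)) : ∃ C : ℝ, 0 ≤ C ∧ ∀ (N : ℕ) (τ : ℝ), τ ≠ 0 →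
    |BN J σ s τ N| ≤ C * τ ^ 2 * Real.exp (7 / 4 * |τ|) := by
  obtain ⟨C, hC, hloc⟩ := gF_local h hs
  set M0 : ℕ := ⌈2 * C⌉₊ + 1 with hM0
  have hM0C : 2 * C ≤ M0 := by rw [hM0]; push_cast; linarith [Nat.le_ceil (2 * C)]
  have hM01 : (1 : ℝ) ≤ M0 := by rw [hM0]; push_cast; linarith [(Nat.cast_nonneg ⌈2 * C⌉₊ : (0 : ℝ) ≤ _)]
  refine ⟨11 * Real.exp 3 * (J.card : ℝ) ^ 2 + 12 * (J.card : ℝ) ^ 2 + 2 * M0, by positivity, fun N τ hτ => ?_⟩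
  obtain ⟨hb0, hb1⟩ := BN_bound h hs hτ N
  rw [abs_of_nonneg hb0]
  refine hb1.trans ?_
  rw [LL_step (Fs_meas J σ s) (fun x _ => (Fs_abs h x).le) hs]
  have hm : 0 < N + 1 := Nat.succ_pos N
  have ha := abs_nonneg τ
  have key := fun (M : ℕ) (hM : 0 < M) (S l : ℝ) (hl : 0 < l) (hS : ∀ x ∈ Ioc 0 (2 * Real.pi), |Fs J σ s x - gF J σ s M x| ≤ S) =>
    ell_le h hs hM hm τ hl hS
  set X := -Real.log (xs (wc (Fs J σ s) τ) (N + 1) 0) - τ * f0 J σ s with hX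
  have hXa : X ≤ 2 * |τ| := by
    have h1 := Real.log_le_log (Real.exp_pos _) (x0_lower h hs τ hm)
    rw [Real.log_exp] at h1
    have h2 : |τ * f0 J σ s| ≤ |τ| := by rw [abs_mul]; exact mul_le_of_le_one_right ha (f0_abs h hs)
    have := (abs_le.1 h2).1
    rw [hX]; linarith
  have hmR : (0 : ℝ) < (N : ℝ) + 1 := by positivity
  set m : ℝ := (N : ℝ) + 1 with hmd
  have hcast : ((N + 1 : ℕ) : ℝ) = m := by push_cast; rfl
  rw [hcast] at key
  set c : ℝ := (J.card : ℝ) with hc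
  have hexp1 : 1 ≤ Real.exp (7 / 4 * |τ|) := Real.one_le_exp (by positivity)
  have hτ2 : 0 ≤ τ ^ 2 := sq_nonneg τ
  have p1 : 0 ≤ 11 * Real.exp 3 * c ^ 2 := by positivity
  have p2 : 0 ≤ 12 * c ^ 2 := by positivity
  have p3 : (0 : ℝ) ≤ 2 * M0 := by positivity
  have hg2 : 0 ≤ τ ^ 2 * Real.exp (7 / 4 * |τ|) := by positivity
  rcases le_total |τ| 1 with h1 | h1
  · have k := key (N + 1) hm 2 1 one_pos (fun x _ => by
      rw [dist_eq h hs hm]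
      have : |Fs J σ s x * gF J σ s (N + 1) x| ≤ 1 := by
        rw [abs_mul, Fs_abs h, one_mul]; exact gF_abs h hs hm x
      linarith [(abs_le.1 this).1])
    rw [hcast] at k
    calc m * X ≤ _ := mul_le_mul_of_nonneg_left k hmR.le
      _ ≤ 11 * Real.exp 3 * c ^ 2 * τ ^ 2 := dom_small ha h1 hmR
      _ ≤ 11 * Real.exp 3 * c ^ 2 * (τ ^ 2 * Real.exp (7 / 4 * |τ|)) := by
          gcongr; exact le_mul_of_one_le_right hτ2 hexp1
      _ ≤ _ := by nlinarith
  · set E := Real.exp (|τ| / 4) with hE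
    have hE1 : 1 ≤ E := Real.one_le_exp (by positivity)
    have hE7 : E ^ 7 = Real.exp (7 / 4 * |τ|) := by rw [hE, ← Real.exp_nat_mul]; congr 1; push_cast; ring
    rcases le_total (M0 : ℝ) (m / E) with h2 | h2
    · set M := ⌈m / E⌉₊ with hM
      have b1 : m / E ≤ M := Nat.le_ceil _
      have b2 : (M : ℝ) ≤ 2 * (m / E) := by
        have := Nat.ceil_lt_add_one (a := m / E) (by linarith)
        linarith
      have hMp : (0 : ℝ) < M := by linarith
      have hMn : 0 < M := by exact_mod_cast hMp
      have k := key M hMn (3 / 2) (M / (m * E ^ 3)) (by positivity) (fun x hx => by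
        rw [dist_eq h hs hMn]
        have h3 := hloc M hMn x hx
        have : C / M ≤ 1 / 2 := by rw [div_le_iff₀ hMp]; linarith
        linarith)
      calc m * X ≤ _ := mul_le_mul_of_nonneg_left k hmR.le
        _ ≤ 12 * c ^ 2 * τ ^ 2 * E ^ 7 := dom_mid hE hE1 hmR hMp b1 b2
        _ = 12 * c ^ 2 * (τ ^ 2 * Real.exp (7 / 4 * |τ|)) := by rw [hE7]; ring
        _ ≤ _ := by nlinarith
    · have h3 : m ≤ M0 * E := (div_le_iff₀ (by linarith)).1 h2
      have h4 : |τ| ≤ τ ^ 2 := by rw [← sq_abs]; nlinarith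
      have h5 : E ≤ E ^ 7 := le_self_pow₀ hE1 (by norm_num)
      calc m * X ≤ m * (2 * |τ|) := mul_le_mul_of_nonneg_left hXa hmR.le
        _ ≤ (M0 * E) * (2 * |τ|) := by gcongr
        _ ≤ (M0 * E ^ 7) * (2 * τ ^ 2) := by gcongr
        _ = 2 * M0 * (τ ^ 2 * Real.exp (7 / 4 * |τ|)) := by rw [hE7]; ring
        _ ≤ _ := by nlinarith

end EE
end

noncomputable section
namespace EE
open MeasureTheory Set Filter Topology

lemma sinh_lower {t : ℝ} (ht : 0 < t) : t ≤ Real.sinh t * (Real.exp (-t) * (1 + 2 * t)) := by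
  have h1 := Real.add_one_le_exp (2 * t)
  have e : Real.exp t * Real.exp (-t) = 1 := by rw [← Real.exp_add]; simp
  have e2 : Real.exp (2 * t) * Real.exp (-t) = Real.exp t := by rw [← Real.exp_add]; ring_nf
  have e3 : Real.sinh t * (Real.exp (-t) * (1 + 2 * t)) = (1 - Real.exp (-t) ^ 2) * (1 + 2 * t) / 2 := by
    rw [Real.sinh_eq]; linear_combination ((1 + 2 * t) / 2) * e
  have e4 : Real.exp (-t) ^ 2 * (1 + 2 * t) ≤ 1 := by
    have : Real.exp (-t) ^ 2 * Real.exp (2 * t) = 1 := by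
      rw [← Real.exp_nat_mul, ← Real.exp_add, ← Real.exp_zero]; congr 1; push_cast; ring
    rw [← this]; gcongr; linarith
  rw [e3]; linarith

lemma dom_exp {t : ℝ} (ht : 0 < t) : t ^ 2 * Real.exp (7 / 4 * t) / Real.sinh t ^ 2 ≤ 1024 * Real.exp (-(1 / 8) * t) := by
  have hs : 0 < Real.sinh t := Real.sinh_pos_iff.2 ht
  have h1 := sinh_lower ht
  rw [div_le_iff₀ (by positivity)]
  have h2 : 1 + 2 * t ≤ 32 * Real.exp (t / 16) := by linarith [Real.add_one_le_exp (t / 16)]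
  have h3 : t ^ 2 ≤ (Real.sinh t * (Real.exp (-t) * (32 * Real.exp (t / 16)))) ^ 2 := by
    gcongr; exact h1.trans (by gcongr)
  calc t ^ 2 * Real.exp (7 / 4 * t) ≤ (Real.sinh t * (Real.exp (-t) * (32 * Real.exp (t / 16)))) ^ 2 * Real.exp (7 / 4 * t) := by gcongr
    _ = 1024 * (Real.exp (-t) ^ 2 * Real.exp (t / 16) ^ 2 * Real.exp (7 / 4 * t)) * Real.sinh t ^ 2 := by ring
    _ = _ := by
      congr 2
      rw [← Real.exp_nat_mul, ← Real.exp_nat_mul, ← Real.exp_add, ← Real.exp_add]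
      congr 1; push_cast; ring

lemma dom_int : IntegrableOn (fun t : ℝ => Real.exp (-(1 / 8) * t)) (Ioi 0) :=
  exp_neg_integrableOn_Ioi 0 (by norm_num)

lemma gam_int (k : ℕ) : IntegrableOn (fun t : ℝ => 4 * ((k : ℝ) + 1) * (t ^ 2 * Real.exp (-((2 * ((k : ℝ) + 1)) * t)))) (Ioi 0) ∧
    ∫ t in Ioi (0 : ℝ), 4 * ((k : ℝ) + 1) * (t ^ 2 * Real.exp (-((2 * ((k : ℝ) + 1)) * t))) = 1 / ((k : ℝ) + 1) ^ 2 := by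
  have hr : (0 : ℝ) < 2 * ((k : ℝ) + 1) := by positivity
  have h1 := Real.integral_rpow_mul_exp_neg_mul_Ioi (a := 3) (r := 2 * ((k : ℝ) + 1)) (by norm_num) hr
  have h2 : Real.Gamma 3 = 2 := by
    rw [show (3 : ℝ) = (2 : ℕ) + 1 by norm_num, Real.Gamma_nat_eq_factorial]; norm_num [Nat.factorial]
  have e : ∀ t : ℝ, t ^ ((3 : ℝ) - 1) = t ^ 2 := fun t => by
    rw [show (3 : ℝ) - 1 = (2 : ℕ) by norm_num, Real.rpow_natCast]
  simp only [e, h2] at h1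
  have h3 : ∫ t in Ioi (0 : ℝ), 4 * ((k : ℝ) + 1) * (t ^ 2 * Real.exp (-((2 * ((k : ℝ) + 1)) * t))) = 1 / ((k : ℝ) + 1) ^ 2 := by
    rw [integral_const_mul, h1, show (3 : ℝ) = (3 : ℕ) by norm_num, Real.rpow_natCast]
    field_simp; norm_num
  refine ⟨?_, h3⟩
  refine Integrable.of_integral_ne_zero ?_
  rw [h3]; positivity

lemma sinh_series {t : ℝ} (ht : 0 < t) :
    HasSum (fun k : ℕ => 4 * ((k : ℝ) + 1) * (t ^ 2 * Real.exp (-((2 * ((k : ℝ) + 1)) * t)))) (t ^ 2 / Real.sinh t ^ 2) := by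
  set q := Real.exp (-(2 * t)) with hq
  have hq1 : q < 1 := by rw [hq, Real.exp_lt_one_iff]; linarith
  have hq0 : 0 < q := Real.exp_pos _
  have h1 := hasSum_coe_mul_geometric_of_norm_lt_one (𝕜 := ℝ) (r := q) (by rw [Real.norm_eq_abs, abs_of_pos hq0]; exact hq1)
  rw [← hasSum_nat_add_iff' 1] at h1
  have h2 := (h1.mul_left (4 * t ^ 2))
  have hs : 0 < Real.sinh t := Real.sinh_pos_iff.2 ht
  have e : 4 * t ^ 2 * (q / (1 - q) ^ 2 - ∑ i ∈ Finset.range 1, ((i : ℕ) : ℝ) * q ^ i) = t ^ 2 / Real.sinh t ^ 2 := by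
    have : (1 - q) ^ 2 = 4 * q * Real.sinh t ^ 2 := by
      have e1 : q = Real.exp (-t) ^ 2 := by rw [hq, ← Real.exp_nat_mul]; congr 1; push_cast; ring
      have e2 : Real.exp t * Real.exp (-t) = 1 := by rw [← Real.exp_add]; simp
      rw [Real.sinh_eq, e1]
      have : Real.exp (-t) * (Real.exp t - Real.exp (-t)) = 1 - Real.exp (-t) ^ 2 := by linear_combination e2
      rw [← this]; ring
    rw [this]; simp; field_simp
  rw [e] at h2
  refine Eq.mpr (congrArg (fun F => HasSum F _) (funext fun k => ?_)) h2
  have : Real.exp (-((2 * ((k : ℝ) + 1)) * t)) = q ^ (k + 1) := by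
    rw [hq, ← Real.exp_nat_mul]; congr 1; push_cast; ring
  rw [this]; push_cast; ring

lemma sinh_integral : ∫ t in Ioi (0 : ℝ), t ^ 2 / Real.sinh t ^ 2 = Real.pi ^ 2 / 6 := by
  have hz : HasSum (fun k : ℕ => 1 / ((k : ℝ) + 1) ^ 2) (Real.pi ^ 2 / 6) := by
    have := hasSum_zeta_two
    rw [← hasSum_nat_add_iff' 1] at this
    simpa using this
  have h1 := hasSum_integral_of_summable_integral_norm (μ := volume.restrict (Ioi (0 : ℝ)))
    (F := fun (k : ℕ) (t : ℝ) => 4 * ((k : ℝ) + 1) * (t ^ 2 * Real.exp (-((2 * ((k : ℝ) + 1)) * t)))) (fun k => (gam_int k).1) (by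
      refine Eq.mpr (congrArg Summable (funext fun k => ?_)) hz.summable
      rw [← (gam_int k).2]
      refine integral_congr_ae (Eventually.of_forall fun t => ?_)
      dsimp only
      rw [Real.norm_eq_abs, abs_of_nonneg (by positivity)])
  have h2 : (fun k : ℕ => ∫ t in Ioi (0 : ℝ), 4 * ((k : ℝ) + 1) * (t ^ 2 * Real.exp (-((2 * ((k : ℝ) + 1)) * t)))) = fun k : ℕ => 1 / ((k : ℝ) + 1) ^ 2 :=
    funext fun k => (gam_int k).2
  rw [h2] at h1
  rw [hz.unique h1]
  refine setIntegral_congr_fun measurableSet_Ioi fun t ht => ?_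
  exact (sinh_series ht).tsum_eq.symm

end EE
end

noncomputable section
namespace EE
open MeasureTheory Set Filter Topology

/-- alternating signs -/
def sg (J : Finset ℝ) (φ : ℝ) : ℝ := (-1) ^ (J.filter (fun a => a ≤ φ)).card

lemma sg_sum (A : Finset ℝ) : 1 + 2 * ∑ φ ∈ A, sg A φ = (-1) ^ A.card := by
  induction A using Finset.induction_on_max with
  | empty => simp
  | insert a A hA ih =>
    have hn : a ∉ A := fun h => lt_irrefl _ (hA a h)
    have e1 : ∀ φ ∈ A, sg (insert a A) φ = sg A φ := by
      intro φ hφ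
      rw [sg, sg, Finset.filter_insert, if_neg (not_le.2 (hA φ hφ))]
    have e2 : sg (insert a A) a = (-1) ^ (A.card + 1) := by
      rw [sg, Finset.filter_true_of_mem, Finset.card_insert_of_notMem hn]
      intro x hx
      rcases Finset.mem_insert.1 hx with h | h
      · exact h.le
      · exact (hA x h).le
    rw [Finset.sum_insert hn, Finset.sum_congr rfl e1, e2, Finset.card_insert_of_notMem hn]
    rw [pow_succ]; linarith

lemma Fs_sg (J : Finset ℝ) (x : ℝ) : Fs J (sg J) 1 x = (-1) ^ (J.filter (fun a => a < x)).card := by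
  rw [← sg_sum, Fs, Finset.sum_filter]
  congr 2
  refine Finset.sum_congr rfl fun φ _ => ?_
  unfold hv
  split_ifs with h
  · rw [mul_one, sg, sg, Finset.filter_filter]
    congr 2
    refine Finset.filter_congr fun a _ => ?_
    constructor
    · intro h2; exact ⟨h2.trans_lt h, h2⟩
    · exact fun h2 => h2.2
  · rw [mul_zero]

lemma step_sg {J : Finset ℝ} (hJ : ∀ φ ∈ J, φ ∈ Ioo 0 (2 * Real.pi)) (he : Even J.card) : Step J (sg J) 1 where
  mem := hJ
  sq φ _ := by rw [sg, ← pow_mul, mul_comm, pow_mul]; norm_num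
  sum0 := by have := sg_sum J; rw [he.neg_one_pow] at this; linarith
  val x := by rw [Fs_sg, ← pow_mul, mul_comm, pow_mul]; norm_num
  left φ hφ := by
    rw [Fs_sg, sg]
    have : J.filter (fun a => a ≤ φ) = insert φ (J.filter (fun a => a < φ)) := by
      ext a; simp only [Finset.mem_filter, Finset.mem_insert]
      constructor
      · rintro ⟨h1, h2⟩
        rcases h2.eq_or_lt with h | h
        · exact Or.inl h
        · exact Or.inr ⟨h1, h⟩
      · rintro (h | h)
        · rw [h]; exact ⟨hφ, le_rfl⟩
        · exact ⟨h.1, h.2.le⟩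
    rw [this, Finset.card_insert_of_notMem (by simp), pow_succ]; ring

section data
variable {R : ℕ} {θ : ℕ → ℝ}

def JA (R : ℕ) (θ : ℕ → ℝ) : Finset ℝ := (Finset.Icc 1 R).image θ
def JB (R : ℕ) (θ : ℕ → ℝ) : Finset ℝ := (Finset.Icc 1 R).image (fun r => 2 * Real.pi - θ r)
def JJ (R : ℕ) (θ : ℕ → ℝ) : Finset ℝ := JA R θ ∪ JB R θ

lemma th_lt (hmono : ∀ r ≤ R, θ r < θ (r + 1)) {i j : ℕ} (hij : i < j) (hj : j ≤ R + 1) : θ i < θ j := by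
  induction j with
  | zero => omega
  | succ j ih =>
    rcases (Nat.lt_succ_iff.1 hij).eq_or_lt with h | h
    · subst h; exact hmono _ (by omega)
    · exact (ih h (by omega)).trans (hmono j (by omega))

lemma th_le (hmono : ∀ r ≤ R, θ r < θ (r + 1)) {i j : ℕ} (hij : i ≤ j) (hj : j ≤ R + 1) : θ i ≤ θ j := by
  rcases hij.eq_or_lt with h | h
  · rw [h]
  · exact (th_lt hmono h hj).le

lemma th_inj (hmono : ∀ r ≤ R, θ r < θ (r + 1)) {i j : ℕ} (hi : i ≤ R + 1) (hj : j ≤ R + 1) (h : θ i = θ j) : i = j := by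
  rcases lt_trichotomy i j with h1 | h1 | h1
  · exact absurd h (th_lt hmono h1 hj).ne
  · exact h1
  · exact absurd h.symm (th_lt hmono h1 hi).ne

lemma JA_mem (hθ0 : θ 0 = 0) (hθtop : θ (R + 1) = Real.pi) (hmono : ∀ r ≤ R, θ r < θ (r + 1)) {φ : ℝ} (h : φ ∈ JA R θ) : 0 < φ ∧ φ < Real.pi := by
  obtain ⟨r, hr, rfl⟩ := Finset.mem_image.1 h
  rw [Finset.mem_Icc] at hr
  exact ⟨hθ0 ▸ th_lt hmono (by omega) (by omega), hθtop ▸ th_lt hmono (by omega) (by omega)⟩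

lemma JB_mem (hθ0 : θ 0 = 0) (hθtop : θ (R + 1) = Real.pi) (hmono : ∀ r ≤ R, θ r < θ (r + 1)) {φ : ℝ} (h : φ ∈ JB R θ) : Real.pi < φ ∧ φ < 2 * Real.pi := by
  obtain ⟨r, hr, rfl⟩ := Finset.mem_image.1 h
  have := JA_mem hθ0 hθtop hmono (Finset.mem_image_of_mem θ hr)
  constructor <;> linarith

lemma JJ_disj (hθ0 : θ 0 = 0) (hθtop : θ (R + 1) = Real.pi) (hmono : ∀ r ≤ R, θ r < θ (r + 1)) : Disjoint (JA R θ) (JB R θ) := by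
  rw [Finset.disjoint_left]
  intro φ h1 h2
  linarith [JA_mem hθ0 hθtop hmono h1, JB_mem hθ0 hθtop hmono h2]

lemma JA_sub_card (hmono : ∀ r ≤ R, θ r < θ (r + 1)) {S : Finset ℕ} (hS : ∀ i ∈ S, i ≤ R) : (S.image θ).card = S.card :=
  Finset.card_image_of_injOn fun i hi j hj h => th_inj hmono ((hS i hi).trans (Nat.le_succ R)) ((hS j hj).trans (Nat.le_succ R)) h

lemma JB_sub_card (hmono : ∀ r ≤ R, θ r < θ (r + 1)) {S : Finset ℕ} (hS : ∀ i ∈ S, i ≤ R) : (S.image (fun r => 2 * Real.pi - θ r)).card = S.card :=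
  Finset.card_image_of_injOn fun i hi j hj h => th_inj hmono ((hS i hi).trans (Nat.le_succ R)) ((hS j hj).trans (Nat.le_succ R)) (by
    have : 2 * Real.pi - θ i = 2 * Real.pi - θ j := h
    linarith)

lemma JA_card (hmono : ∀ r ≤ R, θ r < θ (r + 1)) : (JA R θ).card = R := by
  rw [JA, JA_sub_card hmono (fun i hi => (Finset.mem_Icc.1 hi).2)]; simp

lemma JB_card (hmono : ∀ r ≤ R, θ r < θ (r + 1)) : (JB R θ).card = R := by
  rw [JB, JB_sub_card hmono (fun i hi => (Finset.mem_Icc.1 hi).2)]; simp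

lemma JJ_card (hθ0 : θ 0 = 0) (hθtop : θ (R + 1) = Real.pi) (hmono : ∀ r ≤ R, θ r < θ (r + 1)) : (JJ R θ).card = 2 * R := by
  rw [JJ, Finset.card_union_of_disjoint (JJ_disj hθ0 hθtop hmono), JA_card hmono, JB_card hmono]; ring

lemma JJ_step (hθ0 : θ 0 = 0) (hθtop : θ (R + 1) = Real.pi) (hmono : ∀ r ≤ R, θ r < θ (r + 1)) : Step (JJ R θ) (sg (JJ R θ)) 1 := by
  refine step_sg (fun φ hφ => ?_) (by rw [JJ_card hθ0 hθtop hmono]; exact even_two_mul R)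
  rcases Finset.mem_union.1 hφ with h | h
  · have := JA_mem hθ0 hθtop hmono h
    exact ⟨this.1, by linarith [Real.pi_pos]⟩
  · have := JB_mem hθ0 hθtop hmono h
    exact ⟨by linarith [Real.pi_pos], this.2⟩

lemma JJ_pi (hθ0 : θ 0 = 0) (hθtop : θ (R + 1) = Real.pi) (hmono : ∀ r ≤ R, θ r < θ (r + 1)) : Real.pi ∉ JJ R θ := by
  intro hφ
  rcases Finset.mem_union.1 hφ with h | h
  · exact lt_irrefl _ (JA_mem hθ0 hθtop hmono h).2
  · exact lt_irrefl _ (JB_mem hθ0 hθtop hmono h).1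

lemma th_find (hθ0 : θ 0 = 0) (hθtop : θ (R + 1) = Real.pi) {x : ℝ} (h0 : 0 < x) (hpi : x < Real.pi)
    (hx : ∀ r, 1 ≤ r → r ≤ R → x ≠ θ r) : ∃ r ≤ R, θ r < x ∧ x < θ (r + 1) := by
  classical
  have hex : ∃ n, x < θ (n + 1) := ⟨R, by rw [hθtop]; exact hpi⟩
  have hf := Nat.find_spec hex
  have hle : Nat.find hex ≤ R := Nat.find_min' hex (by rw [hθtop]; exact hpi)
  refine ⟨Nat.find hex, hle, ?_, hf⟩
  rcases Nat.eq_zero_or_pos (Nat.find hex) with h | h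
  · rw [h, hθ0]; exact h0
  · have h1 := Nat.find_min hex (m := Nat.find hex - 1) (by omega)
    rw [Nat.sub_add_cancel h, not_lt] at h1
    exact lt_of_le_of_ne h1 (hx _ h hle).symm

lemma Fs_eq (hθ0 : θ 0 = 0) (hθtop : θ (R + 1) = Real.pi) (hmono : ∀ r ≤ R, θ r < θ (r + 1))
    {f : ℝ → ℝ} (hper : ∀ t, f (t + 2 * Real.pi) = f t) (heven : ∀ t, f (-t) = f t)
    (hval : ∀ r ≤ R, ∀ t, θ r < t → t < θ (r + 1) → f t = (-1 : ℝ) ^ r)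
    {x : ℝ} (h0 : 0 < x) (h2 : x < 2 * Real.pi) (hpi : x ≠ Real.pi) (hx : x ∉ JJ R θ) : Fs (JJ R θ) (sg (JJ R θ)) 1 x = f x := by
  rw [Fs_sg, JJ, Finset.filter_union, Finset.card_union_of_disjoint
    ((JJ_disj hθ0 hθtop hmono).mono (Finset.filter_subset _ _) (Finset.filter_subset _ _))]
  rw [JJ, Finset.mem_union, not_or] at hx
  rcases hpi.lt_or_gt with h | h
  · obtain ⟨r, hr, h3, h4⟩ := th_find hθ0 hθtop h0 h (fun r h1 h2 e => hx.1 (e ▸ Finset.mem_image_of_mem θ (Finset.mem_Icc.2 ⟨h1, h2⟩)))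
    have eB : (JB R θ).filter (fun a => a < x) = ∅ := by
      refine Finset.filter_eq_empty_iff.2 fun a ha => ?_
      have := JB_mem hθ0 hθtop hmono ha
      linarith
    have eA : (JA R θ).filter (fun a => a < x) = (Finset.Icc 1 r).image θ := by
      ext a
      simp only [JA, Finset.mem_filter, Finset.mem_image, Finset.mem_Icc]
      constructor
      · rintro ⟨⟨i, hi, rfl⟩, h5⟩
        refine ⟨i, ⟨hi.1, ?_⟩, rfl⟩
        by_contra h6
        have := th_le hmono (i := r + 1) (j := i) (by omega) (by omega)
        linarith
      · rintro ⟨i, hi, rfl⟩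
        exact ⟨⟨i, ⟨hi.1, hi.2.trans hr⟩, rfl⟩, (th_le hmono hi.2 (by omega)).trans_lt h3⟩
    rw [eA, eB, JA_sub_card hmono (fun i hi => (Finset.mem_Icc.1 hi).2.trans hr), hval r hr x h3 h4]
    simp
  · have hf : f x = f (2 * Real.pi - x) := by
      rw [← heven x, ← hper]; congr 1; ring
    obtain ⟨r, hr, h3, h4⟩ := th_find hθ0 hθtop (x := 2 * Real.pi - x) (by linarith) (by linarith)
      (fun r h1 h2 e => hx.2 (Finset.mem_image.2 ⟨r, Finset.mem_Icc.2 ⟨h1, h2⟩, by rw [← e]; ring⟩))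
    have eA : (JA R θ).filter (fun a => a < x) = JA R θ := by
      refine Finset.filter_true_of_mem fun a ha => ?_
      have := JA_mem hθ0 hθtop hmono ha
      linarith
    have eB : (JB R θ).filter (fun a => a < x) = (Finset.Icc (r + 1) R).image (fun r => 2 * Real.pi - θ r) := by
      ext a
      simp only [JB, Finset.mem_filter, Finset.mem_image, Finset.mem_Icc]
      constructor
      · rintro ⟨⟨i, hi, rfl⟩, h5⟩
        refine ⟨i, ⟨?_, hi.2⟩, rfl⟩
        by_contra h6
        have := th_le hmono (i := i) (j := r) (by omega) (by omega)
        linarith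
      · rintro ⟨i, hi, rfl⟩
        refine ⟨⟨i, ⟨by omega, hi.2⟩, rfl⟩, ?_⟩
        have := th_le hmono hi.1 (by omega : i ≤ R + 1)
        linarith
    rw [eA, eB, JB_sub_card hmono (fun i hi => (Finset.mem_Icc.1 hi).2), hf, hval r hr _ h3 h4, JA_card hmono, Nat.card_Icc]
    obtain ⟨d, rfl⟩ := Nat.exists_eq_add_of_le hr
    rw [show r + d + (r + d + 1 - (r + 1)) = r + 2 * d by omega, pow_add, pow_mul]; norm_num

lemma Fs_eq_ae (hθ0 : θ 0 = 0) (hθtop : θ (R + 1) = Real.pi) (hmono : ∀ r ≤ R, θ r < θ (r + 1))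
    {f : ℝ → ℝ} (hper : ∀ t, f (t + 2 * Real.pi) = f t) (heven : ∀ t, f (-t) = f t)
    (hval : ∀ r ≤ R, ∀ t, θ r < t → t < θ (r + 1) → f t = (-1 : ℝ) ^ r) :
    (∀ᵐ x : ℝ, x ∈ Ioc 0 (2 * Real.pi) → f x = Fs (JJ R θ) (sg (JJ R θ)) 1 x) ∧ Sym (Fs (JJ R θ) (sg (JJ R θ)) 1) := by
  have hE := (Finset.countable_toSet (insert Real.pi (insert (2 * Real.pi) (JJ R θ ∪ (JJ R θ).image (fun x => 2 * Real.pi - x))))).ae_notMem volume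
  have key : ∀ {x : ℝ}, 0 < x → x < 2 * Real.pi → x ≠ Real.pi → x ∉ JJ R θ → Fs (JJ R θ) (sg (JJ R θ)) 1 x = f x :=
    fun h0 h2 hp hx => Fs_eq hθ0 hθtop hmono hper heven hval h0 h2 hp hx
  constructor
  · filter_upwards [hE] with x hx hx2
    simp only [Finset.coe_insert, Finset.coe_union, Finset.coe_image, mem_insert_iff, mem_union, Finset.mem_coe, mem_image, not_or, not_exists] at hx
    exact (key hx2.1 (lt_of_le_of_ne hx2.2 hx.2.1) hx.1 hx.2.2.1).symm
  · unfold Sym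
    filter_upwards [hE] with x hx hx2
    simp only [Finset.coe_insert, Finset.coe_union, Finset.coe_image, mem_insert_iff, mem_union, Finset.mem_coe, mem_image, not_or, not_exists] at hx
    have h2 := lt_of_le_of_ne hx2.2 hx.2.1
    rw [key hx2.1 h2 hx.1 hx.2.2.1, key (by linarith) (by linarith [hx2.1]) (fun h => hx.1 (by linarith))
      (fun h => hx.2.2.2 _ ⟨h, by ring⟩), ← heven x, ← hper (-x)]
    congr 1; ring

end data
end EE
end

noncomputable section
namespace EE
open MeasureTheory Set Filter Topology Matrix

section spec
variable {n : ℕ} {A : Matrix (Fin n) (Fin n) ℂ} {B : Matrix (Fin n) (Fin n) ℝ}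

lemma spec_charpoly (hA : A.IsHermitian) (hAB : A = B.map Complex.ofReal) :
    B.charpoly = ∏ k, (Polynomial.X - Polynomial.C (hA.eigenvalues k)) := by
  have h1 := hA.charpoly_eq
  have h2 : A.charpoly = B.charpoly.map Complex.ofRealHom := by
    rw [← Matrix.charpoly_map]; exact congrArg Matrix.charpoly hAB
  refine Polynomial.map_injective Complex.ofRealHom Complex.ofRealHom.injective ?_
  rw [← h2, h1, Polynomial.map_prod]
  refine Finset.prod_congr rfl fun k _ => ?_
  simp

lemma spec_eval (hA : A.IsHermitian) (hAB : A = B.map Complex.ofReal) (x : ℝ) :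
    (Matrix.scalar (Fin n) x - B).det = ∏ k, (x - hA.eigenvalues k) := by
  rw [← Matrix.eval_charpoly, spec_charpoly hA hAB, Polynomial.eval_prod]
  refine Finset.prod_congr rfl fun k _ => ?_
  simp

lemma spec_det (hA : A.IsHermitian) (hAB : A = B.map Complex.ofReal) (a : ℝ) {b : ℝ} (hb : b ≠ 0) :
    (a • (1 : Matrix (Fin n) (Fin n) ℝ) + b • B).det = ∏ k, (a + b * hA.eigenvalues k) := by
  have e : a • (1 : Matrix (Fin n) (Fin n) ℝ) + b • B = (-b) • (Matrix.scalar (Fin n) (-a / b) - B) := by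
    ext i j
    by_cases h : i = j
    · subst h; simp; field_simp; ring
    · simp [h, Matrix.one_apply_ne, Matrix.diagonal_apply_ne]
  rw [e, Matrix.det_smul, spec_eval hA hAB, Fintype.card, ← Finset.prod_const, ← Finset.prod_mul_distrib]
  refine Finset.prod_congr rfl fun k _ => ?_
  field_simp; ring

lemma spec_bound (hA : A.IsHermitian) (hAB : A = B.map Complex.ofReal) (hB : B.IsHermitian)
    (h1 : ∀ v : Fin n → ℝ, v ⬝ᵥ (B *ᵥ v) ≤ ∑ j, v j ^ 2) (h2 : ∀ v : Fin n → ℝ, - ∑ j, v j ^ 2 ≤ v ⬝ᵥ (B *ᵥ v)) (k : Fin n) :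
    -1 ≤ hA.eigenvalues k ∧ hA.eigenvalues k ≤ 1 := by
  set x := hA.eigenvalues k with hx
  have h0 : (Matrix.scalar (Fin n) x - B).det = 0 := by
    rw [spec_eval hA hAB]; exact Finset.prod_eq_zero (Finset.mem_univ k) (by rw [hx]; ring)
  have hS : (Matrix.scalar (Fin n) x - B).IsHermitian := by
    refine Matrix.IsHermitian.sub ?_ hB
    rw [Matrix.IsHermitian, Matrix.scalar_apply, Matrix.diagonal_conjTranspose]; congr 1
  have hq : ∀ v : Fin n → ℝ, v ⬝ᵥ ((Matrix.scalar (Fin n) x - B) *ᵥ v) = x * ∑ j, v j ^ 2 - v ⬝ᵥ (B *ᵥ v) := by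
    intro v
    rw [Matrix.sub_mulVec, dotProduct_sub]
    congr 1
    simp only [dotProduct, Matrix.scalar_apply, Matrix.mulVec_diagonal, Finset.mul_sum]
    refine Finset.sum_congr rfl fun j _ => by ring
  have hv : ∀ v : Fin n → ℝ, v ≠ 0 → 0 < ∑ j, v j ^ 2 := by
    intro v hv
    obtain ⟨i, hi⟩ := Function.ne_iff.1 hv
    exact Finset.sum_pos' (fun j _ => sq_nonneg _) ⟨i, Finset.mem_univ i, by have : v i ≠ 0 := hi; positivity⟩
  constructor
  · by_contra h
    push Not at h
    have : (-(Matrix.scalar (Fin n) x - B)).PosDef := by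
      refine Matrix.PosDef.of_dotProduct_mulVec_pos hS.neg fun v hv0 => ?_
      rw [star_trivial, Matrix.neg_mulVec, dotProduct_neg, hq]
      nlinarith [hv v hv0, h2 v]
    have := this.det_pos
    rw [Matrix.det_neg, h0] at this; simp at this
  · by_contra h
    push Not at h
    have : (Matrix.scalar (Fin n) x - B).PosDef := by
      refine Matrix.PosDef.of_dotProduct_mulVec_pos hS fun v hv0 => ?_
      rw [star_trivial, hq]
      nlinarith [hv v hv0, h1 v]
    have := this.det_pos
    rw [h0] at this; simp at this

lemma spec_int (hA : A.IsHermitian) (hAB : A = B.map Complex.ofReal)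
    (hb : ∀ k, -1 ≤ hA.eigenvalues k ∧ hA.eigenvalues k ≤ 1) :
    IntegrableOn (fun t => ∑ k, eInt (hA.eigenvalues k) t) (Ioi 0) ∧
    ∫ t in Ioi (0 : ℝ), ∑ k, eInt (hA.eigenvalues k) t = 2 * Real.log 2 * ∑ k, entBin (hA.eigenvalues k) := by
  constructor
  · exact integrable_finsetSum _ fun k _ => eInt_integrable (hb k).1 (hb k).2
  · rw [integral_finsetSum _ fun k _ => eInt_integrable (hb k).1 (hb k).2, Finset.mul_sum]
    exact Finset.sum_congr rfl fun k _ => eInt_integral (hb k).1 (hb k).2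

lemma spec_sum (hA : A.IsHermitian) (hAB : A = B.map Complex.ofReal)
    (hb : ∀ k, -1 ≤ hA.eigenvalues k ∧ hA.eigenvalues k ≤ 1) {t : ℝ} (ht : 0 < t) :
    ∑ k, eInt (hA.eigenvalues k) t = (Real.log (Real.cosh t • (1 : Matrix (Fin n) (Fin n) ℝ) + Real.sinh t • B).det +
      Real.log (Real.cosh (-t) • (1 : Matrix (Fin n) (Fin n) ℝ) + Real.sinh (-t) • B).det) / Real.sinh t ^ 2 := by
  have hs : Real.sinh t ≠ 0 := (Real.sinh_pos_iff.2 ht).ne'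
  rw [spec_det hA hAB _ hs, spec_det hA hAB _ (by rw [Real.sinh_neg]; exact neg_ne_zero.2 hs)]
  have p1 : ∀ k, Real.cosh t + Real.sinh t * hA.eigenvalues k ≠ 0 := fun k => by
    rw [mul_comm]; exact (ent_pos (hb k).1 (hb k).2 t).ne'
  have p2 : ∀ k, Real.cosh (-t) + Real.sinh (-t) * hA.eigenvalues k ≠ 0 := fun k => by
    rw [mul_comm]; exact (ent_pos (hb k).1 (hb k).2 (-t)).ne'
  rw [Real.log_prod fun k _ => p1 k, Real.log_prod fun k _ => p2 k, ← Finset.sum_add_distrib, Finset.sum_div]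
  refine Finset.sum_congr rfl fun k _ => ?_
  rw [eInt, Real.cosh_neg, Real.sinh_neg]
  congr 3 <;> ring_nf

end spec

variable {J : Finset ℝ} {σ : ℝ → ℝ} {s : ℝ}

lemma TM_wc (h : Step J σ s) (τ : ℝ) (n : ℕ) :
    TM (wc (Fs J σ s) τ) n = Real.cosh τ • (1 : Matrix (Fin n) (Fin n) ℝ) + Real.sinh τ • TM (rc (Fs J σ s)) n := by
  ext i j
  simp only [TM, Matrix.of_apply, Matrix.add_apply, Matrix.smul_apply, smul_eq_mul, wc_eq h, Matrix.one_apply]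
  by_cases hij : i = j
  · subst hij; simp
  · have : ((i : ℤ) - (j : ℤ)) ≠ 0 := by
      intro e; apply hij; ext; omega
    simp [hij, this]

lemma MM_wc (h : Step J σ s) (τ : ℝ) (n : ℕ) :
    MM (wc (Fs J σ s) τ) n = Real.cosh τ • (1 : Matrix (Fin n) (Fin n) ℝ) + Real.sinh τ • MM (rc (Fs J σ s)) n := by
  ext i j
  simp only [MM, Matrix.of_apply, Matrix.add_apply, Matrix.smul_apply, smul_eq_mul, wc_eq h, Matrix.one_apply]
  have h2 : ((i : ℤ) + (j : ℤ) + 2) ≠ 0 := by omega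
  by_cases hij : i = j
  · subst hij; simp only [sub_self, if_true, if_neg h2]; ring
  · have : ((i : ℤ) - (j : ℤ)) ≠ 0 := by
      intro e; apply hij; ext; omega
    simp only [hij, this, h2, if_false]; ring

lemma TM_form_bd (h : Step J σ s) (hs : Sym (Fs J σ s)) (n : ℕ) (v : Fin n → ℝ) :
    v ⬝ᵥ (TM (rc (Fs J σ s)) n *ᵥ v) ≤ ∑ j, v j ^ 2 ∧ - ∑ j, v j ^ 2 ≤ v ⬝ᵥ (TM (rc (Fs J σ s)) n *ᵥ v) := by
  rw [TM_form, ← ext0_sq]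
  have h1 := rc_upper (Fs_adm h) hs (M := 1) (fun x _ => (abs_le.1 (Fs_abs h x).le).2) n (ext0 v)
  have h2 := rc_coer (Fs_adm h) hs (δ := -1) (fun x _ => (abs_le.1 (Fs_abs h x).le).1) n (ext0 v)
  constructor <;> linarith

lemma MM_form_bd (h : Step J σ s) (hs : Sym (Fs J σ s)) (n : ℕ) (v : Fin n → ℝ) :
    v ⬝ᵥ (MM (rc (Fs J σ s)) n *ᵥ v) ≤ ∑ j, v j ^ 2 ∧ - ∑ j, v j ^ 2 ≤ v ⬝ᵥ (MM (rc (Fs J σ s)) n *ᵥ v) := by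
  rw [MM_form (rc_even hs), ← ext0_sq]
  have h1 := rc_upper (Fs_adm h) hs (M := 1) (fun x _ => (abs_le.1 (Fs_abs h x).le).2) (2 * n + 1) (asym n (ext0 v))
  have h2 := rc_coer (Fs_adm h) hs (δ := -1) (fun x _ => (abs_le.1 (Fs_abs h x).le).1) (2 * n + 1) (asym n (ext0 v))
  rw [asym_sq] at h1 h2
  constructor <;> linarith

/-- main convergence, in terms of an integrand representation -/
lemma main_conv (h : Step J σ s) (hs : Sym (Fs J σ s)) (hl : s ^ 2 = 1) (hpi : Real.pi ∉ J)
    {A T : (N : ℕ) → Matrix (Fin N) (Fin N) ℂ} (hA : ∀ N, (A N).IsHermitian) (hT : ∀ N, (T N).IsHermitian)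
    (hA2 : ∀ N, A N = (MM (rc (Fs J σ s)) N).map Complex.ofReal) (hT2 : ∀ N, T N = (TM (rc (Fs J σ s)) N).map Complex.ofReal) :
    (∀ N k, -1 ≤ (hA N).eigenvalues k ∧ (hA N).eigenvalues k ≤ 1) ∧
    Tendsto (fun N => 2 * (∑ k, entBin ((hA N).eigenvalues k)) - ∑ k, entBin ((hT N).eigenvalues k)) atTop (𝓝 ((J.card : ℝ) / 6)) := by
  have bA : ∀ N k, -1 ≤ (hA N).eigenvalues k ∧ (hA N).eigenvalues k ≤ 1 := fun N =>
    spec_bound (hA N) (hA2 N) (MM_isHermitian (rc_even hs) N) (fun v => (MM_form_bd h hs N v).1) (fun v => (MM_form_bd h hs N v).2)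
  have bT : ∀ N k, -1 ≤ (hT N).eigenvalues k ∧ (hT N).eigenvalues k ≤ 1 := fun N =>
    spec_bound (hT N) (hT2 N) (TM_isHermitian (rc_even hs) N) (fun v => (TM_form_bd h hs N v).1) (fun v => (TM_form_bd h hs N v).2)
  refine ⟨bA, ?_⟩
  set G : ℕ → ℝ → ℝ := fun N t => 2 * (∑ k, eInt ((hA N).eigenvalues k) t) - ∑ k, eInt ((hT N).eigenvalues k) t with hG
  have iA := fun N => spec_int (hA N) (hA2 N) (bA N)
  have iT := fun N => spec_int (hT N) (hT2 N) (bT N)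
  have Gint : ∀ N, IntegrableOn (G N) (Ioi 0) := fun N => ((iA N).1.const_mul 2).sub (iT N).1
  have Gval : ∀ N, ∫ t in Ioi (0 : ℝ), G N t = 2 * Real.log 2 * (2 * (∑ k, entBin ((hA N).eigenvalues k)) - ∑ k, entBin ((hT N).eigenvalues k)) := by
    intro N
    rw [hG]
    dsimp only
    rw [integral_sub ((iA N).1.const_mul 2) (iT N).1, integral_const_mul, (iA N).2, (iT N).2]; ring
  have hm := Fs_meas J σ s
  have hB : ∀ x ∈ Icc 0 (2 * Real.pi), |Fs J σ s x| ≤ 1 := fun x _ => (Fs_abs h x).le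
  have Geq : ∀ N, ∀ t : ℝ, 0 < t → G N t = (BN J σ s t N + BN J σ s (-t) N +
      (Zn (Fs J σ s) t (2 * N + 1) + Zn (Fs J σ s) (-t) (2 * N + 1))) / Real.sinh t ^ 2 := by
    intro N t ht
    rw [hG]
    dsimp only
    rw [spec_sum (hA N) (hA2 N) (bA N) ht, spec_sum (hT N) (hT2 N) (bT N) ht, ← MM_wc h, ← MM_wc h, ← TM_wc h, ← TM_wc h]
    have m1 := MM_log hm hB hs t N
    have m2 := MM_log hm hB hs (-t) N
    have t1 := LL_TM hm hB hs t N
    have t2 := LL_TM hm hB hs (-t) N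
    rw [← t1, ← t2, BN, BN, ← mul_div_assoc, ← sub_div]
    congr 1
    linear_combination m1 + m2
  obtain ⟨C, hC, HC⟩ := BN_dom h hs
  obtain ⟨⟨K, hK, HK⟩, Hlim⟩ := Zn_final h hs hl hpi
  have lim := tendsto_integral_of_dominated_convergence (μ := volume.restrict (Ioi (0 : ℝ))) (F := G)
    (f := fun t => 2 * (J.card / Real.pi ^ 2 * Real.log 2) * (t ^ 2 / Real.sinh t ^ 2))
    (fun t => (2 * C + K) * (1024 * Real.exp (-(1 / 8) * t))) (fun N => (Gint N).aestronglyMeasurable)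
    ((dom_int.const_mul 1024).const_mul _) (fun N => by
      filter_upwards [ae_restrict_mem measurableSet_Ioi] with t ht
      have ht0 : 0 < t := ht
      have hsp : 0 < Real.sinh t := Real.sinh_pos_iff.2 ht0
      rw [Geq N t ht0, Real.norm_eq_abs, abs_div, abs_of_pos (pow_pos hsp 2)]
      have b1 := HC N t ht0.ne'
      have b2 := HC N (-t) (neg_ne_zero.2 ht0.ne')
      have b3 := HK t (2 * N + 1) (Nat.succ_pos _)
      rw [abs_neg, neg_sq] at b2
      rw [abs_of_pos ht0] at b1 b2
      have e1 : 1 ≤ Real.exp (7 / 4 * t) := Real.one_le_exp (by positivity)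
      have b4 : K * t ^ 2 ≤ K * t ^ 2 * Real.exp (7 / 4 * t) := le_mul_of_one_le_right (by positivity) e1
      calc _ ≤ ((2 * C + K) * (t ^ 2 * Real.exp (7 / 4 * t))) / Real.sinh t ^ 2 := by
            gcongr
            refine (abs_add_le _ _).trans ?_
            have := abs_add_le (BN J σ s t N) (BN J σ s (-t) N)
            linarith
        _ = (2 * C + K) * (t ^ 2 * Real.exp (7 / 4 * t) / Real.sinh t ^ 2) := by ring
        _ ≤ _ := by gcongr; exact dom_exp ht0) (by
      filter_upwards [ae_restrict_mem measurableSet_Ioi] with t ht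
      have ht0 : 0 < t := ht
      have l1 := BN_lim h ht0.ne'
      have l2 := BN_lim h (neg_ne_zero.2 ht0.ne')
      have l3 : Tendsto (fun N : ℕ => Zn (Fs J σ s) t (2 * N + 1) + Zn (Fs J σ s) (-t) (2 * N + 1)) atTop (𝓝 0) :=
        (Hlim t).comp (tendsto_atTop_mono (fun N => (by omega : N ≤ 2 * N + 1)) tendsto_id)
      have l4 := ((l1.add l2).add l3).div_const (Real.sinh t ^ 2)
      refine (Eq.mpr (congrArg₂ (fun F x => Tendsto F atTop (𝓝 x)) (funext fun N => ?_) ?_) l4)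
      · exact Geq N t ht0
      · ring)
  rw [integral_const_mul, sinh_integral] at lim
  have hlog : 0 < Real.log 2 := Real.log_pos (by norm_num)
  have lim2 := lim.div_const (2 * Real.log 2)
  refine (Eq.mpr (congrArg₂ (fun F x => Tendsto F atTop (𝓝 x)) (funext fun N => ?_) ?_) lim2)
  · rw [Gval]; field_simp
  · have := Real.pi_pos
    field_simp

theorem main_thm (R : ℕ) (hR : 1 ≤ R) (θ : ℕ → ℝ)
    (hθ0 : θ 0 = 0) (hθtop : θ (R + 1) = Real.pi)
    (hmono : ∀ r ≤ R, θ r < θ (r + 1))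
    (f : ℝ → ℝ) (hper : ∀ t, f (t + 2 * Real.pi) = f t) (heven : ∀ t, f (-t) = f t)
    (hval : ∀ r ≤ R, ∀ t, θ r < t → t < θ (r + 1) → f t = (-1 : ℝ) ^ r) :
    ∃ (hM : ∀ N : ℕ,
        (Matrix.of fun j k : Fin N =>
          fourierCoef f ((j : ℤ) - (k : ℤ)) - fourierCoef f ((j : ℤ) + (k : ℤ) + 2)).IsHermitian)
      (hT : ∀ N : ℕ,
        (Matrix.of fun j k : Fin N => fourierCoef f ((j : ℤ) - (k : ℤ))).IsHermitian),
      (∀ (N : ℕ) (k : Fin N), (hM N).eigenvalues k ∈ Set.Icc (-1 : ℝ) 1) ∧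
      Filter.Tendsto
        (fun N : ℕ => 2 * (∑ k : Fin N, entBin ((hM N).eigenvalues k))
          - ∑ k : Fin N, entBin ((hT N).eigenvalues k))
        Filter.atTop (nhds ((R : ℝ) / 3)) := by
  have h := JJ_step hθ0 hθtop hmono
  have hpi := JJ_pi hθ0 hθtop hmono
  have hcard := JJ_card hθ0 hθtop hmono
  obtain ⟨hae, hs⟩ := Fs_eq_ae hθ0 hθtop hmono hper heven hval
  set F := Fs (JJ R θ) (sg (JJ R θ)) 1 with hF
  have hc : ∀ n : ℤ, fourierCoef f n = ((rc F n : ℝ) : ℂ) := by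
    intro n
    rw [rc_real hs]
    refine cf_congr (g := fun x => (f x : ℂ)) ?_ n
    filter_upwards [hae] with x hx hx2
    rw [hx hx2]
  have eM : ∀ N : ℕ, (Matrix.of fun j k : Fin N =>
      fourierCoef f ((j : ℤ) - (k : ℤ)) - fourierCoef f ((j : ℤ) + (k : ℤ) + 2)) = (MM (rc F) N).map Complex.ofReal := by
    intro N; ext i j
    simp [MM, hc]
  have eT : ∀ N : ℕ, (Matrix.of fun j k : Fin N => fourierCoef f ((j : ℤ) - (k : ℤ))) = (TM (rc F) N).map Complex.ofReal := by
    intro N; ext i j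
    simp [TM, hc]
  have herm : ∀ {N : ℕ} {B : Matrix (Fin N) (Fin N) ℝ}, B.IsHermitian → (B.map Complex.ofReal).IsHermitian := by
    intro N B hB
    exact hB.map Complex.ofReal (fun x => (Complex.conj_ofReal x).symm)
  have hM : ∀ N : ℕ, (Matrix.of fun j k : Fin N =>
      fourierCoef f ((j : ℤ) - (k : ℤ)) - fourierCoef f ((j : ℤ) + (k : ℤ) + 2)).IsHermitian := fun N => by
    rw [eM]; exact herm (MM_isHermitian (rc_even hs) N)
  have hT : ∀ N : ℕ, (Matrix.of fun j k : Fin N => fourierCoef f ((j : ℤ) - (k : ℤ))).IsHermitian := fun N => by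
    rw [eT]; exact herm (TM_isHermitian (rc_even hs) N)
  obtain ⟨h1, h2⟩ := main_conv h hs (by norm_num) hpi hM hT eM eT
  refine ⟨hM, hT, fun N k => h1 N k, ?_⟩
  rw [hcard] at h2
  have e : ((2 * R : ℕ) : ℝ) / 6 = (R : ℝ) / 3 := by push_cast; ring
  rwa [e] at h2

end EE
end

/-- With `f` the sign symbol with jumps at `±θ_1,…,±θ_R`, the Toeplitz-minus-Hankel
matrix `M_N = (f_{j−k} − f_{j+k+2})` of the semi-infinite chain has eigenvalues in
`[−1,1]`, and `2·S(M_N) − S(T_N(f)) → R/3` as `N → ∞`. -/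
theorem entanglement_entropy_boundary_chain (R : ℕ) (hR : 1 ≤ R) (θ : ℕ → ℝ)
    (hθ0 : θ 0 = 0) (hθtop : θ (R + 1) = Real.pi)
    (hmono : ∀ r ≤ R, θ r < θ (r + 1))
    (f : ℝ → ℝ) (hper : ∀ t, f (t + 2 * Real.pi) = f t) (heven : ∀ t, f (-t) = f t)
    (hval : ∀ r ≤ R, ∀ t, θ r < t → t < θ (r + 1) → f t = (-1 : ℝ) ^ r) :
    ∃ (hM : ∀ N : ℕ,
        (Matrix.of fun j k : Fin N =>
          fourierCoef f ((j : ℤ) - (k : ℤ)) - fourierCoef f ((j : ℤ) + (k : ℤ) + 2)).IsHermitian)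
      (hT : ∀ N : ℕ,
        (Matrix.of fun j k : Fin N => fourierCoef f ((j : ℤ) - (k : ℤ))).IsHermitian),
      (∀ (N : ℕ) (k : Fin N), (hM N).eigenvalues k ∈ Set.Icc (-1 : ℝ) 1) ∧
      Filter.Tendsto
        (fun N : ℕ => 2 * (∑ k : Fin N, entBin ((hM N).eigenvalues k))
          - ∑ k : Fin N, entBin ((hT N).eigenvalues k))
        Filter.atTop (nhds ((R : ℝ) / 3)) :=
  EE.main_thm R hR θ hθ0 hθtop hmono f hper heven hval

end
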